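/- Assume (β,h) satisfy the AT condition and condition (AT+). Then there exists a constant C > 0 such that for every i ∈ [N], 𝔼 ( ∑_{j,k ≠ i, j ≠ k} g_{ij} g_{ik} m_{kj}^{(i)} )⁴ ≤ C N^{−2}, where m_{kj}^{(i)} is the correlation of σ_k and σ_j under the Gibbs measure with spin σ_i removed. -/

import Mathlib

open MeasureTheory ProbabilityTheory Real Filter

noncomputable section

namespace SK

/-- The spin value `±1` encoded by a Boolean. -/
def spin (b : Bool) : ℝ := if b then 1 else -1

/-- SK Hamiltonian with coupling matrix `g`, inverse temperature `β` and external
field vector `hv`:  `H(σ) = β ∑_{i<j} g_{ij} σ_i σ_j + ∑_i hv_i σ_i`. -/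
def hamiltonian (N : ℕ) (β : ℝ) (g : Fin N → Fin N → ℝ) (hv : Fin N → ℝ)
    (σ : Fin N → ℝ) : ℝ :=
  β * ∑ i : Fin N, ∑ j : Fin N, (if i < j then g i j * σ i * σ j else 0)
    + ∑ i : Fin N, hv i * σ i

/-- Partition function `Z_N`. -/
def partitionZ (N : ℕ) (β : ℝ) (g : Fin N → Fin N → ℝ) (hv : Fin N → ℝ) : ℝ :=
  ∑ s : Fin N → Bool, Real.exp (hamiltonian N β g hv (fun i => spin (s i)))

/-- Gibbs expectation `⟨f⟩`. -/
def gibbs (N : ℕ) (β : ℝ) (g : Fin N → Fin N → ℝ) (hv : Fin N → ℝ)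
    (f : (Fin N → ℝ) → ℝ) : ℝ :=
  (∑ s : Fin N → Bool, f (fun i => spin (s i)) *
      Real.exp (hamiltonian N β g hv (fun i => spin (s i)))) / partitionZ N β g hv

/-- Magnetization `m_i = ⟨σ_i⟩`. -/
def mag (N : ℕ) (β : ℝ) (g : Fin N → Fin N → ℝ) (hv : Fin N → ℝ) (i : Fin N) : ℝ :=
  gibbs N β g hv (fun σ => σ i)

/-- Two point correlation `m_{ij} = ⟨σ_i σ_j⟩ - ⟨σ_i⟩⟨σ_j⟩`. -/
def corr (N : ℕ) (β : ℝ) (g : Fin N → Fin N → ℝ) (hv : Fin N → ℝ) (i j : Fin N) : ℝ :=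
  gibbs N β g hv (fun σ => σ i * σ j) - mag N β g hv i * mag N β g hv j

/-- Operator (ℓ²→ℓ²) norm of an `N×N` real matrix. -/
def opNorm (N : ℕ) (A : Fin N → Fin N → ℝ) : ℝ :=
  sSup {x : ℝ | ∃ u : Fin N → ℝ, (∑ i, u i ^ 2) = 1 ∧
    x = Real.sqrt (∑ i, (∑ j, A i j * u j) ^ 2)}

/-- `q ↦ E tanh²(h + β √q Z)`, `Z` standard Gaussian. -/
def qtanh (β h q : ℝ) : ℝ :=
  ∫ z, Real.tanh (h + β * Real.sqrt q * z) ^ 2 ∂(gaussianReal 0 1)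

/-- `q` is the (unique) solution in `(0,1)` of `q = E tanh²(h + β √q Z)`. -/
def isFixedq (β h q : ℝ) : Prop := 0 < q ∧ q < 1 ∧ q = qtanh β h q

/-- The de Almeida–Thouless condition `β² E sech⁴(h + β √q Z) < 1`. -/
def ATcond (β h q : ℝ) : Prop :=
  β ^ 2 * ∫ z, (Real.cosh (h + β * Real.sqrt q * z))⁻¹ ^ 4 ∂(gaussianReal 0 1) < 1

/-- The functional `Φ(m, q')` from condition (AT+). -/
def Phi (β h q m q' : ℝ) : ℝ :=
  Real.log 2 + β ^ 2 / 4 * (1 - q') ^ 2 - β ^ 2 / 4 * m * (q' ^ 2 - q ^ 2)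
    + (1 / m) * ∫ z, Real.log (∫ z', Real.cosh (h + β * Real.sqrt q * z
        + β * Real.sqrt (q' - q) * z') ^ m ∂(gaussianReal 0 1)) ∂(gaussianReal 0 1)

/-- Condition (AT+): `(∂_m Φ)(m, q')|_{m=1} < 0` for all `q < q' ≤ 1`. -/
def ATplus (β h q : ℝ) : Prop :=
  ∀ q' : ℝ, q < q' → q' ≤ 1 → deriv (fun m => Phi β h q m q') 1 < 0

/-- `G` is a GOE random matrix: symmetric, zero diagonal, and the entries above the
diagonal are i.i.d. centered Gaussians of variance `1/N`. -/
def IsGOE (N : ℕ) {Ω : Type*} [MeasurableSpace Ω] (P : Measure Ω)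
    (G : Ω → Fin N → Fin N → ℝ) : Prop :=
  (∀ ω i j, G ω i j = G ω j i) ∧ (∀ ω i, G ω i i = 0) ∧
  iIndepFun (m := fun _ : {p : Fin N × Fin N // p.1 < p.2} => (inferInstance : MeasurableSpace ℝ))
    (fun p ω => G ω p.1.1 p.1.2) P ∧
  ∀ p : {p : Fin N × Fin N // p.1 < p.2},
    Measure.map (fun ω => G ω p.1.1 p.1.2) P = gaussianReal 0 (N : NNReal)⁻¹


/-- Couplings of the system with the spin `i` removed. -/
def redCoup (N : ℕ) (g : Fin N → Fin N → ℝ) (i : Fin N) : Fin N → Fin N → ℝ :=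
  fun u v => if u = i ∨ v = i then 0 else g u v

/-- Correlation `m^{(i)}_{kj}` of the Gibbs measure with the spin `i` removed. -/
def corrRemoved (N : ℕ) (β h : ℝ) (g : Fin N → Fin N → ℝ) (i k j : Fin N) : ℝ :=
  corr N β (redCoup N g i) (fun u => if u = i then 0 else h) k j

set_option linter.unusedSectionVars false
set_option linter.unusedVariables false

/-! ### Gaussian toolbox -/

/-- The standard Gaussian measure on `κ → ℝ`. -/
abbrev gm (κ : Type*) [Fintype κ] : Measure (κ → ℝ) := Measure.pi fun _ => gaussianReal 0 1

/-- the standard Gaussian on `ℝ`. -/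
abbrev g1 : Measure ℝ := gaussianReal 0 1

/-- exponentially bounded families. -/
def EB {κ Θ : Type*} [Fintype κ] (F : Θ → (κ → ℝ) → ℝ) : Prop :=
  ∃ C, 0 ≤ C ∧ ∀ θ x, |F θ x| ≤ C * exp (C * ∑ k, |x k|)

section EB
variable {κ Θ : Type*} [Fintype κ] {F G : Θ → (κ → ℝ) → ℝ}

lemma sum_abs_nonneg (x : κ → ℝ) : 0 ≤ ∑ k, |x k| := Finset.sum_nonneg fun _ _ => abs_nonneg _

lemma EB.of_le (A B : ℝ) (h : ∀ θ x, |F θ x| ≤ A * exp (B * ∑ k, |x k|)) : EB F := by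
  refine ⟨max (max A B) 0, le_max_right _ _, fun θ x => (h θ x).trans ?_⟩
  have h0 := sum_abs_nonneg x
  have hA : A ≤ max (max A B) 0 := (le_max_left _ _).trans (le_max_left _ _)
  have hB : B ≤ max (max A B) 0 := (le_max_right _ _).trans (le_max_left _ _)
  have h1 : exp (B * ∑ k, |x k|) ≤ exp (max (max A B) 0 * ∑ k, |x k|) :=
    exp_le_exp.2 (mul_le_mul_of_nonneg_right hB h0)
  exact mul_le_mul hA h1 (exp_pos _).le (le_max_right _ _)

lemma EB.const (c : ℝ) : EB (fun (_ : Θ) (_ : κ → ℝ) => c) :=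
  EB.of_le |c| 0 (by simp)

lemma EB.bdd (c : ℝ) (h : ∀ θ x, |F θ x| ≤ c) : EB F :=
  EB.of_le c 0 (by simpa using h)

lemma EB.mono (hG : EB G) (h : ∀ θ x, |F θ x| ≤ |G θ x|) : EB F := by
  obtain ⟨C, h0, hC⟩ := hG
  exact ⟨C, h0, fun θ x => (h θ x).trans (hC θ x)⟩

lemma EB.add (hF : EB F) (hG : EB G) : EB (fun θ x => F θ x + G θ x) := by
  obtain ⟨C, h0, hC⟩ := hF
  obtain ⟨D, h0', hD⟩ := hG
  refine ⟨C + D, by positivity, fun θ x => ?_⟩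
  have hx := sum_abs_nonneg x
  have h1 : exp (C * ∑ k, |x k|) ≤ exp ((C + D) * ∑ k, |x k|) := by
    apply exp_le_exp.2; nlinarith
  have h2 : exp (D * ∑ k, |x k|) ≤ exp ((C + D) * ∑ k, |x k|) := by
    apply exp_le_exp.2; nlinarith
  calc |F θ x + G θ x| ≤ |F θ x| + |G θ x| := abs_add_le _ _
    _ ≤ C * exp (C * ∑ k, |x k|) + D * exp (D * ∑ k, |x k|) := add_le_add (hC θ x) (hD θ x)
    _ ≤ C * exp ((C + D) * ∑ k, |x k|) + D * exp ((C + D) * ∑ k, |x k|) := by gcongr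
    _ = _ := by ring

lemma EB.mul (hF : EB F) (hG : EB G) : EB (fun θ x => F θ x * G θ x) := by
  obtain ⟨C, h0, hC⟩ := hF
  obtain ⟨D, h0', hD⟩ := hG
  refine EB.of_le (C * D) (C + D) fun θ x => ?_
  rw [abs_mul]
  calc |F θ x| * |G θ x| ≤ (C * exp (C * ∑ k, |x k|)) * (D * exp (D * ∑ k, |x k|)) :=
        mul_le_mul (hC θ x) (hD θ x) (abs_nonneg _) (by positivity)
    _ = _ := by rw [add_mul, exp_add]; ring

lemma EB.neg (hF : EB F) : EB (fun θ x => - F θ x) :=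
  hF.mono (by simp)

lemma EB.sub (hF : EB F) (hG : EB G) : EB (fun θ x => F θ x - G θ x) := by
  simpa [sub_eq_add_neg] using hF.add hG.neg

lemma EB.const_mul (c : ℝ) (hF : EB F) : EB (fun θ x => c * F θ x) := (EB.const c).mul hF

lemma EB.abs (hF : EB F) : EB (fun θ x => |F θ x|) := hF.mono (by simp)

lemma EB.pow (hF : EB F) (n : ℕ) : EB (fun θ x => F θ x ^ n) := by
  induction n with
  | zero => simpa using EB.const (Θ := Θ) (κ := κ) 1
  | succ n ih => simpa [pow_succ] using ih.mul hF

lemma EB.sum {ι : Type*} {s : Finset ι} {F : ι → Θ → (κ → ℝ) → ℝ} (h : ∀ i ∈ s, EB (F i)) :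
    EB (fun θ x => ∑ i ∈ s, F i θ x) := by
  classical
  induction s using Finset.induction_on with
  | empty => simpa using EB.const (Θ := Θ) (κ := κ) 0
  | insert a s ha ih =>
    simp only [Finset.sum_insert ha]
    exact (h a (by simp)).add (ih fun i hi => h i (by simp [hi]))

lemma EB.coord (k : κ) : EB (fun (_ : Θ) (x : κ → ℝ) => x k) := by
  refine EB.of_le 1 1 fun θ x => ?_
  have : |x k| ≤ ∑ k, |x k| := Finset.single_le_sum (f := fun k => |x k|)
    (fun _ _ => abs_nonneg _) (Finset.mem_univ k)
  have h2 := add_one_le_exp (∑ k, |x k|)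
  simp only [one_mul]; linarith

lemma EB.sumabs : EB (fun (_ : Θ) (x : κ → ℝ) => ∑ k, |x k|) :=
  EB.sum fun k _ => (EB.coord k).abs

lemma EB.comp {Θ' : Type*} (hF : EB F) (g : Θ' → Θ) : EB (fun θ x => F (g θ) x) := by
  obtain ⟨C, h0, hC⟩ := hF
  exact ⟨C, h0, fun θ x => hC _ x⟩

lemma integrable_exp_abs_pi (A : ℝ) : Integrable (fun x : κ → ℝ => exp (A * ∑ k, |x k|)) (gm κ) := by
  have h : ∀ x : κ → ℝ, exp (A * ∑ k, |x k|) = ∏ k, exp (A * |x k|) := fun x => by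
    rw [Finset.mul_sum, exp_sum]
  simp_rw [h]
  apply Integrable.fintype_prod (f := fun _ t => exp (A * |t|))
  intro i
  exact integrable_exp_mul_abs (X := fun x => x) (integrable_exp_mul_gaussianReal A)
    (integrable_exp_mul_gaussianReal (-A))

lemma EB.integrable (hF : EB F) (θ : Θ) (hc : Measurable (F θ)) : Integrable (F θ) (gm κ) := by
  obtain ⟨C, h0, hC⟩ := hF
  refine Integrable.mono' ((integrable_exp_abs_pi (κ := κ) C).const_mul C) hc.aestronglyMeasurable ?_
  exact Eventually.of_forall fun x => hC θ x

/-- differentiation under the Gaussian integral -/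
lemma hasDerivAt_integral_gm {F F' : ℝ → (κ → ℝ) → ℝ} (θ : ℝ)
    (hF : EB (fun _ : Unit => F θ)) (hF' : EB (fun s : Metric.ball θ 1 => F' s))
    (hm : ∀ θ, Measurable (F θ)) (hm' : Measurable (F' θ))
    (hd : ∀ θ x, HasDerivAt (fun s => F s x) (F' θ x) θ) :
    HasDerivAt (fun s => ∫ x, F s x ∂(gm κ)) (∫ x, F' θ x ∂(gm κ)) θ := by
  obtain ⟨C, h0, hC⟩ := hF'
  have hb : Integrable (fun x : κ → ℝ => C * exp (C * ∑ k, |x k|)) (gm κ) :=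
    (integrable_exp_abs_pi (κ := κ) C).const_mul C
  have h1 : Integrable (F θ) (gm κ) := hF.integrable () (hm θ)
  have h2 : ∀ᵐ x ∂(gm κ), ∀ s ∈ Metric.ball θ 1, ‖F' s x‖ ≤ C * exp (C * ∑ k, |x k|) :=
    Eventually.of_forall fun x s hs => hC ⟨s, hs⟩ x
  have h3 : ∀ᵐ x ∂(gm κ), ∀ s ∈ Metric.ball θ 1, HasDerivAt (fun s => F s x) (F' s x) s :=
    Eventually.of_forall fun x s _ => hd s x
  have h4 : ∀ᶠ s in nhds θ, AEStronglyMeasurable (F s) (gm κ) :=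
    Eventually.of_forall fun s => (hm s).aestronglyMeasurable
  exact (hasDerivAt_integral_of_dominated_loc_of_deriv_le (μ := gm κ) (𝕜 := ℝ) (F := F) (F' := F')
    (x₀ := θ) (s := Metric.ball θ 1) (Metric.ball_mem_nhds θ one_pos) h4 h1
    hm'.aestronglyMeasurable h2 hb h3).2

end EB

/-! ### resampling a coordinate -/
section resample
variable {κ : Type*} [Fintype κ] [DecidableEq κ]

lemma measurePreserving_update (k : κ) :
    MeasurePreserving (fun p : (κ → ℝ) × ℝ => Function.update p.1 k p.2) ((gm κ).prod g1) (gm κ) := by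
  have hmeas : Measurable (fun p : (κ → ℝ) × ℝ => Function.update p.1 k p.2) := by
    rw [measurable_pi_iff]
    intro j
    by_cases h : j = k
    · subst h; simpa using measurable_snd
    · simp only [Function.update_of_ne h]
      exact (measurable_pi_apply j).comp measurable_fst
  refine ⟨hmeas, ?_⟩
  symm
  apply Measure.pi_eq
  intro s hs
  rw [Measure.map_apply hmeas (MeasurableSet.univ_pi hs)]
  have : (fun p : (κ → ℝ) × ℝ => Function.update p.1 k p.2) ⁻¹' (Set.univ.pi s) =
      (Set.univ.pi (Function.update s k Set.univ)) ×ˢ (s k) := by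
    ext p
    simp only [Set.mem_preimage, Set.mem_pi, Set.mem_univ, true_imp_iff, Set.mem_prod]
    constructor
    · intro h
      refine ⟨fun j => ?_, by simpa using h k⟩
      by_cases hj : j = k
      · subst hj; simp
      · have := h j; simpa [Function.update_of_ne hj] using this
    · rintro ⟨h1, h2⟩ j
      by_cases hj : j = k
      · subst hj; simpa using h2
      · have := h1 j; simpa [Function.update_of_ne hj] using this
  rw [this, Measure.prod_prod, Measure.pi_pi]
  rw [← Finset.mul_prod_erase _ _ (Finset.mem_univ k),
    ← Finset.mul_prod_erase Finset.univ (fun i => (gaussianReal 0 1) (s i)) (Finset.mem_univ k)]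
  simp only [Function.update_self, measure_univ, one_mul]
  rw [mul_comm]
  congr 1
  apply Finset.prod_congr rfl
  intro j hj
  rw [Function.update_of_ne (Finset.ne_of_mem_erase hj)]

lemma integral_resample (k : κ) {f : (κ → ℝ) → ℝ} (hf : Integrable f (gm κ)) :
    ∫ x, f x ∂(gm κ) = ∫ x, ∫ s, f (Function.update x k s) ∂g1 ∂(gm κ) := by
  have hp := measurePreserving_update (κ := κ) k
  have h1 : ∫ x, f x ∂(gm κ) = ∫ p : (κ → ℝ) × ℝ, f (Function.update p.1 k p.2) ∂((gm κ).prod g1) := by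
    have h2 := integral_map (μ := (gm κ).prod g1) (f := f) hp.measurable.aemeasurable
      (by rw [hp.map_eq]; exact hf.aestronglyMeasurable)
    rw [hp.map_eq] at h2
    exact h2
  rw [h1, integral_prod]
  have : Integrable (f ∘ fun p : (κ → ℝ) × ℝ => Function.update p.1 k p.2) ((gm κ).prod g1) :=
    hp.integrable_comp_of_integrable hf
  exact this

end resample

/-! ### Stein's lemma -/

lemma integrable_exp_abs_one (A : ℝ) : Integrable (fun x : ℝ => exp (A * |x|)) g1 :=
  integrable_exp_mul_abs (X := fun x => x) (integrable_exp_mul_gaussianReal A)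
    (integrable_exp_mul_gaussianReal (-A))

lemma integrable_of_exp_bound {f : ℝ → ℝ} (hf : Measurable f) (A B : ℝ)
    (h : ∀ x, |f x| ≤ A * exp (B * |x|)) : Integrable f g1 :=
  Integrable.mono' ((integrable_exp_abs_one B).const_mul A) hf.aestronglyMeasurable
    (Eventually.of_forall fun x => h x)

lemma abs_le_exp_abs (x : ℝ) : |x| ≤ exp |x| := by
  have := add_one_le_exp |x|; linarith

lemma stein_one {f f' : ℝ → ℝ} (hd : ∀ x, HasDerivAt f (f' x) x) (hm : Measurable f')
    (A B : ℝ) (hf : ∀ x, |f x| ≤ A * exp (B * |x|)) (hf' : ∀ x, |f' x| ≤ A * exp (B * |x|)) :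
    ∫ x, x * f x ∂g1 = ∫ x, f' x ∂g1 := by
  have hmf : Measurable f := (continuous_iff_continuousAt.2 fun x => (hd x).continuousAt).measurable
  have i1 : Integrable f g1 := integrable_of_exp_bound hmf A B hf
  have i2 : Integrable f' g1 := integrable_of_exp_bound hm A B hf'
  have i3 : Integrable (fun x => x * f x) g1 := by
    refine integrable_of_exp_bound (measurable_id.mul hmf) A (B + 1) fun x => ?_
    rw [abs_mul]
    calc |x| * |f x| ≤ exp |x| * (A * exp (B * |x|)) :=
          mul_le_mul (abs_le_exp_abs x) (hf x) (abs_nonneg _) (exp_pos _).le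
      _ = _ := by rw [add_mul, exp_add, one_mul]; ring
  have hpd : ∀ x, HasDerivAt (gaussianPDFReal 0 1) (- x * gaussianPDFReal 0 1 x) x := by
    intro x
    rw [gaussianPDFReal_def]
    have h1 : HasDerivAt (fun x : ℝ => -(x - 0) ^ 2 / (2 * ((1 : NNReal) : ℝ))) (-x) x := by
      have := (((hasDerivAt_id x).sub_const 0).fun_pow 2).fun_neg.div_const (2 * ((1 : NNReal) : ℝ))
      refine this.congr_deriv ?_
      simp only [NNReal.coe_one, id_eq]
      norm_num
      ring
    have := h1.exp.const_mul ((√(2 * π * ((1 : NNReal) : ℝ)))⁻¹)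
    refine this.congr_deriv ?_
    ring
  have conv : ∀ g : ℝ → ℝ, Integrable g g1 ↔ Integrable (fun x => gaussianPDFReal 0 1 x * g x) := by
    intro g
    rw [g1, gaussianReal_of_var_ne_zero _ one_ne_zero,
      integrable_withDensity_iff_integrable_smul' (measurable_gaussianPDF 0 1)
        (Eventually.of_forall fun x => gaussianPDF_lt_top)]
    simp only [toReal_gaussianPDF, smul_eq_mul]
  have key := integral_eq_zero_of_hasDerivAt_of_integrable
    (f := fun x => gaussianPDFReal 0 1 x * f x)
    (f' := fun x => gaussianPDFReal 0 1 x * f' x - gaussianPDFReal 0 1 x * (x * f x))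
    (fun x => by
      have := (hpd x).fun_mul (hd x)
      refine this.congr_deriv ?_
      ring) (((conv _).1 i2).sub ((conv _).1 i3)) ((conv _).1 i1)
  rw [integral_sub ((conv _).1 i2) ((conv _).1 i3)] at key
  rw [integral_gaussianReal_eq_integral_smul one_ne_zero,
    integral_gaussianReal_eq_integral_smul one_ne_zero]
  simp only [smul_eq_mul]
  linarith

section
variable {κ : Type*} [Fintype κ] [DecidableEq κ]

lemma sum_abs_update (x : κ → ℝ) (k : κ) (s : ℝ) :
    ∑ j, |Function.update x k s j| ≤ ∑ j, |x j| + |s| := by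
  rw [← Finset.add_sum_erase _ _ (Finset.mem_univ k)]
  simp only [Function.update_self]
  have h : ∑ j ∈ Finset.univ.erase k, |Function.update x k s j| = ∑ j ∈ Finset.univ.erase k, |x j| :=
    Finset.sum_congr rfl fun j hj => by rw [Function.update_of_ne (Finset.ne_of_mem_erase hj)]
  rw [h]
  have : ∑ j ∈ Finset.univ.erase k, |x j| ≤ ∑ j, |x j| :=
    Finset.sum_le_sum_of_subset_of_nonneg (Finset.erase_subset _ _) fun _ _ _ => abs_nonneg _
  linarith

/-- Stein's lemma (Gaussian integration by parts) in coordinate `k`. -/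
lemma stein (k : κ) {f f' : (κ → ℝ) → ℝ} (hf : EB (fun _ : Unit => f)) (hf' : EB (fun _ : Unit => f'))
    (hm : Measurable f) (hm' : Measurable f')
    (hd : ∀ x, HasDerivAt (fun s => f (Function.update x k s)) (f' x) (x k)) :
    ∫ x, x k * f x ∂(gm κ) = ∫ x, f' x ∂(gm κ) := by
  have i1 : Integrable (fun x => x k * f x) (gm κ) :=
    ((EB.coord (Θ := Unit) k).mul hf).integrable () ((measurable_pi_apply k).mul hm)
  have i2 : Integrable f' (gm κ) := hf'.integrable () hm'
  rw [integral_resample k i1, integral_resample k i2]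
  congr 1
  ext x
  simp only [Function.update_self]
  obtain ⟨C, hC0, hC⟩ := hf
  obtain ⟨D, hD0, hD⟩ := hf'
  have hu : Measurable fun s : ℝ => Function.update x k s := measurable_update x
  have hx := sum_abs_nonneg x
  refine stein_one (fun s => ?_) (hm'.comp hu) ((C + D) * exp ((C + D) * ∑ j, |x j|)) (C + D) ?_ ?_
  · have := hd (Function.update x k s)
    simpa using this
  · intro s
    refine (hC () _).trans ?_
    rw [mul_assoc, ← exp_add]
    have := sum_abs_update x k s
    have hs := abs_nonneg s
    have hs2 := sum_abs_nonneg (Function.update x k s)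
    apply mul_le_mul (by linarith) _ (exp_pos _).le (by linarith)
    apply exp_le_exp.2
    nlinarith
  · intro s
    refine (hD () _).trans ?_
    rw [mul_assoc, ← exp_add]
    have := sum_abs_update x k s
    have hs := abs_nonneg s
    have hs2 := sum_abs_nonneg (Function.update x k s)
    apply mul_le_mul (by linarith) _ (exp_pos _).le (by linarith)
    apply exp_le_exp.2
    nlinarith

end

/-- The law of a subfamily of coordinates. -/
lemma gm_map_comp {κ ι : Type*} [Fintype κ] [Fintype ι] (e : ι → κ) (he : Function.Injective e) :
    Measure.map (fun x : κ → ℝ => fun i => x (e i)) (gm κ) = gm ι := by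
  have h := (iIndepFun_pi (μ := fun _ : κ => gaussianReal 0 1) (X := fun _ x => x)
    (fun i => measurable_id.aemeasurable)).precomp he
  have := h.map_fun_eq_pi_map (fun i => (measurable_pi_apply _).aemeasurable)
  rw [this]
  congr 1
  ext1 i
  exact (measurePreserving_eval (fun _ : κ => gaussianReal 0 1) (e i)).map_eq

lemma integral_comp_coords {κ ι : Type*} [Fintype κ] [Fintype ι] (e : ι → κ)
    (he : Function.Injective e) {f : (ι → ℝ) → ℝ} (hf : Measurable f) :
    ∫ x, f (fun i => x (e i)) ∂(gm κ) = ∫ y, f y ∂(gm ι) := by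
  rw [← gm_map_comp e he, integral_map]
  · exact (measurable_pi_lambda _ fun i => measurable_pi_apply _).aemeasurable
  · exact hf.aestronglyMeasurable


/-! ### concentration -/

lemma integral_exp_mul_g1 (c : ℝ) : ∫ x, exp (c * x) ∂g1 = exp (c ^ 2 / 2) := by
  have h := congrFun (mgf_fun_id_gaussianReal (μ := 0) (v := 1)) c
  rw [mgf] at h
  rw [h]; simp

lemma integrable_exp_mul_g1 (c : ℝ) : Integrable (fun x => exp (c * x)) g1 :=
  integrable_exp_mul_gaussianReal c

lemma lip_exp_bound {f : ℝ → ℝ} {L : ℝ} (_ : 0 ≤ L) (hf : ∀ s t, |f s - f t| ≤ L * |s - t|) (l x : ℝ) :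
    exp (l * f x) ≤ exp (|l| * |f 0|) * exp (|l| * L * |x|) := by
  rw [← exp_add]
  apply exp_le_exp.2
  have h1 := hf x 0
  rw [sub_zero] at h1
  have h2 : |f x| ≤ |f 0| + L * |x| := by
    have := abs_sub_abs_le_abs_sub (f x) (f 0); linarith
  calc l * f x ≤ |l * f x| := le_abs_self _
    _ = |l| * |f x| := abs_mul _ _
    _ ≤ |l| * (|f 0| + L * |x|) := by gcongr
    _ = _ := by ring

lemma lip_cont {f : ℝ → ℝ} {L : ℝ} (hL : 0 ≤ L) (hf : ∀ s t, |f s - f t| ≤ L * |s - t|) :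
    Continuous f := by
  have : LipschitzWith ⟨L, hL⟩ f := LipschitzWith.of_dist_le_mul fun s t => by
    rw [Real.dist_eq, Real.dist_eq]; exact hf s t
  exact this.continuous

lemma conc_one {f : ℝ → ℝ} {L : ℝ} (hL : 0 ≤ L) (hf : ∀ s t, |f s - f t| ≤ L * |s - t|) (l : ℝ) :
    Integrable f g1 ∧ ∫ s, exp (l * f s) ∂g1 ≤ exp (l * ∫ s, f s ∂g1 + l ^ 2 * L ^ 2) := by
  have hc := lip_cont hL hf
  have ie : ∀ l : ℝ, Integrable (fun s => exp (l * f s)) g1 := fun l => by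
    refine integrable_of_exp_bound (by fun_prop) (exp (|l| * |f 0|)) (|l| * L) fun x => ?_
    rw [abs_of_pos (exp_pos _)]
    exact lip_exp_bound hL hf l x
  have i1 : Integrable f g1 := by
    refine Integrable.mono' ((ie 1).add (ie (-1))) hc.aestronglyMeasurable
      (Eventually.of_forall fun x => ?_)
    simp only [Real.norm_eq_abs, Pi.add_apply, one_mul, neg_mul]
    have h1 := add_one_le_exp (f x)
    have h2 := add_one_le_exp (-f x)
    have h3 := exp_pos (f x)
    have h4 := exp_pos (-f x)
    rcases abs_cases (f x) with h | h <;> linarith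
  refine ⟨i1, ?_⟩
  set A := ∫ s, exp (l * f s) ∂g1 with hA
  set B := ∫ s, exp (-l * f s) ∂g1 with hB
  have hA0 : 0 ≤ A := integral_nonneg fun s => (exp_pos _).le
  have jen : exp (-l * ∫ s, f s ∂g1) ≤ B := by
    have := convexOn_exp.map_integral_le (μ := g1) (f := fun s => -l * f s) continuous_exp.continuousOn
      isClosed_univ (Eventually.of_forall fun _ => Set.mem_univ _) (i1.const_mul _) (ie (-l))
    rw [integral_const_mul] at this
    exact this
  have key : A * B ≤ exp (l ^ 2 * L ^ 2) := by
    have e1 : A * B = ∫ s, ∫ t, cosh (l * f s - l * f t) ∂g1 ∂g1 := by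
      have : ∀ s, ∫ t, cosh (l * f s - l * f t) ∂g1 = 1 / 2 * (exp (l * f s) * B + exp (-l * f s) * A) := by
        intro s
        rw [hA, hB, ← integral_const_mul, ← integral_const_mul,
          ← integral_add ((ie (-l)).const_mul _) ((ie l).const_mul _), ← integral_const_mul]
        congr 1; ext t
        rw [cosh_eq, neg_mul, neg_mul, ← exp_add, ← exp_add]
        have : -(l * f s - l * f t) = -(l * f s) + l * f t := by ring
        rw [this]; ring_nf
      simp_rw [this]
      rw [integral_const_mul, integral_add ((ie l).mul_const _) ((ie (-l)).mul_const _),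
        integral_mul_const, integral_mul_const]
      ring
    have e2 : ∫ s, ∫ t, cosh (l * L * s - l * L * t) ∂g1 ∂g1 = exp (l ^ 2 * L ^ 2) := by
      have : ∀ s, ∫ t, cosh (l * L * s - l * L * t) ∂g1 =
          1 / 2 * (exp ((l * L) * s) * exp ((-(l*L)) ^ 2 / 2) + exp (-(l * L) * s) * exp ((l * L) ^ 2 / 2)) := by
        intro s
        rw [← integral_exp_mul_g1, ← integral_exp_mul_g1, ← integral_const_mul, ← integral_const_mul,
          ← integral_add ((integrable_exp_mul_g1 _).const_mul _) ((integrable_exp_mul_g1 _).const_mul _),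
          ← integral_const_mul]
        congr 1; ext t
        rw [cosh_eq, ← exp_add, ← exp_add]
        ring_nf
      simp_rw [this]
      rw [integral_const_mul, integral_add ((integrable_exp_mul_g1 _).mul_const _) ((integrable_exp_mul_g1 _).mul_const _),
        integral_mul_const, integral_mul_const, integral_exp_mul_g1, integral_exp_mul_g1, ← exp_add, ← exp_add]
      ring_nf
    rw [e1, ← e2]
    have hcb : ∀ a b : ℝ, cosh (a - b) ≤ exp |a| * exp |b| := fun a b => by
      rw [← exp_add, ← cosh_abs]
      have : cosh |a - b| ≤ exp |a - b| := by
        rw [cosh_eq]; have := exp_le_exp.2 (show -|a-b| ≤ |a-b| by have := abs_nonneg (a-b); linarith)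
        linarith
      exact this.trans (exp_le_exp.2 (abs_sub _ _))
    have cont1 : Continuous fun p : ℝ × ℝ => cosh (l * f p.1 - l * f p.2) := by fun_prop
    have cont2 : Continuous fun p : ℝ × ℝ => cosh (l * L * p.1 - l * L * p.2) := by fun_prop
    have iabs : Integrable (fun s => exp |l * f s|) g1 := by
      refine integrable_of_exp_bound (by fun_prop) (exp (|l| * |f 0|)) (|l| * L) fun x => ?_
      rw [abs_of_pos (exp_pos _)]
      rcases abs_cases (l * f x) with h | h
      · rw [h.1]; exact lip_exp_bound hL hf l x
      · rw [h.1]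
        have := lip_exp_bound hL hf (-l) x
        rw [abs_neg] at this
        rwa [← neg_mul]
    have iabs2 : Integrable (fun s : ℝ => exp |l * L * s|) g1 := by
      refine integrable_of_exp_bound (by fun_prop) 1 |l * L| fun x => ?_
      rw [abs_of_pos (exp_pos _), abs_mul, one_mul]
    have I1 : Integrable (fun p : ℝ × ℝ => cosh (l * f p.1 - l * f p.2)) (g1.prod g1) :=
      Integrable.mono' (iabs.mul_prod iabs) cont1.aestronglyMeasurable
        (Eventually.of_forall fun p => by
          rw [Real.norm_eq_abs, abs_of_pos (cosh_pos _)]; exact hcb _ _)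
    have I2 : Integrable (fun p : ℝ × ℝ => cosh (l * L * p.1 - l * L * p.2)) (g1.prod g1) :=
      Integrable.mono' (iabs2.mul_prod iabs2) cont2.aestronglyMeasurable
        (Eventually.of_forall fun p => by
          rw [Real.norm_eq_abs, abs_of_pos (cosh_pos _)]; exact hcb _ _)
    have h := integral_mono I1 I2 (fun p => by
      simp only
      rw [cosh_le_cosh, ← mul_sub, ← mul_sub, abs_mul, abs_mul, abs_mul, mul_assoc, abs_of_nonneg hL]
      exact mul_le_mul_of_nonneg_left (hf _ _) (abs_nonneg _))
    rw [integral_prod _ I1, integral_prod _ I2] at h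
    exact h
  have h1 : A * exp (-l * ∫ s, f s ∂g1) ≤ exp (l ^ 2 * L ^ 2) :=
    (mul_le_mul_of_nonneg_left jen hA0).trans key
  have h2 := mul_le_mul_of_nonneg_right h1 (exp_pos (l * ∫ s, f s ∂g1)).le
  rw [mul_assoc, ← exp_add, ← exp_add] at h2
  rw [show -l * ∫ s, f s ∂g1 + l * ∫ s, f s ∂g1 = 0 by ring, exp_zero, mul_one] at h2
  rwa [add_comm (l * _)]

section
variable {κ : Type*} [Fintype κ]

lemma lip_cont_pi {F : (κ → ℝ) → ℝ} {L : κ → ℝ}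
    (hF : ∀ x y, |F x - F y| ≤ ∑ k, L k * |x k - y k|) : Continuous F := by
  rw [continuous_iff_continuousAt]
  intro y
  rw [ContinuousAt, tendsto_iff_dist_tendsto_zero]
  refine squeeze_zero (g := fun x => ∑ k, L k * |x k - y k|) (fun x => dist_nonneg)
    (fun x => hF x y) ?_
  have : Continuous fun x : κ → ℝ => ∑ k, L k * |x k - y k| := by fun_prop
  have h := this.tendsto y
  simpa using h

lemma lip_EB {F : (κ → ℝ) → ℝ} {L : κ → ℝ} (hL : ∀ k, 0 ≤ L k)
    (hF : ∀ x y, |F x - F y| ≤ ∑ k, L k * |x k - y k|) : EB (fun _ : Unit => F) := by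
  have h : EB (fun (_ : Unit) (x : κ → ℝ) => |F 0| + ∑ k, L k * |x k|) :=
    (EB.const _).add (EB.sum fun k _ => (EB.coord k).abs.const_mul (L k))
  refine h.mono fun _ x => ?_
  have h1 := hF x 0
  simp only [Pi.zero_apply, sub_zero] at h1
  have h2 := abs_sub_abs_le_abs_sub (F x) (F 0)
  have h3 : 0 ≤ ∑ k, L k * |x k| := Finset.sum_nonneg fun k _ => mul_nonneg (hL k) (abs_nonneg _)
  rw [abs_of_nonneg (a := |F 0| + _) (by positivity)]
  linarith

lemma lip_exp_EB {F : (κ → ℝ) → ℝ} {L : κ → ℝ} (hL : ∀ k, 0 ≤ L k)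
    (hF : ∀ x y, |F x - F y| ≤ ∑ k, L k * |x k - y k|) (l : ℝ) :
    EB (fun (_ : Unit) x => exp (l * F x)) := by
  refine EB.of_le (exp (|l| * |F 0|)) (|l| * ∑ k, L k) fun _ x => ?_
  rw [abs_of_pos (exp_pos _), ← exp_add]
  apply exp_le_exp.2
  have h1 := hF x 0
  simp only [Pi.zero_apply, sub_zero] at h1
  have h2 := abs_sub_abs_le_abs_sub (F x) (F 0)
  have h4 : ∑ k, L k * |x k| ≤ (∑ k, L k) * ∑ k, |x k| := by
    rw [Finset.sum_mul]
    refine Finset.sum_le_sum fun k _ => mul_le_mul_of_nonneg_left ?_ (hL k)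
    exact Finset.single_le_sum (f := fun k => |x k|) (fun _ _ => abs_nonneg _) (Finset.mem_univ k)
  calc l * F x ≤ |l * F x| := le_abs_self _
    _ = |l| * |F x| := abs_mul _ _
    _ ≤ |l| * (|F 0| + (∑ k, L k) * ∑ k, |x k|) := by
      apply mul_le_mul_of_nonneg_left _ (abs_nonneg _); linarith
    _ = _ := by ring

lemma concentration_aux [DecidableEq κ] (l : ℝ) (A : Finset κ) :
    ∀ (F : (κ → ℝ) → ℝ) (L : κ → ℝ), (∀ k, 0 ≤ L k) → (∀ k, k ∉ A → L k = 0) →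
    (∀ x y, |F x - F y| ≤ ∑ k, L k * |x k - y k|) →
    ∫ x, exp (l * F x) ∂(gm κ) ≤ exp (l * ∫ x, F x ∂(gm κ) + l ^ 2 * ∑ k ∈ A, L k ^ 2) := by
  induction A using Finset.induction_on with
  | empty =>
    intro F L hL h0 hF
    have hc : ∀ x, F x = F 0 := fun x => by
      have := hF x 0
      simp only [h0 _ (Finset.notMem_empty _), zero_mul, Finset.sum_const_zero] at this
      have := abs_nonpos_iff.1 this
      linarith
    have : F = fun _ => F 0 := funext hc
    rw [this]; simp
  | insert k A hk ih =>
    intro F L hL h0 hF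
    have upd : ∀ (x : κ → ℝ) (s t : ℝ), |F (Function.update x k s) - F (Function.update x k t)| ≤ L k * |s - t| := by
      intro x s t
      refine (hF _ _).trans (le_of_eq ?_)
      rw [Finset.sum_eq_single k]
      · simp
      · intro j _ hj; simp [Function.update_of_ne hj]
      · simp
    set F' : (κ → ℝ) → ℝ := fun x => ∫ s, F (Function.update x k s) ∂g1 with hF'
    set L' := Function.update L k 0 with hL'
    have hL'0 : ∀ j, 0 ≤ L' j := fun j => by
      by_cases h : j = k
      · subst h; simp [hL']
      · simp [hL', Function.update_of_ne h, hL]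
    have hL'1 : ∀ j, j ∉ A → L' j = 0 := fun j hj => by
      by_cases h : j = k
      · subst h; simp [hL']
      · rw [hL', Function.update_of_ne h]; exact h0 j (by simp [h, hj])
    have hlip' : ∀ x y, |F' x - F' y| ≤ ∑ j, L' j * |x j - y j| := by
      intro x y
      simp only [hF']
      rw [← integral_sub (conc_one (hL k) (upd x) 0).1 (conc_one (hL k) (upd y) 0).1]
      have hb : ∀ s, ‖F (Function.update x k s) - F (Function.update y k s)‖ ≤ ∑ j, L' j * |x j - y j| := by
        intro s
        refine (hF _ _).trans (Finset.sum_le_sum fun j _ => ?_)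
        by_cases h : j = k
        · subst h; simp [hL']
        · simp [hL', Function.update_of_ne h]
      have := norm_integral_le_of_norm_le_const (μ := g1) (Eventually.of_forall hb)
      simpa using this
    have hcF := lip_cont_pi hF
    have iF : Integrable F (gm κ) := (lip_EB hL hF).integrable () hcF.measurable
    have iE : Integrable (fun x => exp (l * F x)) (gm κ) :=
      (lip_exp_EB hL hF l).integrable () (by fun_prop)
    have iE' : Integrable (fun x => exp (l * F' x)) (gm κ) :=
      (lip_exp_EB hL'0 hlip' l).integrable () (by have := lip_cont_pi hlip'; fun_prop)
    have e1 : ∫ x, F x ∂(gm κ) = ∫ x, F' x ∂(gm κ) := integral_resample k iF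
    have ihh := ih F' L' hL'0 hL'1 hlip'
    have hsum : ∑ j ∈ A, L' j ^ 2 = ∑ j ∈ A, L j ^ 2 := Finset.sum_congr rfl fun j hj => by
      rw [hL', Function.update_of_ne (by rintro rfl; exact hk hj)]
    rw [integral_resample k iE, Finset.sum_insert hk, e1]
    have step : ∫ x, ∫ s, exp (l * F (Function.update x k s)) ∂g1 ∂(gm κ) ≤
        ∫ x, exp (l * F' x) * exp (l ^ 2 * L k ^ 2) ∂(gm κ) := by
      apply integral_mono_of_nonneg
      · exact Eventually.of_forall fun x => integral_nonneg fun s => (exp_pos _).le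
      · exact iE'.mul_const _
      · refine Eventually.of_forall fun x => ?_
        simp only
        rw [← exp_add]
        exact (conc_one (hL k) (upd x) l).2
    refine step.trans ?_
    rw [integral_mul_const]
    refine (mul_le_mul_of_nonneg_right ihh (exp_pos _).le).trans (le_of_eq ?_)
    rw [← exp_add, hsum]; ring_nf

/-- Gaussian concentration (Laplace transform form). -/
lemma concentration (l : ℝ) {F : (κ → ℝ) → ℝ} {L : κ → ℝ} (hL : ∀ k, 0 ≤ L k)
    (hF : ∀ x y, |F x - F y| ≤ ∑ k, L k * |x k - y k|) :
    ∫ x, exp (l * F x) ∂(gm κ) ≤ exp (l * ∫ x, F x ∂(gm κ) + l ^ 2 * ∑ k, L k ^ 2) := by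
  classical
  exact concentration_aux l Finset.univ F L hL (fun k hk => absurd (Finset.mem_univ k) hk) hF

end

/-! ### finite Gibbs measures -/
section gibbsfin
variable {S : Type*} [Fintype S]

/-- partition function -/
def Zf (H : S → ℝ) : ℝ := ∑ σ, exp (H σ)

/-- Gibbs average -/
def ga (H c : S → ℝ) : ℝ := (∑ σ, c σ * exp (H σ)) / Zf H

lemma Zf_pos [Nonempty S] (H : S → ℝ) : 0 < Zf H :=
  Finset.sum_pos (fun _ _ => exp_pos _) Finset.univ_nonempty

lemma ga_const [Nonempty S] (H : S → ℝ) (a : ℝ) : ga H (fun _ => a) = a := by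
  rw [ga, ← Finset.mul_sum]; exact mul_div_cancel_right₀ _ (Zf_pos H).ne'

lemma ga_add (H c d : S → ℝ) : ga H (fun σ => c σ + d σ) = ga H c + ga H d := by
  simp only [ga, add_mul, Finset.sum_add_distrib, add_div]

lemma ga_mul_const (H c : S → ℝ) (a : ℝ) : ga H (fun σ => a * c σ) = a * ga H c := by
  simp only [ga, mul_assoc, ← Finset.mul_sum, mul_div_assoc]

lemma ga_sum {ι : Type*} (s : Finset ι) (H : S → ℝ) (c : ι → S → ℝ) :
    ga H (fun σ => ∑ i ∈ s, c i σ) = ∑ i ∈ s, ga H (c i) := by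
  simp only [ga, Finset.sum_mul, ← Finset.sum_div]
  rw [Finset.sum_comm]

lemma ga_mono [Nonempty S] (H : S → ℝ) {c d : S → ℝ} (h : ∀ σ, c σ ≤ d σ) : ga H c ≤ ga H d :=
  div_le_div_of_nonneg_right (Finset.sum_le_sum fun σ _ =>
    mul_le_mul_of_nonneg_right (h σ) (exp_pos _).le) (Zf_pos H).le

lemma ga_nonneg [Nonempty S] (H : S → ℝ) {c : S → ℝ} (h : ∀ σ, 0 ≤ c σ) : 0 ≤ ga H c := by
  have := ga_mono H h; rwa [ga_const] at this

lemma ga_abs_le [Nonempty S] (H : S → ℝ) {c : S → ℝ} {C : ℝ} (h : ∀ σ, |c σ| ≤ C) : |ga H c| ≤ C := by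
  rw [abs_le]
  constructor
  · have := ga_mono H (c := fun _ => -C) (d := c) fun σ => (abs_le.1 (h σ)).1
    rwa [ga_const] at this
  · have := ga_mono H (c := c) (d := fun _ => C) fun σ => (abs_le.1 (h σ)).2
    rwa [ga_const] at this

lemma Zf_rpow_abs_le [Nonempty S] {H : S → ℝ} {B : ℝ} (hB : ∀ σ, |H σ| ≤ B) (r : ℝ) :
    |Zf H ^ r| ≤ exp (|r| * (log (Fintype.card S) + B)) := by
  have hz := Zf_pos H
  rw [abs_of_pos (rpow_pos_of_pos hz _), rpow_def_of_pos hz]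
  apply exp_le_exp.2
  have hcard : (1 : ℝ) ≤ Fintype.card S := by exact_mod_cast Fintype.card_pos
  have h1 : log (Zf H) ≤ log (Fintype.card S) + B := by
    rw [← log_exp B, ← log_mul (by positivity) (exp_pos _).ne']
    apply log_le_log hz
    calc Zf H ≤ ∑ _σ : S, exp B := Finset.sum_le_sum fun σ _ => exp_le_exp.2 (abs_le.1 (hB σ)).2
      _ = _ := by simp
  have h2 : -B ≤ log (Zf H) := by
    rw [← log_exp (-B)]
    apply log_le_log (exp_pos _)
    obtain ⟨σ⟩ := ‹Nonempty S›
    calc exp (-B) ≤ exp (H σ) := exp_le_exp.2 (abs_le.1 (hB σ)).1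
      _ ≤ Zf H := Finset.single_le_sum (f := fun σ => exp (H σ)) (fun _ _ => (exp_pos _).le) (Finset.mem_univ σ)
  have h3 : |log (Zf H)| ≤ log (Fintype.card S) + B := by
    rw [abs_le]
    have := log_nonneg hcard
    constructor <;> linarith
  calc log (Zf H) * r ≤ |log (Zf H) * r| := le_abs_self _
    _ = |r| * |log (Zf H)| := by rw [abs_mul, mul_comm]
    _ ≤ _ := mul_le_mul_of_nonneg_left h3 (abs_nonneg _)

lemma Zf_rpow_lower [Nonempty S] {H : S → ℝ} {B : ℝ} (hB : ∀ σ, |H σ| ≤ B) {m : ℝ} (hm : 0 ≤ m) :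
    exp (-(m * B)) ≤ Zf H ^ m := by
  have hz := Zf_pos H
  rw [rpow_def_of_pos hz]
  apply exp_le_exp.2
  have h2 : -B ≤ log (Zf H) := by
    rw [← log_exp (-B)]
    apply log_le_log (exp_pos _)
    obtain ⟨σ⟩ := ‹Nonempty S›
    calc exp (-B) ≤ exp (H σ) := exp_le_exp.2 (abs_le.1 (hB σ)).1
      _ ≤ Zf H := Finset.single_le_sum (f := fun σ => exp (H σ)) (fun _ _ => (exp_pos _).le) (Finset.mem_univ σ)
  nlinarith

lemma hasDerivAt_Zf {H : ℝ → S → ℝ} {H' : S → ℝ} {t : ℝ} (h : ∀ σ, HasDerivAt (fun s => H s σ) (H' σ) t)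
    (c : S → ℝ) :
    HasDerivAt (fun s => ∑ σ, c σ * exp (H s σ)) (∑ σ, c σ * H' σ * exp (H t σ)) t := by
  refine HasDerivAt.fun_sum fun σ _ => ?_
  refine ((h σ).exp.const_mul (c σ)).congr_deriv ?_
  ring

lemma hasDerivAt_ga [Nonempty S] {H : ℝ → S → ℝ} {H' : S → ℝ} {t : ℝ}
    (h : ∀ σ, HasDerivAt (fun s => H s σ) (H' σ) t) (c : S → ℝ) :
    HasDerivAt (fun s => ga (H s) c)
      (ga (H t) (fun σ => c σ * H' σ) - ga (H t) c * ga (H t) H') t := by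
  have h1 := hasDerivAt_Zf h c
  have h2 := hasDerivAt_Zf h (fun _ => 1)
  simp only [one_mul] at h2
  refine (h1.fun_div h2 (Zf_pos (H t)).ne').congr_deriv ?_
  have := (Zf_pos (H t)).ne'
  simp only [ga]
  rw [show (∑ σ, exp (H t σ)) = Zf (H t) from rfl]
  field_simp

lemma hasDerivAt_W [Nonempty S] {H : ℝ → S → ℝ} {H' : S → ℝ} {t : ℝ}
    (h : ∀ σ, HasDerivAt (fun s => H s σ) (H' σ) t) (c : S → ℝ) (m : ℝ) :
    HasDerivAt (fun s => Zf (H s) ^ m * ga (H s) c)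
      (Zf (H t) ^ m * (ga (H t) (fun σ => c σ * H' σ) - (1 - m) * (ga (H t) c * ga (H t) H'))) t := by
  have h2 := hasDerivAt_Zf h (fun _ => 1)
  simp only [one_mul] at h2
  have h3 : HasDerivAt (fun s => Zf (H s) ^ m) _ t := h2.rpow_const (p := m) (Or.inl (Zf_pos (H t)).ne')
  refine (h3.fun_mul (hasDerivAt_ga h c)).congr_deriv ?_
  have hz := Zf_pos (H t)
  rw [show (∑ σ, exp (H t σ)) = Zf (H t) from rfl, rpow_sub_one hz.ne']
  have : ∑ σ, H' σ * exp (H t σ) = ga (H t) H' * Zf (H t) := by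
    rw [ga, div_mul_cancel₀ _ hz.ne']
  rw [this]
  field_simp
  ring

lemma measurable_Zf {α : Type*} [MeasurableSpace α] {H : α → S → ℝ} (h : ∀ σ, Measurable fun x => H x σ) :
    Measurable fun x => Zf (H x) :=
  Finset.measurable_sum _ fun σ _ => (h σ).exp

lemma measurable_ga {α : Type*} [MeasurableSpace α] {H c : α → S → ℝ} (h : ∀ σ, Measurable fun x => H x σ)
    (hc : ∀ σ, Measurable fun x => c x σ) : Measurable fun x => ga (H x) (c x) :=
  (Finset.measurable_sum _ fun σ _ => (hc σ).mul (h σ).exp).div (measurable_Zf h)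

end gibbsfin

/-! ### the inner integral -/
section inner
variable {S ℓ : Type*} [Fintype S] [Nonempty S] [Fintype ℓ]

lemma EB_Zpow {Θ : Type*} {H : Θ → (ℓ → ℝ) → S → ℝ} {B : ℝ}
    (hB : ∀ t y σ, |H t y σ| ≤ B * (1 + ∑ l, |y l|)) (m : ℝ) : EB (fun t y => Zf (H t y) ^ m) := by
  refine EB.of_le (exp (|m| * (log (Fintype.card S) + B))) (|m| * B) fun t y => ?_
  refine (Zf_rpow_abs_le (hB t y) m).trans (le_of_eq ?_)
  rw [← exp_add]; ring_nf

lemma EB_lin {Θ : Type*} (B : ℝ) : EB (fun (_ : Θ) (y : ℓ → ℝ) => B * (1 + ∑ l, |y l|)) :=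
  ((EB.const 1).add EB.sumabs).const_mul B

lemma EB_ga {Θ : Type*} {H c : Θ → (ℓ → ℝ) → S → ℝ} {B : ℝ}
    (hB : ∀ t y σ, |c t y σ| ≤ B * (1 + ∑ l, |y l|)) : EB (fun t y => ga (H t y) (c t y)) :=
  (EB_lin B).mono fun t y => (ga_abs_le _ (hB t y)).trans (le_abs_self _)

lemma inner_deriv {H H' : ℝ → (ℓ → ℝ) → S → ℝ} {t₀ B : ℝ}
    (hB : ∀ t ∈ Metric.ball t₀ 1, ∀ y σ, |H t y σ| ≤ B * (1 + ∑ l, |y l|))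
    (hB' : ∀ t ∈ Metric.ball t₀ 1, ∀ y σ, |H' t y σ| ≤ B * (1 + ∑ l, |y l|))
    (hm : ∀ t σ, Measurable fun y => H t y σ) (hm' : ∀ t σ, Measurable fun y => H' t y σ)
    (hd : ∀ t y σ, HasDerivAt (fun s => H s y σ) (H' t y σ) t) (c : S → ℝ) (m : ℝ) :
    HasDerivAt (fun t => ∫ y, Zf (H t y) ^ m * ga (H t y) c ∂(gm ℓ))
      (∫ y, Zf (H t₀ y) ^ m * (ga (H t₀ y) (fun σ => c σ * H' t₀ y σ)
        - (1 - m) * (ga (H t₀ y) c * ga (H t₀ y) (H' t₀ y))) ∂(gm ℓ)) t₀ := by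
  have h0 : t₀ ∈ Metric.ball t₀ 1 := Metric.mem_ball_self one_pos
  obtain ⟨C, hC⟩ : ∃ C, ∀ σ, |c σ| ≤ C :=
    ⟨∑ σ, |c σ|, fun σ => Finset.single_le_sum (f := fun σ => |c σ|) (fun _ _ => abs_nonneg _) (Finset.mem_univ σ)⟩
  have hC0 : 0 ≤ C := by obtain ⟨σ⟩ := ‹Nonempty S›; exact (abs_nonneg _).trans (hC σ)
  have hBc : ∀ (H : (ℓ → ℝ) → S → ℝ) y, |ga (H y) c| ≤ C := fun H y => ga_abs_le _ hC
  apply hasDerivAt_integral_gm (F := fun t y => Zf (H t y) ^ m * ga (H t y) c)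
    (F' := fun t y => Zf (H t y) ^ m * (ga (H t y) (fun σ => c σ * H' t y σ)
        - (1 - m) * (ga (H t y) c * ga (H t y) (H' t y)))) t₀
  · exact (EB_Zpow (H := fun _ : Unit => H t₀) (fun _ => hB t₀ h0) m).mul (EB.bdd C fun _ y => hBc _ _)
  · refine (EB_Zpow (H := fun t : Metric.ball t₀ 1 => H t) (fun t => hB t t.2) m).mul (EB.sub ?_ (EB.const_mul _ (EB.mul ?_ ?_)))
    · refine EB_ga (B := C * B) fun t y σ => ?_
      rw [abs_mul, mul_assoc]
      exact mul_le_mul (hC σ) (hB' t t.2 y σ) (abs_nonneg _) hC0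
    · exact EB.bdd C fun t y => hBc _ _
    · exact EB_ga (B := B) fun t y σ => hB' t t.2 y σ
  · intro t
    exact ((measurable_Zf (hm t)).pow_const m).mul (measurable_ga (hm t) fun σ => measurable_const)
  · exact ((measurable_Zf (hm _)).pow_const m).mul
      ((measurable_ga (hm _) fun σ => measurable_const.mul (hm' _ σ)).sub
        (Measurable.const_mul (Measurable.mul (measurable_ga (c := fun _ => c) (hm _) fun σ => measurable_const)
          (measurable_ga (hm _) (hm' _))) _))
  · intro t y
    exact hasDerivAt_W (hd t y) c m

/-- linear Hamiltonian in the inner Gaussians -/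
def Hy (v : S → ℝ) (D : ℓ → S → ℝ) (y : ℓ → ℝ) (σ : S) : ℝ := v σ + ∑ l, D l σ * y l

lemma Hy_meas (v : S → ℝ) (D : ℓ → S → ℝ) (σ : S) : Measurable fun y => Hy v D y σ := by
  unfold Hy; fun_prop

lemma Hy_bound {v : S → ℝ} {D : ℓ → S → ℝ} {A B : ℝ} (hv : ∀ σ, |v σ| ≤ A) (hD : ∀ l σ, |D l σ| ≤ B) (y : ℓ → ℝ) (σ : S) :
    |Hy v D y σ| ≤ A + B * ∑ l, |y l| := by
  unfold Hy
  refine (abs_add_le _ _).trans (add_le_add (hv σ) ((Finset.abs_sum_le_sum_abs _ _).trans ?_))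
  rw [Finset.mul_sum]
  refine Finset.sum_le_sum fun l _ => ?_
  rw [abs_mul]
  exact mul_le_mul_of_nonneg_right (hD l σ) (abs_nonneg _)

lemma exists_bd {ι : Type*} [Fintype ι] (v : ι → ℝ) : ∃ A, 0 ≤ A ∧ ∀ i, |v i| ≤ A :=
  ⟨∑ σ, |v σ|, Finset.sum_nonneg fun _ _ => abs_nonneg _,
    fun σ => Finset.single_le_sum (f := fun σ => |v σ|) (fun _ _ => abs_nonneg _) (Finset.mem_univ σ)⟩

lemma Hy_lin (v : S → ℝ) (D : ℓ → S → ℝ) : ∃ B, 0 ≤ B ∧ ∀ y σ, |Hy v D y σ| ≤ B * (1 + ∑ l, |y l|) := by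
  obtain ⟨A, hA0, hA⟩ := exists_bd v
  obtain ⟨B, hB0, hB⟩ := exists_bd (fun p : ℓ × S => D p.1 p.2)
  refine ⟨A + B, by positivity, fun y σ => (Hy_bound hA (fun l σ => hB (l, σ)) y σ).trans ?_⟩
  have := sum_abs_nonneg y
  nlinarith

/-- inner Stein -/
lemma inner_stein [DecidableEq ℓ] (v : S → ℝ) (D : ℓ → S → ℝ) (m : ℝ) (l : ℓ) (c : S → ℝ) :
    ∫ y, y l * (Zf (Hy v D y) ^ m * ga (Hy v D y) c) ∂(gm ℓ) =
    ∫ y, Zf (Hy v D y) ^ m * (ga (Hy v D y) (fun σ => c σ * D l σ) -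
      (1 - m) * (ga (Hy v D y) c * ga (Hy v D y) (D l))) ∂(gm ℓ) := by
  obtain ⟨B, hB0, hB⟩ := Hy_lin v D
  obtain ⟨C, hC0, hC⟩ := exists_bd c
  obtain ⟨E, hE0, hE⟩ := exists_bd (D l)
  have hz := EB_Zpow (H := fun _ : Unit => Hy v D) (fun _ => hB) m
  have hga : ∀ c : S → ℝ, EB (fun (_ : Unit) y => ga (Hy v D y) c) := fun c => by
    obtain ⟨C, hC0, hC⟩ := exists_bd c
    exact EB.bdd C fun _ y => ga_abs_le _ hC
  have mz : Measurable fun y => Zf (Hy v D y) ^ m := (measurable_Zf (Hy_meas v D)).pow_const m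
  have mg : ∀ c : S → ℝ, Measurable fun y => ga (Hy v D y) c := fun c =>
    measurable_ga (Hy_meas v D) fun σ => measurable_const
  apply stein l
  · exact hz.mul (hga c)
  · exact hz.mul ((hga _).sub (((hga c).mul (hga _)).const_mul _))
  · exact mz.mul (mg c)
  · exact mz.mul ((mg _).sub (((mg c).mul (mg _)).const_mul _))
  · intro y
    have := hasDerivAt_W (H := fun s => Hy v D (Function.update y l s)) (H' := D l) (t := y l) ?_ c m
    · simpa using this
    · intro σ
      unfold Hy
      have h1 : ∀ s, ∑ l', D l' σ * Function.update y l s l' = D l σ * s + ∑ l' ∈ Finset.univ.erase l, D l' σ * y l' := by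
        intro s
        rw [← Finset.add_sum_erase _ _ (Finset.mem_univ l), Function.update_self]
        congr 1
        exact Finset.sum_congr rfl fun j hj => by rw [Function.update_of_ne (Finset.ne_of_mem_erase hj)]
      simp_rw [h1]
      have := (((hasDerivAt_id (y l)).const_mul (D l σ)).add_const (∑ l' ∈ Finset.univ.erase l, D l' σ * y l')).const_add (v σ)
      simpa using this

end inner

section nested
variable {S ℓ κ : Type*} [Fintype S] [Nonempty S] [Fintype ℓ] [Fintype κ]

/-- inner integral -/
def Yi (m : ℝ) (v : S → ℝ) (D : ℓ → S → ℝ) : ℝ := ∫ y, Zf (Hy v D y) ^ m ∂(gm ℓ)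

/-- tilted average -/
def Tl (m : ℝ) (v : S → ℝ) (D : ℓ → S → ℝ) (g : (ℓ → ℝ) → ℝ) : ℝ :=
  (∫ y, Zf (Hy v D y) ^ m * g y ∂(gm ℓ)) / Yi m v D

lemma int_Zg (m : ℝ) (v : S → ℝ) (D : ℓ → S → ℝ) {g : (ℓ → ℝ) → ℝ} (hg : EB (fun _ : Unit => g))
    (hm : Measurable g) : Integrable (fun y => Zf (Hy v D y) ^ m * g y) (gm ℓ) := by
  obtain ⟨B, hB0, hB⟩ := Hy_lin v D
  have hz := EB_Zpow (H := fun _ : Unit => Hy v D) (fun _ => hB) m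
  exact (hz.mul hg).integrable () (((measurable_Zf (Hy_meas v D)).pow_const m).mul hm)

lemma int_Z (m : ℝ) (v : S → ℝ) (D : ℓ → S → ℝ) : Integrable (fun y => Zf (Hy v D y) ^ m) (gm ℓ) := by
  simpa using int_Zg m v D (g := fun _ => 1) (EB.const 1) measurable_const

lemma Yi_pos (m : ℝ) (v : S → ℝ) (D : ℓ → S → ℝ) : 0 < Yi m v D := by
  rw [Yi, integral_pos_iff_support_of_nonneg (fun y => (rpow_pos_of_pos (Zf_pos _) _).le) (int_Z m v D)]
  have : (Function.support fun y => Zf (Hy v D y) ^ m) = Set.univ := by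
    ext y; simpa using (rpow_pos_of_pos (Zf_pos _) _).ne'
  rw [this]; simp

lemma Tl_add {m : ℝ} {v : S → ℝ} {D : ℓ → S → ℝ} {g g' : (ℓ → ℝ) → ℝ} (hg : EB (fun _ : Unit => g))
    (hm : Measurable g) (hg' : EB (fun _ : Unit => g')) (hm' : Measurable g') :
    Tl m v D (fun y => g y + g' y) = Tl m v D g + Tl m v D g' := by
  rw [Tl, Tl, Tl, ← add_div, ← integral_add (int_Zg m v D hg hm) (int_Zg m v D hg' hm')]
  simp only [mul_add]

lemma Tl_const_mul {m : ℝ} {v : S → ℝ} {D : ℓ → S → ℝ} {g : (ℓ → ℝ) → ℝ} (a : ℝ) :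
    Tl m v D (fun y => a * g y) = a * Tl m v D g := by
  rw [Tl, Tl, ← mul_div_assoc, ← integral_const_mul]
  congr 2; ext y; ring

lemma Tl_sum {m : ℝ} {v : S → ℝ} {D : ℓ → S → ℝ} {ι : Type*} (s : Finset ι) {g : ι → (ℓ → ℝ) → ℝ}
    (hg : ∀ i, EB (fun _ : Unit => g i)) (hm : ∀ i, Measurable (g i)) :
    Tl m v D (fun y => ∑ i ∈ s, g i y) = ∑ i ∈ s, Tl m v D (g i) := by
  simp only [Tl, ← Finset.sum_div, Finset.mul_sum]
  rw [integral_finsetSum]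
  intro i _
  exact int_Zg m v D (hg i) (hm i)

lemma Tl_const {m : ℝ} {v : S → ℝ} {D : ℓ → S → ℝ} (a : ℝ) : Tl m v D (fun _ => a) = a := by
  rw [Tl, integral_mul_const]
  exact mul_div_cancel_left₀ _ (Yi_pos m v D).ne'

lemma Tl_mono {m : ℝ} {v : S → ℝ} {D : ℓ → S → ℝ} {g g' : (ℓ → ℝ) → ℝ} (hg : EB (fun _ : Unit => g))
    (hm : Measurable g) (hg' : EB (fun _ : Unit => g')) (hm' : Measurable g') (h : ∀ y, g y ≤ g' y) :
    Tl m v D g ≤ Tl m v D g' := by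
  apply div_le_div_of_nonneg_right _ (Yi_pos m v D).le
  apply integral_mono (int_Zg m v D hg hm) (int_Zg m v D hg' hm')
  intro y
  exact mul_le_mul_of_nonneg_left (h y) (rpow_pos_of_pos (Zf_pos _) _).le

lemma Tl_abs_le {m : ℝ} {v : S → ℝ} {D : ℓ → S → ℝ} {g : (ℓ → ℝ) → ℝ} {C : ℝ} (hm : Measurable g)
    (h : ∀ y, |g y| ≤ C) : |Tl m v D g| ≤ C := by
  have hg : EB (fun _ : Unit => g) := EB.bdd C fun _ => h
  rw [abs_le]
  constructor
  · have := Tl_mono (m := m) (v := v) (D := D) (EB.const (-C)) measurable_const hg hm fun y => (abs_le.1 (h y)).1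
    rwa [Tl_const] at this
  · have := Tl_mono (m := m) (v := v) (D := D) hg hm (EB.const C) measurable_const fun y => (abs_le.1 (h y)).2
    rwa [Tl_const] at this

lemma EB_gaHy (v : S → ℝ) (D : ℓ → S → ℝ) (c : S → ℝ) : EB (fun (_ : Unit) y => ga (Hy v D y) c) := by
  obtain ⟨C, hC0, hC⟩ := exists_bd c
  exact EB.bdd C fun _ y => ga_abs_le _ hC

lemma meas_gaHy (v : S → ℝ) (D : ℓ → S → ℝ) (c : S → ℝ) : Measurable fun y => ga (Hy v D y) c :=
  measurable_ga (Hy_meas v D) fun σ => measurable_const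

lemma logYi_bound {m : ℝ} (hm : 0 < m) (B : ℝ) : ∃ K, 0 ≤ K ∧ ∀ (v : S → ℝ) (D : ℓ → S → ℝ) (A : ℝ),
    (∀ σ, |v σ| ≤ A) → (∀ l σ, |D l σ| ≤ B) → |log (Yi m v D)| ≤ K + m * A := by
  set c0 := ∫ y : ℓ → ℝ, exp (-(m * B) * ∑ l, |y l|) ∂(gm ℓ) with hc0
  set c1 := ∫ y : ℓ → ℝ, exp ((m * B) * ∑ l, |y l|) ∂(gm ℓ) with hc1
  have p0 : 0 < c0 := integral_exp_pos (integrable_exp_abs_pi _)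
  have p1 : 0 < c1 := integral_exp_pos (integrable_exp_abs_pi _)
  have hcard : (1 : ℝ) ≤ Fintype.card S := by exact_mod_cast Fintype.card_pos
  refine ⟨|log c0| + |log c1| + m * log (Fintype.card S), by have := log_nonneg hcard; positivity, fun v D A hv hD => ?_⟩
  have h1 : exp (-(m * A)) * c0 ≤ Yi m v D := by
    rw [hc0, ← integral_const_mul]
    apply integral_mono ((integrable_exp_abs_pi _).const_mul _) (int_Z m v D)
    intro y
    simp only
    rw [← exp_add]
    refine le_trans (le_of_eq ?_) (Zf_rpow_lower (Hy_bound hv hD y) hm.le)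
    ring_nf
  have h2 : Yi m v D ≤ exp (m * (log (Fintype.card S) + A)) * c1 := by
    rw [hc1, ← integral_const_mul]
    apply integral_mono (int_Z m v D) ((integrable_exp_abs_pi _).const_mul _)
    intro y
    simp only
    rw [← exp_add]
    refine (le_abs_self _).trans ((Zf_rpow_abs_le (Hy_bound hv hD y) m).trans (le_of_eq ?_))
    rw [abs_of_pos hm]; ring_nf
  have l1 := log_le_log (by positivity) h1
  have l2 := log_le_log (Yi_pos m v D) h2
  rw [log_mul (exp_pos _).ne' p0.ne', log_exp] at l1
  rw [log_mul (exp_pos _).ne' p1.ne', log_exp] at l2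
  have a0 := neg_abs_le (log c0)
  have a1 := le_abs_self (log c1)
  have b0 := abs_nonneg (log c0)
  have b1 := abs_nonneg (log c1)
  have := log_nonneg hcard
  have h5 : 0 ≤ m * log (Fintype.card S) := by positivity
  rw [abs_le]; constructor <;> nlinarith

lemma meas_int {f : (κ → ℝ) → (ℓ → ℝ) → ℝ} (hf : Measurable fun p : (κ → ℝ) × (ℓ → ℝ) => f p.1 p.2) :
    Measurable fun x => ∫ y, f x y ∂(gm ℓ) :=
  (hf.stronglyMeasurable.integral_prod_right' (ν := gm ℓ)).measurable

/-- measurability of the nested Hamiltonian -/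
lemma meas_HH (e : S → ℝ) (A : κ → S → ℝ) (D : ℓ → S → ℝ) (σ : S) :
    Measurable fun p : (κ → ℝ) × (ℓ → ℝ) => Hy (Hy e A p.1) D p.2 σ := by
  unfold Hy; fun_prop

lemma meas_Zg (e : S → ℝ) (A : κ → S → ℝ) (D : ℓ → S → ℝ) (m : ℝ) {g : (κ → ℝ) → (ℓ → ℝ) → ℝ}
    (hg : Measurable fun p : (κ → ℝ) × (ℓ → ℝ) => g p.1 p.2) :
    Measurable fun x => ∫ y, Zf (Hy (Hy e A x) D y) ^ m * g x y ∂(gm ℓ) :=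
  meas_int (((measurable_Zf (meas_HH e A D)).pow_const m).mul hg)

lemma meas_Yi (e : S → ℝ) (A : κ → S → ℝ) (D : ℓ → S → ℝ) (m : ℝ) :
    Measurable fun x => Yi m (Hy e A x) D :=
  meas_int ((measurable_Zf (meas_HH e A D)).pow_const m)

lemma meas_Tl (e : S → ℝ) (A : κ → S → ℝ) (D : ℓ → S → ℝ) (m : ℝ) {g : (κ → ℝ) → (ℓ → ℝ) → ℝ}
    (hg : Measurable fun p : (κ → ℝ) × (ℓ → ℝ) => g p.1 p.2) :
    Measurable fun x => Tl m (Hy e A x) D (g x) :=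
  (meas_Zg e A D m hg).div (meas_Yi e A D m)

lemma meas_ga2 (e : S → ℝ) (A : κ → S → ℝ) (D : ℓ → S → ℝ) (c : S → ℝ) :
    Measurable fun p : (κ → ℝ) × (ℓ → ℝ) => ga (Hy (Hy e A p.1) D p.2) c :=
  measurable_ga (meas_HH e A D) fun σ => measurable_const

/-- The quantity `⟨c d⟩ - (1-m)⟨c⟩⟨d⟩`. -/
def qf (m : ℝ) (H c d : S → ℝ) : ℝ := ga H (fun σ => c σ * d σ) - (1 - m) * (ga H c * ga H d)

lemma qf_smul (m : ℝ) (H c d : S → ℝ) (a : ℝ) : qf m H c (fun σ => a * d σ) = a * qf m H c d := by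
  rw [qf, qf, ga_mul_const]
  have : (fun σ => c σ * (a * d σ)) = fun σ => a * (c σ * d σ) := by ext; ring
  rw [this, ga_mul_const]; ring

lemma meas_qf (e : S → ℝ) (A : κ → S → ℝ) (D : ℓ → S → ℝ) (m : ℝ) (c d : S → ℝ) :
    Measurable fun p : (κ → ℝ) × (ℓ → ℝ) => qf m (Hy (Hy e A p.1) D p.2) c d :=
  (meas_ga2 e A D _).sub (((meas_ga2 e A D c).mul (meas_ga2 e A D d)).const_mul _)

lemma meas_qf1 (v : S → ℝ) (D : ℓ → S → ℝ) (m : ℝ) (c d : S → ℝ) :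
    Measurable fun y => qf m (Hy v D y) c d :=
  (meas_gaHy v D _).sub (((meas_gaHy v D c).mul (meas_gaHy v D d)).const_mul _)

lemma qf_bdd (m : ℝ) (c d : S → ℝ) : ∃ C, 0 ≤ C ∧ ∀ H : S → ℝ, |qf m H c d| ≤ C := by
  obtain ⟨C1, h10, h1⟩ := exists_bd c
  obtain ⟨C2, h20, h2⟩ := exists_bd d
  refine ⟨C1 * C2 + |1 - m| * (C1 * C2), by positivity, fun H => ?_⟩
  have h12 : |ga H (fun σ => c σ * d σ)| ≤ C1 * C2 := ga_abs_le H fun σ => by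
    rw [abs_mul]; exact mul_le_mul (h1 σ) (h2 σ) (abs_nonneg _) h10
  refine (abs_sub _ _).trans (add_le_add h12 ?_)
  rw [abs_mul, abs_mul]
  exact mul_le_mul_of_nonneg_left (mul_le_mul (ga_abs_le H h1) (ga_abs_le H h2) (abs_nonneg _) h10) (abs_nonneg _)

/-- derivative of a tilted average in an outer coordinate. -/
lemma Tl_deriv_x [DecidableEq κ] (e : S → ℝ) (A : κ → S → ℝ) (D : ℓ → S → ℝ) (m : ℝ) (c : S → ℝ) (k : κ) (x : κ → ℝ) :
    HasDerivAt (fun s => Tl m (Hy e A (Function.update x k s)) D (fun y => ga (Hy (Hy e A (Function.update x k s)) D y) c))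
      (Tl m (Hy e A x) D (fun y => qf m (Hy (Hy e A x) D y) c (A k))
        - m * (Tl m (Hy e A x) D (fun y => ga (Hy (Hy e A x) D y) c) *
          Tl m (Hy e A x) D (fun y => ga (Hy (Hy e A x) D y) (A k)))) (x k) := by
  have hH : ∀ s σ, Hy e A (Function.update x k s) σ = Hy e A x σ + A k σ * (s - x k) := by
    intro s σ
    unfold Hy
    rw [← Finset.add_sum_erase _ _ (Finset.mem_univ k), Function.update_self,
      ← Finset.add_sum_erase Finset.univ (fun k => A k σ * x k) (Finset.mem_univ k)]
    rw [Finset.sum_congr rfl fun j hj => by rw [Function.update_of_ne (Finset.ne_of_mem_erase hj)]]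
    ring
  obtain ⟨C1, h10, h1⟩ := exists_bd (Hy e A x)
  obtain ⟨C2, h20, h2⟩ := exists_bd (A k)
  obtain ⟨C3, h30, h3⟩ := exists_bd (fun p : ℓ × S => D p.1 p.2)
  have hB : ∀ t ∈ Metric.ball (x k) 1, ∀ y σ, |Hy (Hy e A (Function.update x k t)) D y σ| ≤ (C1 + C2 + C3) * (1 + ∑ l, |y l|) := by
    intro t ht y σ
    have hv : ∀ σ, |Hy e A (Function.update x k t) σ| ≤ C1 + C2 := by
      intro σ
      rw [hH]
      refine (abs_add_le _ _).trans (add_le_add (h1 σ) ?_)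
      rw [abs_mul]
      have : |t - x k| ≤ 1 := by rw [Metric.mem_ball, Real.dist_eq] at ht; exact ht.le
      calc |A k σ| * |t - x k| ≤ C2 * 1 := mul_le_mul (h2 σ) this (abs_nonneg _) h20
        _ = C2 := mul_one _
    refine (Hy_bound hv (fun l σ => h3 (l, σ)) y σ).trans ?_
    have := sum_abs_nonneg y
    nlinarith
  have hB' : ∀ t ∈ Metric.ball (x k) 1, ∀ (y : ℓ → ℝ) σ, |A k σ| ≤ (C1 + C2 + C3) * (1 + ∑ l, |y l|) := by
    intro t ht y σ
    refine (h2 σ).trans ?_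
    have := sum_abs_nonneg y
    nlinarith
  have hd : ∀ t (y : ℓ → ℝ) σ, HasDerivAt (fun s => Hy (Hy e A (Function.update x k s)) D y σ) (A k σ) t := by
    intro t y σ
    have : (fun s => Hy (Hy e A (Function.update x k s)) D y σ) =
        fun s => Hy e A x σ + A k σ * (s - x k) + ∑ l, D l σ * y l := by
      ext s; rw [Hy, hH]
    rw [this]
    have := ((((hasDerivAt_id t).sub_const (x k)).const_mul (A k σ)).const_add (Hy e A x σ)).add_const (∑ l, D l σ * y l)
    simpa using this
  have D1 := inner_deriv (H := fun t y => Hy (Hy e A (Function.update x k t)) D y) (H' := fun _ _ => A k) hB hB'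
    (fun t σ => Hy_meas _ _ σ) (fun t σ => measurable_const) hd c m
  have D2 := inner_deriv (H := fun t y => Hy (Hy e A (Function.update x k t)) D y) (H' := fun _ _ => A k) hB hB'
    (fun t σ => Hy_meas _ _ σ) (fun t σ => measurable_const) hd (fun _ => 1) m
  simp only [ga_const, mul_one, one_mul, Function.update_eq_self] at D1 D2
  have hY := (Yi_pos m (Hy e A x) D).ne'
  refine (D1.fun_div D2 (by simpa [Yi] using hY)).congr_deriv ?_
  have e2 : ∫ y, Zf (Hy (Hy e A x) D y) ^ m * (ga (Hy (Hy e A x) D y) (A k) - (1 - m) * ga (Hy (Hy e A x) D y) (A k)) ∂(gm ℓ)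
      = m * ∫ y, Zf (Hy (Hy e A x) D y) ^ m * ga (Hy (Hy e A x) D y) (A k) ∂(gm ℓ) := by
    rw [← integral_const_mul]; congr 1; ext y; ring
  simp only [Function.update_eq_self] at *
  rw [e2]
  change _ / (Yi m (Hy e A x) D) ^ 2 = _
  simp only [Tl]
  change (_ * Yi m (Hy e A x) D - _) / (Yi m (Hy e A x) D) ^ 2 = _
  simp only [qf]
  field_simp

end nested

section nested2
variable {S ℓ κ : Type*} [Fintype S] [Nonempty S] [Fintype ℓ] [Fintype κ]

/-- amplitudes times coefficients -/
def AM {κ S : Type*} (a : κ → ℝ → ℝ) (c : κ → S → ℝ) (θ : ℝ) : κ → S → ℝ := fun k σ => a k θ * c k σ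

/-- an amplitude path: functions with derivative, both bounded by `C`. -/
def AmpPath {κ : Type*} (a a' : κ → ℝ → ℝ) (C : ℝ) : Prop :=
  0 ≤ C ∧ ∀ k θ, HasDerivAt (a k) (a' k θ) θ ∧ |a k θ| ≤ C ∧ |a' k θ| ≤ C

lemma AM_bd {a a' : κ → ℝ → ℝ} {C : ℝ} (h : AmpPath a a' C) (c : κ → S → ℝ) :
    ∃ B, 0 ≤ B ∧ ∀ θ k σ, |AM a c θ k σ| ≤ B ∧ |AM a' c θ k σ| ≤ B := by
  obtain ⟨C1, h10, h1⟩ := exists_bd (fun p : κ × S => c p.1 p.2)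
  refine ⟨C * C1, mul_nonneg h.1 h10, fun θ k σ => ?_⟩
  simp only [AM, abs_mul]
  exact ⟨mul_le_mul (h.2 k θ).2.1 (h1 (k, σ)) (abs_nonneg _) h.1,
    mul_le_mul (h.2 k θ).2.2 (h1 (k, σ)) (abs_nonneg _) h.1⟩

/-- the θ-derivative of the inner free energy -/
def PP (m : ℝ) (e : S → ℝ) (a a' : κ → ℝ → ℝ) (c : κ → S → ℝ) (b b' : ℓ → ℝ → ℝ) (d : ℓ → S → ℝ)
    (θ : ℝ) (x : κ → ℝ) : ℝ :=
  ∑ k, a' k θ * (x k * Tl m (Hy e (AM a c θ) x) (AM b d θ) (fun y => ga (Hy (Hy e (AM a c θ) x) (AM b d θ) y) (c k)))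
  + ∑ l, b' l θ * Tl m (Hy e (AM a c θ) x) (AM b d θ) (fun y => qf m (Hy (Hy e (AM a c θ) x) (AM b d θ) y) (d l) (AM b d θ l))

lemma Hy_AM_hasDeriv {a a' : κ → ℝ → ℝ} {C : ℝ} (h : AmpPath a a' C) (c : κ → S → ℝ) (v v' : ℝ → S → ℝ)
    (σ : S) (θ : ℝ) (hv : HasDerivAt (fun t => v t σ) (v' θ σ) θ) (x : κ → ℝ) :
    HasDerivAt (fun t => Hy (v t) (AM a c t) x σ) (Hy (v' θ) (AM a' c θ) x σ) θ := by
  unfold Hy AM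
  refine hv.fun_add (HasDerivAt.fun_sum fun k _ => ?_)
  exact (((h.2 k θ).1).mul_const _).mul_const _

lemma theta_deriv [DecidableEq ℓ] {m : ℝ} (hm : 0 < m) (e : S → ℝ) {a a' : κ → ℝ → ℝ} {Ca : ℝ} (ha : AmpPath a a' Ca)
    (c : κ → S → ℝ) {b b' : ℓ → ℝ → ℝ} {Cb : ℝ} (hb : AmpPath b b' Cb) (d : ℓ → S → ℝ) (x : κ → ℝ) (θ : ℝ) :
    HasDerivAt (fun t => 1 / m * log (Yi m (Hy e (AM a c t) x) (AM b d t)))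
      (PP m e a a' c b b' d θ x) θ := by
  obtain ⟨B1, hB10, hB1⟩ := AM_bd ha c
  obtain ⟨B2, hB20, hB2⟩ := AM_bd hb d
  obtain ⟨B3, hB30, hB3⟩ := exists_bd e
  have hx := sum_abs_nonneg x
  set H := fun t (y : ℓ → ℝ) => Hy (Hy e (AM a c t) x) (AM b d t) y with hH
  set H' := fun t (y : ℓ → ℝ) => Hy (Hy (fun _ => 0) (AM a' c t) x) (AM b' d t) y with hH'
  have bd1 : ∀ t ∈ Metric.ball θ 1, ∀ y σ, |H t y σ| ≤ (B3 + B1 * (∑ k, |x k|) + B2) * (1 + ∑ l, |y l|) := by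
    intro t _ y σ
    refine (Hy_bound (Hy_bound hB3 (fun k σ => (hB1 t k σ).1) x) (fun k σ => (hB2 t k σ).1) y σ).trans ?_
    have := sum_abs_nonneg y
    have h2 := mul_nonneg hB10 hx
    nlinarith
  have bd2 : ∀ t ∈ Metric.ball θ 1, ∀ y σ, |H' t y σ| ≤ (B3 + B1 * (∑ k, |x k|) + B2) * (1 + ∑ l, |y l|) := by
    intro t _ y σ
    refine (Hy_bound (Hy_bound (A := B3) (by simpa using hB30) (fun k σ => (hB1 t k σ).2) x) (fun k σ => (hB2 t k σ).2) y σ).trans ?_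
    have := sum_abs_nonneg y
    have h2 := mul_nonneg hB10 hx
    nlinarith
  have hd : ∀ t y σ, HasDerivAt (fun s => H s y σ) (H' t y σ) t := by
    intro t y σ
    apply Hy_AM_hasDeriv hb d (fun t => Hy e (AM a c t) x) (fun t => Hy (fun _ => 0) (AM a' c t) x)
    apply Hy_AM_hasDeriv ha c (fun _ => e) (fun _ _ => 0)
    exact hasDerivAt_const _ _
  have D1 := inner_deriv (H := H) (H' := H') bd1 bd2
    (fun t σ => Hy_meas _ _ σ) (fun t σ => Hy_meas _ _ σ) hd (fun _ => 1) m
  simp only [ga_const, mul_one, one_mul] at D1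
  have hY := Yi_pos m (Hy e (AM a c θ) x) (AM b d θ)
  have D2 : HasDerivAt (fun t => 1 / m * log (Yi m (Hy e (AM a c t) x) (AM b d t))) _ θ :=
    (D1.log (by simpa [Yi] using hY.ne')).const_mul (1 / m)
  refine D2.congr_deriv ?_
  set v := Hy e (AM a c θ) x with hv
  set D := AM b d θ with hD
  have e1 : ∀ y, Zf (H θ y) ^ m * (ga (H θ y) (H' θ y) - (1 - m) * ga (H θ y) (H' θ y)) =
      m * (∑ k, a' k θ * (x k * (Zf (Hy v D y) ^ m * ga (Hy v D y) (c k)))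
        + ∑ l, b' l θ * (y l * (Zf (Hy v D y) ^ m * ga (Hy v D y) (d l)))) := by
    intro y
    have : ga (H θ y) (H' θ y) = ∑ k, a' k θ * x k * ga (Hy v D y) (c k) + ∑ l, b' l θ * y l * ga (Hy v D y) (d l) := by
      have h0 : H' θ y = fun σ => (∑ k, a' k θ * x k * c k σ) + ∑ l, b' l θ * y l * d l σ := by
        ext σ
        simp only [hH', Hy, AM, zero_add]
        congr 1 <;> exact Finset.sum_congr rfl fun k _ => by ring
      rw [h0, ga_add, ga_sum, ga_sum]
      simp only [ga_mul_const]
      rfl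
    rw [this]
    change Zf (Hy v D y) ^ m * _ = _
    rw [show ∀ X : ℝ, X - (1 - m) * X = m * X by intro X; ring, mul_left_comm]
    congr 1
    rw [mul_add, Finset.mul_sum, Finset.mul_sum]
    congr 1 <;> exact Finset.sum_congr rfl fun k _ => by ring
  have i1 : ∀ c : S → ℝ, Integrable (fun y => Zf (Hy v D y) ^ m * ga (Hy v D y) c) (gm ℓ) := fun c =>
    int_Zg m v D (EB_gaHy v D c) (meas_gaHy v D c)
  have i2 : ∀ l (c : S → ℝ), Integrable (fun y : ℓ → ℝ => y l * (Zf (Hy v D y) ^ m * ga (Hy v D y) c)) (gm ℓ) := fun l c => by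
    have := int_Zg m v D (g := fun y : ℓ → ℝ => y l * ga (Hy v D y) c) ((EB.coord l).mul (EB_gaHy v D c)) (show Measurable (fun y : ℓ → ℝ => y l * ga (Hy v D y) c) from (measurable_pi_apply l).mul (meas_gaHy v D c))
    refine this.congr (Eventually.of_forall fun y => ?_)
    simp only; ring
  simp_rw [e1]
  rw [integral_const_mul, integral_add (integrable_finsetSum _ fun k _ => ((i1 _).const_mul _).const_mul _)
    (integrable_finsetSum _ fun l _ => (i2 _ _).const_mul _),
    integral_finsetSum _ (fun k _ => ((i1 _).const_mul _).const_mul _),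
    integral_finsetSum _ (fun l _ => (i2 _ _).const_mul _)]
  simp only [integral_const_mul, inner_stein]
  change 1 / m * (m * _ / Yi m v D) = _
  rw [PP, mul_div_assoc, ← mul_assoc, one_div, inv_mul_cancel₀ hm.ne', one_mul, add_div, Finset.sum_div, Finset.sum_div]
  congr 1
  · exact Finset.sum_congr rfl fun k _ => by simp only [Tl]; rw [mul_div_assoc, mul_div_assoc]
  · exact Finset.sum_congr rfl fun k _ => by simp only [Tl, qf]; rw [mul_div_assoc]

/-- the outer free energy -/
def FF (m : ℝ) (e : S → ℝ) (A : κ → S → ℝ) (D : ℓ → S → ℝ) : ℝ :=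
  ∫ x, 1 / m * log (Yi m (Hy e A x) D) ∂(gm κ)

/-- pointwise integrand after integration by parts -/
def RR (m : ℝ) (e : S → ℝ) (a a' : κ → ℝ → ℝ) (c : κ → S → ℝ) (b b' : ℓ → ℝ → ℝ) (d : ℓ → S → ℝ)
    (θ : ℝ) (x : κ → ℝ) : ℝ :=
  ∑ k, a k θ * a' k θ * (Tl m (Hy e (AM a c θ) x) (AM b d θ) (fun y => qf m (Hy (Hy e (AM a c θ) x) (AM b d θ) y) (c k) (c k))
      - m * Tl m (Hy e (AM a c θ) x) (AM b d θ) (fun y => ga (Hy (Hy e (AM a c θ) x) (AM b d θ) y) (c k)) ^ 2)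
  + ∑ l, b l θ * b' l θ * Tl m (Hy e (AM a c θ) x) (AM b d θ) (fun y => qf m (Hy (Hy e (AM a c θ) x) (AM b d θ) y) (d l) (d l))

lemma meas_Tlga (e : S → ℝ) (A : κ → S → ℝ) (D : ℓ → S → ℝ) (m : ℝ) (c : S → ℝ) :
    Measurable fun x => Tl m (Hy e A x) D (fun y => ga (Hy (Hy e A x) D y) c) :=
  meas_Tl e A D m (g := fun x y => ga (Hy (Hy e A x) D y) c) (meas_ga2 e A D c)

lemma meas_Tlqf (e : S → ℝ) (A : κ → S → ℝ) (D : ℓ → S → ℝ) (m : ℝ) (c d : S → ℝ) :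
    Measurable fun x => Tl m (Hy e A x) D (fun y => qf m (Hy (Hy e A x) D y) c d) :=
  meas_Tl e A D m (g := fun x y => qf m (Hy (Hy e A x) D y) c d) (meas_qf e A D m c d)

lemma EB_Tlga {Θ : Type*} (e : S → ℝ) (A : Θ → κ → S → ℝ) (D : Θ → ℓ → S → ℝ) (m : ℝ) (c : S → ℝ) :
    EB fun t x => Tl m (Hy e (A t) x) (D t) (fun y => ga (Hy (Hy e (A t) x) (D t) y) c) := by
  obtain ⟨C, h0, hC⟩ := exists_bd c
  exact EB.bdd C fun t x => Tl_abs_le (meas_gaHy _ _ _) fun y => ga_abs_le _ hC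

lemma EB_Tlqf {Θ : Type*} (e : S → ℝ) (A : Θ → κ → S → ℝ) (D : Θ → ℓ → S → ℝ) (m : ℝ) (c d : S → ℝ) :
    EB fun t x => Tl m (Hy e (A t) x) (D t) (fun y => qf m (Hy (Hy e (A t) x) (D t) y) c d) := by
  obtain ⟨C, h0, hC⟩ := qf_bdd m c d
  exact EB.bdd C fun t x => Tl_abs_le (meas_qf1 _ _ _ _ _) fun y => hC _

lemma EB_bdd_mul {Θ : Type*} {F : Θ → (κ → ℝ) → ℝ} (hF : EB F) {f : Θ → ℝ} {C : ℝ} (hf : ∀ t, |f t| ≤ C) :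
    EB fun t x => f t * F t x :=
  (EB.bdd C fun t _ => hf t : EB fun t (_ : κ → ℝ) => f t).mul hF

lemma qf_AM {b : ℓ → ℝ → ℝ} {d : ℓ → S → ℝ} {m : ℝ} (e : S → ℝ) (A : κ → S → ℝ) (θ : ℝ) (x : κ → ℝ) (l : ℓ) :
    Tl m (Hy e A x) (AM b d θ) (fun y => qf m (Hy (Hy e A x) (AM b d θ) y) (d l) (AM b d θ l)) =
    b l θ * Tl m (Hy e A x) (AM b d θ) (fun y => qf m (Hy (Hy e A x) (AM b d θ) y) (d l) (d l)) := by
  rw [← Tl_const_mul]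
  congr 1; ext y
  rw [← qf_smul]; rfl

/-- The nested interpolation derivative. -/
lemma nested_deriv {m : ℝ} (hm : 0 < m) (e : S → ℝ) {a a' : κ → ℝ → ℝ} {Ca : ℝ} (ha : AmpPath a a' Ca)
    (c : κ → S → ℝ) {b b' : ℓ → ℝ → ℝ} {Cb : ℝ} (hb : AmpPath b b' Cb) (d : ℓ → S → ℝ) (θ : ℝ) :
    HasDerivAt (fun t => FF m e (AM a c t) (AM b d t)) (∫ x, RR m e a a' c b b' d θ x ∂(gm κ)) θ := by
  classical
  obtain ⟨B1, hB10, hB1⟩ := AM_bd ha c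
  obtain ⟨B2, hB20, hB2⟩ := AM_bd hb d
  obtain ⟨B3, hB30, hB3⟩ := exists_bd e
  have D1 : HasDerivAt (fun t => FF m e (AM a c t) (AM b d t)) (∫ x, PP m e a a' c b b' d θ x ∂(gm κ)) θ := by
    apply hasDerivAt_integral_gm (F := fun t x => 1 / m * log (Yi m (Hy e (AM a c t) x) (AM b d t)))
      (F' := PP m e a a' c b b' d) θ
    · obtain ⟨K, hK0, hK⟩ := logYi_bound (S := S) (ℓ := ℓ) hm B2
      have : EB (fun (_ : Unit) (x : κ → ℝ) => |1 / m| * (K + m * (B3 + B1 * ∑ k, |x k|))) :=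
        EB.const_mul _ ((EB.const K).add (EB.const_mul m ((EB.const B3).add (EB.sumabs.const_mul B1))))
      refine this.mono fun _ x => ?_
      rw [abs_mul]
      refine le_trans ?_ (le_abs_self _)
      exact mul_le_mul_of_nonneg_left (hK _ _ _ (Hy_bound hB3 (fun k σ => (hB1 θ k σ).1) x) (fun k σ => (hB2 θ k σ).1)) (abs_nonneg _)
    · unfold PP
      refine (EB.sum fun k _ => ?_).add (EB.sum fun l _ => ?_)
      · exact EB_bdd_mul ((EB.coord k).mul (EB_Tlga (κ := κ) (Θ := Metric.ball θ 1) e (fun s => AM a c s) (fun s => AM b d s) m (c k))) fun t => (ha.2 k t).2.2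
      · simp_rw [qf_AM (κ := κ)]
        exact EB_bdd_mul (EB_bdd_mul (EB_Tlqf (κ := κ) (Θ := Metric.ball θ 1) e (fun s => AM a c s) (fun s => AM b d s) m _ _) fun t => (hb.2 l t).2.1) fun t => (hb.2 l t).2.2
    · intro t
      exact (measurable_log.comp (meas_Yi e _ _ m)).const_mul _
    · unfold PP
      refine (Finset.measurable_sum _ fun k _ => ?_).add (Finset.measurable_sum _ fun l _ => ?_)
      · exact ((measurable_pi_apply k).mul (meas_Tlga e _ _ m (c k))).const_mul _
      · exact (meas_Tlqf e _ _ m _ _).const_mul _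
    · intro t x
      exact theta_deriv hm e ha c hb d x t
  refine D1.congr_deriv ?_
  have i1 : ∀ k, Integrable (fun x : κ → ℝ => x k * Tl m (Hy e (AM a c θ) x) (AM b d θ) (fun y => ga (Hy (Hy e (AM a c θ) x) (AM b d θ) y) (c k))) (gm κ) :=
    fun k => ((EB.coord (Θ := Unit) k).mul (EB_Tlga e (fun _ => AM a c θ) (fun _ => AM b d θ) m (c k))).integrable ()
      ((measurable_pi_apply k).mul (meas_Tlga e _ _ m (c k)))
  have i2 : ∀ c₁ d₁ : S → ℝ, Integrable (fun x : κ → ℝ => Tl m (Hy e (AM a c θ) x) (AM b d θ) (fun y => qf m (Hy (Hy e (AM a c θ) x) (AM b d θ) y) c₁ d₁)) (gm κ) :=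
    fun c₁ d₁ => (EB_Tlqf e (fun _ : Unit => AM a c θ) (fun _ => AM b d θ) m c₁ d₁).integrable () (meas_Tlqf e _ _ m _ _)
  have i3 : ∀ c₁ : S → ℝ, Integrable (fun x : κ → ℝ => Tl m (Hy e (AM a c θ) x) (AM b d θ) (fun y => ga (Hy (Hy e (AM a c θ) x) (AM b d θ) y) c₁) ^ 2) (gm κ) :=
    fun c₁ => ((EB_Tlga e (fun _ : Unit => AM a c θ) (fun _ => AM b d θ) m c₁).pow 2).integrable () ((meas_Tlga e _ _ m c₁).pow_const 2)
  have i4 : ∀ k, Integrable (fun x : κ → ℝ => a k θ * a' k θ * (Tl m (Hy e (AM a c θ) x) (AM b d θ) (fun y => qf m (Hy (Hy e (AM a c θ) x) (AM b d θ) y) (c k) (c k)) - m * Tl m (Hy e (AM a c θ) x) (AM b d θ) (fun y => ga (Hy (Hy e (AM a c θ) x) (AM b d θ) y) (c k)) ^ 2)) (gm κ) :=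
    fun k => ((i2 _ _).sub ((i3 _).const_mul _)).const_mul _
  simp only [PP, RR, qf_AM]
  rw [integral_add (integrable_finsetSum _ fun k _ => (i1 k).const_mul _)
      (integrable_finsetSum _ fun l _ => ((i2 _ _).const_mul _).const_mul _),
    integral_add (integrable_finsetSum _ fun k _ => i4 k)
      (integrable_finsetSum _ fun l _ => (i2 _ _).const_mul _),
    integral_finsetSum _ (fun k _ => (i1 k).const_mul _),
    integral_finsetSum _ (fun l _ => ((i2 _ _).const_mul _).const_mul _),
    integral_finsetSum _ (fun k _ => i4 k),
    integral_finsetSum _ (fun l _ => (i2 _ _).const_mul _)]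
  congr 1
  · refine Finset.sum_congr rfl fun k _ => ?_
    rw [integral_const_mul, integral_const_mul, mul_comm (a k θ), mul_assoc]
    congr 1
    rw [← integral_const_mul]
    have hAk : AM a c θ k = fun σ => a k θ * c k σ := rfl
    apply stein k
    · exact EB_Tlga e (fun _ => AM a c θ) (fun _ => AM b d θ) m (c k)
    · exact ((EB_Tlqf e (fun _ => AM a c θ) (fun _ => AM b d θ) m (c k) (c k)).sub
        (((EB_Tlga e (fun _ => AM a c θ) (fun _ => AM b d θ) m (c k)).pow 2).const_mul m)).const_mul (a k θ)
    · exact meas_Tlga e _ _ m (c k)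
    · exact ((meas_Tlqf e _ _ m (c k) (c k)).sub (((meas_Tlga e _ _ m (c k)).pow_const 2).const_mul m)).const_mul (a k θ)
    · intro x
      refine (Tl_deriv_x e (AM a c θ) (AM b d θ) m (c k) k x).congr_deriv ?_
      rw [hAk]
      simp only [qf_smul, Tl_const_mul, ga_mul_const]
      ring
  · refine Finset.sum_congr rfl fun l _ => ?_
    rw [integral_const_mul, integral_const_mul, integral_const_mul]
    ring

end nested2

section guerra
variable {S ℓ κ : Type*} [Fintype S] [Nonempty S] [Fintype ℓ] [Fintype κ]

lemma quad_lb {ι : Type*} [Fintype ι] (w : ι → ℝ) (c : ι → S → ℝ) (p : S → ℝ) (hp : ∀ s, 0 ≤ p s) (hp1 : ∑ s, p s = 1)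
    {K : ℝ} (h : ∀ s s', -K ≤ ∑ k, w k * (c k s * c k s')) :
    -K ≤ ∑ k, w k * (∑ s, p s * c k s) ^ 2 := by
  have e1 : ∑ k, w k * (∑ s, p s * c k s) ^ 2 = ∑ s, ∑ s', p s * p s' * ∑ k, w k * (c k s * c k s') := by
    simp_rw [sq, Finset.sum_mul_sum, Finset.mul_sum]
    rw [Finset.sum_comm]
    refine Finset.sum_congr rfl fun s _ => ?_
    rw [Finset.sum_comm]
    refine Finset.sum_congr rfl fun s' _ => Finset.sum_congr rfl fun k _ => by ring
  rw [e1]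
  have e2 : -K = ∑ s, ∑ s', p s * p s' * -K := by
    simp_rw [mul_assoc, ← Finset.mul_sum, ← Finset.sum_mul]
    rw [hp1]; ring
  rw [e2]
  exact Finset.sum_le_sum fun s _ => Finset.sum_le_sum fun s' _ =>
    mul_le_mul_of_nonneg_left (h s s') (mul_nonneg (hp _) (hp _))

lemma ga_eq_sum (H c : S → ℝ) : ga H c = ∑ s, (exp (H s) / Zf H) * c s := by
  rw [ga, Finset.sum_div]; exact Finset.sum_congr rfl fun s _ => by ring

lemma wt_sum (H : S → ℝ) : ∑ s, exp (H s) / Zf H = 1 := by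
  rw [← Finset.sum_div]; exact div_self (Zf_pos H).ne'

lemma Tlga_eq_sum [DecidableEq S] (m : ℝ) (v : S → ℝ) (D : ℓ → S → ℝ) (c : S → ℝ) :
    Tl m v D (fun y => ga (Hy v D y) c) =
      ∑ s, Tl m v D (fun y => ga (Hy v D y) (fun s' => if s' = s then 1 else 0)) * c s := by
  have : ∀ y, ga (Hy v D y) c = ∑ s, c s * ga (Hy v D y) (fun s' => if s' = s then 1 else 0) := by
    intro y
    simp_rw [← ga_mul_const]
    rw [← ga_sum]
    congr 1; ext s'; simp
  simp_rw [this]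
  rw [Tl_sum _ (fun s => (EB_gaHy v D _).const_mul _) (fun s => (meas_gaHy v D _).const_mul _)]
  exact Finset.sum_congr rfl fun s _ => by rw [Tl_const_mul, mul_comm]

lemma RR_le {m : ℝ} (hm : 0 ≤ m) (hm1 : m ≤ 1) (e : S → ℝ) {a a' : κ → ℝ → ℝ}
    (c : κ → S → ℝ) {b b' : ℓ → ℝ → ℝ} (d : ℓ → S → ℝ) (θ : ℝ) (x : κ → ℝ) {k1 k2 k3 : ℝ}
    (h1 : ∀ s, ∑ k, a k θ * a' k θ * (c k s * c k s) + ∑ l, b l θ * b' l θ * (d l s * d l s) ≤ k1)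
    (h2 : ∀ s s', -k2 ≤ ∑ k, a k θ * a' k θ * (c k s * c k s') + ∑ l, b l θ * b' l θ * (d l s * d l s'))
    (h3 : ∀ s s', -k3 ≤ ∑ k, a k θ * a' k θ * (c k s * c k s')) :
    RR m e a a' c b b' d θ x ≤ k1 + (1 - m) * k2 + m * k3 := by
  classical
  set v := Hy e (AM a c θ) x with hv
  set D := AM b d θ with hD
  have q1 : ∀ H : S → ℝ, ∑ k, a k θ * a' k θ * qf m H (c k) (c k) + ∑ l, b l θ * b' l θ * qf m H (d l) (d l)
      ≤ k1 + (1 - m) * k2 := by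
    intro H
    have e1 : ∑ k, a k θ * a' k θ * qf m H (c k) (c k) + ∑ l, b l θ * b' l θ * qf m H (d l) (d l)
      = ga H (fun s => ∑ k, a k θ * a' k θ * (c k s * c k s) + ∑ l, b l θ * b' l θ * (d l s * d l s))
        - (1 - m) * (∑ k, a k θ * a' k θ * ga H (c k) ^ 2 + ∑ l, b l θ * b' l θ * ga H (d l) ^ 2) := by
      rw [ga_add, ga_sum, ga_sum]
      simp_rw [ga_mul_const, qf, mul_sub, mul_add, Finset.sum_sub_distrib, Finset.mul_sum]
      have : ∀ (w g : ℝ), w * ((1 - m) * (g * g)) = (1 - m) * (w * g ^ 2) := by intros; ring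
      simp_rw [this]; ring
    have e2 := ga_mono H h1
    rw [ga_const] at e2
    have e3 : -k2 ≤ ∑ k, a k θ * a' k θ * ga H (c k) ^ 2 + ∑ l, b l θ * b' l θ * ga H (d l) ^ 2 := by
      have := quad_lb (ι := κ ⊕ ℓ) (Sum.elim (fun k => a k θ * a' k θ) (fun l => b l θ * b' l θ)) (Sum.elim c d)
        (fun s => exp (H s) / Zf H) (fun s => div_nonneg (exp_pos _).le (Zf_pos H).le) (wt_sum H) (K := k2)
        (by simpa [Fintype.sum_sum_type] using h2)
      simpa [Fintype.sum_sum_type, ga_eq_sum] using this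
    rw [e1]
    nlinarith
  have q2 : -k3 ≤ ∑ k, a k θ * a' k θ * Tl m v D (fun y => ga (Hy v D y) (c k)) ^ 2 := by
    simp_rw [Tlga_eq_sum m v D (c _)]
    apply quad_lb
    · intro s
      have := Tl_mono (m := m) (v := v) (D := D) (EB.const 0) measurable_const
        (EB_gaHy v D (fun s' => if s' = s then 1 else 0)) (meas_gaHy v D _)
        (fun y => ga_nonneg _ fun s' => by split_ifs <;> simp)
      rwa [Tl_const] at this
    · have := Tlga_eq_sum m v D (fun _ => 1)
      simp only [ga_const, Tl_const, mul_one] at this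
      exact this.symm
    · exact h3
  have q3 : ∑ k, a k θ * a' k θ * Tl m v D (fun y => qf m (Hy v D y) (c k) (c k))
      + ∑ l, b l θ * b' l θ * Tl m v D (fun y => qf m (Hy v D y) (d l) (d l)) ≤ k1 + (1 - m) * k2 := by
    have EBq : ∀ c d : S → ℝ, EB (fun (_ : Unit) y => qf m (Hy v D y) c d) := fun c d => by
      obtain ⟨C, h0, hC⟩ := qf_bdd m c d
      exact EB.bdd C fun _ y => hC _
    have mq : ∀ c d : S → ℝ, Measurable (fun y => qf m (Hy v D y) c d) := fun c d => meas_qf1 v D m c d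
    have EA : EB fun (_ : Unit) y => ∑ k, a k θ * a' k θ * qf m (Hy v D y) (c k) (c k) := EB.sum fun k _ => (EBq _ _).const_mul _
    have EC : EB fun (_ : Unit) y => ∑ l, b l θ * b' l θ * qf m (Hy v D y) (d l) (d l) := EB.sum fun k _ => (EBq _ _).const_mul _
    have MA : Measurable fun y => ∑ k, a k θ * a' k θ * qf m (Hy v D y) (c k) (c k) := Finset.measurable_sum _ fun k _ => (mq _ _).const_mul _
    have MC : Measurable fun y => ∑ l, b l θ * b' l θ * qf m (Hy v D y) (d l) (d l) := Finset.measurable_sum _ fun k _ => (mq _ _).const_mul _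
    simp_rw [← Tl_const_mul]
    rw [← Tl_sum _ (fun k => (EBq _ _).const_mul _) (fun k => (mq _ _).const_mul _),
      ← Tl_sum _ (fun k => (EBq _ _).const_mul _) (fun k => (mq _ _).const_mul _), ← Tl_add EA MA EC MC]
    have := Tl_mono (m := m) (v := v) (D := D) (g := fun y => ∑ k, a k θ * a' k θ * qf m (Hy v D y) (c k) (c k) + ∑ l, b l θ * b' l θ * qf m (Hy v D y) (d l) (d l)) (EA.add EC) (MA.add MC)
      (EB.const (k1 + (1 - m) * k2)) measurable_const fun y => q1 (Hy v D y)
    rwa [Tl_const] at this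
  unfold RR
  have : ∀ w A B : ℝ, w * (A - m * B ^ 2) = w * A - m * (w * B ^ 2) := by intros; ring
  simp_rw [this, Finset.sum_sub_distrib, ← Finset.mul_sum]
  rw [← hv, ← hD]
  nlinarith

lemma RR_integrable (m : ℝ) (e : S → ℝ) (a a' : κ → ℝ → ℝ)
    (c : κ → S → ℝ) (b b' : ℓ → ℝ → ℝ) (d : ℓ → S → ℝ) (θ : ℝ) :
    Integrable (fun x => RR m e a a' c b b' d θ x) (gm κ) := by
  have i2 : ∀ c₁ d₁ : S → ℝ, Integrable (fun x : κ → ℝ => Tl m (Hy e (AM a c θ) x) (AM b d θ) (fun y => qf m (Hy (Hy e (AM a c θ) x) (AM b d θ) y) c₁ d₁)) (gm κ) :=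
    fun c₁ d₁ => (EB_Tlqf e (fun _ : Unit => AM a c θ) (fun _ => AM b d θ) m c₁ d₁).integrable () (meas_Tlqf e _ _ m _ _)
  have i3 : ∀ c₁ : S → ℝ, Integrable (fun x : κ → ℝ => Tl m (Hy e (AM a c θ) x) (AM b d θ) (fun y => ga (Hy (Hy e (AM a c θ) x) (AM b d θ) y) c₁) ^ 2) (gm κ) :=
    fun c₁ => ((EB_Tlga e (fun _ : Unit => AM a c θ) (fun _ => AM b d θ) m c₁).pow 2).integrable () ((meas_Tlga e _ _ m c₁).pow_const 2)
  unfold RR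
  exact (integrable_finsetSum _ fun k _ => ((i2 _ _).sub ((i3 _).const_mul _)).const_mul _).add
    (integrable_finsetSum _ fun l _ => (i2 _ _).const_mul _)

/-- Abstract Guerra bound. -/
lemma guerra {m : ℝ} (hm : 0 < m) (hm1 : m ≤ 1) (e : S → ℝ) {a a' : κ → ℝ → ℝ} {Ca : ℝ} (ha : AmpPath a a' Ca)
    (c : κ → S → ℝ) {b b' : ℓ → ℝ → ℝ} {Cb : ℝ} (hb : AmpPath b b' Cb) (d : ℓ → S → ℝ) {k1 k2 k3 : ℝ}
    (wa : κ → ℝ) (wb : ℓ → ℝ) (hwa : ∀ k θ, a k θ * a' k θ = sin θ * cos θ * wa k)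
    (hwb : ∀ k θ, b k θ * b' k θ = sin θ * cos θ * wb k)
    (h1 : ∀ s, ∑ k, wa k * (c k s * c k s) + ∑ l, wb l * (d l s * d l s) ≤ k1)
    (h2 : ∀ s s', -k2 ≤ ∑ k, wa k * (c k s * c k s') + ∑ l, wb l * (d l s * d l s'))
    (h3 : ∀ s s', -k3 ≤ ∑ k, wa k * (c k s * c k s')) :
    FF m e (AM a c (π / 2)) (AM b d (π / 2)) ≤ FF m e (AM a c 0) (AM b d 0) + (k1 + (1 - m) * k2 + m * k3) / 2 := by
  set K := k1 + (1 - m) * k2 + m * k3 with hK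
  have hd := fun θ => nested_deriv hm e ha c hb d θ
  have hle : ∀ θ ∈ Set.Icc (0:ℝ) (π/2), ∫ x, RR m e a a' c b b' d θ x ∂(gm κ) ≤ sin θ * cos θ * K := by
    intro θ hθ
    have hsc : 0 ≤ sin θ * cos θ := mul_nonneg (sin_nonneg_of_nonneg_of_le_pi hθ.1 (by linarith [hθ.2, pi_pos]))
      (cos_nonneg_of_neg_pi_div_two_le_of_le (by linarith [hθ.1, pi_pos]) hθ.2)
    have hpt : ∀ x, RR m e a a' c b b' d θ x ≤ sin θ * cos θ * K := by
      intro x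
      have := RR_le hm.le hm1 e (a := a) (a' := a') c (b := b) (b' := b') d θ x
        (k1 := sin θ * cos θ * k1) (k2 := sin θ * cos θ * k2) (k3 := sin θ * cos θ * k3) ?_ ?_ ?_
      · refine this.trans (le_of_eq ?_); rw [hK]; ring
      · intro s
        simp_rw [hwa, hwb, mul_assoc, ← Finset.mul_sum]
        have := mul_le_mul_of_nonneg_left (h1 s) hsc
        simpa [mul_add, mul_assoc] using this
      · intro s s'
        simp_rw [hwa, hwb, mul_assoc, ← Finset.mul_sum]
        have := mul_le_mul_of_nonneg_left (h2 s s') hsc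
        simpa [mul_add, mul_assoc] using this
      · intro s s'
        simp_rw [hwa, mul_assoc, ← Finset.mul_sum]
        have := mul_le_mul_of_nonneg_left (h3 s s') hsc
        simpa [mul_add, mul_assoc] using this
    have := integral_mono (RR_integrable m e a a' c b b' d θ) (integrable_const (sin θ * cos θ * K)) hpt
    simpa using this
  have hanti : AntitoneOn (fun θ => FF m e (AM a c θ) (AM b d θ) - sin θ ^ 2 * (K / 2)) (Set.Icc 0 (π/2)) := by
    have hdd : ∀ θ, HasDerivAt (fun θ => FF m e (AM a c θ) (AM b d θ) - sin θ ^ 2 * (K / 2))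
      (∫ x, RR m e a a' c b b' d θ x ∂(gm κ) - sin θ * cos θ * K) θ := by
      intro θ
      refine ((hd θ).sub (((hasDerivAt_sin θ).pow 2).mul_const (K / 2))).congr_deriv ?_
      simp; ring
    apply antitoneOn_of_deriv_nonpos (convex_Icc _ _)
    · exact fun θ _ => (hdd θ).continuousAt.continuousWithinAt
    · exact fun θ _ => (hdd θ).differentiableAt.differentiableWithinAt
    · intro θ hθ
      rw [interior_Icc] at hθ
      rw [(hdd θ).deriv]
      linarith [hle θ ⟨hθ.1.le, hθ.2.le⟩]
  have := hanti (Set.left_mem_Icc.2 (by positivity)) (Set.right_mem_Icc.2 (by positivity)) (by positivity)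
  simp at this
  linarith

end guerra

section emptyinner
variable {S κ : Type*} [Fintype S] [Nonempty S] [Fintype κ]

lemma Tl_empty {ℓ : Type*} [Fintype ℓ] [IsEmpty ℓ] (m : ℝ) (v : S → ℝ) (D : ℓ → S → ℝ) (g : (ℓ → ℝ) → ℝ) (y : ℓ → ℝ) :
    Tl m v D g = g y := by
  rw [← Tl_const (m := m) (v := v) (D := D) (g y)]
  congr 1; ext z; rw [Subsingleton.elim z y]

lemma Yi_zero {ℓ : Type*} [Fintype ℓ] (m : ℝ) (v : S → ℝ) (D : ℓ → S → ℝ) (hD : ∀ l s, D l s = 0) :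
    Yi m v D = Zf v ^ m := by
  have : ∀ y, Hy v D y = v := by intro y; ext s; simp [Hy, hD]
  simp [Yi, this]

lemma FF_zero {ℓ : Type*} [Fintype ℓ] {m : ℝ} (hm : 0 < m) (e : S → ℝ) (A : κ → S → ℝ) (D : ℓ → S → ℝ) (hD : ∀ l s, D l s = 0) :
    FF m e A D = ∫ x, log (Zf (Hy e A x)) ∂(gm κ) := by
  unfold FF
  congr 1; ext x
  rw [Yi_zero m _ _ hD, log_rpow (Zf_pos _)]
  field_simp

/-- simple interpolation derivative -/
lemma logZ_deriv (e : S → ℝ) {a a' : κ → ℝ → ℝ} {Ca : ℝ} (ha : AmpPath a a' Ca) (c : κ → S → ℝ) (θ : ℝ) :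
    HasDerivAt (fun t => ∫ x, log (Zf (Hy e (AM a c t) x)) ∂(gm κ))
      (∫ x, ∑ k, a k θ * a' k θ * (ga (Hy e (AM a c θ) x) (fun s => c k s * c k s) - ga (Hy e (AM a c θ) x) (c k) ^ 2) ∂(gm κ)) θ := by
  have hb : AmpPath (fun (_ : Fin 0) (_ : ℝ) => (0:ℝ)) (fun _ _ => 0) 0 := ⟨le_rfl, fun k => k.elim0⟩
  have := nested_deriv (ℓ := Fin 0) one_pos e ha c hb (fun _ _ => 0) θ
  have e1 : ∀ t, FF (ℓ := Fin 0) 1 e (AM a c t) (AM (fun (_ : Fin 0) (_ : ℝ) => (0:ℝ)) (fun _ _ => 0) t) = ∫ x, log (Zf (Hy e (AM a c t) x)) ∂(gm κ) :=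
    fun t => FF_zero one_pos e _ _ fun l => l.elim0
  simp_rw [e1] at this
  refine this.congr_deriv ?_
  congr 1; ext x
  unfold RR
  rw [Finset.univ_eq_empty (α := Fin 0), Finset.sum_empty, add_zero]
  refine Finset.sum_congr rfl fun k _ => ?_
  rw [Tl_empty _ _ _ _ 0, Tl_empty _ _ _ _ 0]
  have : ∀ v : S → ℝ, ∀ D : Fin 0 → S → ℝ, Hy v D 0 = v := by intro v D; ext s; simp [Hy]
  simp only [this, qf]; ring

end emptyinner

section model
variable {V : Type*} [Fintype V] [LinearOrder V]

/-- increasing pairs -/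
abbrev Pr (V : Type*) [LinearOrder V] := {p : V × V // p.1 < p.2}
/-- disorder index -/
abbrev Ks (V : Type*) [LinearOrder V] := Pr V ⊕ (V × Fin 3)

/-- unnormalised overlap -/
def ov (s s' : V → Bool) : ℝ := ∑ i, spin (s i) * spin (s' i)

lemma spin_mul_self (b : Bool) : spin b * spin b = 1 := by cases b <;> simp [spin]
lemma spin_abs (b : Bool) : |spin b| = 1 := by cases b <;> simp [spin]

lemma ov_self (s : V → Bool) : ov s s = Fintype.card V := by simp [ov, spin_mul_self]

lemma ov_abs_le (s s' : V → Bool) : |ov s s'| ≤ Fintype.card V := by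
  refine (Finset.abs_sum_le_sum_abs _ _).trans ?_
  simp [abs_mul, spin_abs]

lemma ov_comm (s s' : V → Bool) : ov s s' = ov s' s := by
  unfold ov; exact Finset.sum_congr rfl fun i _ => mul_comm _ _

lemma sum_pairs (f : V → ℝ) : (∑ i, f i) ^ 2 = 2 * (∑ p : Pr V, f p.1.1 * f p.1.2) + ∑ i, f i ^ 2 := by
  have h1 : ∑ p : Pr V, f p.1.1 * f p.1.2 = ∑ p : V × V, if p.1 < p.2 then f p.1 * f p.2 else 0 := by
    rw [← Finset.sum_filter]
    exact (Finset.sum_subtype (Finset.univ.filter fun p : V × V => p.1 < p.2) (by simp) (fun p => f p.1 * f p.2)).symm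
  have h2 : ∑ p : Pr V, f p.1.1 * f p.1.2 = ∑ p : V × V, if p.2 < p.1 then f p.1 * f p.2 else 0 := by
    rw [h1, ← (Equiv.prodComm V V).sum_comp]
    refine Finset.sum_congr rfl fun p _ => ?_
    simp [mul_comm]
  have h3 : ∑ i, f i ^ 2 = ∑ p : V × V, if p.1 = p.2 then f p.1 * f p.2 else 0 := by
    rw [Fintype.sum_prod_type]
    simp [sq]
  rw [two_mul]
  nth_rw 1 [h1]
  rw [h2, h3, ← Finset.sum_add_distrib, ← Finset.sum_add_distrib, sq, Finset.sum_mul_sum, ← Fintype.sum_prod_type']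
  refine Finset.sum_congr rfl fun p _ => ?_
  rcases lt_trichotomy p.1 p.2 with h | h | h
  · simp [h, h.ne, h.not_gt]
  · simp [h]
  · simp [h, h.ne', h.not_gt]

lemma pair_sum (s s' : V → Bool) :
    ∑ p : Pr V, (spin (s p.1.1) * spin (s p.1.2)) * (spin (s' p.1.1) * spin (s' p.1.2)) =
      (ov s s' ^ 2 - Fintype.card V) / 2 := by
  have := sum_pairs (V := V) fun i => spin (s i) * spin (s' i)
  have h2 : ∑ i, (spin (s i) * spin (s' i)) ^ 2 = Fintype.card V := by
    have : ∀ i, (spin (s i) * spin (s' i)) ^ 2 = 1 := fun i => by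
      have a := spin_mul_self (s i); have b := spin_mul_self (s' i)
      calc _ = (spin (s i) * spin (s i)) * (spin (s' i) * spin (s' i)) := by ring
        _ = 1 := by rw [a, b]; norm_num
    simp [this]
  rw [h2] at this
  have h3 : ∑ p : Pr V, (spin (s p.1.1) * spin (s p.1.2)) * (spin (s' p.1.1) * spin (s' p.1.2)) =
    ∑ p : Pr V, (spin (s p.1.1) * spin (s' p.1.1)) * (spin (s p.1.2) * spin (s' p.1.2)) :=
    Finset.sum_congr rfl fun p _ => by ring
  rw [h3]
  unfold ov
  linarith

/-- single system: field term -/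
def e1 (h : ℝ) (s : V → Bool) : ℝ := ∑ i, h * spin (s i)
/-- single system: coefficients -/
def cS : Ks V → (V → Bool) → ℝ
  | Sum.inl p, s => spin (s p.1.1) * spin (s p.1.2)
  | Sum.inr (i, j), s => if j = 0 then spin (s i) else 0
/-- single system: amplitudes -/
def aS (β q N : ℝ) : Ks V → ℝ → ℝ
  | Sum.inl _, t => sin t * (β / √N)
  | Sum.inr _, t => cos t * (β * √q)
/-- derivative of the amplitudes -/
def aS' (β q N : ℝ) : Ks V → ℝ → ℝ
  | Sum.inl _, t => cos t * (β / √N)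
  | Sum.inr _, t => -sin t * (β * √q)

lemma abs_sin_mul_le (t c : ℝ) : |sin t * c| ≤ |c| := by
  rw [abs_mul]; exact mul_le_of_le_one_left (abs_nonneg _) (abs_sin_le_one t)
lemma abs_cos_mul_le (t c : ℝ) : |cos t * c| ≤ |c| := by
  rw [abs_mul]; exact mul_le_of_le_one_left (abs_nonneg _) (abs_cos_le_one t)
lemma abs_neg_sin_mul_le (t c : ℝ) : |-sin t * c| ≤ |c| := by
  rw [neg_mul, abs_neg]; exact abs_sin_mul_le t c

lemma ampS (β q N : ℝ) : AmpPath (aS (V := V) β q N) (aS' β q N) (|β / √N| + |β * √q|) := by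
  refine ⟨by positivity, fun k t => ?_⟩
  have h1 := abs_nonneg (β / √N)
  have h2 := abs_nonneg (β * √q)
  rcases k with p | k
  · refine ⟨(hasDerivAt_sin t).mul_const _, ?_, ?_⟩
    · exact (abs_sin_mul_le _ _).trans (by linarith)
    · exact (abs_cos_mul_le _ _).trans (by linarith)
  · refine ⟨(hasDerivAt_cos t).mul_const _, ?_, ?_⟩
    · exact (abs_cos_mul_le _ _).trans (by linarith)
    · exact (abs_neg_sin_mul_le _ _).trans (by linarith)

/-- Hamiltonian of the single system at angle t -/
def HS (β h q N t : ℝ) (x : Ks V → ℝ) : (V → Bool) → ℝ := Hy (e1 h) (AM (aS β q N) cS t) x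

/-- free energy -/
def phi (V : Type*) [Fintype V] [LinearOrder V] (β h q N t : ℝ) : ℝ :=
  ∫ x, log (Zf (HS (V := V) β h q N t x)) ∂(gm (Ks V))

/-- two-replica average -/
def ga2 {S : Type*} [Fintype S] (H : S → ℝ) (f : S → S → ℝ) : ℝ := ga H (fun s => ga H (fun s' => f s s'))

lemma ga_prod {S : Type*} [Fintype S] (H c d : S → ℝ) : ga H c * ga H d = ga2 H (fun s s' => c s * d s') := by
  unfold ga2
  simp_rw [ga_mul_const, mul_comm (c _)]
  rw [ga_mul_const, mul_comm]

lemma phi_deriv (β h q N : ℝ) (hq : 0 ≤ q) (hN : 0 < N) (t : ℝ) :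
    HasDerivAt (fun t => phi V β h q N t)
      (sin t * cos t * (β ^ 2 * N / 2) * ((Fintype.card V / N - q) ^ 2 -
        ∫ x, ga2 (HS (V := V) β h q N t x) (fun s s' => (ov s s' / N - q) ^ 2) ∂(gm (Ks V)))) t := by
  have := logZ_deriv (S := V → Bool) (e1 h) (ampS (V := V) β q N) cS t
  refine this.congr_deriv ?_
  have hNs : √N ^ 2 = N := sq_sqrt hN.le
  have hqs : √q ^ 2 = q := sq_sqrt hq
  have key : ∀ s s' : V → Bool, ∑ k, aS (V := V) β q N k t * aS' β q N k t * (cS k s * cS k s') =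
      sin t * cos t * (β ^ 2 * N / 2) * ((ov s s' / N - q) ^ 2 - q ^ 2 - Fintype.card V / N ^ 2) := by
    intro s s'
    rw [Fintype.sum_sum_type, Fintype.sum_prod_type]
    simp only [aS, aS', cS, Fin.sum_univ_three]
    simp only [Fin.isValue, if_true, one_ne_zero, if_false, Fin.reduceEq, mul_zero, add_zero]
    rw [← Finset.mul_sum, ← Finset.mul_sum, pair_sum]
    change _ + _ * ov s s' = _
    have : sin t * (β / √N) * (cos t * (β / √N)) = sin t * cos t * β ^ 2 / N := by
      rw [← hNs]; field_simp; rw [sqrt_sq (sqrt_nonneg _)]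
    rw [this]
    have : cos t * (β * √q) * (-sin t * (β * √q)) = - (sin t * cos t * β ^ 2 * q) := by
      calc _ = - (sin t * cos t * β ^ 2 * √q ^ 2) := by ring
        _ = _ := by rw [hqs]
    rw [this]
    field_simp
    ring
  have e : ∀ x, ∑ k, aS (V := V) β q N k t * aS' β q N k t * (ga (HS (V := V) β h q N t x) (fun s => cS k s * cS k s) - ga (HS (V := V) β h q N t x) (cS k) ^ 2)
     = sin t * cos t * (β ^ 2 * N / 2) * ((Fintype.card V / N - q) ^ 2 - ga2 (HS (V := V) β h q N t x) (fun s s' => (ov s s' / N - q) ^ 2)) := by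
    intro x
    set H := HS (V := V) β h q N t x
    simp_rw [sq (ga H _), ga_prod, mul_sub, Finset.sum_sub_distrib, ga2, ← ga_mul_const, ← ga_sum]
    simp_rw [key, ov_self]
    rw [ga_const]
    have h2 : ∀ s, ga H (fun s' => sin t * cos t * (β ^ 2 * N / 2) * ((ov s s' / N - q) ^ 2 - q ^ 2 - Fintype.card V / N ^ 2))
       = ga H (fun s' => sin t * cos t * (β ^ 2 * N / 2) * (ov s s' / N - q) ^ 2) - sin t * cos t * (β ^ 2 * N / 2) * (q ^ 2 + Fintype.card V / N ^ 2) := by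
      intro s
      rw [sub_eq_add_neg, ← ga_const H (-(sin t * cos t * (β ^ 2 * N / 2) * (q ^ 2 + Fintype.card V / N ^ 2))), ← ga_add]
      congr 1; ext s'; ring
    simp_rw [h2, sub_eq_add_neg]
    rw [ga_add, ga_const]
    ring
  change ∫ x, ∑ k, aS (V := V) β q N k t * aS' β q N k t * (ga (HS (V := V) β h q N t x) (fun s => cS k s * cS k s) - ga (HS (V := V) β h q N t x) (cS k) ^ 2) ∂(gm (Ks V)) = _
  simp_rw [e]
  rw [integral_const_mul, integral_sub (integrable_const _)]
  · simp
  · refine EB.integrable (Θ := Unit) (F := fun _ x => ga2 (HS (V := V) β h q N t x) (fun s s' => (ov s s' / N - q) ^ 2)) ?_ () ?_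
    · obtain ⟨C, h0, hC⟩ := exists_bd (fun p : (V → Bool) × (V → Bool) => (ov p.1 p.2 / N - q) ^ 2)
      exact EB.bdd C fun _ x => ga_abs_le _ fun s => ga_abs_le _ fun s' => hC (s, s')
    · exact measurable_ga (fun s => Hy_meas _ _ s) fun s => measurable_ga (fun s => Hy_meas _ _ s) fun s' => measurable_const

end model

section coupled
variable {V : Type*} [Fintype V] [LinearOrder V]

/-- coupled coefficients -/
def cC : Ks V → (V → Bool) × (V → Bool) → ℝ
  | Sum.inl p, s => spin (s.1 p.1.1) * spin (s.1 p.1.2) + spin (s.2 p.1.1) * spin (s.2 p.1.2)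
  | Sum.inr (i, j), s => if j = 2 then spin (s.1 i) - spin (s.2 i) else spin (s.1 i) + spin (s.2 i)
/-- site amplitudes of the coupled path -/
def sA (β q Ap Am t θ : ℝ) (j : Fin 3) : ℝ :=
  if j = 0 then cos t * (β * √q) else if j = 1 then cos θ * (sin t * β * √Ap) else cos θ * (sin t * β * √Am)
/-- derivative -/
def sA' (β q Ap Am t θ : ℝ) (j : Fin 3) : ℝ :=
  if j = 0 then 0 else if j = 1 then -sin θ * (sin t * β * √Ap) else -sin θ * (sin t * β * √Am)
/-- coupled amplitudes -/
def aC (β q N Ap Am t : ℝ) : Ks V → ℝ → ℝ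
  | Sum.inl _, θ => sin θ * (sin t * (β / √N))
  | Sum.inr (i, j), θ => sA β q Ap Am t θ j
/-- derivative -/
def aC' (β q N Ap Am t : ℝ) : Ks V → ℝ → ℝ
  | Sum.inl _, θ => cos θ * (sin t * (β / √N))
  | Sum.inr (i, j), θ => sA' β q Ap Am t θ j
/-- product weights -/
def wC (β N Ap Am t : ℝ) : Ks V → ℝ
  | Sum.inl _ => sin t ^ 2 * β ^ 2 / N
  | Sum.inr (i, j) => if j = 0 then 0 else if j = 1 then -(sin t ^ 2 * β ^ 2 * Ap) else -(sin t ^ 2 * β ^ 2 * Am)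
/-- inner coefficients -/
def dC (η : ℝ) (i : V) (s : (V → Bool) × (V → Bool)) : ℝ := spin (s.1 i) + η * spin (s.2 i)
/-- inner amplitude -/
def bC (β B t : ℝ) (_ : V) (θ : ℝ) : ℝ := cos θ * (sin t * β * √B)
/-- derivative -/
def bC' (β B t : ℝ) (_ : V) (θ : ℝ) : ℝ := -sin θ * (sin t * β * √B)

lemma ampC (β q N Ap Am t : ℝ) : AmpPath (aC (V := V) β q N Ap Am t) (aC' β q N Ap Am t)
    (|sin t * (β / √N)| + |cos t * (β * √q)| + |sin t * β * √Ap| + |sin t * β * √Am|) := by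
  refine ⟨by positivity, fun k θ => ?_⟩
  have h1 := abs_nonneg (sin t * (β / √N))
  have h2 := abs_nonneg (cos t * (β * √q))
  have h3 := abs_nonneg (sin t * β * √Ap)
  have h4 := abs_nonneg (sin t * β * √Am)
  rcases k with p | ⟨i, j⟩
  · refine ⟨(hasDerivAt_sin θ).mul_const _, ?_, ?_⟩
    · exact (abs_sin_mul_le _ _).trans (by linarith)
    · exact (abs_cos_mul_le _ _).trans (by linarith)
  · by_cases h0 : j = 0
    · subst h0
      have e1 : aC (V := V) β q N Ap Am t (Sum.inr (i, 0)) = fun _ => cos t * (β * √q) := by ext θ; simp [aC, sA]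
      have e2 : aC' (V := V) β q N Ap Am t (Sum.inr (i, 0)) = fun _ => 0 := by ext θ; simp [aC', sA']
      rw [e1, e2]
      exact ⟨hasDerivAt_const _ _, by linarith, by rw [abs_zero]; linarith⟩
    by_cases h1 : j = 1
    · subst h1
      have e1 : aC (V := V) β q N Ap Am t (Sum.inr (i, 1)) = fun θ => cos θ * (sin t * β * √Ap) := by ext θ; simp [aC, sA]
      have e2 : aC' (V := V) β q N Ap Am t (Sum.inr (i, 1)) = fun θ => -sin θ * (sin t * β * √Ap) := by ext θ; simp [aC', sA']
      rw [e1, e2]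
      refine ⟨(hasDerivAt_cos θ).mul_const _, ?_, ?_⟩
      · exact (abs_cos_mul_le _ _).trans (by linarith)
      · exact (abs_neg_sin_mul_le _ _).trans (by linarith)
    · have e1 : aC (V := V) β q N Ap Am t (Sum.inr (i, j)) = fun θ => cos θ * (sin t * β * √Am) := by ext θ; simp [aC, sA, h0, h1]
      have e2 : aC' (V := V) β q N Ap Am t (Sum.inr (i, j)) = fun θ => -sin θ * (sin t * β * √Am) := by ext θ; simp [aC', sA', h0, h1]
      rw [e1, e2]
      refine ⟨(hasDerivAt_cos θ).mul_const _, ?_, ?_⟩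
      · exact (abs_cos_mul_le _ _).trans (by linarith)
      · exact (abs_neg_sin_mul_le _ _).trans (by linarith)

lemma ampB (β B t : ℝ) : AmpPath (bC (V := V) β B t) (bC' β B t) |sin t * β * √B| :=
  ⟨abs_nonneg _, fun k θ => ⟨(hasDerivAt_cos θ).mul_const _, abs_cos_mul_le _ _, abs_neg_sin_mul_le _ _⟩⟩

lemma wC_eq (β q : ℝ) {N Ap Am : ℝ} (t : ℝ) (hN : 0 < N) (hp : 0 ≤ Ap) (hm : 0 ≤ Am) (k : Ks V) (θ : ℝ) :
    aC β q N Ap Am t k θ * aC' β q N Ap Am t k θ = sin θ * cos θ * wC β N Ap Am t k := by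
  have hNs : √N ^ 2 = N := sq_sqrt hN.le
  have h1 : √Ap ^ 2 = Ap := sq_sqrt hp
  have h2 : √Am ^ 2 = Am := sq_sqrt hm
  rcases k with p | ⟨i, j⟩
  · simp only [aC, aC', wC]
    calc _ = sin θ * cos θ * (sin t ^ 2 * β ^ 2 / √N ^ 2) := by ring
      _ = _ := by rw [hNs]
  · simp only [aC, aC', wC, sA, sA']
    split_ifs
    · ring
    · calc _ = sin θ * cos θ * -(sin t ^ 2 * β ^ 2 * √Ap ^ 2) := by ring
        _ = _ := by rw [h1]
    · calc _ = sin θ * cos θ * -(sin t ^ 2 * β ^ 2 * √Am ^ 2) := by ring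
        _ = _ := by rw [h2]

lemma cov_outer (β N Ap Am t : ℝ) (s s' : (V → Bool) × (V → Bool)) :
    ∑ k, wC β N Ap Am t k * (cC k s * cC k s') = sin t ^ 2 * β ^ 2 *
     ((ov s.1 s'.1 ^ 2 + ov s.1 s'.2 ^ 2 + ov s.2 s'.1 ^ 2 + ov s.2 s'.2 ^ 2 - 4 * Fintype.card V) / (2 * N)
      - (Ap + Am) * (ov s.1 s'.1 + ov s.2 s'.2) - (Ap - Am) * (ov s.1 s'.2 + ov s.2 s'.1)) := by
  rw [Fintype.sum_sum_type, Fintype.sum_prod_type]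
  simp only [wC, cC, Fin.sum_univ_three]
  simp only [Fin.isValue, if_true, one_ne_zero, if_false, Fin.reduceEq, mul_zero, zero_mul, zero_add]
  have a1 := pair_sum s.1 s'.1
  have a2 := pair_sum s.1 s'.2
  have a3 := pair_sum s.2 s'.1
  have a4 := pair_sum s.2 s'.2
  have e : ∑ p : Pr V, sin t ^ 2 * β ^ 2 / N * ((spin (s.1 p.1.1) * spin (s.1 p.1.2) + spin (s.2 p.1.1) * spin (s.2 p.1.2)) *
      (spin (s'.1 p.1.1) * spin (s'.1 p.1.2) + spin (s'.2 p.1.1) * spin (s'.2 p.1.2))) =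
      sin t ^ 2 * β ^ 2 / N * ((ov s.1 s'.1 ^ 2 - Fintype.card V) / 2 + (ov s.1 s'.2 ^ 2 - Fintype.card V) / 2 + (ov s.2 s'.1 ^ 2 - Fintype.card V) / 2 + (ov s.2 s'.2 ^ 2 - Fintype.card V) / 2) := by
    rw [← a1, ← a2, ← a3, ← a4, ← Finset.mul_sum, ← Finset.sum_add_distrib, ← Finset.sum_add_distrib, ← Finset.sum_add_distrib]
    congr 1
    exact Finset.sum_congr rfl fun p _ => by ring
  rw [e]
  have e2 : ∑ x : V, (-(sin t ^ 2 * β ^ 2 * Ap) * ((spin (s.1 x) + spin (s.2 x)) * (spin (s'.1 x) + spin (s'.2 x))) +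
      -(sin t ^ 2 * β ^ 2 * Am) * ((spin (s.1 x) - spin (s.2 x)) * (spin (s'.1 x) - spin (s'.2 x)))) =
     - (sin t ^ 2 * β ^ 2 * ((Ap + Am) * (ov s.1 s'.1 + ov s.2 s'.2) + (Ap - Am) * (ov s.1 s'.2 + ov s.2 s'.1))) := by
    unfold ov
    rw [← Finset.sum_add_distrib, ← Finset.sum_add_distrib, Finset.mul_sum, Finset.mul_sum, ← Finset.sum_add_distrib, Finset.mul_sum, ← Finset.sum_neg_distrib]
    exact Finset.sum_congr rfl fun p _ => by ring
  rw [e2]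
  ring

lemma cov_inner (β B t η : ℝ) (hη : η ^ 2 = 1) (s s' : (V → Bool) × (V → Bool)) :
    ∑ i, -(sin t ^ 2 * β ^ 2 * B) * (dC η i s * dC η i s') = - (sin t ^ 2 * β ^ 2 *
      (B * (ov s.1 s'.1 + ov s.2 s'.2) + η * B * (ov s.1 s'.2 + ov s.2 s'.1))) := by
  unfold ov dC
  rw [← Finset.sum_add_distrib, ← Finset.sum_add_distrib, Finset.mul_sum, Finset.mul_sum, ← Finset.sum_add_distrib, Finset.mul_sum, ← Finset.sum_neg_distrib]
  refine Finset.sum_congr rfl fun p _ => ?_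
  have : spin (s.1 p) * spin (s'.1 p) * B + η ^ 2 * (spin (s.2 p) * spin (s'.2 p) * B) + η * B * (spin (s.1 p) * spin (s'.2 p) + spin (s.2 p) * spin (s'.1 p)) =
    B * (spin (s.1 p) * spin (s'.1 p) + spin (s.2 p) * spin (s'.2 p)) + η * B * (spin (s.1 p) * spin (s'.2 p) + spin (s.2 p) * spin (s'.1 p)) := by rw [hη]; ring
  rw [← this]; ring

/-- coupled field -/
def e2 (h : ℝ) (s : (V → Bool) × (V → Bool)) : ℝ := e1 h s.1 + e1 h s.2

/-- restricted pair states -/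
abbrev SU (U : Set ℝ) := {s : (V → Bool) × (V → Bool) // ov s.1 s.2 ∈ U}

/-- restricted two-replica partition function -/
def ZU (U : Set ℝ) (H : (V → Bool) → ℝ) : ℝ :=
  open Classical in ∑ s : (V → Bool) × (V → Bool), if ov s.1 s.2 ∈ U then exp (H s.1 + H s.2) else 0

open Classical in
lemma ZU_eq (U : Set ℝ) (H : (V → Bool) → ℝ) : ZU U H = Zf (S := SU (V := V) U) (fun s => H s.1.1 + H s.1.2) := by
  unfold ZU Zf
  rw [← Finset.sum_filter]
  exact (Finset.sum_subtype (Finset.univ.filter fun s : (V → Bool) × (V → Bool) => ov s.1 s.2 ∈ U) (by simp) (fun s => exp (H s.1 + H s.2)))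

open Classical in
lemma guerra_SK (β h q : ℝ) {N Ap Am B η m : ℝ} (t : ℝ) (hN : 0 < N) (hp : 0 ≤ Ap) (ham : 0 ≤ Am) (hq : Ap + Am = q)
    (hB : 0 ≤ B) (hη : η ^ 2 = 1) (hm : 0 < m) (hm1 : m ≤ 1) (U : Set ℝ) [Nonempty (SU (V := V) U)] (Q : ℝ)
    (hQ : ∀ u ∈ U, (u / N - (Ap - Am + η * B)) ^ 2 ≤ Q) :
    ∫ x, log (ZU U (HS (V := V) β h q N t x)) ∂(gm (Ks V)) ≤
      FF m (fun s : SU (V := V) U => e2 h s.1) (AM (aC β q N Ap Am t) (fun k s => cC k s.1) 0) (AM (bC β B t) (fun k s => dC η k s.1) 0)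
      + sin t ^ 2 * β ^ 2 * N / 2 * ((Fintype.card V / N - (q + B)) ^ 2 + Q
        - m * ((q + B) ^ 2 + (Ap - Am + η * B) ^ 2 - q ^ 2 - (Ap - Am) ^ 2)) := by
  set n : ℝ := ((Fintype.card V : ℕ) : ℝ) with hn
  set w := Ap - Am with hw
  set T := sin t ^ 2 * β ^ 2 with hT
  have hT0 : 0 ≤ T := by positivity
  have hTN : 0 ≤ T * N / 2 := by positivity
  have g := guerra (S := SU (V := V) U) hm hm1 (fun s => e2 h s.1) (ampC (V := V) β q N Ap Am t) (fun k s => cC k s.1)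
    (ampB (V := V) β B t) (fun k s => dC η k s.1)
    (k1 := T * N * ((n / N - (q + B)) ^ 2 + Q - (q + B) ^ 2 - (w + η * B) ^ 2 - 2 * n / N ^ 2))
    (k2 := T * N * ((q + B) ^ 2 + (w + η * B) ^ 2 + 2 * n / N ^ 2))
    (k3 := T * N * (q ^ 2 + w ^ 2 + 2 * n / N ^ 2))
    (wC β N Ap Am t) (fun _ => -(sin t ^ 2 * β ^ 2 * B)) (wC_eq β q t hN hp ham) ?_ ?_ ?_ ?_
  · rw [FF_zero hm] at g
    · have e : ∀ x : Ks V → ℝ, Zf (Hy (fun s : SU (V := V) U => e2 h s.1) (AM (aC β q N Ap Am t) (fun k s => cC k s.1) (π / 2)) x)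
          = ZU U (HS (V := V) β h q N t x) := by
        intro x
        rw [ZU_eq]
        congr 1; ext s
        simp only [HS, Hy, e2, AM]
        have : ∀ k : Ks V, aC β q N Ap Am t k (π / 2) * cC k s.1 * x k = aS β q N k t * cS k s.1.1 * x k + aS β q N k t * cS k s.1.2 * x k := by
          intro k
          rcases k with p | ⟨i, j⟩
          · simp only [aC, cC, aS, cS, sin_pi_div_two]; ring
          · simp only [aC, cC, aS, cS, sA, cos_pi_div_two]
            fin_cases j <;> simp
            ring
        simp_rw [this, Finset.sum_add_distrib]
        ring
      simp_rw [e] at g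
      refine g.trans (le_of_eq ?_)
      congr 1
      ring
    · intro l s
      simp [AM, bC]
  · intro k θ
    have : √B ^ 2 = B := sq_sqrt hB
    simp only [bC, bC']
    calc _ = sin θ * cos θ * -(sin t ^ 2 * β ^ 2 * √B ^ 2) := by ring
      _ = _ := by rw [this]
  · intro s
    rw [cov_outer, cov_inner _ _ _ _ hη, hq, ov_self, ov_self, ov_comm s.1.2 s.1.1, ← hT, ← hn, ← hw]
    have := mul_le_mul_of_nonneg_left (hQ _ s.2) (mul_nonneg hT0 hN.le)
    set u := ov s.1.1 s.1.2
    have e3 : T * ((n ^ 2 + u ^ 2 + u ^ 2 + n ^ 2 - 4 * n) / (2 * N) - q * (n + n) - w * (u + u)) + -(T * (B * (n + n) + η * B * (u + u)))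
      = T * N * ((n / N - (q + B)) ^ 2 + (u / N - (w + η * B)) ^ 2 - (q + B) ^ 2 - (w + η * B) ^ 2 - 2 * n / N ^ 2) := by
      field_simp; ring
    rw [e3]
    linarith
  · intro s s'
    rw [cov_outer, cov_inner _ _ _ _ hη, hq, ← hT, ← hn, ← hw]
    set r1 := ov s.1.1 s'.1.1
    set r2 := ov s.1.1 s'.1.2
    set r3 := ov s.1.2 s'.1.1
    set r4 := ov s.1.2 s'.1.2
    have : T * ((r1 ^ 2 + r2 ^ 2 + r3 ^ 2 + r4 ^ 2 - 4 * n) / (2 * N) - q * (r1 + r4) - w * (r2 + r3)) + -(T * (B * (r1 + r4) + η * B * (r2 + r3)))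
      = T * N / 2 * ((r1 / N - (q + B)) ^ 2 + (r4 / N - (q + B)) ^ 2 + (r2 / N - (w + η * B)) ^ 2 + (r3 / N - (w + η * B)) ^ 2) - T * N * ((q + B) ^ 2 + (w + η * B) ^ 2 + 2 * n / N ^ 2) := by
      field_simp; ring
    rw [this]
    have := mul_nonneg hTN (by positivity : 0 ≤ (r1 / N - (q + B)) ^ 2 + (r4 / N - (q + B)) ^ 2 + (r2 / N - (w + η * B)) ^ 2 + (r3 / N - (w + η * B)) ^ 2)
    linarith
  · intro s s'
    rw [cov_outer, hq, ← hT, ← hn, ← hw]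
    set r1 := ov s.1.1 s'.1.1
    set r2 := ov s.1.1 s'.1.2
    set r3 := ov s.1.2 s'.1.1
    set r4 := ov s.1.2 s'.1.2
    have : T * ((r1 ^ 2 + r2 ^ 2 + r3 ^ 2 + r4 ^ 2 - 4 * n) / (2 * N) - q * (r1 + r4) - w * (r2 + r3))
      = T * N / 2 * ((r1 / N - q) ^ 2 + (r4 / N - q) ^ 2 + (r2 / N - w) ^ 2 + (r3 / N - w) ^ 2) - T * N * (q ^ 2 + w ^ 2 + 2 * n / N ^ 2) := by
      field_simp; ring
    rw [this]
    have := mul_nonneg hTN (by positivity : 0 ≤ (r1 / N - q) ^ 2 + (r4 / N - q) ^ 2 + (r2 / N - w) ^ 2 + (r3 / N - w) ^ 2)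
    linarith

end coupled

lemma EB_logYi {S κ ℓ : Type*} [Fintype S] [Nonempty S] [Fintype κ] [Fintype ℓ] {m : ℝ} (hm : 0 < m) (e : S → ℝ) (A : κ → S → ℝ)
    (D : ℓ → S → ℝ) : EB (fun (_ : Unit) x => 1 / m * log (Yi m (Hy e A x) D)) := by
  obtain ⟨B, hB0, hB⟩ := exists_bd (fun p : ℓ × S => D p.1 p.2)
  obtain ⟨K, hK0, hK⟩ := logYi_bound (S := S) (ℓ := ℓ) hm B
  obtain ⟨C, hC0, hC⟩ := Hy_lin e A
  refine EB.const_mul _ ((((EB.const (Θ := Unit) (κ := κ) 1).add EB.sumabs).const_mul (m * C)).const_mul 1 |>.add (EB.const K) |>.mono fun _ x => ?_)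
  refine (hK _ D _ (hC x) fun l σ => hB (l, σ)).trans (le_trans (le_of_eq ?_) (le_abs_self _))
  ring

lemma FF_integrable {S κ ℓ : Type*} [Fintype S] [Nonempty S] [Fintype κ] [Fintype ℓ] {m : ℝ} (hm : 0 < m) (e : S → ℝ) (A : κ → S → ℝ)
    (D : ℓ → S → ℝ) : Integrable (fun x => 1 / m * log (Yi m (Hy e A x) D)) (gm κ) :=
  (EB_logYi hm e A D).integrable () ((meas_Yi e A D m).log.const_mul _)

lemma integral_eval {κ : Type*} [Fintype κ] (k : κ) {f : ℝ → ℝ} (hf : Measurable f) :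
    ∫ x, f (x k) ∂(gm κ) = ∫ y, f y ∂g1 := by
  have := (measurePreserving_eval (fun _ : κ => gaussianReal 0 1) k)
  have h2 := integral_map (μ := gm κ) (φ := Function.eval k) (f := f) this.measurable.aemeasurable hf.aestronglyMeasurable
  rw [show Measure.map (Function.eval k) (gm κ) = g1 from this.map_eq] at h2
  exact h2.symm

lemma Zf_prod {V T : Type*} [Fintype V] [DecidableEq V] [Fintype T] (H : V → T → ℝ) :
    Zf (fun s : V → T => ∑ i, H i (s i)) = ∏ i, Zf (H i) := by
  unfold Zf
  rw [Finset.prod_univ_sum, Fintype.piFinset_univ]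
  exact Finset.sum_congr rfl fun s _ => exp_sum _ _

section site
/-- site coefficients -/
def cT (j : Fin 3) (s : Bool × Bool) : ℝ := if j = 2 then spin s.1 - spin s.2 else spin s.1 + spin s.2
/-- site field -/
def eT (h lam : ℝ) (s : Bool × Bool) : ℝ := h * spin s.1 + h * spin s.2 + lam * (spin s.1 * spin s.2)
/-- site Hamiltonian -/
def hT (h lam : ℝ) (a : Fin 3 → ℝ) (b η : ℝ) (x : Fin 3 → ℝ) (y : ℝ) (s : Bool × Bool) : ℝ :=
  eT h lam s + ∑ j, a j * cT j s * x j + b * (spin s.1 + η * spin s.2) * y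
/-- site integrand -/
def gT (m h lam : ℝ) (a : Fin 3 → ℝ) (b η : ℝ) (x : Fin 3 → ℝ) : ℝ :=
  1 / m * log (∫ y, Zf (hT h lam a b η x y) ^ m ∂g1)
/-- site functional -/
def fT (m h lam : ℝ) (a : Fin 3 → ℝ) (b η : ℝ) : ℝ := ∫ x, gT m h lam a b η x ∂(gm (Fin 3))

lemma hT_Hy (h lam : ℝ) (a : Fin 3 → ℝ) (b η : ℝ) (x : Fin 3 → ℝ) (y : Unit → ℝ) :
    hT h lam a b η x (y ()) = Hy (Hy (eT h lam) (fun j s => a j * cT j s) x) (fun (_ : Unit) s => b * (spin s.1 + η * spin s.2)) y := by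
  ext s; simp [hT, Hy]

lemma meas_hT (h lam : ℝ) (a : Fin 3 → ℝ) (b η : ℝ) (x : Fin 3 → ℝ) (s : Bool × Bool) :
    Measurable fun y => hT h lam a b η x y s := by unfold hT; fun_prop

lemma gT_eq (m h lam : ℝ) (a : Fin 3 → ℝ) (b η : ℝ) (x : Fin 3 → ℝ) :
    gT m h lam a b η x = 1 / m * log (Yi m (Hy (eT h lam) (fun j s => a j * cT j s) x) (fun (_ : Unit) s => b * (spin s.1 + η * spin s.2))) := by
  unfold gT Yi
  simp_rw [← hT_Hy]
  rw [← integral_eval (κ := Unit) () ((measurable_Zf (meas_hT h lam a b η x)).pow_const m)]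

lemma gT_integrable {m : ℝ} (hm : 0 < m) (h lam : ℝ) (a : Fin 3 → ℝ) (b η : ℝ) : Integrable (gT m h lam a b η) (gm (Fin 3)) := by
  have : gT m h lam a b η = fun x => 1 / m * log (Yi m (Hy (eT h lam) (fun j s => a j * cT j s) x) (fun (_ : Unit) s => b * (spin s.1 + η * spin s.2))) :=
    funext fun x => gT_eq _ _ _ _ _ _ _
  rw [this]; exact FF_integrable hm _ _ _

lemma gT_meas {m : ℝ} (h lam : ℝ) (a : Fin 3 → ℝ) (b η : ℝ) : Measurable (gT m h lam a b η) := by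
  have : gT m h lam a b η = fun x => 1 / m * log (Yi m (Hy (eT h lam) (fun j s => a j * cT j s) x) (fun (_ : Unit) s => b * (spin s.1 + η * spin s.2))) :=
    funext fun x => gT_eq _ _ _ _ _ _ _
  rw [this]; exact (meas_Yi _ _ _ m).log.const_mul _

lemma hT_int (m h lam : ℝ) (a : Fin 3 → ℝ) (b η : ℝ) (x : Fin 3 → ℝ) : Integrable (fun y => Zf (hT h lam a b η x y) ^ m) g1 := by
  have h1 := int_Z m (Hy (eT h lam) (fun j s => a j * cT j s) x) (fun (_ : Unit) s => b * (spin s.1 + η * spin s.2))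
  simp_rw [← hT_Hy] at h1
  have h2 := (measurePreserving_eval (fun _ : Unit => gaussianReal 0 1) ()).integrable_comp (g := fun y => Zf (hT h lam a b η x y) ^ m)
    ((measurable_Zf (meas_hT h lam a b η x)).pow_const m).aestronglyMeasurable
  exact h2.1 h1

lemma hT_int_pos (m h lam : ℝ) (a : Fin 3 → ℝ) (b η : ℝ) (x : Fin 3 → ℝ) : 0 < ∫ y, Zf (hT h lam a b η x y) ^ m ∂g1 := by
  have := Yi_pos m (Hy (eT h lam) (fun j s => a j * cT j s) x) (fun (_ : Unit) s => b * (spin s.1 + η * spin s.2))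
  unfold Yi at this
  simp_rw [← hT_Hy] at this
  rwa [integral_eval (κ := Unit) () ((measurable_Zf (meas_hT h lam a b η x)).pow_const m)] at this

end site

section F0
variable {V : Type*} [Fintype V] [LinearOrder V]

open Classical in
lemma FF0_le (β h q : ℝ) {N Ap Am B η m : ℝ} (t : ℝ) (hm : 0 < m) (U : Set ℝ) [Nonempty (SU (V := V) U)] (lam K0 : ℝ)
    (hU : ∀ u ∈ U, -lam * u ≤ K0) :
    FF m (fun s : SU (V := V) U => e2 h s.1) (AM (aC β q N Ap Am t) (fun k s => cC k s.1) 0) (AM (bC β B t) (fun k s => dC η k s.1) 0)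
      ≤ K0 + Fintype.card V * fT m h lam (sA β q Ap Am t 0) (sin t * β * √B) η := by
  set a := sA β q Ap Am t 0
  set b := sin t * β * √B
  have hin : ∀ i : V, Function.Injective (fun j : Fin 3 => (Sum.inr (i, j) : Ks V)) := fun i j j' hj => by simpa using hj
  have hI : ∀ i : V, Integrable (fun x : Ks V → ℝ => gT m h lam a b η (fun j => x (Sum.inr (i, j)))) (gm (Ks V)) := by
    intro i
    have h1 : MeasurePreserving (fun x : Ks V → ℝ => fun j : Fin 3 => x (Sum.inr (i, j))) (gm (Ks V)) (gm (Fin 3)) :=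
      ⟨measurable_pi_lambda _ fun j => measurable_pi_apply _, gm_map_comp _ (hin i)⟩
    exact (h1.integrable_comp (gT_meas h lam a b η).aestronglyMeasurable).2 (gT_integrable hm h lam a b η)
  have hR : K0 + Fintype.card V * fT m h lam a b η = ∫ x : Ks V → ℝ, K0 + ∑ i, gT m h lam a b η (fun j => x (Sum.inr (i, j))) ∂(gm (Ks V)) := by
    rw [integral_add (integrable_const _) (integrable_finsetSum _ fun i _ => hI i), integral_finsetSum _ fun i _ => hI i]
    have : ∀ i : V, ∫ x : Ks V → ℝ, gT m h lam a b η (fun j => x (Sum.inr (i, j))) ∂(gm (Ks V)) = fT m h lam a b η := fun i =>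
      integral_comp_coords _ (hin i) (gT_meas h lam a b η)
    simp [this]
  rw [hR]
  unfold FF
  refine integral_mono (FF_integrable hm _ _ _) ((integrable_const _).add (integrable_finsetSum _ fun i _ => hI i)) fun x => ?_
  simp only
  have key : ∀ y : V → ℝ, Zf (Hy (Hy (fun s : SU (V := V) U => e2 h s.1) (AM (aC β q N Ap Am t) (fun k s => cC k s.1) 0) x) (AM (bC β B t) (fun k s => dC η k s.1) 0) y)
     ≤ exp K0 * ∏ i, Zf (hT h lam a b η (fun j => x (Sum.inr (i, j))) (y i)) := by
    intro y
    rw [← Zf_prod]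
    set H' : (V → Bool) × (V → Bool) → ℝ := fun s => ∑ i, hT h lam a b η (fun j => x (Sum.inr (i, j))) (y i) (s.1 i, s.2 i) with hH'
    have e1 : Zf (fun s : V → Bool × Bool => ∑ i, hT h lam a b η (fun j => x (Sum.inr (i, j))) (y i) (s i)) = ∑ s : (V → Bool) × (V → Bool), exp (H' s) := by
      unfold Zf
      rw [← (Equiv.arrowProdEquivProdArrow V (fun _ => Bool) (fun _ => Bool)).sum_comp]
      rfl
    rw [e1, Finset.mul_sum]
    have e2' : ∀ s : SU (V := V) U, Hy (Hy (fun s : SU (V := V) U => e2 h s.1) (AM (aC β q N Ap Am t) (fun k s => cC k s.1) 0) x) (AM (bC β B t) (fun k s => dC η k s.1) 0) y s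
        = -lam * ov s.1.1 s.1.2 + H' s.1 := by
      intro s
      simp only [Hy, AM, hH', hT]
      rw [Fintype.sum_sum_type, Fintype.sum_prod_type]
      have z : ∑ a₁ : Pr V, aC β q N Ap Am t (Sum.inl a₁) 0 * cC (Sum.inl a₁) s.1 * x (Sum.inl a₁) = 0 :=
        Finset.sum_eq_zero fun p _ => by simp [aC]
      rw [z, Finset.sum_add_distrib, Finset.sum_add_distrib, zero_add, ← add_assoc, ← add_assoc]
      congr 1
      · congr 1
        simp only [e2, SK.e1, eT, ov, Finset.sum_add_distrib, ← Finset.mul_sum]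
        ring
      · refine Finset.sum_congr rfl fun i _ => ?_
        simp [bC, dC, b]
    calc Zf _ = ∑ s : SU (V := V) U, exp (-lam * ov s.1.1 s.1.2 + H' s.1) := Finset.sum_congr rfl fun s _ => by rw [e2']
      _ ≤ ∑ s : SU (V := V) U, exp K0 * exp (H' s.1) := Finset.sum_le_sum fun s _ => by
          rw [← exp_add]; exact exp_le_exp.2 (by have := hU _ s.2; linarith)
      _ ≤ ∑ s : (V → Bool) × (V → Bool), exp K0 * exp (H' s) := by
          rw [← Finset.sum_subtype (Finset.univ.filter fun s : (V → Bool) × (V → Bool) => ov s.1 s.2 ∈ U) (by simp) (fun s => exp K0 * exp (H' s))]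
          exact Finset.sum_le_sum_of_subset_of_nonneg (Finset.subset_univ _) fun _ _ _ => by positivity
  have hprod : ∫ y : V → ℝ, ∏ i, Zf (hT h lam a b η (fun j => x (Sum.inr (i, j))) (y i)) ^ m ∂(gm V) =
      ∏ i, ∫ y, Zf (hT h lam a b η (fun j => x (Sum.inr (i, j))) y) ^ m ∂g1 :=
    integral_fintype_prod_eq_prod (fun i y => Zf (hT h lam a b η (fun j => x (Sum.inr (i, j))) y) ^ m)
  have hYi : Yi m (Hy (fun s : SU (V := V) U => e2 h s.1) (AM (aC β q N Ap Am t) (fun k s => cC k s.1) 0) x) (AM (bC β B t) (fun k s => dC η k s.1) 0)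
     ≤ exp (m * K0) * ∏ i, ∫ y, Zf (hT h lam a b η (fun j => x (Sum.inr (i, j))) y) ^ m ∂g1 := by
    rw [← hprod, ← integral_const_mul]
    refine integral_mono (int_Z _ _ _) (Integrable.const_mul ?_ _) fun y => ?_
    · exact Integrable.fintype_prod fun i => hT_int m h lam a b η _
    · simp only
      refine (rpow_le_rpow (Zf_pos _).le (key y) hm.le).trans (le_of_eq ?_)
      rw [mul_rpow (exp_pos _).le (Finset.prod_nonneg fun i _ => (Zf_pos _).le), Real.finsetProd_rpow _ _ fun i _ => (Zf_pos _).le, ← exp_mul, mul_comm K0]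
  have := log_le_log (Yi_pos _ _ _) hYi
  rw [log_mul (exp_pos _).ne' (Finset.prod_ne_zero_iff.2 fun i _ => (hT_int_pos m h lam a b η _).ne'), log_exp,
    log_prod fun i _ => (hT_int_pos m h lam a b η _).ne'] at this
  have h3 := mul_le_mul_of_nonneg_left this (by positivity : 0 ≤ 1 / m)
  refine h3.trans (le_of_eq ?_)
  unfold gT
  rw [mul_add, Finset.mul_sum]
  congr 1
  field_simp

/-- the single site free energy -/
def f1 (β h q : ℝ) : ℝ := ∫ z, log (2 * cosh (h + β * √q * z)) ∂g1

lemma phi_zero (β h q N : ℝ) : phi V β h q N 0 = Fintype.card V * f1 β h q := by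
  have hm : Measurable fun z : ℝ => log (2 * cosh (h + β * √q * z)) := by fun_prop
  have e : ∀ x : Ks V → ℝ, log (Zf (HS (V := V) β h q N 0 x)) = ∑ i, log (2 * cosh (h + β * √q * x (Sum.inr (i, 0)))) := by
    intro x
    have : HS (V := V) β h q N 0 x = fun s => ∑ i, (fun (i : V) (t : Bool) => (h + β * √q * x (Sum.inr (i, 0))) * spin t) i (s i) := by
      ext s
      simp only [HS, Hy, AM, e1]
      rw [Fintype.sum_sum_type, Fintype.sum_prod_type, ← add_assoc, Finset.sum_eq_zero (s := (Finset.univ : Finset (Pr V))) fun p _ => by simp [aS]]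
      rw [add_zero, ← Finset.sum_add_distrib]
      refine Finset.sum_congr rfl fun i _ => ?_
      simp [Fin.sum_univ_three, aS, cS]; ring
    rw [this, Zf_prod (fun (i : V) (t : Bool) => (h + β * √q * x (Sum.inr (i, 0))) * spin t), log_prod fun i _ => (Zf_pos _).ne']
    refine Finset.sum_congr rfl fun i _ => ?_
    simp [Zf, spin, cosh_eq]
    congr 1; ring
  have hI : Integrable (fun z : ℝ => log (2 * cosh (h + β * √q * z))) g1 := by
    refine integrable_of_exp_bound hm (1 + |h| + |β * √q|) 1 fun x => ?_
    have h1 : 1 ≤ cosh (h + β * √q * x) := one_le_cosh _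
    have h2 : cosh (h + β * √q * x) ≤ exp |h + β * √q * x| := by
      rw [← cosh_abs, cosh_eq]
      have := exp_le_exp.2 (neg_le_self (abs_nonneg (h + β * √q * x)))
      linarith
    rw [log_mul (by norm_num) (by linarith), abs_of_nonneg (add_nonneg (log_nonneg (by norm_num)) (log_nonneg h1))]
    have h3 := log_le_log (by linarith) h2
    rw [log_exp] at h3
    have h4 := abs_add_le h (β * √q * x)
    rw [abs_mul] at h4
    have h5 := abs_le_exp_abs x
    have h6 : 1 ≤ exp |x| := one_le_exp (abs_nonneg _)
    have h7 : log 2 ≤ 1 := by have := log_two_lt_d9; linarith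
    have h8 := mul_le_mul_of_nonneg_left h5 (abs_nonneg (β * √q))
    have h9 := mul_le_mul_of_nonneg_left h6 (abs_nonneg h)
    rw [one_mul]; nlinarith
  have hI2 : ∀ k : Ks V, Integrable (fun x : Ks V → ℝ => log (2 * cosh (h + β * √q * x k))) (gm (Ks V)) := fun k =>
    ((measurePreserving_eval (fun _ : Ks V => gaussianReal 0 1) k).integrable_comp hm.aestronglyMeasurable).2 hI
  unfold phi f1
  simp_rw [e]
  rw [integral_finsetSum _ fun i _ => hI2 _]
  have : ∀ i : V, ∫ x : Ks V → ℝ, log (2 * cosh (h + β * √q * x (Sum.inr (i, 0)))) ∂(gm (Ks V)) = ∫ z, log (2 * cosh (h + β * √q * z)) ∂g1 :=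
    fun i => integral_eval (κ := Ks V) _ hm
  simp [this]

end F0

lemma gm_lin_map {κ : Type*} [Fintype κ] (c : κ → ℝ) {σ : ℝ} (hσ : σ ^ 2 = ∑ k, c k ^ 2) :
    Measure.map (fun x : κ → ℝ => ∑ k, c k * x k) (gm κ) = Measure.map (fun z => σ * z) g1 := by
  have hm : Measurable (fun x : κ → ℝ => ∑ k, c k * x k) := by fun_prop
  have hm2 : Measurable (fun z : ℝ => σ * z) := by fun_prop
  have : IsProbabilityMeasure (Measure.map (fun x : κ → ℝ => ∑ k, c k * x k) (gm κ)) := Measure.isProbabilityMeasure_map hm.aemeasurable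
  have : IsProbabilityMeasure (Measure.map (fun z => σ * z) g1) := Measure.isProbabilityMeasure_map hm2.aemeasurable
  have h1 : ∀ ξ : ℝ, ∫ x : ℝ, Complex.exp (ξ * x * Complex.I) ∂g1 = Complex.exp (-(ξ ^ 2 / 2 : ℝ)) := by
    intro ξ
    rw [← charFun_apply_real, charFun_gaussianReal]
    congr 1; push_cast; simp
  refine Measure.ext_of_charFun ?_
  ext ξ
  rw [charFun_apply_real, charFun_apply_real, integral_map hm.aemeasurable (by fun_prop), integral_map hm2.aemeasurable (by fun_prop)]
  have e1 : ∀ x : κ → ℝ, Complex.exp (ξ * ((∑ k, c k * x k : ℝ) : ℂ) * Complex.I) = ∏ k, Complex.exp (((ξ * c k : ℝ) : ℂ) * x k * Complex.I) := by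
    intro x
    rw [← Complex.exp_sum]
    congr 1; push_cast
    rw [Finset.mul_sum, Finset.sum_mul]
    exact Finset.sum_congr rfl fun k _ => by ring
  simp_rw [e1]
  rw [integral_fintype_prod_eq_prod (fun k (x : ℝ) => Complex.exp (((ξ * c k : ℝ) : ℂ) * x * Complex.I))]
  simp_rw [h1]
  have e2 : ∀ z : ℝ, Complex.exp (ξ * ((σ * z : ℝ) : ℂ) * Complex.I) = Complex.exp (((ξ * σ : ℝ) : ℂ) * z * Complex.I) := by
    intro z; congr 1; push_cast; ring
  simp_rw [e2, h1]
  rw [← Complex.exp_sum]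
  congr 1
  rw [mul_pow, hσ, Finset.sum_neg_distrib, ← Complex.ofReal_sum, Finset.mul_sum, Finset.sum_div]
  simp_rw [mul_pow]

lemma integral_lin {κ : Type*} [Fintype κ] (c : κ → ℝ) {σ : ℝ} (hσ : σ ^ 2 = ∑ k, c k ^ 2) {f : ℝ → ℝ} (hf : Measurable f) :
    ∫ x, f (∑ k, c k * x k) ∂(gm κ) = ∫ z, f (σ * z) ∂g1 := by
  have hm : Measurable (fun x : κ → ℝ => ∑ k, c k * x k) := by fun_prop
  have hm2 : Measurable (fun z : ℝ => σ * z) := by fun_prop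
  rw [← integral_map (φ := fun x : κ → ℝ => ∑ k, c k * x k) hm.aemeasurable hf.aestronglyMeasurable, gm_lin_map c hσ,
    integral_map hm2.aemeasurable hf.aestronglyMeasurable]

lemma integrable_lin {κ : Type*} [Fintype κ] (c : κ → ℝ) {σ : ℝ} (hσ : σ ^ 2 = ∑ k, c k ^ 2) {f : ℝ → ℝ} (hf : Measurable f)
    (hi : Integrable (fun z => f (σ * z)) g1) : Integrable (fun x => f (∑ k, c k * x k)) (gm κ) := by
  have hm : Measurable (fun x : κ → ℝ => ∑ k, c k * x k) := by fun_prop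
  have hm2 : Measurable (fun z : ℝ => σ * z) := by fun_prop
  have := (integrable_map_measure (μ := gm κ) (f := fun x : κ → ℝ => ∑ k, c k * x k) (g := f) hf.aestronglyMeasurable hm.aemeasurable)
  rw [gm_lin_map c hσ, integrable_map_measure hf.aestronglyMeasurable hm2.aemeasurable] at this
  exact this.1 hi

lemma Zf_hT (h lam : ℝ) (a : Fin 3 → ℝ) (b η : ℝ) (x : Fin 3 → ℝ) (y : ℝ) :
    Zf (hT h lam a b η x y) = 4 * (cosh lam * (cosh (h + a 0 * x 0 + a 1 * x 1 + a 2 * x 2 + b * y) * cosh (h + a 0 * x 0 + a 1 * x 1 - a 2 * x 2 + η * b * y))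
      + sinh lam * (sinh (h + a 0 * x 0 + a 1 * x 1 + a 2 * x 2 + b * y) * sinh (h + a 0 * x 0 + a 1 * x 1 - a 2 * x 2 + η * b * y))) := by
  set Y1 := h + a 0 * x 0 + a 1 * x 1 + a 2 * x 2 + b * y with hY1
  set Y2 := h + a 0 * x 0 + a 1 * x 1 - a 2 * x 2 + η * b * y with hY2
  have e : ∀ s : Bool × Bool, hT h lam a b η x y s = spin s.1 * Y1 + spin s.2 * Y2 + lam * (spin s.1 * spin s.2) := by
    intro s; simp only [hT, eT, cT, Fin.sum_univ_three, Fin.isValue, if_true, Fin.reduceEq, if_false]; ring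
  have e' : Zf (hT h lam a b η x y) = exp (Y1 + Y2 + lam) + exp (Y1 - Y2 - lam) + exp (-Y1 + Y2 - lam) + exp (-Y1 - Y2 + lam) := by
    unfold Zf
    simp_rw [e]
    simp only [Fintype.sum_prod_type, Fintype.sum_bool, spin]
    norm_num
    ring_nf
  rw [e']
  simp only [cosh_eq, sinh_eq, sub_eq_add_neg, exp_add]
  ring



lemma coshsinh_pos {a : ℝ} (ha : |a| ≤ 1) (l : ℝ) : 0 < cosh l + a * sinh l := by
  have h1 : |a * sinh l| ≤ |sinh l| := by rw [abs_mul]; exact mul_le_of_le_one_left (abs_nonneg _) ha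
  have h2 : |sinh l| < cosh l := by
    rw [abs_lt]; have := exp_pos l; have := exp_pos (-l); rw [cosh_eq, sinh_eq]; constructor <;> linarith
  have := neg_abs_le (a * sinh l)
  linarith

lemma log_coshsinh_aux {a : ℝ} (ha : |a| ≤ 1) {l : ℝ} (hl : 0 ≤ l) : log (cosh l + a * sinh l) ≤ l * a + l ^ 2 / 2 := by
  have hp := coshsinh_pos ha
  have dD : ∀ l, HasDerivAt (fun l => cosh l + a * sinh l) (sinh l + a * cosh l) l := fun l =>
    (hasDerivAt_cosh l).add ((hasDerivAt_sinh l).const_mul a)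
  have dN : ∀ l, HasDerivAt (fun l => sinh l + a * cosh l) (cosh l + a * sinh l) l := fun l =>
    (hasDerivAt_sinh l).add ((hasDerivAt_cosh l).const_mul a)
  have dk : ∀ l, HasDerivAt (fun l => a + l - (sinh l + a * cosh l) / (cosh l + a * sinh l)) (((sinh l + a * cosh l) / (cosh l + a * sinh l)) ^ 2) l := by
    intro l
    refine (((hasDerivAt_id l).const_add a).sub ((dN l).div (dD l) (hp l).ne')).congr_deriv ?_
    have := (hp l).ne'
    field_simp; ring
  have mk : Monotone (fun l => a + l - (sinh l + a * cosh l) / (cosh l + a * sinh l)) :=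
    monotone_of_hasDerivAt_nonneg dk fun l => sq_nonneg _
  have dg : ∀ l, HasDerivAt (fun l => l * a + l ^ 2 / 2 - log (cosh l + a * sinh l)) (a + l - (sinh l + a * cosh l) / (cosh l + a * sinh l)) l := by
    intro l
    refine ((((hasDerivAt_id l).mul_const a).add (((hasDerivAt_id l).pow 2).div_const 2)).sub ((dD l).log (hp l).ne')).congr_deriv ?_
    simp
  have mg : MonotoneOn (fun l => l * a + l ^ 2 / 2 - log (cosh l + a * sinh l)) (Set.Ici 0) := by
    refine monotoneOn_of_deriv_nonneg (convex_Ici 0) (fun x _ => (dg x).continuousAt.continuousWithinAt)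
      (fun x _ => (dg x).differentiableAt.differentiableWithinAt) fun x hx => ?_
    rw [(dg x).deriv]
    have hx0 : 0 ≤ x := by simpa using interior_subset hx
    have := mk hx0
    simpa using this
  have := mg (Set.mem_Ici.2 le_rfl) hl hl
  simp only [zero_mul, cosh_zero, sinh_zero, mul_zero, add_zero, log_one] at this
  norm_num at this
  linarith

lemma log_coshsinh {a : ℝ} (ha : |a| ≤ 1) (l : ℝ) : log (cosh l + a * sinh l) ≤ l * a + l ^ 2 / 2 := by
  rcases le_total 0 l with h | h
  · exact log_coshsinh_aux ha h
  · have := log_coshsinh_aux (a := -a) (by rwa [abs_neg]) (neg_nonneg.2 h)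
    simpa using this


lemma hasDerivAt_tanh' (x : ℝ) : HasDerivAt tanh (1 - tanh x ^ 2) x := by
  have e : tanh = fun x => sinh x / cosh x := funext fun x => tanh_eq_sinh_div_cosh x
  rw [e]
  refine ((hasDerivAt_sinh x).div (hasDerivAt_cosh x) (cosh_pos x).ne').congr_deriv ?_
  have := (cosh_pos x).ne'
  field_simp

lemma cont_tanh : Continuous tanh := continuous_iff_continuousAt.2 fun x => (hasDerivAt_tanh' x).continuousAt

lemma meas_tanh : Measurable tanh := cont_tanh.measurable

lemma one_sub_tanh_sq (x : ℝ) : 1 - tanh x ^ 2 = (cosh x)⁻¹ ^ 2 := by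
  have := (cosh_pos x).ne'
  have h2 := cosh_sq x
  rw [tanh_eq_sinh_div_cosh]
  field_simp; linarith

lemma tanh_sq_le (x : ℝ) : tanh x ^ 2 ≤ 1 := by
  have := one_sub_tanh_sq x
  have h2 : 0 ≤ (cosh x)⁻¹ ^ 2 := by positivity
  linarith

lemma abs_tanh_le (x : ℝ) : |tanh x| ≤ 1 := by
  rw [← sq_le_one_iff_abs_le_one]; exact tanh_sq_le x

lemma abs_one_sub_tanh_sq_le (x : ℝ) : |1 - tanh x ^ 2| ≤ 1 := by
  have := tanh_sq_le x
  rw [abs_le]; constructor <;> nlinarith [sq_nonneg (tanh x)]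

lemma log2cosh_bound (x : ℝ) : |log (2 * cosh x)| ≤ 1 + |x| := by
  have h1 : 1 ≤ cosh x := one_le_cosh _
  have h2 : cosh x ≤ exp |x| := by
    rw [← cosh_abs, cosh_eq]
    have := exp_le_exp.2 (neg_le_self (abs_nonneg x))
    linarith
  rw [log_mul (by norm_num) (by linarith), abs_of_nonneg (add_nonneg (log_nonneg (by norm_num)) (log_nonneg h1))]
  have h3 := log_le_log (by linarith) h2
  rw [log_exp] at h3
  have h7 : log 2 ≤ 1 := by have := log_two_lt_d9; linarith
  linarith

lemma f1_integrable (h σ : ℝ) : Integrable (fun z : ℝ => log (2 * cosh (h + σ * z))) g1 := by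
  refine integrable_of_exp_bound (by fun_prop) (1 + |h| + |σ|) 1 fun x => ?_
  refine (log2cosh_bound _).trans ?_
  have h4 := abs_add_le h (σ * x)
  rw [abs_mul] at h4
  have h5 := abs_le_exp_abs x
  have h6 : 1 ≤ exp |x| := one_le_exp (abs_nonneg _)
  have h8 := mul_le_mul_of_nonneg_left h5 (abs_nonneg σ)
  have h9 := mul_le_mul_of_nonneg_left h6 (abs_nonneg h)
  rw [one_mul]; nlinarith

/-- two-spin overlap function -/
def Gam (h : ℝ) (a : Fin 3 → ℝ) : ℝ :=
  ∫ x : Fin 3 → ℝ, tanh (h + a 0 * x 0 + a 1 * x 1 + a 2 * x 2) * tanh (h + a 0 * x 0 + a 1 * x 1 - a 2 * x 2) ∂(gm (Fin 3))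

lemma integral_Y1 (h : ℝ) (a : Fin 3 → ℝ) {σ : ℝ} (hσ : σ ^ 2 = a 0 ^ 2 + a 1 ^ 2 + a 2 ^ 2) {f : ℝ → ℝ} (hf : Measurable f) :
    ∫ x : Fin 3 → ℝ, f (h + a 0 * x 0 + a 1 * x 1 + a 2 * x 2) ∂(gm (Fin 3)) = ∫ z, f (h + σ * z) ∂g1 := by
  rw [← integral_lin (κ := Fin 3) a (σ := σ) (f := fun z => f (h + z)) (by rw [Fin.sum_univ_three]; exact hσ) (by fun_prop)]
  congr 1; ext x; rw [Fin.sum_univ_three]; ring_nf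

lemma integral_Y2 (h : ℝ) (a : Fin 3 → ℝ) {σ : ℝ} (hσ : σ ^ 2 = a 0 ^ 2 + a 1 ^ 2 + a 2 ^ 2) {f : ℝ → ℝ} (hf : Measurable f) :
    ∫ x : Fin 3 → ℝ, f (h + a 0 * x 0 + a 1 * x 1 - a 2 * x 2) ∂(gm (Fin 3)) = ∫ z, f (h + σ * z) ∂g1 := by
  have := integral_Y1 h (fun j => if j = 2 then -a 2 else a j) (σ := σ) (by simp [hσ]) hf
  rw [← this]
  congr 1; ext x; simp [sub_eq_add_neg]

lemma integrable_Y1 (h : ℝ) (a : Fin 3 → ℝ) : Integrable (fun x : Fin 3 → ℝ => log (2 * cosh (h + a 0 * x 0 + a 1 * x 1 + a 2 * x 2))) (gm (Fin 3)) := by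
  have := integrable_lin (κ := Fin 3) a (σ := √(∑ k, a k ^ 2)) (f := fun z => log (2 * cosh (h + z))) (sq_sqrt (Finset.sum_nonneg fun _ _ => sq_nonneg _)) (by fun_prop) (f1_integrable h _)
  refine this.congr (Eventually.of_forall fun x => ?_)
  simp only; rw [Fin.sum_univ_three]; ring_nf

lemma integrable_Y2 (h : ℝ) (a : Fin 3 → ℝ) : Integrable (fun x : Fin 3 → ℝ => log (2 * cosh (h + a 0 * x 0 + a 1 * x 1 - a 2 * x 2))) (gm (Fin 3)) := by
  have := integrable_Y1 h (fun j => if j = 2 then -a 2 else a j)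
  simpa [sub_eq_add_neg] using this

lemma bdd_integrable {κ : Type*} [Fintype κ] {f : (κ → ℝ) → ℝ} (hf : Measurable f) (C : ℝ) (h : ∀ x, |f x| ≤ C) : Integrable f (gm κ) :=
  Integrable.of_bound hf.aestronglyMeasurable C (Eventually.of_forall h)

lemma iadd {α : Type*} [MeasurableSpace α] {μ : Measure α} {f g : α → ℝ} (hf : Integrable f μ) (hg : Integrable g μ) :
    Integrable (fun x => f x + g x) μ := hf.add hg

lemma fT_b0_le (h lam η : ℝ) (a : Fin 3 → ℝ) {σ : ℝ} (hσ : σ ^ 2 = a 0 ^ 2 + a 1 ^ 2 + a 2 ^ 2) :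
    fT 1 h lam a 0 η ≤ 2 * ∫ z, log (2 * cosh (h + σ * z)) ∂g1 + lam * Gam h a + lam ^ 2 / 2 := by
  have mt := meas_tanh
  have iG : Integrable (fun x : Fin 3 → ℝ => tanh (h + a 0 * x 0 + a 1 * x 1 + a 2 * x 2) * tanh (h + a 0 * x 0 + a 1 * x 1 - a 2 * x 2)) (gm (Fin 3)) := by
    refine bdd_integrable (by fun_prop) 1 fun x => ?_
    rw [abs_mul]; exact mul_le_one₀ (abs_tanh_le _) (abs_nonneg _) (abs_tanh_le _)
  have e : 2 * ∫ z, log (2 * cosh (h + σ * z)) ∂g1 + lam * Gam h a + lam ^ 2 / 2 =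
      ∫ x : Fin 3 → ℝ, log (2 * cosh (h + a 0 * x 0 + a 1 * x 1 + a 2 * x 2)) + log (2 * cosh (h + a 0 * x 0 + a 1 * x 1 - a 2 * x 2)) +
        lam * (tanh (h + a 0 * x 0 + a 1 * x 1 + a 2 * x 2) * tanh (h + a 0 * x 0 + a 1 * x 1 - a 2 * x 2)) + lam ^ 2 / 2 ∂(gm (Fin 3)) := by
    rw [integral_add (iadd (iadd (integrable_Y1 h a) (integrable_Y2 h a)) (iG.const_mul lam)) (integrable_const _),
      integral_add (iadd (integrable_Y1 h a) (integrable_Y2 h a)) (iG.const_mul lam), integral_add (integrable_Y1 h a) (integrable_Y2 h a),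
      integral_Y1 h a hσ (f := fun z => log (2 * cosh z)) (by fun_prop), integral_Y2 h a hσ (f := fun z => log (2 * cosh z)) (by fun_prop), integral_const_mul, Gam]
    simp; ring
  rw [e]
  refine integral_mono (gT_integrable one_pos h lam a 0 η) ?_ fun x => ?_
  · exact (((integrable_Y1 h a).add (integrable_Y2 h a)).add (iG.const_mul lam)).add (integrable_const _)
  · simp only [gT]
    set Y1 := h + a 0 * x 0 + a 1 * x 1 + a 2 * x 2 with hY1
    set Y2 := h + a 0 * x 0 + a 1 * x 1 - a 2 * x 2 with hY2
    have hZ : ∀ y, Zf (hT h lam a 0 η x y) ^ (1 : ℝ) = (2 * cosh Y1) * (2 * cosh Y2) * (cosh lam + tanh Y1 * tanh Y2 * sinh lam) := by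
      intro y
      rw [rpow_one, Zf_hT]
      simp only [zero_mul, mul_zero, add_zero, ← hY1, ← hY2]
      rw [tanh_eq_sinh_div_cosh, tanh_eq_sinh_div_cosh]
      have := (cosh_pos Y1).ne'; have := (cosh_pos Y2).ne'
      field_simp; ring
    simp_rw [hZ]
    have ht : |tanh Y1 * tanh Y2| ≤ 1 := by rw [abs_mul]; exact mul_le_one₀ (abs_tanh_le _) (abs_nonneg _) (abs_tanh_le _)
    have hp := coshsinh_pos ht lam
    have h1 := cosh_pos Y1
    have h2 := cosh_pos Y2
    rw [integral_const, probReal_univ, one_smul, log_mul (by positivity) hp.ne', log_mul (by positivity) (by positivity)]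
    have := log_coshsinh ht lam
    linarith

lemma Gam_path (h σ c0 c1 : ℝ) (hc : c0 ^ 2 + c1 ^ 2 = σ ^ 2) (θ : ℝ) :
    HasDerivAt (fun θ => Gam h ![cos θ * c0, cos θ * c1, sin θ * σ])
      (-4 * σ ^ 2 * (sin θ * cos θ) * ∫ x : Fin 3 → ℝ, (1 - tanh (h + cos θ * c0 * x 0 + cos θ * c1 * x 1 + sin θ * σ * x 2) ^ 2) *
        (1 - tanh (h + cos θ * c0 * x 0 + cos θ * c1 * x 1 - sin θ * σ * x 2) ^ 2) ∂(gm (Fin 3))) θ := by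
  have mt := meas_tanh
  set X1 : ℝ → (Fin 3 → ℝ) → ℝ := fun θ x => h + cos θ * c0 * x 0 + cos θ * c1 * x 1 + sin θ * σ * x 2 with hX1
  set X2 : ℝ → (Fin 3 → ℝ) → ℝ := fun θ x => h + cos θ * c0 * x 0 + cos θ * c1 * x 1 - sin θ * σ * x 2 with hX2
  have mX1 : ∀ θ, Measurable (X1 θ) := fun θ => by simp only [hX1]; fun_prop
  have mX2 : ∀ θ, Measurable (X2 θ) := fun θ => by simp only [hX2]; fun_prop
  have dX1 : ∀ θ x, HasDerivAt (fun s => X1 s x) (-sin θ * c0 * x 0 + -sin θ * c1 * x 1 + cos θ * σ * x 2) θ := by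
    intro θ x
    have h1 := hasDerivAt_cos θ
    have h2 := hasDerivAt_sin θ
    exact (((((h1.mul_const c0).mul_const (x 0)).const_add h).add ((h1.mul_const c1).mul_const (x 1))).add ((h2.mul_const σ).mul_const (x 2)))
  have dX2 : ∀ θ x, HasDerivAt (fun s => X2 s x) (-sin θ * c0 * x 0 + -sin θ * c1 * x 1 - cos θ * σ * x 2) θ := by
    intro θ x
    have h1 := hasDerivAt_cos θ
    have h2 := hasDerivAt_sin θ
    exact (((((h1.mul_const c0).mul_const (x 0)).const_add h).add ((h1.mul_const c1).mul_const (x 1))).sub ((h2.mul_const σ).mul_const (x 2)))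
  set P1 : ℝ → (Fin 3 → ℝ) → ℝ := fun θ x => (1 - tanh (X1 θ x) ^ 2) * tanh (X2 θ x) with hP1
  set P2 : ℝ → (Fin 3 → ℝ) → ℝ := fun θ x => tanh (X1 θ x) * (1 - tanh (X2 θ x) ^ 2) with hP2
  have mP1 : ∀ θ, Measurable (P1 θ) := fun θ => by
    have := mX1 θ; have := mX2 θ; simp only [hP1]; fun_prop
  have mP2 : ∀ θ, Measurable (P2 θ) := fun θ => by
    have := mX1 θ; have := mX2 θ; simp only [hP2]; fun_prop
  have bP1 : ∀ θ x, |P1 θ x| ≤ 1 := fun θ x => by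
    rw [abs_mul]; exact mul_le_one₀ (abs_one_sub_tanh_sq_le _) (abs_nonneg _) (abs_tanh_le _)
  have bP2 : ∀ θ x, |P2 θ x| ≤ 1 := fun θ x => by
    rw [abs_mul]; exact mul_le_one₀ (abs_tanh_le _) (abs_nonneg _) (abs_one_sub_tanh_sq_le _)
  have EP1 : EB P1 := EB.bdd 1 bP1
  have EP2 : EB P2 := EB.bdd 1 bP2
  have main := hasDerivAt_integral_gm (κ := Fin 3) (F := fun θ x => tanh (X1 θ x) * tanh (X2 θ x))
    (F' := fun θ x => -sin θ * c0 * (x 0 * (P1 θ x + P2 θ x)) + -sin θ * c1 * (x 1 * (P1 θ x + P2 θ x)) + cos θ * σ * (x 2 * (P1 θ x - P2 θ x))) θ ?_ ?_ ?_ ?_ ?_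
  · have e0 : (fun θ => Gam h ![cos θ * c0, cos θ * c1, sin θ * σ]) = fun s => ∫ x, tanh (X1 s x) * tanh (X2 s x) ∂(gm (Fin 3)) := by
      ext s; simp [Gam, hX1, hX2]
    rw [e0]
    refine main.congr_deriv ?_
    have hI : ∀ k : Fin 3, Integrable (fun x => x k * (P1 θ x + P2 θ x)) (gm (Fin 3)) := fun k =>
      ((EB.coord (Θ := ℝ) k).mul (EP1.add EP2)).integrable θ ((measurable_pi_apply k).mul ((mP1 θ).add (mP2 θ)))
    have hI2 : Integrable (fun x => x 2 * (P1 θ x - P2 θ x)) (gm (Fin 3)) :=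
      ((EB.coord (Θ := ℝ) (2 : Fin 3)).mul (EP1.sub EP2)).integrable θ ((measurable_pi_apply 2).mul ((mP1 θ).sub (mP2 θ)))
    rw [integral_add (iadd ((hI 0).const_mul _) ((hI 1).const_mul _)) (hI2.const_mul _), integral_add ((hI 0).const_mul _) ((hI 1).const_mul _),
      integral_const_mul, integral_const_mul, integral_const_mul]
    set DD : (Fin 3 → ℝ) → ℝ := fun x => (1 - tanh (X1 θ x) ^ 2) * (1 - tanh (X2 θ x) ^ 2) with hDD
    set WW : (Fin 3 → ℝ) → ℝ := fun x => tanh (X1 θ x) * tanh (X2 θ x) * ((1 - tanh (X1 θ x) ^ 2) + (1 - tanh (X2 θ x) ^ 2)) with hWW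
    have mD : Measurable DD := by have := mX1 θ; have := mX2 θ; simp only [hDD]; fun_prop
    have mW : Measurable WW := by have := mX1 θ; have := mX2 θ; simp only [hWW]; fun_prop
    have bD : ∀ x, |DD x| ≤ 1 := fun x => by
      rw [abs_mul]; exact mul_le_one₀ (abs_one_sub_tanh_sq_le _) (abs_nonneg _) (abs_one_sub_tanh_sq_le _)
    have bW : ∀ x, |WW x| ≤ 2 := fun x => by
      rw [abs_mul, abs_mul]
      have h1 := abs_add_le (1 - tanh (X1 θ x) ^ 2) (1 - tanh (X2 θ x) ^ 2)
      have h2 := abs_one_sub_tanh_sq_le (X1 θ x)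
      have h3 := abs_one_sub_tanh_sq_le (X2 θ x)
      have h4 := mul_le_one₀ (abs_tanh_le (X1 θ x)) (abs_nonneg _) (abs_tanh_le (X2 θ x))
      calc _ ≤ 1 * |1 - tanh (X1 θ x) ^ 2 + (1 - tanh (X2 θ x) ^ 2)| := mul_le_mul_of_nonneg_right h4 (abs_nonneg _)
        _ ≤ 2 := by linarith
    have iD := bdd_integrable mD 1 bD
    have iW := bdd_integrable mW 2 bW
    have s01 : ∀ (k : Fin 3) (c : ℝ), (∀ x s, X1 θ (Function.update x k s) = X1 θ x + c * (s - x k)) → (∀ x s, X2 θ (Function.update x k s) = X2 θ x + c * (s - x k)) →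
        ∫ x, x k * (P1 θ x + P2 θ x) ∂(gm (Fin 3)) = ∫ x, c * (2 * DD x - 2 * WW x) ∂(gm (Fin 3)) := by
      intro k c hc1 hc2
      refine stein k ?_ ?_ ((mP1 θ).add (mP2 θ)) (by fun_prop) ?_
      · exact (EP1.add EP2).comp (fun _ => θ)
      · exact (((EB.bdd 1 fun _ x => bD x).const_mul 2).sub ((EB.bdd 2 fun _ x => bW x).const_mul 2)).const_mul c
      · intro x
        simp only [hP1, hP2, hc1, hc2]
        have l1 : HasDerivAt (fun s => X1 θ x + c * (s - x k)) c (x k) := by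
          simpa using ((((hasDerivAt_id (x k)).sub_const (x k)).const_mul c).const_add (X1 θ x))
        have l2 : HasDerivAt (fun s => X2 θ x + c * (s - x k)) c (x k) := by
          simpa using ((((hasDerivAt_id (x k)).sub_const (x k)).const_mul c).const_add (X2 θ x))
        have t1 := (hasDerivAt_tanh' _).comp (x k) l1
        have t2 := (hasDerivAt_tanh' _).comp (x k) l2
        have := (((t1.pow 2).const_sub 1).mul t2).add (t1.mul ((t2.pow 2).const_sub 1))
        refine this.congr_deriv ?_
        simp only [Function.comp_apply, sub_self, mul_zero, add_zero, hDD, hWW, Pi.pow_apply]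
        ring
    have s2 : ∫ x, x 2 * (P1 θ x - P2 θ x) ∂(gm (Fin 3)) = ∫ x, (sin θ * σ) * (-2 * DD x - 2 * WW x) ∂(gm (Fin 3)) := by
      have hc1 : ∀ x s, X1 θ (Function.update x 2 s) = X1 θ x + (sin θ * σ) * (s - x 2) := by intro x s; simp [hX1]; ring
      have hc2 : ∀ x s, X2 θ (Function.update x 2 s) = X2 θ x + (-(sin θ * σ)) * (s - x 2) := by intro x s; simp [hX2]; ring
      refine stein 2 ?_ ?_ ((mP1 θ).sub (mP2 θ)) (by fun_prop) ?_
      · exact (EP1.sub EP2).comp (fun _ => θ)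
      · exact (((EB.bdd 1 fun _ x => bD x).const_mul (-2)).sub ((EB.bdd 2 fun _ x => bW x).const_mul 2)).const_mul _
      · intro x
        simp only [hP1, hP2, hc1, hc2]
        have l1 : HasDerivAt (fun s => X1 θ x + (sin θ * σ) * (s - x 2)) (sin θ * σ) (x 2) := by
          simpa using ((((hasDerivAt_id (x 2)).sub_const (x 2)).const_mul (sin θ * σ)).const_add (X1 θ x))
        have l2 : HasDerivAt (fun s => X2 θ x + (-(sin θ * σ)) * (s - x 2)) (-(sin θ * σ)) (x 2) := by
          simpa using ((((hasDerivAt_id (x 2)).sub_const (x 2)).const_mul (-(sin θ * σ))).const_add (X2 θ x))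
        have t1 := (hasDerivAt_tanh' _).comp (x 2) l1
        have t2 := (hasDerivAt_tanh' _).comp (x 2) l2
        have := (((t1.pow 2).const_sub 1).mul t2).sub (t1.mul ((t2.pow 2).const_sub 1))
        refine this.congr_deriv ?_
        simp only [Function.comp_apply, sub_self, mul_zero, add_zero, hDD, hWW, Pi.pow_apply]
        ring
    have iDW : Integrable (fun x => 2 * DD x - 2 * WW x) (gm (Fin 3)) := (iD.const_mul 2).sub (iW.const_mul 2)
    have iDW2 : Integrable (fun x => -2 * DD x - 2 * WW x) (gm (Fin 3)) := (iD.const_mul (-2)).sub (iW.const_mul 2)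
    rw [s01 0 (cos θ * c0) (by intro x s; simp [hX1]; ring) (by intro x s; simp [hX2]; ring),
      s01 1 (cos θ * c1) (by intro x s; simp [hX1]; ring) (by intro x s; simp [hX2]; ring), s2]
    simp_rw [integral_const_mul]
    rw [integral_sub (iD.const_mul 2) (iW.const_mul 2), integral_sub (iD.const_mul (-2)) (iW.const_mul 2)]
    simp_rw [integral_const_mul]
    rw [← hc]
    linear_combination (cos θ * sin θ * (-2 * ∫ x, DD x ∂(gm (Fin 3)) - 2 * ∫ x, WW x ∂(gm (Fin 3)))) * (-hc)
  · exact EB.bdd 1 fun _ x => by rw [abs_mul]; exact mul_le_one₀ (abs_tanh_le _) (abs_nonneg _) (abs_tanh_le _)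
  · have hb : ∀ (θ : ℝ) (x : Fin 3 → ℝ), |-sin θ * c0 * (x 0 * (P1 θ x + P2 θ x)) + -sin θ * c1 * (x 1 * (P1 θ x + P2 θ x)) + cos θ * σ * (x 2 * (P1 θ x - P2 θ x))|
        ≤ |(|c0| * (|x 0| * 2) + |c1| * (|x 1| * 2) + |σ| * (|x 2| * 2))| := by
      intro θ x
      have hs : |P1 θ x + P2 θ x| ≤ 2 := (abs_add_le _ _).trans (by linarith [bP1 θ x, bP2 θ x])
      have hd : |P1 θ x - P2 θ x| ≤ 2 := (abs_sub _ _).trans (by linarith [bP1 θ x, bP2 θ x])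
      refine le_trans ?_ (le_abs_self _)
      refine (abs_add_le _ _).trans (add_le_add ((abs_add_le _ _).trans (add_le_add ?_ ?_)) ?_)
      · rw [abs_mul, abs_mul (x 0)]
        exact mul_le_mul (abs_neg_sin_mul_le _ _) (mul_le_mul_of_nonneg_left hs (abs_nonneg _)) (by positivity) (abs_nonneg _)
      · rw [abs_mul, abs_mul (x 1)]
        exact mul_le_mul (abs_neg_sin_mul_le _ _) (mul_le_mul_of_nonneg_left hs (abs_nonneg _)) (by positivity) (abs_nonneg _)
      · rw [abs_mul, abs_mul (x 2)]
        exact mul_le_mul (abs_cos_mul_le _ _) (mul_le_mul_of_nonneg_left hd (abs_nonneg _)) (by positivity) (abs_nonneg _)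
    have hc : ∀ (c : ℝ) (k : Fin 3), EB (fun (_ : Metric.ball θ 1) (x : Fin 3 → ℝ) => |c| * (|x k| * 2)) := fun c k =>
      ((EB.coord k).abs.mul (EB.const 2)).const_mul _
    exact (((hc c0 0).add (hc c1 1)).add (hc σ 2)).mono fun s x => hb s x
  · intro θ; have := mX1 θ; have := mX2 θ; fun_prop
  · have := mP1 θ; have := mP2 θ; fun_prop
  · intro θ x
    have := ((hasDerivAt_tanh' _).comp θ (dX1 θ x)).mul ((hasDerivAt_tanh' _).comp θ (dX2 θ x))
    refine this.congr_deriv ?_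
    simp only [Function.comp_apply, hP1, hP2]
    ring

/-- the interpolation bound expression -/
def gapE (β h q t u Ap Am B η m lam : ℝ) : ℝ :=
  fT m h lam (sA β q Ap Am t 0) (sin t * β * √B) η - 2 * f1 β h q - lam * u
    + sin t ^ 2 * β ^ 2 / 2 * ((1 - (q + B)) ^ 2 - (1 - q) ^ 2 + (u - (Ap - Am + η * B)) ^ 2
      - m * ((q + B) ^ 2 + (Ap - Am + η * B) ^ 2 - q ^ 2 - (Ap - Am) ^ 2))

/-- existence of good parameters -/
def Gap (β h q c K t u : ℝ) : Prop :=
  ∃ Ap Am B η m lam : ℝ, 0 ≤ Ap ∧ 0 ≤ Am ∧ Ap + Am = q ∧ 0 ≤ B ∧ B ≤ 1 ∧ η ^ 2 = 1 ∧ 0 < m ∧ m ≤ 1 ∧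
    |lam| ≤ K * |u - q| ∧ |u - (Ap - Am + η * B)| ≤ K * |u - q| ∧
    gapE β h q t u Ap Am B η m lam ≤ -c * (u - q) ^ 2

lemma Gap.mono {β h q c K t u c' K' : ℝ} (hg : Gap β h q c K t u) (hc : c' ≤ c) (hK : K ≤ K') : Gap β h q c' K' t u := by
  obtain ⟨Ap, Am, B, η, m, lam, h1, h2, h3, h4, h5, h6, h7, h8, h9, h10, h11⟩ := hg
  exact ⟨Ap, Am, B, η, m, lam, h1, h2, h3, h4, h5, h6, h7, h8,
    h9.trans (mul_le_mul_of_nonneg_right hK (abs_nonneg _)), h10.trans (mul_le_mul_of_nonneg_right hK (abs_nonneg _)),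
    h11.trans (by nlinarith [sq_nonneg (u - q)])⟩

lemma sA_sq {β q Ap Am : ℝ} (hA : 0 ≤ Ap) (hA' : 0 ≤ Am) (hq : Ap + Am = q) (t : ℝ) :
    (β * √q) ^ 2 = sA β q Ap Am t 0 0 ^ 2 + sA β q Ap Am t 0 1 ^ 2 + sA β q Ap Am t 0 2 ^ 2 := by
  have h0 : 0 ≤ q := by linarith
  simp only [sA, Fin.isValue, if_true, Fin.reduceEq, if_false, one_ne_zero, cos_zero, one_mul]
  rw [mul_pow, mul_pow (cos t), mul_pow β, mul_pow (sin t * β), mul_pow (sin t * β), sq_sqrt h0, sq_sqrt hA, sq_sqrt hA', mul_pow, cos_sq', ← hq]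
  ring

lemma Gam_lb {h σ : ℝ} (hσ0 : 0 < σ) (a : Fin 3 → ℝ) (ha2 : 0 ≤ a 2) (hσ : σ ^ 2 = a 0 ^ 2 + a 1 ^ 2 + a 2 ^ 2) :
    ∫ z, tanh (h + σ * z) ^ 2 ∂g1 - 2 * a 2 ^ 2 * ∫ z, (cosh (h + σ * z))⁻¹ ^ 4 ∂g1 ≤ Gam h a := by
  have mt := meas_tanh
  set I := ∫ z, (cosh (h + σ * z))⁻¹ ^ 4 ∂g1 with hI
  have hle : a 2 ≤ σ := by nlinarith [sq_nonneg (a 0), sq_nonneg (a 1)]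
  set α := arcsin (a 2 / σ) with hα
  have hs : sin α = a 2 / σ := sin_arcsin (by have : 0 ≤ a 2 / σ := by positivity
                                              linarith) ((div_le_one hσ0).2 hle)
  have hα0 : 0 ≤ α := arcsin_nonneg.2 (by positivity)
  have hα1 : α ≤ π / 2 := arcsin_le_pi_div_two _
  have hcs : cos α ^ 2 * σ ^ 2 = a 0 ^ 2 + a 1 ^ 2 := by
    rw [cos_sq', hs]; field_simp; linarith
  obtain ⟨c0, c1, hc, h0, h1⟩ : ∃ c0 c1, c0 ^ 2 + c1 ^ 2 = σ ^ 2 ∧ a 0 = cos α * c0 ∧ a 1 = cos α * c1 := by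
    by_cases hz : cos α = 0
    · rw [hz] at hcs
      have e0 : a 0 = 0 := by nlinarith [sq_nonneg (a 0), sq_nonneg (a 1)]
      have e1 : a 1 = 0 := by nlinarith [sq_nonneg (a 0), sq_nonneg (a 1)]
      exact ⟨σ, 0, by ring, by rw [e0, hz]; ring, by rw [e1, hz]; ring⟩
    · refine ⟨a 0 / cos α, a 1 / cos α, ?_, by field_simp, by field_simp⟩
      field_simp; linarith
  have h2 : a 2 = sin α * σ := by rw [hs]; field_simp
  have ea : a = ![cos α * c0, cos α * c1, sin α * σ] := by
    ext j; fin_cases j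
    · exact h0
    · exact h1
    · exact h2
  have dG : ∀ θ, HasDerivAt (fun θ => Gam h ![cos θ * c0, cos θ * c1, sin θ * σ] + 2 * (sin θ * σ) ^ 2 * I)
      (-4 * σ ^ 2 * (sin θ * cos θ) * ∫ x : Fin 3 → ℝ, (1 - tanh (h + cos θ * c0 * x 0 + cos θ * c1 * x 1 + sin θ * σ * x 2) ^ 2) *
        (1 - tanh (h + cos θ * c0 * x 0 + cos θ * c1 * x 1 - sin θ * σ * x 2) ^ 2) ∂(gm (Fin 3)) + 4 * σ ^ 2 * (sin θ * cos θ) * I) θ := by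
    intro θ
    refine (Gam_path h σ c0 c1 hc θ).add ?_
    refine ((((hasDerivAt_sin θ).mul_const σ).pow 2).const_mul 2 |>.mul_const I).congr_deriv ?_
    push_cast; ring
  have mono : MonotoneOn (fun θ => Gam h ![cos θ * c0, cos θ * c1, sin θ * σ] + 2 * (sin θ * σ) ^ 2 * I) (Set.Icc 0 (π / 2)) := by
    refine monotoneOn_of_deriv_nonneg (convex_Icc _ _) (fun x _ => (dG x).continuousAt.continuousWithinAt)
      (fun x _ => (dG x).differentiableAt.differentiableWithinAt) fun θ hθ => ?_
    rw [interior_Icc] at hθ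
    rw [(dG θ).deriv]
    have hsc : 0 ≤ sin θ * cos θ := mul_nonneg (sin_nonneg_of_nonneg_of_le_pi hθ.1.le (by linarith [hθ.2, pi_pos]))
      (cos_nonneg_of_neg_pi_div_two_le_of_le (by linarith [hθ.1, pi_pos]) hθ.2.le)
    have hle : ∫ x : Fin 3 → ℝ, (1 - tanh (h + cos θ * c0 * x 0 + cos θ * c1 * x 1 + sin θ * σ * x 2) ^ 2) *
        (1 - tanh (h + cos θ * c0 * x 0 + cos θ * c1 * x 1 - sin θ * σ * x 2) ^ 2) ∂(gm (Fin 3)) ≤ I := by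
      set b : Fin 3 → ℝ := ![cos θ * c0, cos θ * c1, sin θ * σ] with hb
      have hbσ : σ ^ 2 = b 0 ^ 2 + b 1 ^ 2 + b 2 ^ 2 := by
        simp only [hb, Matrix.cons_val]
        have := sin_sq_add_cos_sq θ
        linear_combination (-σ^2) * this - cos θ ^ 2 * hc
      have i1 := integral_Y1 h b hbσ (f := fun z => (1 - tanh z ^ 2) ^ 2) (by fun_prop)
      have i2 := integral_Y2 h b hbσ (f := fun z => (1 - tanh z ^ 2) ^ 2) (by fun_prop)
      have eI : ∫ z, (1 - tanh (h + σ * z) ^ 2) ^ 2 ∂g1 = I := by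
        rw [hI]; congr 1; ext z; rw [one_sub_tanh_sq]; ring
      rw [eI] at i1 i2
      have bd : ∀ z : ℝ, |(1 - tanh z ^ 2) ^ 2| ≤ 1 := fun z => by
        rw [abs_pow]; exact pow_le_one₀ (abs_nonneg _) (abs_one_sub_tanh_sq_le z)
      have j1 : Integrable (fun x : Fin 3 → ℝ => (1 - tanh (h + b 0 * x 0 + b 1 * x 1 + b 2 * x 2) ^ 2) ^ 2) (gm (Fin 3)) :=
        bdd_integrable (by fun_prop) 1 fun x => bd _
      have j2 : Integrable (fun x : Fin 3 → ℝ => (1 - tanh (h + b 0 * x 0 + b 1 * x 1 - b 2 * x 2) ^ 2) ^ 2) (gm (Fin 3)) :=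
        bdd_integrable (by fun_prop) 1 fun x => bd _
      have j3 : Integrable (fun x : Fin 3 → ℝ => (1 - tanh (h + b 0 * x 0 + b 1 * x 1 + b 2 * x 2) ^ 2) * (1 - tanh (h + b 0 * x 0 + b 1 * x 1 - b 2 * x 2) ^ 2)) (gm (Fin 3)) :=
        bdd_integrable (by fun_prop) 1 fun x => by
          rw [abs_mul]; exact mul_le_one₀ (abs_one_sub_tanh_sq_le _) (abs_nonneg _) (abs_one_sub_tanh_sq_le _)
      have := integral_mono (j3.const_mul 2) (iadd j1 j2) fun x => by
        simp only
        nlinarith [sq_nonneg ((1 - tanh (h + b 0 * x 0 + b 1 * x 1 + b 2 * x 2) ^ 2) - (1 - tanh (h + b 0 * x 0 + b 1 * x 1 - b 2 * x 2) ^ 2))]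
      rw [integral_add j1 j2, i1, i2, integral_const_mul] at this
      simp only [hb, Matrix.cons_val] at this
      linarith
    have hp : 0 ≤ 4 * σ ^ 2 * (sin θ * cos θ) := by positivity
    nlinarith [mul_le_mul_of_nonneg_left hle hp]
  have key := mono (Set.mem_Icc.2 ⟨le_rfl, by positivity⟩) (Set.mem_Icc.2 ⟨hα0, hα1⟩) hα0
  simp only [cos_zero, sin_zero, zero_mul, one_mul] at key
  rw [← ea, ← h2] at key
  have e0 : Gam h ![c0, c1, 0] = ∫ z, tanh (h + σ * z) ^ 2 ∂g1 := by
    rw [← integral_Y1 h ![c0, c1, 0] (σ := σ) (by simp [← hc]) (f := fun z => tanh z ^ 2) (by fun_prop)]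
    unfold Gam; congr 1; ext x; simp [sq]
  rw [e0] at key
  simp only [ne_eq, OfNat.ofNat_ne_zero, not_false_eq_true, zero_pow, mul_zero, zero_mul, add_zero] at key
  linarith

lemma Gam_zero (h : ℝ) (a : Fin 3 → ℝ) {σ : ℝ} (ha : a 2 = 0) (hσ : σ ^ 2 = a 0 ^ 2 + a 1 ^ 2 + a 2 ^ 2) :
    Gam h a = ∫ z, tanh (h + σ * z) ^ 2 ∂g1 := by
  have mt := meas_tanh
  rw [← integral_Y1 h a hσ (f := fun z => tanh z ^ 2) (by fun_prop)]
  unfold Gam; congr 1; ext x; rw [ha]; simp [sq]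

lemma gap_S {β h q : ℝ} (hq : isFixedq β h q) {t u : ℝ} (ht : sin t ^ 2 * β ^ 2 ≤ 1 / 2) : Gap β h q (1 / 4) 1 t u := by
  obtain ⟨hq0, hq1, hqe⟩ := hq
  refine ⟨q, 0, 0, 1, 1, u - q, hq0.le, le_rfl, by ring, le_rfl, by norm_num, by norm_num, one_pos, le_rfl, by simp, by simp, ?_⟩
  have hs := sA_sq (β := β) hq0.le le_rfl (add_zero q) t
  have h1 := fT_b0_le h (u - q) 1 (sA β q q 0 t 0) hs
  rw [Gam_zero h _ (by simp [sA]) hs] at h1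
  have h2 : ∫ z, tanh (h + β * √q * z) ^ 2 ∂g1 = q := hqe.symm
  rw [h2] at h1
  unfold gapE f1
  rw [sqrt_zero, mul_zero]
  nlinarith [mul_le_mul_of_nonneg_right ht (sq_nonneg (u - q))]

lemma gap_M {β h q : ℝ} (hβ : 0 < β) (hq : isFixedq β h q) {t u : ℝ} (ht : 0 ≤ sin t) {κ : ℝ} (hκ : κ = β ^ 2 * ∫ z, (cosh (h + β * √q * z))⁻¹ ^ 4 ∂g1)
    (hκ1 : κ < 1) (hu : |u| ≤ q) : Gap β h q ((1 - κ) ^ 2 / 2) 1 t u := by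
  obtain ⟨hq0, hq1, hqe⟩ := hq
  obtain ⟨hu1, hu2⟩ := abs_le.1 hu
  have hκ0 : 0 ≤ κ := by rw [hκ]; exact mul_nonneg (sq_nonneg _) (integral_nonneg fun z => by positivity)
  have hA : 0 ≤ (q + u) / 2 := by linarith
  have hA' : 0 ≤ (q - u) / 2 := by linarith
  refine ⟨(q + u) / 2, (q - u) / 2, 0, 1, 1, -((1 - κ) * (q - u)), hA, hA', by ring, le_rfl, by norm_num, by norm_num, one_pos, le_rfl, ?_, ?_, ?_⟩
  · rw [abs_neg, abs_mul, abs_of_nonneg (by linarith : (0:ℝ) ≤ 1 - κ), abs_sub_comm q u]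
    exact mul_le_mul_of_nonneg_right (by linarith) (abs_nonneg _)
  · have : u - ((q + u) / 2 - (q - u) / 2 + 1 * 0) = 0 := by ring
    rw [this]; simp
  · have hs := sA_sq (β := β) hA hA' (by ring : (q + u) / 2 + (q - u) / 2 = q) t
    have h1 := fT_b0_le h (-((1 - κ) * (q - u))) 1 (sA β q ((q + u) / 2) ((q - u) / 2) t 0) hs
    have e2 : sA β q ((q + u) / 2) ((q - u) / 2) t 0 2 = sin t * β * √((q - u) / 2) := by simp [sA]
    have h3 := Gam_lb (h := h) (σ := β * √q) (by positivity) (sA β q ((q + u) / 2) ((q - u) / 2) t 0) (by rw [e2]; positivity) hs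
    have h2 : ∫ z, tanh (h + β * √q * z) ^ 2 ∂g1 = q := hqe.symm
    rw [h2, e2, mul_pow, mul_pow, sq_sqrt hA'] at h3
    set I := ∫ z, (cosh (h + β * √q * z))⁻¹ ^ 4 ∂g1
    have hst : sin t ^ 2 ≤ 1 := sin_sq_le_one t
    have h4 : (1 - κ) * (q - u) ≤ Gam h (sA β q ((q + u) / 2) ((q - u) / 2) t 0) - u := by
      have : sin t ^ 2 * (κ * (q - u)) ≤ 1 * (κ * (q - u)) := mul_le_mul_of_nonneg_right hst (mul_nonneg hκ0 (by linarith))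
      rw [hκ] at this ⊢
      nlinarith
    have h5 := mul_le_mul_of_nonneg_left h4 (mul_nonneg (by linarith : (0:ℝ) ≤ 1 - κ) (by linarith : (0:ℝ) ≤ q - u))
    unfold gapE f1
    rw [sqrt_zero, mul_zero]
    nlinarith

lemma integral_four_exp (A B D F c d : ℝ) :
    Integrable (fun y : ℝ => A * exp (c * y) + B * exp (-c * y) + D * exp (d * y) + F * exp (-d * y)) g1 ∧
    ∫ y, A * exp (c * y) + B * exp (-c * y) + D * exp (d * y) + F * exp (-d * y) ∂g1 = (A + B) * exp (c ^ 2 / 2) + (D + F) * exp (d ^ 2 / 2) := by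
  have i1 := (integrable_exp_mul_g1 c).const_mul A
  have i2 := (integrable_exp_mul_g1 (-c)).const_mul B
  have i3 := (integrable_exp_mul_g1 d).const_mul D
  have i4 := (integrable_exp_mul_g1 (-d)).const_mul F
  refine ⟨iadd (iadd (iadd i1 i2) i3) i4, ?_⟩
  rw [integral_add (iadd (iadd i1 i2) i3) i4, integral_add (iadd i1 i2) i3, integral_add i1 i2]
  simp only [integral_const_mul, integral_exp_mul_g1, neg_sq]
  ring

lemma exp_bounds {x : ℝ} (h0 : 0 ≤ x) (h1 : x ≤ 1) : 1 + x ≤ exp x ∧ exp x ≤ 1 + x + x ^ 2 := by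
  have := Real.abs_exp_sub_one_sub_id_le (x := x) (by rwa [abs_of_nonneg h0])
  have h2 := (abs_le.1 this).2
  exact ⟨by linarith [add_one_le_exp x], by linarith⟩

/-- normalised ratio -/
def rr (t b y : ℝ) : ℝ := cosh (b * y) + t * sinh (b * y)

lemma rr_eq (t b y : ℝ) : rr t b y = (1 + t) / 2 * exp (b * y) + (1 - t) / 2 * exp (-b * y) := by
  rw [rr, cosh_eq, sinh_eq, neg_mul]; ring

lemma rr_int1 (t b : ℝ) : Integrable (rr t b) g1 ∧ ∫ y, rr t b y ∂g1 = exp (b ^ 2 / 2) := by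
  have e : rr t b = fun y => (1 + t) / 2 * exp (b * y) + (1 - t) / 2 * exp (-b * y) + 0 * exp (0 * y) + 0 * exp (-0 * y) := by
    ext y; rw [rr_eq]; ring
  obtain ⟨h1, h2⟩ := integral_four_exp ((1 + t) / 2) ((1 - t) / 2) 0 0 b 0
  rw [e]; refine ⟨h1, h2.trans ?_⟩; ring

lemma rr_int2 (t b : ℝ) : Integrable (fun y => rr t b y ^ 2) g1 ∧ ∫ y, rr t b y ^ 2 ∂g1 = (1 + t ^ 2) / 2 * exp (2 * b ^ 2) + (1 - t ^ 2) / 2 := by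
  have e : (fun y => rr t b y ^ 2) = fun y => ((1 + t) / 2) ^ 2 * exp (2 * b * y) + ((1 - t) / 2) ^ 2 * exp (-(2 * b) * y) + (1 - t ^ 2) / 2 * exp (0 * y) + 0 * exp (-0 * y) := by
    ext y; rw [rr_eq]
    have e1 : exp (2 * b * y) = exp (b * y) ^ 2 := by rw [← exp_nat_mul]; congr 1; push_cast; ring
    have e2 : exp (-(2 * b) * y) = exp (-b * y) ^ 2 := by rw [← exp_nat_mul]; congr 1; push_cast; ring
    have e3 : exp (b * y) * exp (-b * y) = 1 := by rw [← exp_add]; ring_nf; exact exp_zero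
    rw [e1, e2, zero_mul, exp_zero]
    linear_combination ((1 - t ^ 2) / 2) * e3
  obtain ⟨h1, h2⟩ := integral_four_exp (((1 + t) / 2) ^ 2) (((1 - t) / 2) ^ 2) ((1 - t ^ 2) / 2) 0 (2 * b) 0
  rw [e]; refine ⟨h1, h2.trans ?_⟩
  have : (2 * b) ^ 2 / 2 = 2 * b ^ 2 := by ring
  rw [this]; norm_num; ring

lemma rr_int3 (t b : ℝ) : Integrable (fun y => rr t b y ^ 3) g1 ∧
    ∫ y, rr t b y ^ 3 ∂g1 = (1 + 3 * t ^ 2) / 4 * exp (9 * b ^ 2 / 2) + 3 * (1 - t ^ 2) / 4 * exp (b ^ 2 / 2) := by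
  have e : (fun y => rr t b y ^ 3) = fun y => ((1 + t) / 2) ^ 3 * exp (3 * b * y) + ((1 - t) / 2) ^ 3 * exp (-(3 * b) * y)
      + 3 * (1 - t ^ 2) * (1 + t) / 8 * exp (b * y) + 3 * (1 - t ^ 2) * (1 - t) / 8 * exp (-b * y) := by
    ext y; rw [rr_eq]
    have e1 : exp (3 * b * y) = exp (b * y) ^ 3 := by rw [← exp_nat_mul]; congr 1; push_cast; ring
    have e2 : exp (-(3 * b) * y) = exp (-b * y) ^ 3 := by rw [← exp_nat_mul]; congr 1; push_cast; ring
    have e3 : exp (b * y) * exp (-b * y) = 1 := by rw [← exp_add]; ring_nf; exact exp_zero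
    rw [e1, e2]
    linear_combination (3 * (1 - t ^ 2) * (1 + t) / 8 * exp (b * y) + 3 * (1 - t ^ 2) * (1 - t) / 8 * exp (-b * y)) * e3
  obtain ⟨h1, h2⟩ := integral_four_exp (((1 + t) / 2) ^ 3) (((1 - t) / 2) ^ 3) (3 * (1 - t ^ 2) * (1 + t) / 8) (3 * (1 - t ^ 2) * (1 - t) / 8) (3 * b) b
  rw [e]; refine ⟨h1, h2.trans ?_⟩
  have : (3 * b) ^ 2 / 2 = 9 * b ^ 2 / 2 := by ring
  rw [this]; ring

lemma rr_pos {t : ℝ} (ht : |t| ≤ 1) (b y : ℝ) : 0 < rr t b y := coshsinh_pos ht _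

lemma rr_inv_le {t : ℝ} (ht : |t| ≤ 1) (b y : ℝ) : (rr t b y)⁻¹ ≤ rr (-t) b y := by
  have h1 := rr_pos ht b y
  rw [inv_le_iff_one_le_mul₀ h1, rr, rr]
  have h2 := cosh_sq (b * y)
  have h3 : t ^ 2 ≤ 1 := sq_le_one_iff_abs_le_one _ |>.2 ht
  nlinarith [mul_nonneg (sub_nonneg.2 h3) (sq_nonneg (sinh (b * y)))]

set_option maxHeartbeats 1000000 in
/-- key two-moment comparison -/
lemma rr_diff {t b M : ℝ} (ht : |t| ≤ 1) (hb : b ^ 2 ≤ 1 / 9) (hM1 : 1 ≤ M) (hM2 : M ≤ 2)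
    (i1 : Integrable (fun y => rr t b y ^ M) g1) (i2 : Integrable (fun y => rr t b y ^ (M - 2)) g1) :
    1 ≤ ∫ y, rr t b y ^ M ∂g1 ∧
    ∫ y, rr t b y ^ M ∂g1 - ∫ y, rr t b y ^ (M - 2) ∂g1 ≤ b ^ 2 * (1 - t ^ 2) + 100 * b ^ 2 * ((M - 1) + b ^ 2) := by
  have hp := rr_pos ht b
  have ht2 : t ^ 2 ≤ 1 := sq_le_one_iff_abs_le_one _ |>.2 ht
  have ht0 := sq_nonneg t
  obtain ⟨j1, k1⟩ := rr_int1 t b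
  obtain ⟨j2, k2⟩ := rr_int2 t b
  obtain ⟨j3, k3⟩ := rr_int3 t b
  obtain ⟨l2, m2⟩ := rr_int2 (-t) b
  have hb0 := sq_nonneg b
  obtain ⟨x1, x1'⟩ := exp_bounds (x := b ^ 2 / 2) (by positivity) (by linarith)
  obtain ⟨x2, x2'⟩ := exp_bounds (x := 2 * b ^ 2) (by positivity) (by linarith)
  obtain ⟨x3, x3'⟩ := exp_bounds (x := 9 * b ^ 2 / 2) (by positivity) (by linarith)
  constructor
  · have : ∫ y, 1 + M * (rr t b y - 1) ∂g1 ≤ ∫ y, rr t b y ^ M ∂g1 := by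
      refine integral_mono ((integrable_const _).add ((j1.sub (integrable_const _)).const_mul M)) i1 fun y => ?_
      have := one_add_mul_self_le_rpow_one_add (s := rr t b y - 1) (by linarith [hp y]) hM1
      simpa using this
    have j0 : Integrable (fun y => rr t b y - 1) g1 := j1.sub (integrable_const _)
    rw [integral_add (integrable_const _) (j0.const_mul M), integral_const_mul, integral_sub j1 (integrable_const _), k1] at this
    simp at this
    nlinarith
  · have hA : ∫ y, rr t b y ^ M ∂g1 ≤ (2 - M) * exp (b ^ 2 / 2) + (M - 1) * exp (2 * b ^ 2) := by
      have : ∫ y, rr t b y ^ M ∂g1 ≤ ∫ y, (2 - M) * rr t b y + (M - 1) * rr t b y ^ 2 ∂g1 := by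
        refine integral_mono i1 ((j1.const_mul _).add (j2.const_mul _)) fun y => ?_
        have := geom_mean_le_arith_mean2_weighted (w₁ := 2 - M) (w₂ := M - 1) (p₁ := rr t b y) (p₂ := rr t b y ^ 2) (by linarith) (by linarith) (hp y).le (sq_nonneg _) (by ring)
        refine le_trans (le_of_eq ?_) this
        simp only
        rw [← rpow_natCast, ← rpow_mul (hp y).le, ← rpow_add (hp y)]
        congr 1; push_cast; ring
      rw [integral_add (j1.const_mul _) (j2.const_mul _), integral_const_mul, integral_const_mul, k1, k2] at this
      have h4 : (1 + t ^ 2) / 2 * exp (2 * b ^ 2) + (1 - t ^ 2) / 2 ≤ exp (2 * b ^ 2) := by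
        nlinarith
      nlinarith
    have i5 : Integrable (fun y => 4 - 6 * rr t b y + 4 * rr t b y ^ 2 - rr t b y ^ 3) g1 :=
      (((integrable_const _).sub (j1.const_mul _)).add (j2.const_mul _)).sub j3
    have i6 : Integrable (fun y => (2 - rr t b y) - rr (-t) b y ^ 2) g1 := ((integrable_const _).sub j1).sub l2
    have hB : ∫ y, (4 - 6 * rr t b y + 4 * rr t b y ^ 2 - rr t b y ^ 3) + (M - 1) * ((2 - rr t b y) - rr (-t) b y ^ 2) ∂g1 ≤ ∫ y, rr t b y ^ (M - 2) ∂g1 := by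
      refine integral_mono (iadd i5 (i6.const_mul _)) i2 fun y => ?_
      set r := rr t b y with hr
      have hr0 : 0 < r := hp y
      have a1 : 4 - 6 * r + 4 * r ^ 2 - r ^ 3 ≤ r⁻¹ := by
        rw [← sub_nonneg]
        have : r⁻¹ - (4 - 6 * r + 4 * r ^ 2 - r ^ 3) = (r - 1) ^ 4 / r := by field_simp; ring
        rw [this]; positivity
      have a2 : 2 - r ≤ r⁻¹ := by
        rw [← sub_nonneg]
        have : r⁻¹ - (2 - r) = (r - 1) ^ 2 / r := by field_simp; ring
        rw [this]; positivity
      have a3 : r⁻¹ ^ 2 ≤ rr (-t) b y ^ 2 := pow_le_pow_left₀ (by positivity) (rr_inv_le ht b y) 2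
      have a4 : r⁻¹ + (M - 1) * (r⁻¹ - r⁻¹ ^ 2) ≤ r ^ (M - 2) := by
        have e1 : r ^ (M - 2) = r⁻¹ * exp (log r * (M - 1)) := by
          rw [← rpow_def_of_pos hr0, ← rpow_neg_one, ← rpow_add hr0]; congr 1; ring
        have e2 := add_one_le_exp (log r * (M - 1))
        have e3 := one_sub_inv_le_log_of_pos hr0
        have e4 : (1 - r⁻¹) * (M - 1) ≤ log r * (M - 1) := mul_le_mul_of_nonneg_right e3 (by linarith)
        have e5 : r⁻¹ * (1 + (1 - r⁻¹) * (M - 1)) ≤ r⁻¹ * exp (log r * (M - 1)) := mul_le_mul_of_nonneg_left (by linarith) (by positivity)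
        rw [e1]; linarith
      have a5 := mul_le_mul_of_nonneg_left (by linarith : 2 - r - rr (-t) b y ^ 2 ≤ r⁻¹ - r⁻¹ ^ 2) (by linarith : 0 ≤ M - 1)
      simp only
      linarith
    have i7 : Integrable (fun y => 4 - 6 * rr t b y) g1 := (integrable_const _).sub (j1.const_mul _)
    have i8 : Integrable (fun y => 2 - rr t b y) g1 := (integrable_const _).sub j1
    rw [integral_add i5 (i6.const_mul _), integral_const_mul, integral_sub (iadd i7 (j2.const_mul _)) j3, integral_add i7 (j2.const_mul _),
      integral_sub (integrable_const _) (j1.const_mul _), integral_sub i8 l2, integral_sub (integrable_const _) j1, integral_const_mul, integral_const_mul, k1, k2, k3, m2] at hB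
    simp only [integral_const, probReal_univ, one_smul, neg_sq] at hB
    set E1 := exp (b ^ 2 / 2)
    set E2 := exp (2 * b ^ 2)
    set E3 := exp (9 * b ^ 2 / 2)
    set B := b ^ 2
    have c1 : (1 + t ^ 2) / 2 * E2 + (1 - t ^ 2) / 2 ≤ E2 := by nlinarith
    have c2 : (1 + t ^ 2) / 2 * (1 + 2 * B) ≤ (1 + t ^ 2) / 2 * E2 := mul_le_mul_of_nonneg_left x2 (by linarith)
    have c3 : (1 + 3 * t ^ 2) / 4 * E3 ≤ (1 + 3 * t ^ 2) / 4 * (1 + 9 * B / 2 + (9 * B / 2) ^ 2) := mul_le_mul_of_nonneg_left x3' (by linarith)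
    have c4 : 3 * (1 - t ^ 2) / 4 * E1 ≤ 3 * (1 - t ^ 2) / 4 * (1 + B / 2 + (B / 2) ^ 2) := mul_le_mul_of_nonneg_left x1' (by linarith)
    have hBB : B ^ 2 ≤ B := by nlinarith
    have hM0 : 0 ≤ M - 1 := by linarith
    have c5 : (M - 1) * (2 - E1 - ((1 + t ^ 2) / 2 * E2 + (1 - t ^ 2) / 2)) ≥ (M - 1) * (-(10 * B)) := by
      refine mul_le_mul_of_nonneg_left ?_ hM0
      linarith
    have c6 : (2 - M) * E1 + (M - 1) * E2 ≤ E1 + (M - 1) * (10 * B) := by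
      have : (M - 1) * (E2 - E1) ≤ (M - 1) * (10 * B) := mul_le_mul_of_nonneg_left (by linarith) hM0
      linarith
    have ht4 : t ^ 2 * B ^ 2 ≤ B ^ 2 := by nlinarith [sq_nonneg B]
    have ht5 : 0 ≤ t ^ 2 * B ^ 2 := by positivity
    have hMB := mul_nonneg hM0 hb0
    have hBp := sq_nonneg B
    linarith

lemma Zf_bool (X : ℝ) : Zf (fun s : Bool => X * spin s) = 2 * cosh X := by
  rw [Zf, Fintype.sum_bool, cosh_eq]; simp [spin]; ring

lemma ga_bool (X : ℝ) : ga (fun s : Bool => X * spin s) spin = tanh X := by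
  rw [ga, Zf_bool, tanh_eq_sinh_div_cosh, Fintype.sum_bool, sinh_eq]
  simp [spin]; field_simp; ring

lemma qf_bool (M X : ℝ) : qf M (fun s : Bool => X * spin s) spin spin = 1 + (M - 1) * tanh X ^ 2 := by
  have : (fun s : Bool => spin s * spin s) = fun _ => (1 : ℝ) := by ext s; cases s <;> simp [spin]
  rw [qf, this, ga_const, ga_bool]; ring

lemma Hy_bool (X b : ℝ) (y : Unit → ℝ) : Hy (fun s : Bool => X * spin s) (fun (_ : Unit) s => b * spin s) y = fun s => (X + b * y ()) * spin s := by
  ext s; simp [Hy]; ring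

lemma cosh_rr (X b y : ℝ) : cosh (X + b * y) = cosh X * rr (tanh X) b y := by
  rw [rr, cosh_add, tanh_eq_sinh_div_cosh]
  have := (cosh_pos X).ne'
  field_simp

lemma int_rr_pow (X b p : ℝ) : Integrable (fun y => rr (tanh X) b y ^ p) g1 := by
  have hc := cosh_pos X
  have h1 := int_Z p (fun s : Bool => X * spin s) (fun (_ : Unit) s => b * spin s)
  simp_rw [Hy_bool, Zf_bool] at h1
  have h2 := (measurePreserving_eval (fun _ : Unit => gaussianReal 0 1) ()).integrable_comp (g := fun y => (2 * cosh (X + b * y)) ^ p)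
    (Measurable.aestronglyMeasurable (by fun_prop))
  have h3 := (h2.1 h1).const_mul ((2 * cosh X) ^ p)⁻¹
  refine h3.congr (Eventually.of_forall fun y => ?_)
  simp only
  have h4 := rr_pos (abs_tanh_le X) b y
  rw [cosh_rr, ← mul_assoc, mul_rpow (by positivity) h4.le, inv_mul_cancel_left₀]
  positivity

lemma Yi_bool (M X b : ℝ) : Yi M (fun s : Bool => X * spin s) (fun (_ : Unit) s => b * spin s) = ∫ y, (2 * cosh (X + b * y)) ^ M ∂g1 := by
  unfold Yi
  simp_rw [Hy_bool, Zf_bool]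
  exact integral_eval (κ := Unit) () (f := fun y => (2 * cosh (X + b * y)) ^ M) (by fun_prop)

lemma Tl_bool_le {M X b : ℝ} (hM1 : 1 ≤ M) (hM2 : M ≤ 2) (hb : b ^ 2 ≤ 1 / 9) :
    Tl M (fun s : Bool => X * spin s) (fun (_ : Unit) s => b * spin s)
      (fun y => qf M (Hy (fun s : Bool => X * spin s) (fun (_ : Unit) s => b * spin s) y) spin spin)
    ≤ 1 + (M - 1) * (tanh X ^ 2 + b ^ 2 * (1 - tanh X ^ 2) ^ 2 + 100 * b ^ 2 * ((M - 1) + b ^ 2)) := by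
  have mt := meas_tanh
  have hC := cosh_pos X
  set t := tanh X with ht
  have i1 := int_rr_pow X b M
  have i2 := int_rr_pow X b (M - 2)
  rw [← ht] at i1 i2
  obtain ⟨hA1, hAB⟩ := rr_diff (abs_tanh_le X) hb hM1 hM2 i1 i2
  rw [← ht] at hA1 hAB
  set A := ∫ y, rr t b y ^ M ∂g1 with hA
  set B := ∫ y, rr t b y ^ (M - 2) ∂g1 with hB
  have hr := fun y => rr_pos (abs_tanh_le X) b y
  rw [← ht] at hr
  have eZ : ∀ y, (2 * cosh (X + b * y)) ^ M = (2 * cosh X) ^ M * rr t b y ^ M := fun y => by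
    rw [cosh_rr, ← mul_assoc, mul_rpow (by positivity) (hr y).le]
  have eY : Yi M (fun s : Bool => X * spin s) (fun (_ : Unit) s => b * spin s) = (2 * cosh X) ^ M * A := by
    rw [Yi_bool]; simp_rw [eZ]; rw [integral_const_mul]
  have eT : ∀ y, tanh (X + b * y) ^ 2 = 1 - (1 - t ^ 2) * (rr t b y ^ 2)⁻¹ := fun y => by
    have h1 := one_sub_tanh_sq (X + b * y)
    have h2 := one_sub_tanh_sq X
    rw [cosh_rr] at h1
    rw [ht, h2, ← ht]
    have h3 : (cosh X * rr (tanh X) b y)⁻¹ ^ 2 = (cosh X)⁻¹ ^ 2 * (rr t b y ^ 2)⁻¹ := by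
      rw [← ht, mul_inv, mul_pow, inv_pow (rr t b y)]
    linarith
  have hCM : 0 < (2 * cosh X) ^ M := by positivity
  have e3 : ∫ y : Unit → ℝ, Zf (Hy (fun s : Bool => X * spin s) (fun (_ : Unit) s => b * spin s) y) ^ M *
      qf M (Hy (fun s : Bool => X * spin s) (fun (_ : Unit) s => b * spin s) y) spin spin ∂(gm Unit) = (2 * cosh X) ^ M * (M * A - (M - 1) * (1 - t ^ 2) * B) := by
    simp_rw [Hy_bool, Zf_bool, qf_bool]
    rw [integral_eval (κ := Unit) () (f := fun y => (2 * cosh (X + b * y)) ^ M * (1 + (M - 1) * tanh (X + b * y) ^ 2)) (by fun_prop)]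
    have : ∀ y, (2 * cosh (X + b * y)) ^ M * (1 + (M - 1) * tanh (X + b * y) ^ 2) = (2 * cosh X) ^ M * (M * rr t b y ^ M - (M - 1) * (1 - t ^ 2) * rr t b y ^ (M - 2)) := by
      intro y
      rw [eZ, eT, rpow_sub (hr y), show (2:ℝ) = ((2:ℕ):ℝ) by norm_num, rpow_natCast]
      push_cast
      have := (hr y).ne'
      field_simp; ring
    simp_rw [this]
    rw [integral_const_mul, integral_sub (i1.const_mul _) (i2.const_mul _), integral_const_mul, integral_const_mul]
  rw [Tl, e3, eY, mul_div_mul_left _ _ hCM.ne', div_le_iff₀ (by linarith)]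
  have ht2 := tanh_sq_le X
  rw [← ht] at ht2
  have h5 := mul_le_mul_of_nonneg_left hAB (mul_nonneg (by linarith : 0 ≤ M - 1) (by linarith : 0 ≤ 1 - t ^ 2))
  set K := 100 * b ^ 2 * ((M - 1) + b ^ 2) with hK
  have hK0 : 0 ≤ K := by have : 0 ≤ M - 1 := by linarith
                         positivity
  have h6 : (1 - t ^ 2) * (b ^ 2 * (1 - t ^ 2) + K) ≤ b ^ 2 * (1 - t ^ 2) ^ 2 + K := by nlinarith [sq_nonneg t, mul_nonneg (sq_nonneg t) hK0]
  have h7 : 0 ≤ b ^ 2 * (1 - t ^ 2) ^ 2 + K := by positivity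
  have h8 : (b ^ 2 * (1 - t ^ 2) ^ 2 + K) * 1 ≤ (b ^ 2 * (1 - t ^ 2) ^ 2 + K) * A := mul_le_mul_of_nonneg_left hA1 h7
  have h9 : 0 ≤ M - 1 := by linarith
  have h10 : (1 - t ^ 2) * (A - B) ≤ (b ^ 2 * (1 - t ^ 2) ^ 2 + K) * A := by
    have := mul_le_mul_of_nonneg_left hAB (by linarith : 0 ≤ 1 - t ^ 2)
    linarith
  have h11 := mul_le_mul_of_nonneg_left h10 h9
  linarith

/-- one-replica two-level functional -/
def PM (h σ M b : ℝ) : ℝ :=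
  FF M (fun s : Bool => h * spin s) (fun (_ : Unit) s => σ * spin s) (fun (_ : Unit) s => b * spin s)

lemma PM_eq (h σ b : ℝ) {M : ℝ} : PM h σ M b = ∫ z, 1 / M * log (∫ y, (2 * cosh (h + σ * z + b * y)) ^ M ∂g1) ∂g1 := by
  unfold PM FF
  simp_rw [Hy_bool, Yi_bool]
  refine integral_eval (κ := Unit) () (f := fun z => 1 / M * log (∫ y, (2 * cosh (h + σ * z + b * y)) ^ M ∂g1)) ?_
  have : StronglyMeasurable fun z : ℝ => ∫ y, (2 * cosh (h + σ * z + b * y)) ^ M ∂g1 := by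
    refine StronglyMeasurable.integral_prod_right' (f := fun p : ℝ × ℝ => (2 * cosh (h + σ * p.1 + b * p.2)) ^ M) ?_
    exact Measurable.stronglyMeasurable (by fun_prop)
  exact this.measurable.log.const_mul _

lemma ampc (σ : ℝ) : AmpPath (fun (_ : Unit) (_ : ℝ) => σ) (fun _ _ => 0) |σ| :=
  ⟨abs_nonneg _, fun _ θ => ⟨hasDerivAt_const _ _, le_rfl, by simp⟩⟩

lemma amps (b : ℝ) : AmpPath (fun (_ : Unit) (θ : ℝ) => sin θ * b) (fun _ θ => cos θ * b) |b| :=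
  ⟨abs_nonneg _, fun _ θ => ⟨(hasDerivAt_sin θ).mul_const b, abs_sin_mul_le _ _, abs_cos_mul_le _ _⟩⟩

lemma PM_deriv (h σ b1 : ℝ) {M : ℝ} (hM1 : 1 ≤ M) (hM2 : M ≤ 2) (θ : ℝ) :
    ∃ D, HasDerivAt (fun θ => PM h σ M (sin θ * b1)) D θ ∧ (0 ≤ sin θ * cos θ → (sin θ * b1) ^ 2 ≤ 1 / 9 →
      D ≤ b1 ^ 2 * (sin θ * cos θ) * (1 + (M - 1) * (∫ z, tanh (h + σ * z) ^ 2 ∂g1 + (sin θ * b1) ^ 2 * ∫ z, (cosh (h + σ * z))⁻¹ ^ 4 ∂g1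
        + 100 * (sin θ * b1) ^ 2 * ((M - 1) + (sin θ * b1) ^ 2)))) := by
  have mt := meas_tanh
  have hM0 : 0 < M := by linarith
  have hd := nested_deriv hM0 (fun s : Bool => h * spin s) (ampc σ) (fun _ => spin) (amps b1) (fun _ => spin) θ
  refine ⟨_, hd, fun hsc hb => ?_⟩
  have eI : ∫ z, (cosh (h + σ * z))⁻¹ ^ 4 ∂g1 = ∫ z, (1 - tanh (h + σ * z) ^ 2) ^ 2 ∂g1 := by
    congr 1; ext z; rw [one_sub_tanh_sq]; ring
  rw [eI]
  rw [← integral_eval (κ := Unit) () (f := fun z => tanh (h + σ * z) ^ 2) (by fun_prop),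
    ← integral_eval (κ := Unit) () (f := fun z => (1 - tanh (h + σ * z) ^ 2) ^ 2) (by fun_prop)]
  set b := sin θ * b1 with hbd
  have bd : ∀ z : ℝ, |(1 - tanh z ^ 2) ^ 2| ≤ 1 := fun z => by
    rw [abs_pow]; exact pow_le_one₀ (abs_nonneg _) (abs_one_sub_tanh_sq_le z)
  have j1 : Integrable (fun x : Unit → ℝ => tanh (h + σ * x ()) ^ 2) (gm Unit) := bdd_integrable (by fun_prop) 1 fun x => by
    rw [abs_of_nonneg (sq_nonneg _)]; exact tanh_sq_le _
  have j2 : Integrable (fun x : Unit → ℝ => (1 - tanh (h + σ * x ()) ^ 2) ^ 2) (gm Unit) := bdd_integrable (by fun_prop) 1 fun x => bd _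
  have j3 : Integrable (fun x : Unit → ℝ => tanh (h + σ * x ()) ^ 2 + b ^ 2 * (1 - tanh (h + σ * x ()) ^ 2) ^ 2) (gm Unit) := iadd j1 (j2.const_mul _)
  have j4 : Integrable (fun x : Unit → ℝ => tanh (h + σ * x ()) ^ 2 + b ^ 2 * (1 - tanh (h + σ * x ()) ^ 2) ^ 2 + 100 * b ^ 2 * ((M - 1) + b ^ 2)) (gm Unit) := iadd j3 (integrable_const _)
  have e : b1 ^ 2 * (sin θ * cos θ) * (1 + (M - 1) * (∫ x : Unit → ℝ, tanh (h + σ * x ()) ^ 2 ∂(gm Unit) + b ^ 2 * ∫ x : Unit → ℝ, (1 - tanh (h + σ * x ()) ^ 2) ^ 2 ∂(gm Unit)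
        + 100 * b ^ 2 * ((M - 1) + b ^ 2))) = ∫ x : Unit → ℝ, b1 ^ 2 * (sin θ * cos θ) * (1 + (M - 1) * (tanh (h + σ * x ()) ^ 2 + b ^ 2 * (1 - tanh (h + σ * x ()) ^ 2) ^ 2 + 100 * b ^ 2 * ((M - 1) + b ^ 2))) ∂(gm Unit) := by
    rw [integral_const_mul, integral_add (integrable_const _) (j4.const_mul _), integral_const_mul, integral_add j3 (integrable_const _), integral_add j1 (j2.const_mul _), integral_const_mul]
    simp
  rw [e]
  refine integral_mono (RR_integrable _ _ _ _ _ _ _ _ θ) ((iadd (integrable_const _) (j4.const_mul _)).const_mul _) fun x => ?_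
  have e1 : Hy (fun s : Bool => h * spin s) (AM (fun (_ : Unit) (_ : ℝ) => σ) (fun _ => spin) θ) x = fun s => (h + σ * x ()) * spin s := Hy_bool h σ x
  simp only [RR, e1]
  simp only [mul_zero, zero_mul, Finset.univ_unique, Finset.sum_const_zero, zero_add, Finset.sum_singleton]
  have h2 := Tl_bool_le (X := h + σ * x ()) hM1 hM2 hb
  have h3 := mul_le_mul_of_nonneg_left h2 (mul_nonneg (sq_nonneg b1) hsc)
  refine le_trans (le_of_eq ?_) h3
  have e4 : sin θ * b1 * (cos θ * b1) = b1 ^ 2 * (sin θ * cos θ) := by ring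
  rw [e4]
  rfl

lemma meas_logint (b M : ℝ) : Measurable fun z : ℝ => 1 / M * log (∫ y, (2 * cosh (z + b * y)) ^ M ∂g1) := by
  have : StronglyMeasurable fun z : ℝ => ∫ y, (2 * cosh (z + b * y)) ^ M ∂g1 := by
    refine StronglyMeasurable.integral_prod_right' (f := fun p : ℝ × ℝ => (2 * cosh (p.1 + b * p.2)) ^ M) ?_
    exact Measurable.stronglyMeasurable (by fun_prop)
  exact this.measurable.log.const_mul _

lemma int_logint (h σ b : ℝ) {M : ℝ} (hM : 0 < M) : Integrable (fun z : ℝ => 1 / M * log (∫ y, (2 * cosh (h + σ * z + b * y)) ^ M ∂g1)) g1 := by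
  have h1 := FF_integrable hM (fun s : Bool => h * spin s) (fun (_ : Unit) s => σ * spin s) (fun (_ : Unit) s => b * spin s)
  simp_rw [Hy_bool, Yi_bool] at h1
  have m1 : Measurable fun z : ℝ => 1 / M * log (∫ y, (2 * cosh (h + σ * z + b * y)) ^ M ∂g1) :=
    (meas_logint b M).comp (by fun_prop : Measurable fun z : ℝ => h + σ * z)
  have h2 := (measurePreserving_eval (fun _ : Unit => gaussianReal 0 1) ()).integrable_comp (g := fun z : ℝ => 1 / M * log (∫ y, (2 * cosh (h + σ * z + b * y)) ^ M ∂g1))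
    m1.aestronglyMeasurable
  exact h2.1 h1

lemma Phi_eq (β h q p : ℝ) {M : ℝ} (hM : 0 < M) :
    Phi β h q M p = β ^ 2 / 4 * (1 - p) ^ 2 - β ^ 2 / 4 * M * (p ^ 2 - q ^ 2) + PM h (β * √q) M (β * √(p - q)) := by
  have e : ∀ z, log (∫ y, (2 * cosh (h + β * √q * z + β * √(p - q) * y)) ^ M ∂g1) = M * log 2 + log (∫ y, cosh (h + β * √q * z + β * √(p - q) * y) ^ M ∂g1) := by
    intro z
    have h1 : ∀ y, (2 * cosh (h + β * √q * z + β * √(p - q) * y)) ^ M = 2 ^ M * cosh (h + β * √q * z + β * √(p - q) * y) ^ M := fun y =>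
      mul_rpow (by norm_num) (cosh_pos _).le
    have hp : 0 < ∫ y, (2 * cosh (h + β * √q * z + β * √(p - q) * y)) ^ M ∂g1 := by
      rw [← Yi_bool]; exact Yi_pos _ _ _
    simp_rw [h1] at hp ⊢
    rw [integral_const_mul] at hp ⊢
    have hp2 : 0 < ∫ y, cosh (h + β * √q * z + β * √(p - q) * y) ^ M ∂g1 := by
      by_contra hc
      have : (0:ℝ) < 2 ^ M := by positivity
      nlinarith
    rw [log_mul (by positivity) hp2.ne', log_rpow (by norm_num)]
  have hi := int_logint h (β * √q) (β * √(p - q)) hM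
  have e2 : ∫ z, log (∫ y, cosh (h + β * √q * z + β * √(p - q) * y) ^ M ∂g1) ∂g1 = M * (PM h (β * √q) M (β * √(p - q)) - log 2) := by
    rw [PM_eq]
    have : ∀ z, log (∫ y, cosh (h + β * √q * z + β * √(p - q) * y) ^ M ∂g1) = M * (1 / M * log (∫ y, (2 * cosh (h + β * √q * z + β * √(p - q) * y)) ^ M ∂g1) - log 2) := by
      intro z; rw [e]; field_simp; ring
    simp_rw [this]
    rw [integral_const_mul, integral_sub hi (integrable_const _)]; simp
  rw [Phi, e2]; field_simp; ring

lemma PM_one (h σ b : ℝ) : PM h σ 1 b = ∫ z, log (2 * cosh (h + σ * z)) ∂g1 + b ^ 2 / 2 := by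
  rw [PM_eq]
  have : ∀ z, 1 / 1 * log (∫ y, (2 * cosh (h + σ * z + b * y)) ^ (1:ℝ) ∂g1) = log (2 * cosh (h + σ * z)) + b ^ 2 / 2 := by
    intro z
    simp_rw [rpow_one]
    have hc := cosh_pos (h + σ * z)
    generalize h + σ * z = X at hc ⊢
    simp_rw [cosh_rr, ← mul_assoc]
    rw [integral_const_mul, (rr_int1 _ _).2, log_mul (mul_pos two_pos hc).ne' (exp_pos _).ne', log_exp]; ring
  simp_rw [this]
  rw [integral_add (f1_integrable h σ) (integrable_const _)]; simp

/-- the functional along the angle path -/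
def JT (β h q M θ : ℝ) : ℝ := PM h (β * √q) M (sin θ * (β * √(1 - q))) - f1 β h q - β ^ 2 * (1 - q) * sin θ ^ 2 / 2
  - β ^ 2 / 4 * (M - 1) * ((q + (1 - q) * sin θ ^ 2) ^ 2 - q ^ 2)

lemma JT_zero (β h q : ℝ) {M : ℝ} (hM : 0 < M) : JT β h q M 0 = 0 := by
  unfold JT f1
  rw [PM_eq]
  have : ∀ z, 1 / M * log (∫ y, (2 * cosh (h + β * √q * z + sin 0 * (β * √(1 - q)) * y)) ^ M ∂g1) = log (2 * cosh (h + β * √q * z)) := by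
    intro z
    have := cosh_pos (h + β * √q * z)
    simp only [sin_zero, zero_mul, add_zero, integral_const, probReal_univ, one_smul]
    rw [log_rpow (by positivity)]; field_simp
  simp_rw [this]; simp

lemma JT_Phi {β q θ : ℝ} (h : ℝ) (hq1 : q < 1) (hs : 0 ≤ sin θ) {M : ℝ} (hM : 0 < M) :
    JT β h q M θ = Phi β h q M (q + (1 - q) * sin θ ^ 2) - Phi β h q 1 (q + (1 - q) * sin θ ^ 2) := by
  rw [Phi_eq _ _ _ _ hM, Phi_eq _ _ _ _ one_pos, PM_one]
  have e : β * √(q + (1 - q) * sin θ ^ 2 - q) = sin θ * (β * √(1 - q)) := by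
    rw [add_sub_cancel_left, sqrt_mul (by linarith), sqrt_sq hs]; ring
  have e2 : (sin θ * (β * √(1 - q))) ^ 2 = β ^ 2 * (1 - q) * sin θ ^ 2 := by
    rw [mul_pow, mul_pow, sq_sqrt (by linarith)]; ring
  rw [e, e2, JT, f1]; ring

lemma JT_neg {β h q θ : ℝ} (hq1 : q < 1) (hs : 0 < sin θ) (hAT : ATplus β h q) : ∃ M, 1 < M ∧ M ≤ 2 ∧ JT β h q M θ < 0 := by
  have h1 : sin θ ^ 2 ≤ 1 := sin_sq_le_one θ
  have h2 : 0 < sin θ ^ 2 := by positivity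
  set p := q + (1 - q) * sin θ ^ 2 with hp
  have hd := hAT p (by nlinarith) (by nlinarith)
  have hD : DifferentiableAt ℝ (fun m => Phi β h q m p) 1 := differentiableAt_of_deriv_ne_zero hd.ne
  have ht := (hasDerivAt_iff_tendsto_slope.1 hD.hasDerivAt).mono_left (nhdsWithin_mono 1 (fun x (hx : x ∈ Set.Ioi (1:ℝ)) => ne_of_gt hx))
  have ev := ht.eventually (gt_mem_nhds hd)
  have ev2 : ∀ᶠ M in nhdsWithin (1:ℝ) (Set.Ioi 1), M ∈ Set.Ioc (1:ℝ) 2 := Ioc_mem_nhdsGT (by norm_num)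
  obtain ⟨M, hM, hM1, hM2⟩ := (ev.and ev2).exists
  refine ⟨M, hM1, hM2, ?_⟩
  rw [JT_Phi h hq1 hs.le (by linarith), ← hp]
  rw [slope_def_field, div_lt_iff₀ (by linarith)] at hM
  linarith

lemma JT_deriv {β h q : ℝ} (hq : isFixedq β h q) {κ : ℝ} (hκ : κ = β ^ 2 * ∫ z, (cosh (h + β * √q * z))⁻¹ ^ 4 ∂g1)
    {M : ℝ} (hM1 : 1 ≤ M) (hM2 : M ≤ 2) (θ : ℝ) :
    ∃ D, HasDerivAt (JT β h q M) D θ ∧ (0 ≤ sin θ * cos θ → β ^ 2 * (1 - q) * sin θ ^ 2 ≤ 1 / 9 →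
      D ≤ β ^ 2 * (1 - q) * (sin θ * cos θ) * ((M - 1) * ((1 - q) * sin θ ^ 2) * (κ - 1 + 100 * β ^ 2 * ((M - 1) + β ^ 2 * (1 - q) * sin θ ^ 2)))) := by
  obtain ⟨hq0, hq1, hqe⟩ := hq
  have e2 : (sin θ * (β * √(1 - q))) ^ 2 = β ^ 2 * (1 - q) * sin θ ^ 2 := by
    rw [mul_pow, mul_pow, sq_sqrt (by linarith)]; ring
  have e3 : (β * √(1 - q)) ^ 2 = β ^ 2 * (1 - q) := by
    rw [mul_pow, sq_sqrt (by linarith)]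
  obtain ⟨D, hD, hb⟩ := PM_deriv h (β * √q) (β * √(1 - q)) hM1 hM2 θ
  have h2 : ∫ z, tanh (h + β * √q * z) ^ 2 ∂g1 = q := hqe.symm
  rw [e2, e3, h2] at hb
  have hs := (hasDerivAt_sin θ).pow 2
  have d2 := ((hD.sub_const (f1 β h q)).sub ((hs.const_mul (β ^ 2 * (1 - q))).div_const 2)).sub
    ((((((hs.const_mul (1 - q)).const_add q).pow 2).sub_const (q ^ 2)).const_mul (β ^ 2 / 4 * (M - 1))))
  refine ⟨_, d2, fun hsc h9 => ?_⟩
  have hb' := hb hsc h9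
  simp only [Pi.pow_apply]
  push_cast
  rw [hκ]
  refine (sub_le_sub_right (sub_le_sub_right hb' _) _).trans (le_of_eq ?_)
  ring

lemma JT_local {β h q : ℝ} (hβ : 0 < β) (hq : isFixedq β h q) {κ : ℝ} (hκ : κ = β ^ 2 * ∫ z, (cosh (h + β * √q * z))⁻¹ ^ 4 ∂g1) (hκ1 : κ < 1) :
    ∃ s0 > 0, ∃ c > 0, ∃ M, 1 < M ∧ M ≤ 2 ∧ ∀ θ, 0 ≤ θ → θ ≤ π / 2 → sin θ ≤ s0 → JT β h q M θ ≤ -c * sin θ ^ 4 := by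
  have hq' := hq
  obtain ⟨hq0, hq1, hqe⟩ := hq'
  have hβ2 : 0 < β ^ 2 := by positivity
  have h1q : 0 < 1 - q := by linarith
  have h1κ : 0 < 1 - κ := by linarith
  set ε := min 1 ((1 - κ) / (400 * β ^ 2)) with hε
  have hε0 : 0 < ε := lt_min one_pos (by positivity)
  have hε1 : ε ≤ 1 := min_le_left _ _
  have hε2 : 400 * β ^ 2 * ε ≤ 1 - κ := by
    have := min_le_right 1 ((1 - κ) / (400 * β ^ 2))
    rw [← hε, le_div_iff₀ (by positivity)] at this; linarith
  set y0 := min (1 / 9) ε / (β ^ 2 * (1 - q)) with hy0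
  have hy0p : 0 < y0 := by have : 0 < min (1 / 9) ε := lt_min (by norm_num) hε0
                           positivity
  have hy1 : β ^ 2 * (1 - q) * y0 ≤ 1 / 9 := by rw [hy0, mul_div_cancel₀ _ (by positivity)]; exact min_le_left _ _
  have hy2 : β ^ 2 * (1 - q) * y0 ≤ ε := by rw [hy0, mul_div_cancel₀ _ (by positivity)]; exact min_le_right _ _
  refine ⟨√y0, by positivity, ε * β ^ 2 * (1 - q) ^ 2 * (1 - κ) / 8, by positivity, 1 + ε, by linarith, by linarith, fun θ h0 hpi hs => ?_⟩
  set c := ε * β ^ 2 * (1 - q) ^ 2 * (1 - κ) / 8 with hc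
  have hder := fun θ => JT_deriv hq hκ (M := 1 + ε) (by linarith) (by linarith) θ
  choose D hD hDb using hder
  have hs4 : ∀ x, HasDerivAt (fun θ => JT β h q (1 + ε) θ + c * sin θ ^ 4) (D x + c * (4 * sin x ^ 3 * cos x)) x := fun x => by
    refine (hD x).add ((((hasDerivAt_sin x).pow 4).const_mul c).congr_deriv ?_)
    push_cast; ring
  have anti : AntitoneOn (fun θ => JT β h q (1 + ε) θ + c * sin θ ^ 4) (Set.Icc 0 θ) := by
    refine antitoneOn_of_deriv_nonpos (convex_Icc _ _) (fun x _ => (hs4 x).continuousAt.continuousWithinAt)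
      (fun x _ => (hs4 x).differentiableAt.differentiableWithinAt) fun x hx => ?_
    rw [interior_Icc] at hx
    rw [(hs4 x).deriv]
    have hx1 : 0 ≤ sin x := sin_nonneg_of_nonneg_of_le_pi hx.1.le (by linarith [hx.2, pi_pos])
    have hx2 : 0 ≤ cos x := cos_nonneg_of_neg_pi_div_two_le_of_le (by linarith [hx.1, pi_pos]) (by linarith [hx.2])
    have hx3 : sin x ≤ sin θ := sin_le_sin_of_le_of_le_pi_div_two (by linarith [hx.1, pi_pos]) hpi hx.2.le
    have hx4 : sin x ^ 2 ≤ y0 := by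
      have := pow_le_pow_left₀ hx1 (hx3.trans hs) 2
      rwa [sq_sqrt hy0p.le] at this
    have hx5 : β ^ 2 * (1 - q) * sin x ^ 2 ≤ β ^ 2 * (1 - q) * y0 := mul_le_mul_of_nonneg_left hx4 (by positivity)
    have hb := hDb x (mul_nonneg hx1 hx2) (hx5.trans hy1)
    have hk : κ - 1 + 100 * β ^ 2 * ((1 + ε - 1) + β ^ 2 * (1 - q) * sin x ^ 2) ≤ -(1 - κ) / 2 := by
      have : 100 * β ^ 2 * (β ^ 2 * (1 - q) * sin x ^ 2) ≤ 100 * β ^ 2 * ε := mul_le_mul_of_nonneg_left (hx5.trans hy2) (by positivity)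
      linarith
    have hb2 : D x ≤ β ^ 2 * (1 - q) * (sin x * cos x) * ((1 + ε - 1) * ((1 - q) * sin x ^ 2) * (-(1 - κ) / 2)) := by
      refine hb.trans (mul_le_mul_of_nonneg_left (mul_le_mul_of_nonneg_left hk ?_) (by positivity))
      have : (1 + ε - 1) = ε := by ring
      rw [this]; positivity
    refine (add_le_add_left hb2 _).trans (le_of_eq ?_)
    rw [hc]; ring
  have := anti (Set.left_mem_Icc.2 h0) (Set.right_mem_Icc.2 h0) h0
  simp only [JT_zero β h q (M := 1 + ε) (by linarith), sin_zero] at this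
  norm_num at this
  linarith

lemma JT_gap {β h q : ℝ} (hβ : 0 < β) (hq : isFixedq β h q) (hAT : ATcond β h q) (hATp : ATplus β h q) :
    ∃ c > 0, ∀ θ, 0 ≤ θ → θ ≤ π / 2 → ∃ M, 1 < M ∧ M ≤ 2 ∧ JT β h q M θ ≤ -c * sin θ ^ 4 := by
  obtain ⟨s0, hs0, c, hc, M, hM1, hM2, hloc⟩ := JT_local hβ hq rfl hAT
  obtain ⟨hq0, hq1, hqe⟩ := id hq
  have hK : IsCompact {θ : ℝ | θ ∈ Set.Icc 0 (π / 2) ∧ s0 ≤ sin θ} := by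
    have : {θ : ℝ | θ ∈ Set.Icc 0 (π / 2) ∧ s0 ≤ sin θ} = Set.Icc 0 (π / 2) ∩ {θ | s0 ≤ sin θ} := rfl
    rw [this]
    exact isCompact_Icc.inter_right (isClosed_le continuous_const continuous_sin)
  obtain ⟨c2, hc2, hg⟩ : ∃ c > 0, ∀ θ ∈ {θ : ℝ | θ ∈ Set.Icc 0 (π / 2) ∧ s0 ≤ sin θ}, ∃ M, 1 < M ∧ M ≤ 2 ∧ JT β h q M θ ≤ -c := by
    refine hK.induction_on (p := fun s => ∃ c > 0, ∀ θ ∈ s, ∃ M, 1 < M ∧ M ≤ 2 ∧ JT β h q M θ ≤ -c) ⟨1, one_pos, fun θ hθ => by simp at hθ⟩ ?_ ?_ ?_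
    · rintro s t hst ⟨c, hc, h⟩
      exact ⟨c, hc, fun θ hθ => h θ (hst hθ)⟩
    · rintro s t ⟨c, hc, h⟩ ⟨c', hc', h'⟩
      refine ⟨min c c', lt_min hc hc', fun θ hθ => ?_⟩
      rcases hθ with hθ | hθ
      · obtain ⟨M, h1, h2, h3⟩ := h θ hθ
        exact ⟨M, h1, h2, h3.trans (neg_le_neg (min_le_left _ _))⟩
      · obtain ⟨M, h1, h2, h3⟩ := h' θ hθ
        exact ⟨M, h1, h2, h3.trans (neg_le_neg (min_le_right _ _))⟩
    · intro θ hθ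
      obtain ⟨M, h1, h2, h3⟩ := JT_neg (θ := θ) hq1 (lt_of_lt_of_le hs0 hθ.2) hATp
      obtain ⟨D, hD, -⟩ := JT_deriv hq rfl h1.le h2 θ
      have ev := hD.continuousAt.eventually (gt_mem_nhds (show JT β h q M θ < JT β h q M θ / 2 by linarith))
      refine ⟨{x | JT β h q M x < JT β h q M θ / 2}, mem_nhdsWithin_of_mem_nhds ev, -(JT β h q M θ / 2), by linarith, fun x hx => ⟨M, h1, h2, ?_⟩⟩
      have : JT β h q M x < JT β h q M θ / 2 := hx
      linarith
  refine ⟨min c c2, lt_min hc hc2, fun θ h0 h1 => ?_⟩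
  have hs1 : 0 ≤ sin θ := sin_nonneg_of_nonneg_of_le_pi h0 (by linarith [pi_pos])
  have hs4 : sin θ ^ 4 ≤ 1 := pow_le_one₀ hs1 (sin_le_one θ)
  have hs40 : 0 ≤ sin θ ^ 4 := by positivity
  rcases le_total (sin θ) s0 with hs | hs
  · exact ⟨M, hM1, hM2, (hloc θ h0 h1 hs).trans (by nlinarith [min_le_left c c2])⟩
  · obtain ⟨M', h1', h2', h3'⟩ := hg θ ⟨⟨h0, h1⟩, hs⟩
    refine ⟨M', h1', h2', h3'.trans ?_⟩
    have hm := min_le_right c c2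
    have hm0 : 0 < min c c2 := lt_min hc hc2
    nlinarith

lemma fT_H (β h q b t : ℝ) {M : ℝ} (hM : 0 < M) (hq : 0 ≤ q) : fT (M / 2) h 0 (sA β q q 0 t 0) b 1 = 2 * PM h (β * √q) M b := by
  have hs := sA_sq (β := β) hq le_rfl (add_zero q) t
  rw [PM_eq, ← integral_Y1 h _ hs (f := fun z => 1 / M * log (∫ y, (2 * cosh (z + b * y)) ^ M ∂g1)) (meas_logint b M), fT, ← integral_const_mul]
  congr 1; ext x
  have e2 : sA β q q 0 t 0 2 = 0 := by simp [sA]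
  have : ∀ y, Zf (hT h 0 (sA β q q 0 t 0) b 1 x y) ^ (M / 2) = (2 * cosh (h + sA β q q 0 t 0 0 * x 0 + sA β q q 0 t 0 1 * x 1 + sA β q q 0 t 0 2 * x 2 + b * y)) ^ M := by
    intro y
    rw [Zf_hT, e2]
    simp only [zero_mul, add_zero, sub_zero, cosh_zero, sinh_zero, one_mul]
    set C := cosh (h + sA β q q 0 t 0 0 * x 0 + sA β q q 0 t 0 1 * x 1 + b * y)
    have hC : 0 < C := cosh_pos _
    have e4 : 4 * (C * C) = (2 * C) ^ (2:ℝ) := by rw [rpow_two]; ring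
    rw [e4, ← rpow_mul (by positivity)]; congr 1; ring
  simp only [gT]
  simp_rw [this]
  field_simp

lemma gap_H {β h q : ℝ} (hβ : 0 < β) (hq : isFixedq β h q) (hAT : ATcond β h q) (hATp : ATplus β h q) :
    ∃ c > 0, ∀ t u, 0 ≤ sin t → 1 / 2 ≤ sin t ^ 2 * β ^ 2 → q < u → u ≤ 1 → Gap β h q c 1 t u := by
  obtain ⟨c, hc, hg⟩ := JT_gap hβ hq hAT hATp
  obtain ⟨hq0, hq1, hqe⟩ := id hq
  have h1q : 0 < 1 - q := by linarith
  refine ⟨2 * c * (1 / (2 * β ^ 2)) ^ 2 / (1 - q) ^ 2, by positivity, fun t u ht htb hu hu1 => ?_⟩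
  have hst := sin_le_one t
  set a := sin t * √((u - q) / (1 - q)) with ha
  have hdiv : (u - q) / (1 - q) ≤ 1 := (div_le_one h1q).2 (by linarith)
  have hdiv0 : 0 ≤ (u - q) / (1 - q) := div_nonneg (by linarith) h1q.le
  have ha0 : 0 ≤ a := by positivity
  have ha1 : a ≤ 1 := mul_le_one₀ hst (sqrt_nonneg _) (sqrt_le_one.2 hdiv)
  have hsin : sin (arcsin a) = a := sin_arcsin (by linarith) ha1
  obtain ⟨M, hM1, hM2, hJ⟩ := hg (arcsin a) (arcsin_nonneg.2 ha0) (arcsin_le_pi_div_two _)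
  have ha2 : a ^ 2 = sin t ^ 2 * ((u - q) / (1 - q)) := by rw [ha, mul_pow, sq_sqrt hdiv0]
  have hp : (1 - q) * a ^ 2 = sin t ^ 2 * (u - q) := by rw [ha2]; field_simp
  have hb : sin t * β * √(u - q) = a * (β * √(1 - q)) := by
    have : √(u - q) = √((u - q) / (1 - q)) * √(1 - q) := by
      rw [← sqrt_mul hdiv0]; congr 1; field_simp
    rw [ha, this]; ring
  refine ⟨q, 0, u - q, 1, M / 2, 0, hq0.le, le_rfl, by ring, by linarith, by linarith, by norm_num, by linarith, by linarith, by simp, ?_, ?_⟩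
  · have : u - (q - 0 + 1 * (u - q)) = 0 := by ring
    rw [this]; simp
  · unfold gapE
    rw [fT_H _ _ _ _ _ (by linarith) hq0.le, hb]
    rw [JT, hsin, hp] at hJ
    have h4 : a ^ 4 = (sin t ^ 2) ^ 2 * (u - q) ^ 2 / (1 - q) ^ 2 := by
      have : a ^ 4 = (a ^ 2) ^ 2 := by ring
      rw [this, ha2]; field_simp
    have h5 : (1 / (2 * β ^ 2)) ^ 2 ≤ (sin t ^ 2) ^ 2 := by
      refine pow_le_pow_left₀ (by positivity) ?_ 2
      rw [div_le_iff₀ (by positivity)]; linarith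
    have h6 : (1 / (2 * β ^ 2)) ^ 2 * ((u - q) ^ 2 / (1 - q) ^ 2) ≤ a ^ 4 := by
      rw [h4, mul_div_assoc]; exact mul_le_mul_of_nonneg_right h5 (by positivity)
    have h7 : β ^ 2 * (1 - q) * a ^ 2 = β ^ 2 * (sin t ^ 2 * (u - q)) := by rw [mul_assoc, hp]
    rw [h7] at hJ
    set P := PM h (β * √q) M (a * (β * √(1 - q)))
    set τ := sin t ^ 2
    have hτ1 : τ ≤ 1 := sin_sq_le_one t
    have hτ0 : 0 ≤ τ := sq_nonneg _
    have h8 : 0 ≤ β ^ 2 / 2 * (M - 1) * (τ * (1 - τ) * (u - q) ^ 2) := by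
      have : 0 ≤ M - 1 := by linarith
      have : 0 ≤ 1 - τ := by linarith
      positivity
    have h9 : -(2 * c * (1 / (2 * β ^ 2)) ^ 2 / (1 - q) ^ 2) * (u - q) ^ 2 = -(2 * c * ((1 / (2 * β ^ 2)) ^ 2 * ((u - q) ^ 2 / (1 - q) ^ 2))) := by ring
    rw [h9]
    have h10 := mul_le_mul_of_nonneg_left h6 (by linarith : 0 ≤ 2 * c)
    linarith

/-- constant in the strict Cauchy-Schwarz bound -/
def cL (β : ℝ) : ℝ := ∫ y, y ^ 2 * exp (-(β * |y|)) ∂g1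

lemma sq_le_exp_abs (y : ℝ) : y ^ 2 ≤ 2 * exp |y| := by
  have := quadratic_le_exp_of_nonneg (abs_nonneg y)
  rw [sq_abs] at this; have := abs_nonneg y; linarith

lemma cL_int {β : ℝ} (hβ : 0 ≤ β) : Integrable (fun y : ℝ => y ^ 2 * exp (-(β * |y|))) g1 := by
  refine integrable_of_exp_bound (by fun_prop) 2 1 fun y => ?_
  rw [abs_of_nonneg (by positivity), one_mul]
  have h1 : exp (-(β * |y|)) ≤ 1 := exp_le_one_iff.2 (by have := abs_nonneg y; nlinarith)
  have := sq_le_exp_abs y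
  nlinarith [sq_nonneg y]

lemma cL_pos {β : ℝ} (hβ : 0 ≤ β) : 0 < cL β := by
  unfold cL
  rw [integral_pos_iff_support_of_nonneg (fun y => by positivity) (cL_int hβ)]
  have : Function.support (fun y : ℝ => y ^ 2 * exp (-(β * |y|))) = {0}ᶜ := by
    ext y; simp [exp_ne_zero]
  rw [this]
  have h1 : NullSingletonClass g1 := nullSingletonClass_gaussianReal one_ne_zero
  rw [measure_compl (measurableSet_singleton _) (measure_ne_top _ _), h1.measure_singleton]
  simp

lemma rr_le_exp {t : ℝ} (ht : |t| ≤ 1) (b y : ℝ) : rr t b y ≤ exp |b * y| := by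
  rw [rr, ← cosh_abs]
  have h1 : t * sinh (b * y) ≤ sinh |b * y| := by
    rw [← abs_sinh]
    refine (le_abs_self _).trans ?_
    rw [abs_mul]; exact mul_le_of_le_one_left (abs_nonneg _) ht
  have := cosh_add_sinh |b * y|
  linarith

lemma sqrt_rr_int {t1 t2 b β : ℝ} (h1 : |t1| ≤ 1) (h2 : |t2| ≤ 1) (hb : |b| ≤ β) :
    ∫ y, √(rr t1 b y) * √(rr (-t2) b y) ∂g1 ≤ exp (b ^ 2 / 2) - b ^ 2 * cL β * (t1 + t2) ^ 2 / 8 := by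
  have h2' : |-t2| ≤ 1 := by rwa [abs_neg]
  have hβ : 0 ≤ β := (abs_nonneg b).trans hb
  have i1 := (rr_int1 t1 b).1
  have i2 := (rr_int1 (-t2) b).1
  have ic := cL_int hβ
  have e : exp (b ^ 2 / 2) - b ^ 2 * cL β * (t1 + t2) ^ 2 / 8 =
      ∫ y, 1 / 2 * rr t1 b y + 1 / 2 * rr (-t2) b y + -(b ^ 2 * (t1 + t2) ^ 2 / 8) * (y ^ 2 * exp (-(β * |y|))) ∂g1 := by
    rw [integral_add (iadd (i1.const_mul _) (i2.const_mul _)) (ic.const_mul _), integral_add (i1.const_mul _) (i2.const_mul _),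
      integral_const_mul, integral_const_mul, integral_const_mul, (rr_int1 _ _).2, (rr_int1 _ _).2, cL]
    ring
  rw [e]
  refine integral_mono_of_nonneg (Eventually.of_forall fun y => by positivity)
    (iadd (iadd (i1.const_mul _) (i2.const_mul _)) (ic.const_mul _)) (Eventually.of_forall fun y => ?_)
  simp only
  set r1 := rr t1 b y with hr1
  set r2 := rr (-t2) b y with hr2
  have p1 : 0 < r1 := rr_pos h1 b y
  have p2 : 0 < r2 := rr_pos h2' b y
  have l1 : r1 ≤ exp |b * y| := rr_le_exp h1 b y
  have l2 : r2 ≤ exp |b * y| := rr_le_exp h2' b y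
  have d : r1 - r2 = (t1 + t2) * sinh (b * y) := by rw [hr1, hr2, rr, rr]; ring
  have s1 := sq_sqrt p1.le
  have s2 := sq_sqrt p2.le
  set s := √r1
  set r := √r2
  have e1 : (s - r) ^ 2 * (s + r) ^ 2 = (t1 + t2) ^ 2 * sinh (b * y) ^ 2 := by
    rw [← mul_pow, ← mul_pow, ← d, ← s1, ← s2]; ring
  have e2 : (s + r) ^ 2 ≤ 4 * exp |b * y| := by nlinarith [sq_nonneg (s - r)]
  have e3 : (b * y) ^ 2 ≤ sinh (b * y) ^ 2 := by
    rw [← sq_abs, ← sq_abs (sinh _), abs_sinh]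
    exact pow_le_pow_left₀ (abs_nonneg _) (self_le_sinh_iff.2 (abs_nonneg _)) 2
  have e4 : (t1 + t2) ^ 2 * (b * y) ^ 2 ≤ (s - r) ^ 2 * (4 * exp |b * y|) := by
    calc (t1 + t2) ^ 2 * (b * y) ^ 2 ≤ (t1 + t2) ^ 2 * sinh (b * y) ^ 2 := by gcongr
      _ = (s - r) ^ 2 * (s + r) ^ 2 := e1.symm
      _ ≤ _ := by gcongr
  have e5 : exp |b * y| * exp (-(β * |y|)) ≤ 1 := by
    rw [← exp_add]; refine exp_le_one_iff.2 ?_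
    rw [abs_mul]; have := mul_le_mul_of_nonneg_right hb (abs_nonneg y); linarith
  have e6 : (t1 + t2) ^ 2 * (b * y) ^ 2 * exp (-(β * |y|)) ≤ 4 * (s - r) ^ 2 := by
    calc _ ≤ (s - r) ^ 2 * (4 * exp |b * y|) * exp (-(β * |y|)) := by gcongr
      _ = 4 * (s - r) ^ 2 * (exp |b * y| * exp (-(β * |y|))) := by ring
      _ ≤ 4 * (s - r) ^ 2 * 1 := by gcongr
      _ = _ := by ring
  nlinarith

lemma Gam_D (h : ℝ) (a : Fin 3 → ℝ) {σ q : ℝ} (hσ : σ ^ 2 = a 0 ^ 2 + a 1 ^ 2 + a 2 ^ 2) (hq : ∫ z, tanh (h + σ * z) ^ 2 ∂g1 = q) :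
    Integrable (fun x : Fin 3 → ℝ => (tanh (h + a 0 * x 0 + a 1 * x 1 + a 2 * x 2) + tanh (h + a 0 * x 0 + a 1 * x 1 - a 2 * x 2)) ^ 2) (gm (Fin 3)) ∧
    ∫ x : Fin 3 → ℝ, (tanh (h + a 0 * x 0 + a 1 * x 1 + a 2 * x 2) + tanh (h + a 0 * x 0 + a 1 * x 1 - a 2 * x 2)) ^ 2 ∂(gm (Fin 3)) = 2 * q + 2 * Gam h a := by
  have mt := meas_tanh
  have i1 : Integrable (fun x : Fin 3 → ℝ => tanh (h + a 0 * x 0 + a 1 * x 1 + a 2 * x 2) ^ 2) (gm (Fin 3)) :=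
    bdd_integrable (by fun_prop) 1 fun x => by rw [abs_of_nonneg (sq_nonneg _)]; exact tanh_sq_le _
  have i2 : Integrable (fun x : Fin 3 → ℝ => tanh (h + a 0 * x 0 + a 1 * x 1 - a 2 * x 2) ^ 2) (gm (Fin 3)) :=
    bdd_integrable (by fun_prop) 1 fun x => by rw [abs_of_nonneg (sq_nonneg _)]; exact tanh_sq_le _
  have i3 : Integrable (fun x : Fin 3 → ℝ => tanh (h + a 0 * x 0 + a 1 * x 1 + a 2 * x 2) * tanh (h + a 0 * x 0 + a 1 * x 1 - a 2 * x 2)) (gm (Fin 3)) :=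
    bdd_integrable (by fun_prop) 1 fun x => by
      rw [abs_mul]; exact mul_le_one₀ (abs_tanh_le _) (abs_nonneg _) (abs_tanh_le _)
  have e : (fun x : Fin 3 → ℝ => (tanh (h + a 0 * x 0 + a 1 * x 1 + a 2 * x 2) + tanh (h + a 0 * x 0 + a 1 * x 1 - a 2 * x 2)) ^ 2) =
      fun x => tanh (h + a 0 * x 0 + a 1 * x 1 + a 2 * x 2) ^ 2 + tanh (h + a 0 * x 0 + a 1 * x 1 - a 2 * x 2) ^ 2 +
        2 * (tanh (h + a 0 * x 0 + a 1 * x 1 + a 2 * x 2) * tanh (h + a 0 * x 0 + a 1 * x 1 - a 2 * x 2)) := by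
    ext x; ring
  rw [e]
  refine ⟨iadd (iadd i1 i2) (i3.const_mul 2), ?_⟩
  rw [integral_add (iadd i1 i2) (i3.const_mul 2), integral_add i1 i2, integral_const_mul,
    integral_Y1 h a hσ (f := fun z => tanh z ^ 2) (by fun_prop), integral_Y2 h a hσ (f := fun z => tanh z ^ 2) (by fun_prop), hq, Gam]
  ring

lemma fT_LA (h : ℝ) (a : Fin 3 → ℝ) {σ q b β : ℝ} (hσ : σ ^ 2 = a 0 ^ 2 + a 1 ^ 2 + a 2 ^ 2) (hq : ∫ z, tanh (h + σ * z) ^ 2 ∂g1 = q)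
    (hb : |b| ≤ β) :
    fT (1 / 2) h 0 a b (-1) ≤ 2 * ∫ z, log (2 * cosh (h + σ * z)) ∂g1 + b ^ 2 - b ^ 2 * cL β * exp (-(β ^ 2 / 2)) / 4 * (2 * q + 2 * Gam h a) := by
  obtain ⟨iD, hD⟩ := Gam_D h a hσ hq
  have e : 2 * ∫ z, log (2 * cosh (h + σ * z)) ∂g1 + b ^ 2 - b ^ 2 * cL β * exp (-(β ^ 2 / 2)) / 4 * (2 * q + 2 * Gam h a) =
      ∫ x : Fin 3 → ℝ, log (2 * cosh (h + a 0 * x 0 + a 1 * x 1 + a 2 * x 2)) + log (2 * cosh (h + a 0 * x 0 + a 1 * x 1 - a 2 * x 2)) + b ^ 2 +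
        -(b ^ 2 * cL β * exp (-(β ^ 2 / 2)) / 4) * (tanh (h + a 0 * x 0 + a 1 * x 1 + a 2 * x 2) + tanh (h + a 0 * x 0 + a 1 * x 1 - a 2 * x 2)) ^ 2 ∂(gm (Fin 3)) := by
    rw [integral_add (iadd (iadd (integrable_Y1 h a) (integrable_Y2 h a)) (integrable_const _)) (iD.const_mul _),
      integral_add (iadd (integrable_Y1 h a) (integrable_Y2 h a)) (integrable_const _), integral_add (integrable_Y1 h a) (integrable_Y2 h a),
      integral_Y1 h a hσ (f := fun z => log (2 * cosh z)) (by fun_prop), integral_Y2 h a hσ (f := fun z => log (2 * cosh z)) (by fun_prop), integral_const_mul, hD]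
    simp; ring
  rw [e]
  refine integral_mono (gT_integrable (by norm_num) h 0 a b (-1))
    (iadd (iadd (iadd (integrable_Y1 h a) (integrable_Y2 h a)) (integrable_const _)) (iD.const_mul _)) fun x => ?_
  have hpos := hT_int_pos (1 / 2) h 0 a b (-1) x
  simp only [gT]
  set Y1 := h + a 0 * x 0 + a 1 * x 1 + a 2 * x 2 with hY1
  set Y2 := h + a 0 * x 0 + a 1 * x 1 - a 2 * x 2 with hY2
  have c1 := cosh_pos Y1
  have c2 := cosh_pos Y2
  have hZ : ∀ y, Zf (hT h 0 a b (-1) x y) ^ (1 / 2 : ℝ) = √((2 * cosh Y1) * (2 * cosh Y2)) * (√(rr (tanh Y1) b y) * √(rr (-tanh Y2) b y)) := by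
    intro y
    rw [Zf_hT]
    simp only [cosh_zero, sinh_zero, zero_mul, add_zero, one_mul, ← hY1, ← hY2]
    have p1 := rr_pos (abs_tanh_le Y1) b y
    have p2 := rr_pos (t := -tanh Y2) (by rw [abs_neg]; exact abs_tanh_le Y2) b y
    have e2 : cosh (Y2 + -1 * b * y) = cosh Y2 * rr (-tanh Y2) b y := by
      rw [cosh_rr]; congr 1; rw [rr, rr]
      have : -1 * b * y = -(b * y) := by ring
      rw [this, cosh_neg, sinh_neg]; ring
    rw [cosh_rr, e2, ← sqrt_eq_rpow, ← sqrt_mul p1.le, ← sqrt_mul (by positivity)]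
    congr 1; ring
  simp_rw [hZ, integral_const_mul] at hpos ⊢
  have hI := sqrt_rr_int (b := b) (abs_tanh_le Y1) (abs_tanh_le Y2) hb
  set I := ∫ y, √(rr (tanh Y1) b y) * √(rr (-tanh Y2) b y) ∂g1
  have hsq : 0 < √((2 * cosh Y1) * (2 * cosh Y2)) := sqrt_pos.2 (by positivity)
  have hI0 : 0 < I := (pos_iff_pos_of_mul_pos hpos).1 hsq
  rw [log_mul hsq.ne' hI0.ne', log_sqrt (by positivity), log_mul (by positivity) (by positivity)]
  set D := (tanh Y1 + tanh Y2) ^ 2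
  have hD0 : 0 ≤ D := sq_nonneg _
  have hc := cL_pos ((abs_nonneg b).trans hb)
  have hlog : log I ≤ b ^ 2 / 2 - exp (-(b ^ 2 / 2)) * (b ^ 2 * cL β * D / 8) := by
    have h1 : log (I * exp (-(b ^ 2 / 2))) ≤ I * exp (-(b ^ 2 / 2)) - 1 := log_le_sub_one_of_pos (by positivity)
    rw [log_mul hI0.ne' (exp_pos _).ne', log_exp] at h1
    have h2 := mul_le_mul_of_nonneg_right hI (exp_pos (-(b ^ 2 / 2))).le
    have h3 : exp (b ^ 2 / 2) * exp (-(b ^ 2 / 2)) = 1 := by rw [← exp_add]; simp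
    nlinarith
  have hbb : b ^ 2 ≤ β ^ 2 := by rw [← sq_abs]; exact pow_le_pow_left₀ (abs_nonneg _) hb 2
  have h4 : exp (-(β ^ 2 / 2)) * (b ^ 2 * cL β * D / 8) ≤ exp (-(b ^ 2 / 2)) * (b ^ 2 * cL β * D / 8) := by
    refine mul_le_mul_of_nonneg_right (exp_le_exp.2 (by linarith)) (by positivity)
  norm_num
  nlinarith

/-- first absolute moment constant -/
def kL (β : ℝ) : ℝ := ∫ y, |y| * exp (β * |y|) ∂g1

lemma kL_int (β : ℝ) : Integrable (fun y : ℝ => |y| * exp (β * |y|)) g1 := by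
  refine integrable_of_exp_bound (by fun_prop) 1 (β + 1) fun y => ?_
  rw [abs_of_nonneg (by positivity), one_mul, add_mul, one_mul, exp_add, mul_comm]
  exact mul_le_mul_of_nonneg_left (abs_le_exp_abs y) (exp_pos _).le

lemma fT_LB (h lam : ℝ) (a : Fin 3 → ℝ) {σ b β : ℝ} (hσ : σ ^ 2 = a 0 ^ 2 + a 1 ^ 2 + a 2 ^ 2) (hb0 : 0 ≤ b) (hb : b ≤ β) :
    fT (1 / 2) h lam a b (-1) ≤ 2 * ∫ z, log (2 * cosh (h + σ * z)) ∂g1 + lam * Gam h a + lam ^ 2 / 2 + 2 * b * kL β := by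
  have h1 := fT_b0_le h lam (-1) a hσ
  suffices hs : fT (1 / 2) h lam a b (-1) ≤ fT 1 h lam a 0 (-1) + 2 * b * kL β by linarith
  have ib := gT_integrable (m := 1) one_pos h lam a 0 (-1)
  have e : fT 1 h lam a 0 (-1) + 2 * b * kL β = ∫ x, gT 1 h lam a 0 (-1) x + 2 * b * kL β ∂(gm (Fin 3)) := by
    rw [integral_add ib (integrable_const _), fT]; simp
  rw [e]
  refine integral_mono (gT_integrable (by norm_num) h lam a b (-1)) (iadd ib (integrable_const _)) fun x => ?_
  simp only [gT]
  have hZ0 : ∀ y, hT h lam a 0 (-1) x y = hT h lam a 0 (-1) x 0 := by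
    intro y; ext s; simp [hT]
  set Z0 := Zf (hT h lam a 0 (-1) x 0) with hZ0d
  have pZ0 : 0 < Z0 := Zf_pos _
  have hr : ∫ y, Zf (hT h lam a 0 (-1) x y) ^ (1:ℝ) ∂g1 = Z0 := by
    simp_rw [hZ0, rpow_one]; simp [hZ0d]
  rw [hr]
  have hle : ∀ y, Zf (hT h lam a b (-1) x y) ^ (1/2:ℝ) ≤ √Z0 * (1 + b * (|y| * exp (β * |y|))) := by
    intro y
    have h2 : Zf (hT h lam a b (-1) x y) ≤ Z0 * exp (2 * (b * |y|)) := by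
      rw [hZ0d, Zf, Zf, Finset.sum_mul]
      refine Finset.sum_le_sum fun s _ => ?_
      rw [← exp_add]
      refine exp_le_exp.2 ?_
      simp only [hT, mul_zero, add_zero]
      have h3 : |b * (spin s.1 + -1 * spin s.2) * y| ≤ 2 * (b * |y|) := by
        rw [abs_mul, abs_mul, abs_of_nonneg hb0]
        have : |spin s.1 + -1 * spin s.2| ≤ 2 := by
          unfold spin; split_ifs <;> norm_num
        have h0 := mul_le_mul_of_nonneg_left this (mul_nonneg hb0 (abs_nonneg y))
        linarith
      have := (le_abs_self _).trans h3
      linarith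
    rw [← sqrt_eq_rpow]
    have h4 : √(Z0 * exp (2 * (b * |y|))) = √Z0 * exp (b * |y|) := by
      rw [sqrt_mul pZ0.le, two_mul, exp_add, sqrt_mul_self (exp_pos _).le]
    refine (sqrt_le_sqrt h2).trans ?_
    rw [h4]
    refine mul_le_mul_of_nonneg_left ?_ (sqrt_nonneg _)
    have h5 : exp (b * |y|) ≤ exp (β * |y|) := exp_le_exp.2 (mul_le_mul_of_nonneg_right hb (abs_nonneg _))
    have h6 := add_one_le_exp (-(b * |y|))
    have h7 : exp (b * |y|) * exp (-(b * |y|)) = 1 := by rw [← exp_add]; simp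
    have h8 : 0 ≤ b * |y| := by positivity
    have h9 := exp_pos (b * |y|)
    nlinarith
  have hI := integral_mono (hT_int (1/2) h lam a b (-1) x) ((iadd (integrable_const 1) ((kL_int β).const_mul b)).const_mul (√Z0)) hle
  rw [integral_const_mul, integral_add (integrable_const _) ((kL_int β).const_mul b), integral_const_mul] at hI
  simp only [integral_const, probReal_univ, one_smul] at hI
  have hk : 0 ≤ kL β := integral_nonneg fun y => by positivity
  have hpos := hT_int_pos (1 / 2) h lam a b (-1) x
  have h10 := log_le_log hpos hI
  have hq : 0 < 1 + b * kL β := by positivity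
  rw [show (∫ y, |y| * exp (β * |y|) ∂g1) = kL β from rfl, log_mul (sqrt_pos.2 pZ0).ne' hq.ne', log_sqrt pZ0.le] at h10
  have h11 := log_le_sub_one_of_pos hq
  norm_num
  norm_num at h10
  linarith

lemma gap_L {β h q : ℝ} (hβ : 0 < β) (hq : isFixedq β h q) (hAT : ATcond β h q) :
    ∃ c > 0, ∃ K, ∀ t u, 0 ≤ sin t → -1 ≤ u → u ≤ -q → Gap β h q c K t u := by
  obtain ⟨hq0, hq1, hqe⟩ := hq
  have h2 : ∫ z, tanh (h + β * √q * z) ^ 2 ∂g1 = q := hqe.symm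
  set κ := β ^ 2 * ∫ z, (cosh (h + β * √q * z))⁻¹ ^ 4 ∂g1 with hκ
  have hκ1 : κ < 1 := hAT
  have hκ0 : 0 ≤ κ := mul_nonneg (sq_nonneg _) (integral_nonneg fun z => by positivity)
  set δ := 2 * q * (1 - κ) with hδ
  have hδ0 : 0 < δ := mul_pos (by linarith) (by linarith)
  have hk : 0 ≤ kL β := integral_nonneg fun y => by positivity
  set b0 := δ ^ 2 / (8 * (kL β + 1)) with hb0
  have hb00 : 0 < b0 := by positivity
  have hcL := cL_pos hβ.le
  set cA := b0 ^ 2 * cL β * exp (-(β ^ 2 / 2)) / 4 * (2 * δ) with hcA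
  have hcA0 : 0 < cA := by positivity
  set c := min (δ ^ 2 / 4) cA / 4 with hc
  have hc0 : 0 < c := by positivity
  refine ⟨c, hc0, δ / (2 * q), fun t u ht hu1 huq => ?_⟩
  have hs1 := sin_le_one t
  set b := sin t * β * √(-u - q) with hb
  have hbn : 0 ≤ b := by positivity
  have hb1 : b ≤ β := by
    have : √(-u - q) ≤ 1 := sqrt_le_one.2 (by linarith)
    calc b ≤ 1 * β * 1 := by rw [hb]; gcongr
      _ = β := by ring
  have hb2 : b ^ 2 = sin t ^ 2 * β ^ 2 * (-u - q) := by rw [hb, mul_pow, mul_pow, sq_sqrt (by linarith)]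
  set a := sA β q 0 q t 0 with ha
  have hs : (β * √q) ^ 2 = a 0 ^ 2 + a 1 ^ 2 + a 2 ^ 2 := sA_sq (β := β) le_rfl hq0.le (zero_add q) t
  have ea2 : a 2 = sin t * β * √q := by simp [ha, sA]
  have hG := Gam_lb (h := h) (σ := β * √q) (by positivity) a (by rw [ea2]; positivity) hs
  rw [h2, ea2, mul_pow, mul_pow, sq_sqrt hq0.le] at hG
  have hG2 : δ ≤ q + Gam h a := by
    have : sin t ^ 2 * (κ * q) ≤ 1 * (κ * q) := mul_le_mul_of_nonneg_right (sin_sq_le_one t) (mul_nonneg hκ0 hq0.le)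
    rw [hκ] at this
    rw [hδ, hκ]
    nlinarith
  have hnn : |(0:ℝ)| ≤ δ / (2 * q) * |u - q| := by rw [abs_zero]; positivity
  have huq2 : |u - q| = q - u := by rw [abs_sub_comm, abs_of_nonneg (by linarith)]
  have hw : |u - (0 - q + -1 * (-u - q))| ≤ δ / (2 * q) * |u - q| := by
    have : u - (0 - q + -1 * (-u - q)) = 0 := by ring
    rw [this]; exact hnn
  have hsq4 : c * (u - q) ^ 2 ≤ min (δ ^ 2 / 4) cA := by
    have : (u - q) ^ 2 ≤ 4 := by nlinarith
    have := mul_le_mul_of_nonneg_left this hc0.le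
    linarith
  have hpoly : sin t ^ 2 * β ^ 2 / 2 * ((1 - (q + (-u - q))) ^ 2 - (1 - q) ^ 2 + (u - (0 - q + -1 * (-u - q))) ^ 2
      - 1 / 2 * ((q + (-u - q)) ^ 2 + (0 - q + -1 * (-u - q)) ^ 2 - q ^ 2 - (0 - q) ^ 2)) = -b ^ 2 := by
    rw [hb2]; ring
  by_cases hbb : b ≤ b0
  · refine ⟨0, q, -u - q, -1, 1 / 2, -δ, le_rfl, hq0.le, by ring, by linarith, by linarith, by norm_num, by norm_num, by norm_num, ?_, hw, ?_⟩
    · rw [abs_neg, abs_of_pos hδ0, huq2, div_mul_eq_mul_div, le_div_iff₀ (by positivity)]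
      exact mul_le_mul_of_nonneg_left (by linarith) hδ0.le
    · have hf := fT_LB h (-δ) a hs hbn hb1
      unfold gapE f1
      have h6 := min_le_left (δ ^ 2 / 4) cA
      have h7 : b * kL β ≤ δ ^ 2 / 8 := by
        calc b * kL β ≤ b0 * (kL β + 1) := by gcongr; linarith
          _ = δ ^ 2 / 8 := by rw [hb0]; field_simp
      have h8 := mul_le_mul_of_nonneg_left hG2 hδ0.le
      have h9 : 0 ≤ δ * (-u - q) := mul_nonneg hδ0.le (by linarith)
      have h10 := sq_nonneg b
      rw [hpoly]
      have h11 : δ * (q + Gam h a) = δ * q + δ * Gam h a := by ring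
      have h12 : δ * (-u - q) = -(δ * u) - δ * q := by ring
      have h13 : δ * δ = δ ^ 2 := by ring
      have h14 : (-δ) ^ 2 = δ ^ 2 := by ring
      have h15 : 2 * b * kL β = 2 * (b * kL β) := by ring
      rw [h14, h15] at hf
      rw [h11, h13] at h8
      rw [h12] at h9
      linarith
  · refine ⟨0, q, -u - q, -1, 1 / 2, 0, le_rfl, hq0.le, by ring, by linarith, by linarith, by norm_num, by norm_num, by norm_num, hnn, hw, ?_⟩
    have hf := fT_LA h a (b := b) (β := β) hs h2 (by rwa [abs_of_nonneg hbn])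
    unfold gapE f1
    have h6 := min_le_right (δ ^ 2 / 4) cA
    have h7 : cA ≤ b ^ 2 * cL β * exp (-(β ^ 2 / 2)) / 4 * (2 * q + 2 * Gam h a) := by
      rw [hcA]; push Not at hbb; gcongr; linarith
    rw [hpoly]
    linarith

theorem gap_all {β h q : ℝ} (hβ : 0 < β) (hq : isFixedq β h q) (hAT : ATcond β h q) (hATp : ATplus β h q) :
    ∃ c > 0, ∃ K > 0, ∀ t u, 0 ≤ sin t → |u| ≤ 1 → Gap β h q c K t u := by
  obtain ⟨cH, hcH, HH⟩ := gap_H hβ hq hAT hATp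
  obtain ⟨cL', hcL, KL, HL⟩ := gap_L hβ hq hAT
  set κ := β ^ 2 * ∫ z, (cosh (h + β * √q * z))⁻¹ ^ 4 ∂g1 with hκ
  have hκ1 : κ < 1 := hAT
  have h3 : 0 < (1 - κ) ^ 2 / 2 := by have : 0 < 1 - κ := by linarith
                                      positivity
  refine ⟨min (min (1/4) ((1 - κ) ^ 2 / 2)) (min cH cL'), by positivity, max 1 KL, by positivity, fun t u ht hu => ?_⟩
  obtain ⟨hu1, hu2⟩ := abs_le.1 hu
  by_cases hS : sin t ^ 2 * β ^ 2 ≤ 1 / 2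
  · exact (gap_S hq hS).mono (by simp) (le_max_left _ _)
  push Not at hS
  by_cases hM : |u| ≤ q
  · exact (gap_M hβ hq ht hκ hκ1 hM).mono (by simp) (le_max_left _ _)
  by_cases hH : q < u
  · exact (HH t u ht hS.le hH hu2).mono (by simp) (le_max_left _ _)
  · have : u ≤ -q := by
      by_contra hc
      exact hM (abs_le.2 ⟨by linarith, by linarith⟩)
    exact (HL t u ht hu1 this).mono (by simp) (le_max_right _ _)

lemma logZf_le {S : Type*} [Fintype S] [Nonempty S] {H H' : S → ℝ} {d : ℝ} (hd : ∀ s, |H s - H' s| ≤ d) :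
    log (Zf H) - log (Zf H') ≤ d := by
  have h1 : Zf H ≤ exp d * Zf H' := by
    unfold Zf; rw [Finset.mul_sum]
    refine Finset.sum_le_sum fun s _ => ?_
    rw [← exp_add]; exact exp_le_exp.2 (by have := (abs_le.1 (hd s)).2; linarith)
  have h2 := log_le_log (Zf_pos H) h1
  rw [log_mul (exp_pos _).ne' (Zf_pos _).ne', log_exp] at h2
  linarith

lemma logZf_lip {S : Type*} [Fintype S] [Nonempty S] {H H' : S → ℝ} {d : ℝ} (hd : ∀ s, |H s - H' s| ≤ d) :
    |log (Zf H) - log (Zf H')| ≤ d :=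
  abs_le.2 ⟨by have := logZf_le (H := H') (H' := H) (d := d) fun s => by rw [abs_sub_comm]; exact hd s
               linarith, logZf_le hd⟩

section blocks
variable {V : Type*} [Fintype V] [LinearOrder V]

/-- Lipschitz constants -/
def LS (β q N : ℝ) : Ks V → ℝ
  | Sum.inl _ => |β / √N|
  | Sum.inr _ => |β * √q|

lemma LS_nonneg (β q N : ℝ) (k : Ks V) : 0 ≤ LS β q N k := by rcases k with p | k <;> simp only [LS] <;> positivity

lemma HS_lip (β h q N t : ℝ) (x y : Ks V → ℝ) (s : V → Bool) :
    |HS β h q N t x s - HS β h q N t y s| ≤ ∑ k, LS β q N k * |x k - y k| := by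
  simp only [HS, Hy, AM]
  rw [add_sub_add_left_eq_sub, ← Finset.sum_sub_distrib]
  refine (Finset.abs_sum_le_sum_abs _ _).trans (Finset.sum_le_sum fun k _ => ?_)
  rw [← mul_sub, abs_mul]
  refine mul_le_mul_of_nonneg_right ?_ (abs_nonneg _)
  rw [abs_mul]
  rcases k with p | ⟨i, j⟩
  · simp only [aS, cS, LS]
    rw [abs_mul (spin _), spin_abs, spin_abs, mul_one, mul_one]
    exact abs_sin_mul_le _ _
  · simp only [aS, cS, LS]
    have : |if j = 0 then spin (s i) else 0| ≤ 1 := by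
      split_ifs
      · rw [spin_abs]
      · simp
    exact (mul_le_of_le_one_right (abs_nonneg _) this).trans (abs_cos_mul_le _ _)

lemma LS_sum (β q N : ℝ) (hq0 : 0 ≤ q) (hq : q ≤ 1) (hN : 0 < N) (hn : Fintype.card V ≤ N) : ∑ k : Ks V, (4 * LS β q N k) ^ 2 ≤ 64 * β ^ 2 * N := by
  rw [Fintype.sum_sum_type]
  simp only [LS, mul_pow, sq_abs, div_pow, sq_sqrt hN.le, sq_sqrt hq0]
  rw [Finset.sum_const, Finset.sum_const]
  simp only [Finset.card_univ, Fintype.card_prod, Fintype.card_fin, nsmul_eq_mul]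
  have h1 : (Fintype.card (Pr V) : ℝ) ≤ N ^ 2 := by
    have : Fintype.card (Pr V) ≤ Fintype.card (V × V) := Fintype.card_subtype_le _
    rw [Fintype.card_prod] at this
    have h2 : (Fintype.card (Pr V) : ℝ) ≤ Fintype.card V * Fintype.card V := by exact_mod_cast this
    have h3 : (0:ℝ) ≤ Fintype.card V := by positivity
    nlinarith
  have h4 : (Fintype.card (Pr V) : ℝ) * (4 ^ 2 * (β ^ 2 / N)) ≤ N ^ 2 * (4 ^ 2 * (β ^ 2 / N)) := mul_le_mul_of_nonneg_right h1 (by positivity)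
  have h5 : N ^ 2 * (4 ^ 2 * (β ^ 2 / N)) = 16 * β ^ 2 * N := by field_simp; ring
  have h6 : (((Fintype.card V * 3 : ℕ)) : ℝ) * (4 ^ 2 * (β ^ 2 * q)) ≤ (N * 3) * (4 ^ 2 * (β ^ 2 * 1)) := by
    push_cast
    gcongr
  nlinarith

/-- log of the restricted Gibbs weight -/
def XU (U : Set ℝ) (H : (V → Bool) → ℝ) : ℝ := log (ZU U H) - 2 * log (Zf H)

open Classical in
lemma XU_lip (U : Set ℝ) [Nonempty (SU (V := V) U)] (β h q N t : ℝ) (x y : Ks V → ℝ) :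
    |XU U (HS (V := V) β h q N t x) - XU U (HS β h q N t y)| ≤ ∑ k, 4 * LS β q N k * |x k - y k| := by
  have h1 := logZf_lip (fun s => HS_lip (V := V) β h q N t x y s)
  have h2 := logZf_lip (S := SU (V := V) U) (H := fun s => HS β h q N t x s.1.1 + HS β h q N t x s.1.2)
    (H' := fun s => HS β h q N t y s.1.1 + HS β h q N t y s.1.2) (d := 2 * ∑ k, LS β q N k * |x k - y k|) fun s => by
      have a := HS_lip (V := V) β h q N t x y s.1.1
      have b := HS_lip (V := V) β h q N t x y s.1.2
      rw [add_sub_add_comm]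
      exact (abs_add_le _ _).trans (by linarith)
  rw [← ZU_eq, ← ZU_eq] at h2
  simp_rw [mul_assoc, ← Finset.mul_sum]
  unfold XU
  rw [abs_le] at *
  constructor <;> linarith [h1.1, h1.2, h2.1, h2.2]

open Classical in
lemma ga2_ind (U : Set ℝ) (H : (V → Bool) → ℝ) : ga2 H (fun s s' => if ov s s' ∈ U then 1 else 0) = ZU U H / Zf H ^ 2 := by
  unfold ga2 ga ZU
  have : ∀ s : V → Bool, (∑ s' : V → Bool, (if ov s s' ∈ U then (1:ℝ) else 0) * exp (H s')) / Zf H * exp (H s)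
      = (∑ s' : V → Bool, if ov s s' ∈ U then exp (H s + H s') else 0) / Zf H := by
    intro s
    rw [div_mul_eq_mul_div, Finset.sum_mul]
    congr 1
    refine Finset.sum_congr rfl fun s' _ => ?_
    split_ifs
    · rw [exp_add]; ring
    · simp
  simp_rw [this]
  rw [← Finset.sum_div, Fintype.sum_prod_type, div_div, sq]

open Classical in
lemma ga2_ind_exp (U : Set ℝ) [Nonempty (SU (V := V) U)] (H : (V → Bool) → ℝ) {l : ℝ} (hl1 : l ≤ 1) :
    ga2 H (fun s s' => if ov s s' ∈ U then 1 else 0) ≤ exp (l * XU U H) := by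
  have hz : 0 < Zf H := Zf_pos H
  have hu : 0 < ZU U H := by rw [ZU_eq]; exact Zf_pos _
  have e : ZU U H / Zf H ^ 2 = exp (XU U H) := by
    rw [XU, exp_sub, exp_log hu, two_mul, exp_add, exp_log hz, sq]
  have hle : ga2 H (fun s s' => if ov s s' ∈ U then 1 else 0) ≤ 1 := by
    have : ga2 H (fun s s' => if ov s s' ∈ U then 1 else 0) ≤ ga2 H (fun _ _ => 1) := by
      refine ga_mono _ fun s => ga_mono _ fun s' => ?_
      simp only
      split_ifs <;> norm_num
    refine this.trans ?_
    unfold ga2; simp_rw [ga_const]; exact le_rfl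
  rw [ga2_ind, e] at hle ⊢
  have hX : XU U H ≤ 0 := exp_le_one_iff.1 hle
  exact exp_le_exp.2 (by nlinarith)

/-- deficit of the free energy -/
def Dd (V : Type*) [Fintype V] [LinearOrder V] (β h q N t : ℝ) : ℝ :=
  Fintype.card V * f1 β h q + sin t ^ 2 * (β ^ 2 * N / 4) * (Fintype.card V / N - q) ^ 2 - phi V β h q N t

lemma Dd_zero (β h q N : ℝ) : Dd V β h q N 0 = 0 := by simp [Dd, phi_zero]

lemma Dd_deriv (β h q N : ℝ) (hq : 0 ≤ q) (hN : 0 < N) (t : ℝ) :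
    HasDerivAt (fun t => Dd V β h q N t) (sin t * cos t * (β ^ 2 * N / 2) *
        ∫ x, ga2 (HS (V := V) β h q N t x) (fun s s' => (ov s s' / N - q) ^ 2) ∂(gm (Ks V))) t := by
  unfold Dd
  refine (((((hasDerivAt_sin t).pow 2).mul_const (β ^ 2 * N / 4)).mul_const ((Fintype.card V / N - q) ^ 2)).const_add
    (Fintype.card V * f1 β h q) |>.sub (phi_deriv β h q N hq hN t)).congr_deriv ?_
  push_cast; ring

end blocks

section exle
variable {V : Type*} [Fintype V] [LinearOrder V]

lemma logZ_integrable (β h q N t : ℝ) : Integrable (fun x => log (Zf (HS (V := V) β h q N t x))) (gm (Ks V)) := by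
  have hl : ∀ x y : Ks V → ℝ, |log (Zf (HS (V := V) β h q N t x)) - log (Zf (HS (V := V) β h q N t y))| ≤ ∑ k, LS β q N k * |x k - y k| :=
    fun x y => logZf_lip fun s => HS_lip β h q N t x y s
  exact (lip_EB (LS_nonneg β q N) hl).integrable () (lip_cont_pi hl).measurable

open Classical in
lemma XU_integrable (U : Set ℝ) [Nonempty (SU (V := V) U)] (β h q N t : ℝ) :
    Integrable (fun x => XU U (HS (V := V) β h q N t x)) (gm (Ks V)) :=
  (lip_EB (fun k => mul_nonneg (by norm_num) (LS_nonneg β q N k)) (XU_lip (V := V) U β h q N t)).integrable ()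
    (lip_cont_pi (XU_lip (V := V) U β h q N t)).measurable

set_option maxHeartbeats 1000000 in
lemma EX_arith {β c K T N q u0 B w w' m f f1' lam D ε G M x : ℝ} (hc : 0 < c) (hK : 0 < K)
    (hT : 0 ≤ T) (hTb : T ≤ β ^ 2) (hN : 1 ≤ N)
    (hB : 0 ≤ B) (hB1 : B ≤ 1) (hq0 : 0 ≤ q) (hq : q ≤ 1) (hu : |u0| ≤ 1) (hx : x = u0 - q) (hm : 0 < m) (hm1 : m ≤ 1)
    (hl : |lam| ≤ K * |x|) (hw : |u0 - w'| ≤ K * |x|) (hww : |w| ≤ q)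
    (hM : M = (q + B) ^ 2 + w' ^ 2 - q ^ 2 - w ^ 2)
    (hG : G = f - 2 * f1' - lam * u0 + T / 2 * ((1 - (q + B)) ^ 2 - (1 - q) ^ 2 + (u0 - w') ^ 2 - m * M))
    (hGc : G ≤ -c * x ^ 2) (hε : 0 ≤ ε) :
    N * (-lam * u0 + K * ε * x ^ 2) + (N - 1) * f + T * N / 2 * (((N - 1) / N - (q + B)) ^ 2 + ((u0 - w') ^ 2 + ε * (2 * K + 1) * x ^ 2)
      - m * M) - 2 * ((N - 1) * f1' + T * N / 4 * ((N - 1) / N - q) ^ 2 - D)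
    ≤ -N * c * x ^ 2 + N * (K + β ^ 2 * (2 * K + 1) / 2) * ε * x ^ 2 + (4 * c + 2 * K + β ^ 2 / 2 * (3 + 4 * K ^ 2) + β ^ 2) + 2 * D := by
  have hN0 : N ≠ 0 := by positivity
  have key : N * (-lam * u0 + K * ε * x ^ 2) + (N - 1) * f + T * N / 2 * (((N - 1) / N - (q + B)) ^ 2 + ((u0 - w') ^ 2 + ε * (2 * K + 1) * x ^ 2)
      - m * M) - 2 * ((N - 1) * f1' + T * N / 4 * ((N - 1) / N - q) ^ 2 - D) =
      (N - 1) * G - lam * u0 + N * K * ε * x ^ 2 + T / 2 * ((1 - (q + B)) ^ 2 - (1 - q) ^ 2 + (u0 - w') ^ 2 - m * M) + T * B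
        + T * N / 2 * ε * (2 * K + 1) * x ^ 2 + 2 * D := by
    rw [hG]; field_simp; ring
  rw [key]
  have hx2 : |x| ≤ 2 := by
    rw [hx]; exact (abs_sub _ _).trans (by rw [abs_of_nonneg hq0]; linarith)
  have hxs : x ^ 2 ≤ 4 := by rw [← sq_abs]; nlinarith [abs_nonneg x]
  have h1 : (N - 1) * G ≤ -N * c * x ^ 2 + 4 * c := by nlinarith [mul_le_mul_of_nonneg_left hGc (by linarith : 0 ≤ N - 1)]
  have h2 : -lam * u0 ≤ 2 * K := by
    have : |-lam * u0| ≤ (K * |x|) * 1 := by rw [abs_mul, abs_neg]; exact mul_le_mul hl hu (abs_nonneg _) (by positivity)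
    have h22 := mul_le_mul_of_nonneg_left hx2 hK.le
    linarith [le_abs_self (-lam * u0)]
  have h3 : (u0 - w') ^ 2 ≤ 4 * K ^ 2 := by
    rw [← sq_abs]
    have h22 := mul_le_mul_of_nonneg_left hx2 hK.le
    have : |u0 - w'| ≤ 2 * K := by linarith
    have h23 : |u0 - w'| ^ 2 ≤ (2 * K) ^ 2 := by gcongr
    linarith [mul_pow 2 K 2]
  have hw2 : w ^ 2 ≤ 1 := by rw [← sq_abs]; nlinarith [abs_nonneg w]
  have h4 : -(m * M) ≤ 2 := by
    have : -2 ≤ M := by rw [hM]; nlinarith [sq_nonneg (q + B), sq_nonneg w']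
    nlinarith
  have h5 : (1 - (q + B)) ^ 2 - (1 - q) ^ 2 ≤ 1 := by nlinarith
  have h6 : T / 2 * ((1 - (q + B)) ^ 2 - (1 - q) ^ 2 + (u0 - w') ^ 2 - m * M) ≤ β ^ 2 / 2 * (3 + 4 * K ^ 2) :=
    (mul_le_mul_of_nonneg_left (by linarith : (1 - (q + B)) ^ 2 - (1 - q) ^ 2 + (u0 - w') ^ 2 - m * M ≤ 3 + 4 * K ^ 2) (by linarith)).trans
      (mul_le_mul_of_nonneg_right (by linarith) (by positivity))
  have h7 : T * B ≤ β ^ 2 := by nlinarith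
  have h8 : T * N / 2 * ε * (2 * K + 1) * x ^ 2 ≤ N * (β ^ 2 * (2 * K + 1) / 2) * ε * x ^ 2 := by
    have : T * (N / 2 * ε * (2 * K + 1) * x ^ 2) ≤ β ^ 2 * (N / 2 * ε * (2 * K + 1) * x ^ 2) := mul_le_mul_of_nonneg_right hTb (by positivity)
    linarith
  linarith

set_option maxHeartbeats 1000000 in
open Classical in
lemma EX_le {β h q c K N t u0 ε : ℝ} (hc : 0 < c) (hK : 0 < K) (hq0 : 0 ≤ q) (hq1 : q ≤ 1) (hN : N = Fintype.card V + 1)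
    (hu : |u0| ≤ 1) (hε : 0 ≤ ε) (hε1 : ε ≤ 1) (U : Set ℝ) [Nonempty (SU (V := V) U)]
    (hU : ∀ u ∈ U, |u / N - u0| ≤ ε * |u0 - q|) (hg : Gap β h q c K t u0) :
    ∫ x, XU U (HS (V := V) β h q N t x) ∂(gm (Ks V)) ≤
      -N * c * (u0 - q) ^ 2 + N * (K + β ^ 2 * (2 * K + 1) / 2) * ε * (u0 - q) ^ 2
        + (4 * c + 2 * K + β ^ 2 / 2 * (3 + 4 * K ^ 2) + β ^ 2) + 2 * Dd V β h q N t := by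
  obtain ⟨Ap, Am, B, η, m, lam, h1, h2, h3, h4, h5, h6, h7, h8, h9, h10, h11⟩ := hg
  have hN1 : 1 ≤ N := by rw [hN]; linarith [(Nat.cast_nonneg (Fintype.card V) : (0:ℝ) ≤ _)]
  have hN0 : 0 < N := by linarith
  have hx2 : |u0 - q| ^ 2 = (u0 - q) ^ 2 := sq_abs _
  have g := guerra_SK (V := V) β h q t hN0 h1 h2 h3 h4 h6 h7 h8 U ((u0 - (Ap - Am + η * B)) ^ 2 + ε * (2 * K + 1) * (u0 - q) ^ 2) (by
    intro u hu'
    have a := hU u hu'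
    have e : u / N - (Ap - Am + η * B) = (u / N - u0) + (u0 - (Ap - Am + η * B)) := by ring
    rw [e, ← hx2, add_sq]
    have b1 : (u / N - u0) ^ 2 ≤ ε * |u0 - q| ^ 2 := by
      rw [← sq_abs]
      have : |u / N - u0| ^ 2 ≤ (ε * |u0 - q|) ^ 2 := by gcongr
      refine this.trans ?_
      rw [mul_pow]
      exact mul_le_mul_of_nonneg_right (by nlinarith) (by positivity)
    have b2 : (u / N - u0) * (u0 - (Ap - Am + η * B)) ≤ (ε * |u0 - q|) * (K * |u0 - q|) := by
      refine (le_abs_self _).trans ?_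
      rw [abs_mul]
      exact mul_le_mul a h10 (abs_nonneg _) (by positivity)
    nlinarith)
  have f := FF0_le (V := V) β h q (N := N) (Ap := Ap) (Am := Am) (B := B) (η := η) t h7 U lam (N * (-lam * u0 + K * ε * (u0 - q) ^ 2)) (by
    intro u hu'
    have a := hU u hu'
    have e : -lam * u = N * (-lam * u0 + (-lam) * (u / N - u0)) := by field_simp; ring
    rw [e]
    have b2 : (-lam) * (u / N - u0) ≤ (K * |u0 - q|) * (ε * |u0 - q|) := by
      refine (le_abs_self _).trans ?_
      rw [abs_mul, abs_neg]
      exact mul_le_mul h9 a (abs_nonneg _) (by positivity)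
    refine mul_le_mul_of_nonneg_left ?_ hN0.le
    rw [← hx2]; nlinarith)
  have ie := XU_integrable (V := V) U β h q N t
  have il := logZ_integrable (V := V) β h q N t
  have iz : Integrable (fun x => log (ZU U (HS (V := V) β h q N t x))) (gm (Ks V)) := by
    refine (ie.add (il.const_mul 2)).congr (Eventually.of_forall fun x => ?_)
    simp only [Pi.add_apply, XU]; ring
  have e : ∫ x, XU U (HS (V := V) β h q N t x) ∂(gm (Ks V)) = ∫ x, log (ZU U (HS (V := V) β h q N t x)) ∂(gm (Ks V)) - 2 * phi V β h q N t := by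
    unfold XU phi
    rw [integral_sub iz (il.const_mul 2), integral_const_mul]
  have hnN : (Fintype.card V : ℝ) = N - 1 := by rw [hN]; ring
  have hphi : phi V β h q N t = (N - 1) * f1 β h q + sin t ^ 2 * β ^ 2 * N / 4 * ((N - 1) / N - q) ^ 2 - Dd V β h q N t := by
    unfold Dd; rw [hnN]; ring
  have hs : sin t ^ 2 ≤ 1 := sin_sq_le_one t
  have := EX_arith (β := β) (T := sin t ^ 2 * β ^ 2) (D := Dd V β h q N t) hc hK (by positivity) (by nlinarith [sq_nonneg β]) hN1 h4 h5 hq0 hq1 hu rfl h7 h8 h9 h10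
    (w := Ap - Am) (by rw [abs_le]; constructor <;> linarith) rfl rfl h11 hε
  rw [e, hphi]
  rw [hnN] at g f
  linarith

end exle

section e2
variable {V : Type*} [Fintype V] [LinearOrder V]

/-- disorder and two-replica average -/
def E2 (β h q N t : ℝ) (f : (V → Bool) → (V → Bool) → ℝ) : ℝ := ∫ x, ga2 (HS (V := V) β h q N t x) f ∂(gm (Ks V))

lemma ga2_integrable (β h q N t : ℝ) (f : (V → Bool) → (V → Bool) → ℝ) :
    Integrable (fun x => ga2 (HS (V := V) β h q N t x) f) (gm (Ks V)) := by
  obtain ⟨C, hC0, hC⟩ := exists_bd (fun p : (V → Bool) × (V → Bool) => f p.1 p.2)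
  refine bdd_integrable ?_ C fun x => ga_abs_le _ fun s => ga_abs_le _ fun s' => hC (s, s')
  exact measurable_ga (fun s => Hy_meas _ _ s) fun s => measurable_ga (fun s => Hy_meas _ _ s) fun s => measurable_const

lemma E2_mono (β h q N t : ℝ) {f g : (V → Bool) → (V → Bool) → ℝ} (hfg : ∀ s s', f s s' ≤ g s s') :
    E2 β h q N t f ≤ E2 β h q N t g :=
  integral_mono (ga2_integrable _ _ _ _ _ _) (ga2_integrable _ _ _ _ _ _) fun x => ga_mono _ fun s => ga_mono _ fun s' => hfg s s'

lemma E2_add (β h q N t : ℝ) (f g : (V → Bool) → (V → Bool) → ℝ) :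
    E2 β h q N t (fun s s' => f s s' + g s s') = E2 β h q N t f + E2 β h q N t g := by
  unfold E2
  rw [← integral_add (ga2_integrable _ _ _ _ _ _) (ga2_integrable _ _ _ _ _ _)]
  simp only [ga2, ga_add]

lemma E2_mul (β h q N t a : ℝ) (f : (V → Bool) → (V → Bool) → ℝ) :
    E2 β h q N t (fun s s' => a * f s s') = a * E2 β h q N t f := by
  unfold E2
  rw [← integral_const_mul]
  simp only [ga2, ga_mul_const]

lemma E2_const (β h q N t a : ℝ) : E2 (V := V) β h q N t (fun s s' => a) = a := by
  unfold E2 ga2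
  simp [ga_const]

lemma E2_sum {ι : Type*} (A : Finset ι) (β h q N t : ℝ) (f : ι → (V → Bool) → (V → Bool) → ℝ) :
    E2 β h q N t (fun s s' => ∑ i ∈ A, f i s s') = ∑ i ∈ A, E2 β h q N t (f i) := by
  unfold E2
  rw [← integral_finsetSum _ fun i _ => ga2_integrable _ _ _ _ _ _]
  simp only [ga2, ga_sum]

lemma E2_nonneg (β h q N t : ℝ) {f : (V → Bool) → (V → Bool) → ℝ} (hf : ∀ s s', 0 ≤ f s s') :
    0 ≤ E2 β h q N t f :=
  integral_nonneg fun x => ga_nonneg _ fun s => ga_nonneg _ fun s' => hf s s'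

end e2

open Classical in
lemma block {β h q : ℝ} (hβ : 0 < β) (hq : isFixedq β h q) (hAT : ATcond β h q) (hATp : ATplus β h q) :
    ∃ c > 0, ∃ c4 > 0, ∃ C2 > 0, ∃ ε > 0, ε ≤ 1 ∧ ∀ (V : Type) [Fintype V] [LinearOrder V] (N t u0 : ℝ) (U : Set ℝ),
      N = Fintype.card V + 1 → 0 ≤ sin t → |u0| ≤ 1 → (∀ u ∈ U, |u / N - u0| ≤ ε * |u0 - q|) →
      C2 + 2 * Dd V β h q N t ≤ N * c / 4 * (u0 - q) ^ 2 →
      E2 (V := V) β h q N t (fun s s' => if ov s s' ∈ U then 1 else 0) ≤ exp (-(c4 * N * (u0 - q) ^ 4)) := by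
  obtain ⟨c, hc, K, hK, H⟩ := gap_all hβ hq hAT hATp
  set C1 := K + β ^ 2 * (2 * K + 1) / 2 with hC1
  set C2 := 4 * c + 2 * K + β ^ 2 / 2 * (3 + 4 * K ^ 2) + β ^ 2 with hC2
  set C3 := 64 * β ^ 2 + c with hC3
  have hC1p : 0 < C1 := by positivity
  refine ⟨c, hc, c ^ 2 / (64 * C3), by positivity, C2, by positivity, min 1 (c / (2 * C1)), by positivity, min_le_left _ _, ?_⟩
  intro V _ _ N t u0 U hN ht hu hU hD
  set ε := min 1 (c / (2 * C1)) with hε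
  have hN1 : 1 ≤ N := by rw [hN]; linarith [(Nat.cast_nonneg (Fintype.card V) : (0:ℝ) ≤ _)]
  by_cases hne : Nonempty (SU (V := V) U)
  · have hx4 : (u0 - q) ^ 2 ≤ 4 := by
      have h1 := abs_le.1 hu
      nlinarith [h1.1, h1.2, hq.1, hq.2.1]
    have hX := EX_le (V := V) hc hK hq.1.le hq.2.1.le hN hu (by positivity) (min_le_left _ _) U hU (H t u0 ht hu)
    rw [← hC1, ← hC2] at hX
    set y := N * c / 4 * (u0 - q) ^ 2 with hy
    have hε2 : C1 * ε ≤ c / 2 := by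
      have : C1 * ε ≤ C1 * (c / (2 * C1)) := mul_le_mul_of_nonneg_left (min_le_right _ _) hC1p.le
      refine this.trans (le_of_eq ?_); field_simp
    have hE : ∫ x, XU U (HS (V := V) β h q N t x) ∂(gm (Ks V)) ≤ -y := by
      have : N * (u0 - q) ^ 2 * (C1 * ε) ≤ N * (u0 - q) ^ 2 * (c / 2) := mul_le_mul_of_nonneg_left hε2 (by positivity)
      rw [hy] at hD ⊢
      linarith
    set l := y / (2 * C3 * N) with hl
    have hy0 : 0 ≤ y := by positivity
    have hl0 : 0 ≤ l := by positivity
    have hl1 : l ≤ 1 := by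
      rw [hl, div_le_one (by positivity), hy]
      have : N * c * (u0 - q) ^ 2 ≤ N * c * 4 := mul_le_mul_of_nonneg_left hx4 (by positivity)
      have : 0 ≤ 64 * β ^ 2 * N := by positivity
      rw [hC3]; nlinarith
    have hL := LS_sum (V := V) β q N hq.1.le hq.2.1.le (by linarith) (by linarith)
    have hcon := concentration l (fun k => mul_nonneg (by norm_num) (LS_nonneg β q N k)) (XU_lip (V := V) U β h q N t)
    have h1 : E2 (V := V) β h q N t (fun s s' => if ov s s' ∈ U then 1 else 0) ≤ ∫ x, exp (l * XU U (HS (V := V) β h q N t x)) ∂(gm (Ks V)) := by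
      refine integral_mono (ga2_integrable _ _ _ _ _ _) ?_ fun x => ga2_ind_exp U _ hl1
      exact (lip_exp_EB (fun k => mul_nonneg (by norm_num) (LS_nonneg β q N k)) (XU_lip (V := V) U β h q N t) l).integrable ()
        ((lip_cont_pi (XU_lip (V := V) U β h q N t)).measurable.const_mul l).exp
    refine h1.trans (hcon.trans (exp_le_exp.2 ?_))
    have h2 : l * ∫ x, XU U (HS (V := V) β h q N t x) ∂(gm (Ks V)) ≤ l * (-y) := mul_le_mul_of_nonneg_left hE hl0
    have h3 : l ^ 2 * ∑ k : Ks V, (4 * LS β q N k) ^ 2 ≤ l ^ 2 * (C3 * N) := mul_le_mul_of_nonneg_left (hL.trans (by rw [hC3]; nlinarith)) (by positivity)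
    have h4 : l * (-y) + l ^ 2 * (C3 * N) = -(c ^ 2 / (64 * C3) * N * (u0 - q) ^ 4) := by
      rw [hl, hy]; field_simp; ring
    linarith
  · have : ∀ s s' : V → Bool, ov s s' ∉ U := fun s s' hs => hne ⟨⟨(s, s'), hs⟩⟩
    simp only [this, if_false, E2_const]
    positivity

lemma geom_cover {ρ Δ w : ℝ} (hρ : 1 < ρ) (hΔ : 0 < Δ) (R : ℕ) (hR : |w| < ρ ^ R * Δ) :
    w ^ 8 ≤ Δ ^ 8 + ∑ r ∈ Finset.range R, (ρ ^ (r + 1) * Δ) ^ 8 *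
      ((if ρ ^ r * Δ ≤ w ∧ w ≤ ρ * (ρ ^ r * Δ) then 1 else 0) + (if ρ ^ r * Δ ≤ -w ∧ -w ≤ ρ * (ρ ^ r * Δ) then 1 else 0)) := by
  have hnn : ∀ r ∈ Finset.range R, 0 ≤ (ρ ^ (r + 1) * Δ) ^ 8 *
      (((if ρ ^ r * Δ ≤ w ∧ w ≤ ρ * (ρ ^ r * Δ) then 1 else 0) + (if ρ ^ r * Δ ≤ -w ∧ -w ≤ ρ * (ρ ^ r * Δ) then 1 else 0) : ℝ)) := by
    intro r _
    refine mul_nonneg (by positivity) (add_nonneg ?_ ?_) <;> split_ifs <;> norm_num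
  have hw : w ^ 8 = |w| ^ 8 := (Even.pow_abs (by decide) w).symm
  by_cases hs : |w| < Δ
  · have : |w| ^ 8 ≤ Δ ^ 8 := by gcongr
    rw [hw]; linarith [Finset.sum_nonneg hnn]
  · push Not at hs
    obtain ⟨r, h1, h2⟩ := exists_nat_pow_near (x := |w| / Δ) (y := ρ) (by rwa [one_le_div hΔ]) hρ
    rw [le_div_iff₀ hΔ] at h1
    rw [div_lt_iff₀ hΔ] at h2
    have hr : r ∈ Finset.range R := by
      rw [Finset.mem_range]
      by_contra hcon
      push Not at hcon
      have : ρ ^ R ≤ ρ ^ r := pow_le_pow_right₀ hρ.le hcon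
      nlinarith
    refine le_trans ?_ (le_add_of_nonneg_left (by positivity))
    refine le_trans ?_ (Finset.single_le_sum hnn hr)
    have h3 : |w| ^ 8 ≤ (ρ ^ (r + 1) * Δ) ^ 8 := by gcongr
    have h2' : |w| ≤ ρ * (ρ ^ r * Δ) := by rw [pow_succ] at h2; nlinarith
    rw [hw]
    refine h3.trans (le_mul_of_one_le_right (by positivity) ?_)
    rcases abs_cases w with ⟨e, _⟩ | ⟨e, _⟩ <;> rw [e] at h1 h2'
    · rw [if_pos ⟨h1, h2'⟩]; split_ifs <;> norm_num
    · rw [if_pos (c := ρ ^ r * Δ ≤ -w ∧ -w ≤ ρ * (ρ ^ r * Δ)) ⟨h1, h2'⟩]; split_ifs <;> norm_num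

lemma term_eq {z ρ Δ c : ℝ} (hz : 0 < z) (hc : 0 < c) :
    (z * ρ * Δ) ^ 8 * (2 * (6 / (c * z ^ 4) ^ 3)) = Δ ^ 8 * (2 * (ρ ^ 8 * (6 / c ^ 3))) * (z ^ 4)⁻¹ := by
  field_simp

lemma exp_neg_le_cube {x : ℝ} (hx : 0 < x) : exp (-x) ≤ 6 / x ^ 3 := by
  rw [exp_neg, le_div_iff₀ (by positivity), inv_mul_le_iff₀ (exp_pos _)]
  have := pow_div_factorial_le_exp x hx.le 3
  simp [Nat.factorial] at this
  linarith

lemma mom8 {β h q : ℝ} (hβ : 0 < β) (hq : isFixedq β h q) (hAT : ATcond β h q) (hATp : ATplus β h q) :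
    ∃ K > 0, ∀ (V : Type) [Fintype V] [LinearOrder V] (N t : ℝ),
      N = Fintype.card V + 1 → 0 ≤ sin t → 0 ≤ Dd V β h q N t →
      E2 (V := V) β h q N t (fun s s' => (ov s s' / N - q) ^ 8) ≤ K * (Dd V β h q N t / N + 1 / √N) ^ 4 := by
  classical
  obtain ⟨c, hc, c4, hc4, C2, hC2, ε, hε, hε1, H⟩ := block hβ hq hAT hATp
  set ρ := 1 + ε with hρ
  have hρ1 : 1 < ρ := by linarith
  set A := 4 * (C2 + 2) / c + 1 with hA
  have hA1 : 1 ≤ A := by have : 0 ≤ 4 * (C2 + 2) / c := by positivity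
                         linarith
  set g := (ρ ^ 4)⁻¹ with hg
  have hg0 : 0 ≤ g := by positivity
  have hg1 : g < 1 := inv_lt_one_of_one_lt₀ (one_lt_pow₀ hρ1 (by norm_num))
  have hg1' : 0 < 1 - g := by linarith
  refine ⟨(1 + 2 * (ρ ^ 8 * (6 / c4 ^ 3)) * (1 - g)⁻¹) * A ^ 4, by positivity, ?_⟩
  intro V _ _ N t hN ht hD
  have hN1 : 1 ≤ N := by rw [hN]; linarith [(Nat.cast_nonneg (Fintype.card V) : (0:ℝ) ≤ _)]
  have hN0 : 0 < N := by linarith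
  have hsN : 1 ≤ √N := one_le_sqrt.2 hN1
  have hNs : √N ^ 2 = N := sq_sqrt hN0.le
  set D := Dd V β h q N t with hDd
  set δ := A * (D / N + 1 / √N) with hδ
  have hδ0 : 0 < δ := by positivity
  set Δ := √δ with hΔ
  have hΔ0 : 0 < Δ := sqrt_pos.2 hδ0
  have hΔ2 : Δ ^ 2 = δ := sq_sqrt hδ0.le
  have hΔ4 : 1 ≤ N * Δ ^ 4 := by
    have h1 : 1 / √N ≤ δ := by
      rw [hδ]
      have : 0 ≤ D / N := by positivity
      have : 0 < 1 / √N := by positivity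
      nlinarith
    have h2 : (1 / √N) ^ 2 ≤ δ ^ 2 := by gcongr
    rw [div_pow, hNs, one_pow, div_le_iff₀ hN0] at h2
    calc 1 ≤ δ ^ 2 * N := h2
      _ = N * Δ ^ 4 := by rw [← hΔ2]; ring
  have hcond : ∀ a, Δ ≤ a → C2 + 2 * D ≤ N * c / 4 * a ^ 2 := by
    intro a ha
    have h1 : δ ≤ a ^ 2 := by rw [← hΔ2]; gcongr
    have h2 : N * c / 4 * δ ≤ N * c / 4 * a ^ 2 := mul_le_mul_of_nonneg_left h1 (by positivity)
    refine le_trans ?_ h2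
    have h3 : N * c / 4 * δ = (A * c / 4) * (D + √N) := by
      rw [hδ]
      have : N / √N = √N := by rw [div_eq_iff (by positivity), ← sq, hNs]
      calc _ = A * c / 4 * (N * (D / N) + N / √N) := by ring
        _ = _ := by rw [this, mul_div_cancel₀ _ hN0.ne']
    have h4 : C2 + 2 ≤ A * c / 4 := by
      rw [hA]; have : (4 * (C2 + 2) / c + 1) * c / 4 = C2 + 2 + c / 4 := by field_simp
      linarith
    rw [h3]
    have h5 : (C2 + 2) * (D + √N) ≤ A * c / 4 * (D + √N) := mul_le_mul_of_nonneg_right h4 (by positivity)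
    nlinarith
  have hovN : ∀ s s' : V → Bool, |ov s s' / N| < 1 := by
    intro s s'
    rw [abs_div, abs_of_pos hN0, div_lt_one hN0]
    have := ov_abs_le s s'
    linarith
  have hblk : ∀ a, Δ ≤ a → ∀ σ : ℝ, σ = 1 ∨ σ = -1 →
      E2 (V := V) β h q N t (fun s s' => if a ≤ σ * (ov s s' / N - q) ∧ σ * (ov s s' / N - q) ≤ ρ * a then 1 else 0) ≤ exp (-(c4 * N * a ^ 4)) := by
    intro a ha σ hσ
    have ha0 : 0 < a := by linarith
    have hσ2 : σ * σ = 1 := by rcases hσ with rfl | rfl <;> norm_num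
    have haσ : |σ * a| = a := by
      rcases hσ with rfl | rfl
      · rw [one_mul, abs_of_pos ha0]
      · rw [neg_one_mul, abs_neg, abs_of_pos ha0]
    by_cases hu : |q + σ * a| ≤ 1
    · have := H V N t (q + σ * a) {u | a ≤ σ * (u / N - q) ∧ σ * (u / N - q) ≤ ρ * a} hN ht hu ?_ ?_
      · rw [add_sub_cancel_left, mul_pow] at this
        have e : σ ^ 4 = 1 := by calc σ ^ 4 = (σ * σ) * (σ * σ) := by ring
                                 _ = 1 := by rw [hσ2]; norm_num
        rw [e, one_mul] at this
        convert this
        exact Iff.rfl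
      · rintro u ⟨h1, h2⟩
        rw [add_sub_cancel_left, haσ, abs_le]
        rw [hρ] at h2
        rcases hσ with rfl | rfl
        · constructor <;> nlinarith
        · constructor <;> nlinarith
      · rw [add_sub_cancel_left, mul_pow]
        have e : σ ^ 2 = 1 := by rw [sq, hσ2]
        rw [e, one_mul]; exact hcond a ha
    · have : ∀ s s' : V → Bool, ¬ (a ≤ σ * (ov s s' / N - q) ∧ σ * (ov s s' / N - q) ≤ ρ * a) := by
        rintro s s' ⟨h1, h2⟩
        apply hu
        have h3 := abs_lt.1 (hovN s s')
        have := hq.1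
        have := hq.2.1
        rw [abs_le]
        rcases hσ with rfl | rfl
        · constructor <;> linarith
        · constructor <;> linarith
      simp only [this, if_false, E2_const]
      positivity
  obtain ⟨R, hR⟩ := pow_unbounded_of_one_lt (2 / Δ) hρ1
  have hcov : E2 (V := V) β h q N t (fun s s' => (ov s s' / N - q) ^ 8) ≤ E2 (V := V) β h q N t (fun s s' =>
      Δ ^ 8 + ∑ r ∈ Finset.range R, (ρ ^ (r + 1) * Δ) ^ 8 *
      ((if ρ ^ r * Δ ≤ 1 * (ov s s' / N - q) ∧ 1 * (ov s s' / N - q) ≤ ρ * (ρ ^ r * Δ) then 1 else 0)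
        + (if ρ ^ r * Δ ≤ (-1) * (ov s s' / N - q) ∧ (-1) * (ov s s' / N - q) ≤ ρ * (ρ ^ r * Δ) then 1 else 0))) := by
    refine E2_mono _ _ _ _ _ fun s s' => ?_
    simp only [one_mul, neg_one_mul]
    refine geom_cover hρ1 hΔ0 R ?_
    rw [div_lt_iff₀ hΔ0] at hR
    refine lt_of_le_of_lt ?_ hR
    refine (abs_sub _ _).trans ?_
    have := hovN s s'
    rw [abs_of_pos hq.1]
    linarith [hq.2.1]
  refine hcov.trans ?_
  rw [E2_add, E2_const, E2_sum]
  simp_rw [E2_mul, E2_add]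
  have hterm : ∀ r ∈ Finset.range R, (ρ ^ (r + 1) * Δ) ^ 8 * (E2 (V := V) β h q N t (fun s s' => if ρ ^ r * Δ ≤ 1 * (ov s s' / N - q) ∧ 1 * (ov s s' / N - q) ≤ ρ * (ρ ^ r * Δ) then 1 else 0)
        + E2 (V := V) β h q N t (fun s s' => if ρ ^ r * Δ ≤ (-1) * (ov s s' / N - q) ∧ (-1) * (ov s s' / N - q) ≤ ρ * (ρ ^ r * Δ) then 1 else 0))
      ≤ Δ ^ 8 * (2 * (ρ ^ 8 * (6 / c4 ^ 3))) * g ^ r := by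
    intro r _
    have ha : Δ ≤ ρ ^ r * Δ := le_mul_of_one_le_left hΔ0.le (one_le_pow₀ hρ1.le)
    have b1 := hblk _ ha 1 (Or.inl rfl)
    have b2 := hblk _ ha (-1) (Or.inr rfl)
    have hy : c4 * (ρ ^ r) ^ 4 ≤ c4 * N * (ρ ^ r * Δ) ^ 4 := by
      calc c4 * (ρ ^ r) ^ 4 = (c4 * (ρ ^ r) ^ 4) * 1 := by ring
        _ ≤ (c4 * (ρ ^ r) ^ 4) * (N * Δ ^ 4) := mul_le_mul_of_nonneg_left hΔ4 (by positivity)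
        _ = _ := by ring
    have b3 : exp (-(c4 * N * (ρ ^ r * Δ) ^ 4)) ≤ 6 / (c4 * (ρ ^ r) ^ 4) ^ 3 :=
      (exp_le_exp.2 (neg_le_neg hy)).trans (exp_neg_le_cube (by positivity))
    calc _ ≤ (ρ ^ (r + 1) * Δ) ^ 8 * (2 * (6 / (c4 * (ρ ^ r) ^ 4) ^ 3)) := by
            refine mul_le_mul_of_nonneg_left ?_ (by positivity)
            linarith
      _ = _ := by
        have e : (ρ ^ 4) ^ r = (ρ ^ r) ^ 4 := pow_right_comm _ _ _
        rw [hg, inv_pow, e, pow_succ]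
        exact term_eq (pow_pos (by linarith) r) hc4
  refine (add_le_add_right (Finset.sum_le_sum hterm) _).trans ?_
  rw [← Finset.mul_sum]
  have hgs : ∑ r ∈ Finset.range R, g ^ r ≤ (1 - g)⁻¹ := by
    rw [← tsum_geometric_of_lt_one hg0 hg1]
    exact (summable_geometric_of_lt_one hg0 hg1).sum_le_tsum _ (fun i _ => by positivity)
  have hΔ8 : Δ ^ 8 = A ^ 4 * (D / N + 1 / √N) ^ 4 := by
    calc Δ ^ 8 = (Δ ^ 2) ^ 4 := by ring
      _ = _ := by rw [hΔ2, hδ, mul_pow]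
  calc _ ≤ Δ ^ 8 + Δ ^ 8 * (2 * (ρ ^ 8 * (6 / c4 ^ 3))) * (1 - g)⁻¹ := by gcongr
    _ = _ := by
      rw [hΔ8]
      generalize (D / N + 1 / √N) ^ 4 = z1
      generalize ρ ^ 8 * (6 / c4 ^ 3) = z2
      generalize (1 - g)⁻¹ = z3
      generalize A ^ 4 = z4
      ring

lemma mom2 {β h q : ℝ} (hβ : 0 < β) (hq : isFixedq β h q) (hAT : ATcond β h q) (hATp : ATplus β h q) :
    ∃ K > 0, ∀ (V : Type) [Fintype V] [LinearOrder V] (N t : ℝ),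
      N = Fintype.card V + 1 → 0 ≤ sin t → 0 ≤ Dd V β h q N t →
      E2 (V := V) β h q N t (fun s s' => (ov s s' / N - q) ^ 2) ≤ K * (Dd V β h q N t / N + 1 / √N) := by
  obtain ⟨K, hK, H⟩ := mom8 hβ hq hAT hATp
  refine ⟨1 + K, by positivity, fun V _ _ N t hN ht hD => ?_⟩
  have hN1 : 1 ≤ N := by rw [hN]; linarith [(Nat.cast_nonneg (Fintype.card V) : (0:ℝ) ≤ _)]
  have h1 := H V N t hN ht hD
  set δ := Dd V β h q N t / N + 1 / √N with hδ
  have hδ0 : 0 < δ := by positivity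
  have h2 : E2 (V := V) β h q N t (fun s s' => (ov s s' / N - q) ^ 2) ≤ E2 (V := V) β h q N t (fun s s' => δ + (δ ^ 3)⁻¹ * (ov s s' / N - q) ^ 8) := by
    refine E2_mono _ _ _ _ _ fun s s' => ?_
    set y := (ov s s' / N - q) ^ 2 with hy
    have hy0 : 0 ≤ y := by positivity
    have e : (ov s s' / N - q) ^ 8 = y ^ 4 := by rw [hy]; ring
    rw [e]
    by_cases hyd : y ≤ δ
    · have : 0 ≤ (δ ^ 3)⁻¹ * y ^ 4 := by positivity
      linarith
    · push Not at hyd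
      have h3 : δ ^ 3 ≤ y ^ 3 := by gcongr
      have : y ≤ (δ ^ 3)⁻¹ * y ^ 4 := by
        rw [le_inv_mul_iff₀ (by positivity)]
        calc δ ^ 3 * y ≤ y ^ 3 * y := mul_le_mul_of_nonneg_right h3 hy0
          _ = y ^ 4 := by ring
      linarith
  refine h2.trans ?_
  rw [E2_add, E2_const, E2_mul]
  have h3 : (δ ^ 3)⁻¹ * E2 (V := V) β h q N t (fun s s' => (ov s s' / N - q) ^ 8) ≤ (δ ^ 3)⁻¹ * (K * δ ^ 4) :=
    mul_le_mul_of_nonneg_left h1 (by positivity)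
  have h4 : (δ ^ 3)⁻¹ * (K * δ ^ 4) = K * δ := by field_simp
  linarith

lemma sc_nonneg {t : ℝ} (ht : t ∈ Set.Icc 0 (π / 2)) : 0 ≤ sin t ∧ 0 ≤ cos t :=
  ⟨sin_nonneg_of_nonneg_of_le_pi ht.1 (by linarith [ht.2, pi_pos]), cos_nonneg_of_neg_pi_div_two_le_of_le (by linarith [ht.1, pi_pos]) ht.2⟩

lemma Dd_nonneg {V : Type} [Fintype V] [LinearOrder V] (β h q N : ℝ) (hq : 0 ≤ q) (hN : 0 < N) {t : ℝ} (ht : t ∈ Set.Icc 0 (π / 2)) :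
    0 ≤ Dd V β h q N t := by
  have hm : MonotoneOn (fun t => Dd V β h q N t) (Set.Icc 0 (π / 2)) := by
    refine monotoneOn_of_deriv_nonneg (convex_Icc _ _) (fun t _ => (Dd_deriv β h q N hq hN t).continuousAt.continuousWithinAt)
      (fun t _ => (Dd_deriv β h q N hq hN t).differentiableAt.differentiableWithinAt) fun t ht => ?_
    rw [(Dd_deriv β h q N hq hN t).deriv]
    obtain ⟨a, b⟩ := sc_nonneg (interior_subset ht)
    have : 0 ≤ ∫ x, ga2 (HS (V := V) β h q N t x) (fun s s' => (ov s s' / N - q) ^ 2) ∂(gm (Ks V)) :=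
      E2_nonneg β h q N t fun s s' => sq_nonneg _
    positivity
  have := hm (Set.left_mem_Icc.2 (by positivity)) ht ht.1
  simpa [Dd_zero] using this

lemma Dd_le {β h q : ℝ} (hβ : 0 < β) (hq : isFixedq β h q) (hAT : ATcond β h q) (hATp : ATplus β h q) :
    ∃ K > 0, ∀ (V : Type) [Fintype V] [LinearOrder V] (N : ℝ), N = Fintype.card V + 1 → Dd V β h q N (π / 2) ≤ K * √N := by
  obtain ⟨K, hK, H⟩ := mom2 hβ hq hAT hATp
  set K' := β ^ 2 / 2 * K with hK'
  have hK'0 : 0 < K' := by positivity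
  refine ⟨exp (K' * (π / 2)), by positivity, fun V _ _ N hN => ?_⟩
  have hN1 : 1 ≤ N := by rw [hN]; linarith [(Nat.cast_nonneg (Fintype.card V) : (0:ℝ) ≤ _)]
  have hN0 : 0 < N := by linarith
  have hNs : √N ^ 2 = N := sq_sqrt hN0.le
  have hd : ∀ t, HasDerivAt (fun t => exp (-(K' * t)) * (Dd V β h q N t + √N))
      (exp (-(K' * t)) * (-(K' * 1)) * (Dd V β h q N t + √N) + exp (-(K' * t)) * (sin t * cos t * (β ^ 2 * N / 2) *
        ∫ x, ga2 (HS (V := V) β h q N t x) (fun s s' => (ov s s' / N - q) ^ 2) ∂(gm (Ks V)))) t := fun t =>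
    ((((hasDerivAt_id t).const_mul K').neg).exp).mul ((Dd_deriv β h q N hq.1.le hN0 t).add_const _)
  have hm : AntitoneOn (fun t => exp (-(K' * t)) * (Dd V β h q N t + √N)) (Set.Icc 0 (π / 2)) := by
    refine antitoneOn_of_deriv_nonpos (convex_Icc _ _) (fun t _ => (hd t).continuousAt.continuousWithinAt)
      (fun t _ => (hd t).differentiableAt.differentiableWithinAt) fun t ht => ?_
    rw [(hd t).deriv]
    have ht' := interior_subset ht
    obtain ⟨a, b⟩ := sc_nonneg ht'
    have hD := Dd_nonneg (V := V) β h q N hq.1.le hN0 ht'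
    have h2 := H V N t hN a hD
    have h0 : 0 ≤ E2 (V := V) β h q N t (fun s s' => (ov s s' / N - q) ^ 2) := E2_nonneg β h q N t fun s s' => sq_nonneg _
    change _ * _ * _ + _ * (_ * E2 (V := V) β h q N t (fun s s' => (ov s s' / N - q) ^ 2)) ≤ 0
    have hsc : sin t * cos t ≤ 1 := mul_le_one₀ (sin_le_one t) b (cos_le_one t)
    have h3 : sin t * cos t * (β ^ 2 * N / 2) * E2 (V := V) β h q N t (fun s s' => (ov s s' / N - q) ^ 2)
        ≤ 1 * (β ^ 2 * N / 2) * (K * (Dd V β h q N t / N + 1 / √N)) := by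
      gcongr
    have h4 : 1 * (β ^ 2 * N / 2) * (K * (Dd V β h q N t / N + 1 / √N)) = K' * (Dd V β h q N t + √N) := by
      have : N / √N = √N := by rw [div_eq_iff (by positivity), ← sq, hNs]
      calc _ = K' * (N * (Dd V β h q N t / N) + N / √N) := by rw [hK']; ring
        _ = _ := by rw [this, mul_div_cancel₀ _ hN0.ne']
    have h5 := mul_le_mul_of_nonneg_left (h3.trans h4.le) (exp_pos (-(K' * t))).le
    linarith
  have := hm (Set.left_mem_Icc.2 (by positivity)) (Set.right_mem_Icc.2 (by positivity)) (by positivity : (0:ℝ) ≤ π / 2)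
  simp only [Dd_zero, mul_zero, neg_zero, exp_zero, one_mul, zero_add] at this
  rw [exp_neg, inv_mul_le_iff₀ (exp_pos _)] at this
  linarith [sqrt_nonneg N]

/-- eighth moment of the overlap deviation -/
theorem ov8 {β h q : ℝ} (hβ : 0 < β) (hq : isFixedq β h q) (hAT : ATcond β h q) (hATp : ATplus β h q) :
    ∃ K > 0, ∀ (V : Type) [Fintype V] [LinearOrder V] (N : ℝ), N = Fintype.card V + 1 →
      E2 (V := V) β h q N (π / 2) (fun s s' => (ov s s' / N - q) ^ 8) ≤ K / N ^ 2 := by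
  obtain ⟨K, hK, H⟩ := mom8 hβ hq hAT hATp
  obtain ⟨K2, hK2, H2⟩ := Dd_le hβ hq hAT hATp
  refine ⟨K * (K2 + 1) ^ 4, by positivity, fun V _ _ N hN => ?_⟩
  have hN1 : 1 ≤ N := by rw [hN]; linarith [(Nat.cast_nonneg (Fintype.card V) : (0:ℝ) ≤ _)]
  have hN0 : 0 < N := by linarith
  have hNs : √N ^ 2 = N := sq_sqrt hN0.le
  have hD := Dd_nonneg (V := V) β h q N hq.1.le hN0 (t := π / 2) (Set.right_mem_Icc.2 (by positivity))
  refine (H V N (π / 2) hN (by simp) hD).trans ?_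
  have h1 : Dd V β h q N (π / 2) / N + 1 / √N ≤ (K2 + 1) / √N := by
    have : Dd V β h q N (π / 2) / N ≤ K2 * √N / N := div_le_div_of_nonneg_right (H2 V N hN) hN0.le
    have e : K2 * √N / N = K2 / √N := by rw [div_eq_div_iff hN0.ne' (by positivity)]; rw [mul_assoc, ← sq, hNs]
    rw [add_div]; linarith
  calc _ ≤ K * ((K2 + 1) / √N) ^ 4 := by gcongr
    _ = _ := by rw [div_pow, ← hNs]; field_simp; ring_nf; simp [sqrt_sq (sqrt_nonneg _)]

section replicas
variable {S ι ι' κ : Type*} [Fintype S] [Nonempty S] [Fintype ι] [Fintype ι'] [DecidableEq ι] [DecidableEq ι'] [Fintype κ]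

lemma ga_equiv {S' : Type*} [Fintype S'] (e : S' ≃ S) (H c : S → ℝ) :
    ga H c = ga (fun s => H (e s)) (fun s => c (e s)) := by
  unfold ga Zf
  rw [← e.sum_comp (fun σ => exp (H σ)), ← e.sum_comp (fun σ => c σ * exp (H σ))]

/-- Gibbs average over replicas -/
def gR (H : S → ℝ) (F : (ι → S) → ℝ) : ℝ := ga (fun τ : ι → S => ∑ u, H (τ u)) F

lemma gR_prod (H : S → ℝ) (φ : ι → S → ℝ) : gR H (fun τ : ι → S => ∏ u, φ u (τ u)) = ∏ u, ga H (φ u) := by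
  unfold gR ga Zf
  rw [Finset.prod_div_distrib]
  simp_rw [exp_sum, ← Finset.prod_mul_distrib]
  rw [Finset.prod_univ_sum, Finset.prod_univ_sum]
  simp [Fintype.piFinset_univ]

lemma gR_expand {R : Type*} [Fintype R] (H : S → ℝ) (G : R → ℝ) (φ : R → ι → S → ℝ) :
    gR H (fun τ : ι → S => ∑ r, G r * ∏ u, φ r u (τ u)) = ∑ r, G r * ∏ u, ga H (φ r u) := by
  simp_rw [← gR_prod]
  unfold gR
  rw [ga_sum]; simp_rw [ga_mul_const]

lemma gR_marg (j : ι → ι') (hj : Function.Injective j) (H : S → ℝ) (G : (ι → S) → ℝ) :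
    gR H (fun τ : ι' → S => G (fun a => τ (j a))) = gR H G := by
  classical
  have h1 : ∀ ρ : ι → S, G ρ = ∑ ρ0 : ι → S, G ρ0 * ∏ a, (if ρ a = ρ0 a then (1:ℝ) else 0) := by
    intro ρ
    rw [Finset.sum_eq_single ρ]
    · simp
    · intro b _ hb
      obtain ⟨a, ha⟩ := Function.ne_iff.1 hb
      rw [Finset.prod_eq_zero (Finset.mem_univ a) (if_neg (Ne.symm ha)), mul_zero]
    · simp
  have h2 : ∀ (ρ0 : ι → S) (τ : ι' → S), ∏ a, (if τ (j a) = ρ0 a then (1:ℝ) else 0) =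
      ∏ u, (fun s => ∏ a, (if j a = u then (if s = ρ0 a then (1:ℝ) else 0) else 1)) (τ u) := by
    intro ρ0 τ
    refine Fintype.prod_of_injective j hj _ _ (fun u hu => ?_) (fun a => ?_)
    · exact Finset.prod_eq_one fun a _ => if_neg fun h => hu ⟨a, h⟩
    · simp only [hj.eq_iff]; simp
  have e1 : (fun τ : ι' → S => G (fun a => τ (j a))) = fun τ => ∑ ρ0 : ι → S, G ρ0 *
      ∏ u, (fun s => ∏ a, (if j a = u then (if s = ρ0 a then (1:ℝ) else 0) else 1)) (τ u) := by
    ext τ; rw [h1]; simp_rw [← h2]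
  have e2 : G = fun ρ => ∑ ρ0 : ι → S, G ρ0 * ∏ a, (fun s => if s = ρ0 a then (1:ℝ) else 0) (ρ a) := by
    ext ρ; exact h1 ρ
  rw [e1]
  conv_rhs => rw [e2]
  rw [gR_expand H G (fun (ρ0 : ι → S) (u : ι') (s : S) => ∏ a, (if j a = u then (if s = ρ0 a then (1:ℝ) else 0) else 1)),
    gR_expand H G (fun (ρ0 : ι → S) (a : ι) (s : S) => if s = ρ0 a then (1:ℝ) else 0)]
  refine Finset.sum_congr rfl fun ρ0 _ => ?_
  congr 1
  symm
  refine Fintype.prod_of_injective j hj _ _ (fun u hu => ?_) (fun a => ?_)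
  · rw [show (fun s => ∏ a, (if j a = u then (if s = ρ0 a then (1:ℝ) else 0) else 1)) = fun _ : S => (1:ℝ) from ?_, ga_const]
    ext s; exact Finset.prod_eq_one fun a _ => if_neg fun h => hu ⟨a, h⟩
  · congr 1; ext s; simp only [hj.eq_iff]; simp

lemma gR_two (H : S → ℝ) (f : S → S → ℝ) : gR H (fun τ : Fin 2 → S => f (τ 0) (τ 1)) = ga2 H f := by
  classical
  have h1 : ∀ s s', f s s' = ∑ p : S × S, f p.1 p.2 * ((if s = p.1 then (1:ℝ) else 0) * (if s' = p.2 then (1:ℝ) else 0)) := by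
    intro s s'
    rw [Finset.sum_eq_single (s, s')]
    · simp
    · rintro ⟨b, b'⟩ _ hb
      by_cases hs : s = b
      · have : s' ≠ b' := fun h => hb (by rw [hs, h])
        simp [this]
      · simp [hs]
    · simp
  have e1 : (fun τ : Fin 2 → S => f (τ 0) (τ 1)) = fun τ => ∑ p : S × S, f p.1 p.2 *
      ∏ u : Fin 2, (![fun s => if s = p.1 then (1:ℝ) else 0, fun s => if s = p.2 then (1:ℝ) else 0] u) (τ u) := by
    ext τ; rw [h1]; simp [Fin.prod_univ_two]
  rw [e1]
  unfold gR
  rw [ga_sum]; simp_rw [ga_mul_const]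
  have := fun p : S × S => gR_prod (ι := Fin 2) H ![fun s => if s = p.1 then (1:ℝ) else 0, fun s => if s = p.2 then (1:ℝ) else 0]
  unfold gR at this
  simp_rw [this, Fin.prod_univ_two]
  simp only [Matrix.cons_val_zero, Matrix.cons_val_one, ga_prod]
  have e2 : f = fun s s' => ∑ p : S × S, f p.1 p.2 * ((if s = p.1 then (1:ℝ) else 0) * (if s' = p.2 then (1:ℝ) else 0)) := by
    ext s s'; exact h1 s s'
  conv_rhs => rw [e2]
  unfold ga2
  simp_rw [ga_sum, ga_mul_const]

/-- one-dimensional differentiation in one coordinate -/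
lemma Hy_update [DecidableEq κ] (v : S → ℝ) (D : κ → S → ℝ) (y : κ → ℝ) (l : κ) (s : ℝ) (σ : S) :
    Hy v D (Function.update y l s) σ = Hy v D y σ + D l σ * (s - y l) := by
  unfold Hy
  rw [← Finset.add_sum_erase _ _ (Finset.mem_univ l), ← Finset.add_sum_erase _ (fun l => D l σ * y l) (Finset.mem_univ l), Function.update_self]
  rw [Finset.sum_congr rfl fun j hj => by rw [Function.update_of_ne (Finset.ne_of_mem_erase hj)]]
  ring

lemma gaHy_integrable (v : S → ℝ) (D : κ → S → ℝ) (F : S → ℝ) : Integrable (fun x => ga (Hy v D x) F) (gm κ) := by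
  obtain ⟨C, hC0, hC⟩ := exists_bd F
  exact bdd_integrable (measurable_ga (Hy_meas _ _) fun σ => measurable_const) C fun x => ga_abs_le _ hC

/-- derivative of an averaged Gibbs expectation -/
lemma rep_deriv1 (e : S → ℝ) {a a' : κ → ℝ → ℝ} {Ca : ℝ} (ha : AmpPath a a' Ca) (c : κ → S → ℝ) (F : S → ℝ) (θ : ℝ) :
    HasDerivAt (fun t => ∫ x, ga (Hy e (AM a c t) x) F ∂(gm κ))
      (∫ x, ∑ k, a k θ * a' k θ * (ga (Hy e (AM a c θ) x) (fun s => F s * c k s * c k s)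
         - 2 * (ga (Hy e (AM a c θ) x) (fun s => F s * c k s) * ga (Hy e (AM a c θ) x) (c k))
         + 2 * (ga (Hy e (AM a c θ) x) F * (ga (Hy e (AM a c θ) x) (c k) * ga (Hy e (AM a c θ) x) (c k)))
         - ga (Hy e (AM a c θ) x) F * ga (Hy e (AM a c θ) x) (fun s => c k s * c k s)) ∂(gm κ)) θ := by
  classical
  obtain ⟨B1, hB10, hB1⟩ := AM_bd ha c
  obtain ⟨B3, hB30, hB3⟩ := exists_bd e
  have D1 := inner_deriv (H := fun t x => Hy e (AM a c t) x) (H' := fun t x => Hy (fun _ => 0) (AM a' c t) x) (t₀ := θ) (B := B3 + B1)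
    (by
      intro t _ y σ
      refine (Hy_bound hB3 (fun k σ => (hB1 t k σ).1) y σ).trans ?_
      have := sum_abs_nonneg y
      nlinarith)
    (by
      intro t _ y σ
      refine (Hy_bound (A := B3) (by simpa using hB30) (fun k σ => (hB1 t k σ).2) y σ).trans ?_
      have := sum_abs_nonneg y
      nlinarith)
    (fun t σ => Hy_meas _ _ σ) (fun t σ => Hy_meas _ _ σ)
    (by
      intro t y σ
      apply Hy_AM_hasDeriv ha c (fun _ => e) (fun _ _ => 0)
      exact hasDerivAt_const _ _) F 0
  simp only [rpow_zero, one_mul, sub_zero] at D1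
  refine D1.congr_deriv ?_
  set A := AM a c θ with hA
  have hgb : ∀ c : S → ℝ, EB (fun (_ : Unit) y => ga (Hy e A y) c) := fun c => by
    obtain ⟨C, hC0, hC⟩ := exists_bd c
    exact EB.bdd C fun _ y => ga_abs_le _ hC
  have mg : ∀ c : S → ℝ, Measurable fun y => ga (Hy e A y) c := fun c =>
    measurable_ga (Hy_meas e A) fun σ => measurable_const
  have h1 : ∀ x, ga (Hy e A x) (fun σ => F σ * Hy (fun _ => 0) (AM a' c θ) x σ) - ga (Hy e A x) F * ga (Hy e A x) (Hy (fun _ => 0) (AM a' c θ) x)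
      = ∑ k, a' k θ * (x k * (ga (Hy e A x) (fun s => F s * c k s) - ga (Hy e A x) F * ga (Hy e A x) (c k))) := by
    intro x
    have q1 : ∀ G : S → ℝ, ga (Hy e A x) (fun σ => G σ * Hy (fun _ => 0) (AM a' c θ) x σ) = ∑ k, a' k θ * (x k * ga (Hy e A x) (fun s => G s * c k s)) := by
      intro G
      simp only [Hy, zero_add, Finset.mul_sum, AM]
      rw [ga_sum]
      refine Finset.sum_congr rfl fun k _ => ?_
      rw [← ga_mul_const, ← ga_mul_const]
      congr 1; ext s; ring
    have q2 := q1 fun _ => 1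
    simp only [one_mul] at q2
    rw [q1, show ga (Hy e A x) (Hy (fun _ => 0) (AM a' c θ) x) = ga (Hy e A x) (fun σ => Hy (fun _ => 0) (AM a' c θ) x σ) from rfl, q2, Finset.mul_sum, ← Finset.sum_sub_distrib]
    refine Finset.sum_congr rfl fun k _ => ?_
    ring
  simp_rw [h1]
  have hcov : ∀ k, EB (fun (_ : Unit) x => ga (Hy e A x) (fun s => F s * c k s) - ga (Hy e A x) F * ga (Hy e A x) (c k)) :=
    fun k => (hgb _).sub ((hgb _).mul (hgb _))
  have mcov : ∀ k, Measurable fun x => ga (Hy e A x) (fun s => F s * c k s) - ga (Hy e A x) F * ga (Hy e A x) (c k) :=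
    fun k => (mg _).sub ((mg _).mul (mg _))
  set X := fun k x => a k θ * (ga (Hy e A x) (fun s => F s * c k s * c k s)
         - 2 * (ga (Hy e A x) (fun s => F s * c k s) * ga (Hy e A x) (c k))
         + 2 * (ga (Hy e A x) F * (ga (Hy e A x) (c k) * ga (Hy e A x) (c k)))
         - ga (Hy e A x) F * ga (Hy e A x) (fun s => c k s * c k s)) with hX
  have eX : ∀ k, EB (fun (_ : Unit) x => X k x) := fun k =>
    EB.const_mul _ ((((hgb _).sub (((hgb _).mul (hgb _)).const_mul _)).add (((hgb _).mul ((hgb _).mul (hgb _))).const_mul _)).sub ((hgb _).mul (hgb _)))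
  have mX : ∀ k, Measurable (X k) := fun k =>
    ((((mg _).sub (((mg _).mul (mg _)).const_mul _)).add (((mg _).mul ((mg _).mul (mg _))).const_mul _)).sub ((mg _).mul (mg _))).const_mul _
  have st : ∀ k, ∫ x, x k * (ga (Hy e A x) (fun s => F s * c k s) - ga (Hy e A x) F * ga (Hy e A x) (c k)) ∂(gm κ) = ∫ x, X k x ∂(gm κ) := by
    intro k
    refine stein k (hcov k) (eX k) (mcov k) (mX k) fun x => ?_
    have hd : ∀ G : S → ℝ, HasDerivAt (fun s => ga (Hy e A (Function.update x k s)) G) (a k θ * (ga (Hy e A x) (fun s => G s * c k s) - ga (Hy e A x) G * ga (Hy e A x) (c k))) (x k) := by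
      intro G
      have := hasDerivAt_ga (H := fun s => Hy e A (Function.update x k s)) (H' := A k) (t := x k) ?_ G
      · refine this.congr_deriv ?_
        rw [Function.update_eq_self]
        have p1 : ∀ G : S → ℝ, ga (Hy e A x) (fun σ => G σ * A k σ) = a k θ * ga (Hy e A x) (fun s => G s * c k s) := by
          intro G
          rw [← ga_mul_const]; congr 1; ext s; simp only [hA, AM]; ring
        have p2 := p1 fun _ => 1
        simp only [one_mul] at p2
        rw [p1, show ga (Hy e A x) (A k) = ga (Hy e A x) (fun s => A k s) from rfl, p2]
        ring
      · intro σ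
        simp_rw [Hy_update]
        simpa using ((((hasDerivAt_id (x k)).sub_const (x k)).const_mul (A k σ)).const_add (Hy e A x σ))
    refine ((hd _).sub ((hd F).mul (hd (c k)))).congr_deriv ?_
    simp only [hX, Function.update_eq_self]
    ring
  rw [integral_finsetSum _ fun k _ => ?_]
  · simp_rw [integral_const_mul, st]
    rw [integral_finsetSum _ fun k _ => ?_]
    · refine Finset.sum_congr rfl fun k _ => ?_
      rw [← integral_const_mul]
      congr 1; ext x; simp only [hX]; ring
    · have := ((eX k).integrable () (mX k)).const_mul (a' k θ)
      refine this.congr (Eventually.of_forall fun x => ?_)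
      simp only [hX]; ring
  · exact (((EB.coord (Θ := Unit) k).mul (hcov k)).integrable () ((measurable_pi_apply k).mul (mcov k))).const_mul _

/-- replica weights -/
def MM : Fin 3 → Fin 3 → ℝ := ![![1, -2, 0], ![0, -1, 2], ![0, 0, 0]]

lemma MM_abs (a b : Fin 3) : |MM a b| ≤ 2 := by
  fin_cases a <;> fin_cases b <;> simp [MM]

/-- replica derivative operator -/
def TT (K : S → S → ℝ) (F : (ι → S) → ℝ) (τ : Fin 3 × ι → S) : ℝ :=
  F (fun u => τ (0, u)) * ∑ x, ∑ y, MM x.1 y.1 * (if x = y then 0 else K (τ x) (τ y))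

/-- disorder and replica average -/
def ER (e : S → ℝ) (A : κ → S → ℝ) (F : (ι → S) → ℝ) : ℝ := ∫ x, gR (Hy e A x) F ∂(gm κ)

lemma gR_Hy (e : S → ℝ) (A : κ → S → ℝ) (x : κ → ℝ) :
    (fun τ : ι → S => ∑ u, Hy e A x (τ u)) = Hy (fun τ => ∑ u, e (τ u)) (fun k τ => ∑ u, A k (τ u)) x := by
  ext τ
  simp only [Hy, Finset.sum_add_distrib, Finset.sum_mul]
  rw [Finset.sum_comm]

lemma gR_integrable (e : S → ℝ) (A : κ → S → ℝ) (F : (ι → S) → ℝ) : Integrable (fun x => gR (Hy e A x) F) (gm κ) := by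
  unfold gR
  simp_rw [gR_Hy]
  exact gaHy_integrable _ _ _

lemma ER_deriv (e : S → ℝ) {a a' : κ → ℝ → ℝ} {Ca : ℝ} (ha : AmpPath a a' Ca) (c : κ → S → ℝ) (F : (ι → S) → ℝ) (θ : ℝ)
    (K : S → S → ℝ) (sc kd : ℝ) (hK : ∀ s s', ∑ k, a k θ * a' k θ * (c k s * c k s') = sc * K s s') (hd : ∀ s, K s s = kd) :
    HasDerivAt (fun t => ER e (AM a c t) F) (sc * ER e (AM a c θ) (TT K F)) θ := by
  have D := rep_deriv1 (S := ι → S) (fun τ => ∑ u, e (τ u)) ha (fun k τ => ∑ u, c k (τ u)) F θ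
  have hH : ∀ t x, Hy (fun τ : ι → S => ∑ u, e (τ u)) (AM a (fun k τ => ∑ u, c k (τ u)) t) x = fun τ : ι → S => ∑ u, Hy e (AM a c t) x (τ u) := by
    intro t x
    rw [gR_Hy]; congr 1; ext k τ; simp only [AM, Finset.mul_sum]
  simp_rw [hH] at D
  refine D.congr_deriv ?_
  unfold ER
  rw [← integral_const_mul]
  congr 1; ext x
  set H := Hy e (AM a c θ) x
  set HH := fun τ : ι → S => ∑ u, H (τ u) with hHH
  set C := fun k (τ : ι → S) => ∑ u, c k (τ u) with hC
  have g3 : ∀ f g h : (ι → S) → ℝ, ga HH f * (ga HH g * ga HH h) = gR HH (fun ρ : Fin 3 → ι → S => f (ρ 0) * g (ρ 1) * h (ρ 2)) := by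
    intro f g h
    have := gR_prod (ι := Fin 3) HH ![f, g, h]
    simp only [Fin.prod_univ_three, Matrix.cons_val_zero, Matrix.cons_val_one, Matrix.cons_val] at this
    rw [this]; ring
  have g1 : ∀ f : (ι → S) → ℝ, ga HH f = gR HH (fun ρ : Fin 3 → ι → S => f (ρ 0)) := by
    intro f
    have := g3 f (fun _ => 1) (fun _ => 1)
    simpa [ga_const] using this
  have g2 : ∀ f g : (ι → S) → ℝ, ga HH f * ga HH g = gR HH (fun ρ : Fin 3 → ι → S => f (ρ 0) * g (ρ 1)) := by
    intro f g
    have := g3 f g (fun _ => 1)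
    simpa [ga_const] using this
  have br : ∀ k, a k θ * a' k θ * (ga HH (fun s => F s * C k s * C k s) - 2 * (ga HH (fun s => F s * C k s) * ga HH (C k))
       + 2 * (ga HH F * (ga HH (C k) * ga HH (C k))) - ga HH F * ga HH (fun s => C k s * C k s))
      = gR HH (fun ρ : Fin 3 → ι → S => a k θ * a' k θ * (F (ρ 0) * ∑ p, ∑ r, MM p r * (C k (ρ p) * C k (ρ r)))) := by
    intro k
    rw [g1, g2, g3, g2]
    unfold gR
    rw [ga_mul_const]
    congr 1
    have : (fun ρ : Fin 3 → ι → S => F (ρ 0) * ∑ p, ∑ r, MM p r * (C k (ρ p) * C k (ρ r))) = fun ρ =>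
       (F (ρ 0) * C k (ρ 0) * C k (ρ 0) + (-2) * (F (ρ 0) * C k (ρ 0) * C k (ρ 1))) + (2 * (F (ρ 0) * C k (ρ 1) * C k (ρ 2)) + (-1) * (F (ρ 0) * (C k (ρ 1) * C k (ρ 1)))) := by
      ext ρ
      simp only [Fin.sum_univ_three, MM, Matrix.cons_val_zero, Matrix.cons_val_one, Matrix.cons_val]
      ring
    rw [this, ga_add, ga_add, ga_add, ga_mul_const, ga_mul_const, ga_mul_const]
    ring
  change ∑ k, a k θ * a' k θ * (ga HH (fun s => F s * C k s * C k s) - 2 * (ga HH (fun s => F s * C k s) * ga HH (C k))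
       + 2 * (ga HH F * (ga HH (C k) * ga HH (C k))) - ga HH F * ga HH (fun s => C k s * C k s)) = _
  simp_rw [br]
  unfold gR
  rw [← ga_sum, ← ga_mul_const, ga_equiv (Equiv.curry (Fin 3) ι S)]
  have e1 : (fun s : Fin 3 × ι → S => ∑ u, HH ((Equiv.curry (Fin 3) ι S) s u)) = fun τ => ∑ u, H (τ u) := by
    ext τ; rw [Fintype.sum_prod_type]; rfl
  rw [e1]
  congr 1; ext τ
  unfold TT
  simp only [Equiv.curry_apply]
  have e2 : ∀ k p, C k (fun u => τ (p, u)) = ∑ u, c k (τ (p, u)) := fun k p => rfl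
  have e3 : ∀ k, ∑ p, ∑ r, MM p r * (C k (Function.curry τ p) * C k (Function.curry τ r)) = ∑ x : Fin 3 × ι, ∑ y : Fin 3 × ι, MM x.1 y.1 * (c k (τ x) * c k (τ y)) := by
    intro k
    rw [Fintype.sum_prod_type]
    refine Finset.sum_congr rfl fun p _ => ?_
    rw [Finset.sum_comm, Fintype.sum_prod_type]
    refine Finset.sum_congr rfl fun r _ => ?_
    simp only [hC, Function.curry_apply]
    rw [Finset.sum_mul_sum, Finset.mul_sum, Finset.sum_comm]
    refine Finset.sum_congr rfl fun u _ => ?_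
    rw [Finset.mul_sum]
  simp_rw [e3]
  have e4 : ∑ x : Fin 3 × ι, ∑ y : Fin 3 × ι, MM x.1 y.1 * (if x = y then 0 else K (τ x) (τ y)) = ∑ x : Fin 3 × ι, ∑ y : Fin 3 × ι, MM x.1 y.1 * K (τ x) (τ y) := by
    have : ∀ x y : Fin 3 × ι, MM x.1 y.1 * (if x = y then 0 else K (τ x) (τ y)) = MM x.1 y.1 * K (τ x) (τ y) - if x = y then MM x.1 x.1 * kd else 0 := by
      intro x y
      by_cases hxy : x = y
      · subst hxy; simp [hd]
      · simp [hxy]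
    simp_rw [this, Finset.sum_sub_distrib]
    have z : ∑ x : Fin 3 × ι, ∑ y : Fin 3 × ι, (if x = y then MM x.1 x.1 * kd else 0) = 0 := by
      simp only [Finset.sum_ite_eq, Finset.mem_univ, if_true]
      rw [Fintype.sum_prod_type]
      simp [Fin.sum_univ_three, MM]
    rw [z, sub_zero]
  rw [e4]
  have e5 : ∀ k, a k θ * a' k θ * (F (Function.curry τ 0) * ∑ x : Fin 3 × ι, ∑ y : Fin 3 × ι, MM x.1 y.1 * (c k (τ x) * c k (τ y)))
     = F (fun u => τ (0, u)) * ∑ x : Fin 3 × ι, ∑ y : Fin 3 × ι, MM x.1 y.1 * (a k θ * a' k θ * (c k (τ x) * c k (τ y))) := by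
    intro k
    rw [mul_left_comm, Finset.mul_sum]
    congr 1
    refine Finset.sum_congr rfl fun x _ => ?_
    rw [Finset.mul_sum]
    exact Finset.sum_congr rfl fun y _ => by ring
  simp_rw [e5]
  rw [← Finset.mul_sum, mul_left_comm]
  congr 1
  rw [Finset.sum_comm, Finset.mul_sum]
  refine Finset.sum_congr rfl fun x _ => ?_
  rw [Finset.sum_comm, Finset.mul_sum]
  refine Finset.sum_congr rfl fun y _ => ?_
  rw [← Finset.mul_sum, hK]; ring

end replicas

section ER
variable {S ι ι' κ : Type*} [Fintype S] [Nonempty S] [Fintype ι] [Fintype ι'] [DecidableEq ι] [DecidableEq ι'] [Fintype κ]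
variable (e : S → ℝ) (A : κ → S → ℝ)

lemma ER_mono {F G : (ι → S) → ℝ} (h : ∀ τ, F τ ≤ G τ) : ER e A F ≤ ER e A G :=
  integral_mono (gR_integrable _ _ _) (gR_integrable _ _ _) fun x => ga_mono _ h

lemma ER_add (F G : (ι → S) → ℝ) : ER e A (fun τ => F τ + G τ) = ER e A F + ER e A G := by
  unfold ER
  rw [← integral_add (gR_integrable _ _ _) (gR_integrable _ _ _)]
  simp only [gR, ga_add]

lemma ER_mul (a : ℝ) (F : (ι → S) → ℝ) : ER e A (fun τ => a * F τ) = a * ER e A F := by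
  unfold ER
  rw [← integral_const_mul]
  simp only [gR, ga_mul_const]

lemma ER_const (a : ℝ) : ER e A (fun _ : ι → S => a) = a := by
  unfold ER gR
  simp [ga_const]

lemma ER_sum {R : Type*} (s : Finset R) (F : R → (ι → S) → ℝ) :
    ER e A (fun τ => ∑ r ∈ s, F r τ) = ∑ r ∈ s, ER e A (F r) := by
  unfold ER
  rw [← integral_finsetSum _ fun i _ => gR_integrable _ _ _]
  simp only [gR, ga_sum]

lemma ER_nonneg {F : (ι → S) → ℝ} (h : ∀ τ, 0 ≤ F τ) : 0 ≤ ER e A F := by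
  have := ER_mono e A h; rwa [ER_const] at this

lemma ER_marg (j : ι → ι') (hj : Function.Injective j) (G : (ι → S) → ℝ) :
    ER e A (fun τ : ι' → S => G (fun a => τ (j a))) = ER e A G := by
  unfold ER; simp_rw [gR_marg j hj]

lemma ER_abs (F : (ι → S) → ℝ) : |ER e A F| ≤ ER e A (fun τ => |F τ|) := by
  rw [abs_le]
  constructor
  · have := ER_mono e A (F := fun τ => (-1) * |F τ|) (G := F) fun τ => by linarith [neg_abs_le (F τ)]
    rw [ER_mul] at this; linarith
  · exact ER_mono e A fun τ => le_abs_self _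

/-- sum of the off-diagonal kernels -/
def PK (K : S → S → ℝ) (τ : ι → S) : ℝ := ∑ x, ∑ y, if x = y then 0 else |K (τ x) (τ y)|

lemma PK_nonneg (K : S → S → ℝ) (τ : ι → S) : 0 ≤ PK K τ :=
  Finset.sum_nonneg fun x _ => Finset.sum_nonneg fun y _ => by split_ifs <;> positivity

lemma TT_abs (K : S → S → ℝ) (F : (ι → S) → ℝ) (τ : Fin 3 × ι → S) :
    |TT K F τ| ≤ |F (fun u => τ (0, u))| * (2 * PK K τ) := by
  unfold TT PK
  rw [abs_mul]
  refine mul_le_mul_of_nonneg_left ?_ (abs_nonneg _)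
  rw [Finset.mul_sum]
  refine (Finset.abs_sum_le_sum_abs _ _).trans (Finset.sum_le_sum fun x _ => ?_)
  rw [Finset.mul_sum]
  refine (Finset.abs_sum_le_sum_abs _ _).trans (Finset.sum_le_sum fun y _ => ?_)
  split_ifs
  · simp
  · rw [abs_mul]; exact mul_le_mul_of_nonneg_right (MM_abs _ _) (abs_nonneg _)

lemma PK_le {K : S → S → ℝ} {k0 : ℝ} (hk0 : 0 ≤ k0) (hK : ∀ s s', |K s s'| ≤ k0) (τ : ι → S) :
    PK K τ ≤ (Fintype.card ι : ℝ) ^ 2 * k0 := by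
  unfold PK
  refine (Finset.sum_le_sum (g := fun _ => ∑ y : ι, k0) fun x _ => Finset.sum_le_sum fun y _ => ?_).trans ?_
  · split_ifs
    · exact hk0
    · exact hK _ _
  · simp; apply le_of_eq; ring

lemma PK_marg (K : S → S → ℝ) (j : ι → ι') (hj : Function.Injective j) (τ : ι' → S) :
    PK K (fun a => τ (j a)) ≤ PK K τ := by
  unfold PK
  rw [← Fintype.sum_prod_type', ← Fintype.sum_prod_type']
  have hinj : Function.Injective (Prod.map j j) := hj.prodMap hj
  rw [show ∑ p : ι × ι, (if p.1 = p.2 then 0 else |K (τ (j p.1)) (τ (j p.2))|) = ∑ p : ι × ι, (fun p : ι' × ι' => if p.1 = p.2 then 0 else |K (τ p.1) (τ p.2)|) (Prod.map j j p) from ?_]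
  · rw [← Finset.sum_image (s := Finset.univ) (g := Prod.map j j) (f := fun p : ι' × ι' => if p.1 = p.2 then 0 else |K (τ p.1) (τ p.2)|) fun a _ b _ h => hinj h]
    refine Finset.sum_le_sum_of_subset_of_nonneg (Finset.subset_univ _) fun p _ _ => ?_
    split_ifs <;> positivity
  · refine Finset.sum_congr rfl fun p _ => ?_
    simp [hj.eq_iff]

end ER

section taylor
variable {S ι κ : Type*} [Fintype S] [Nonempty S] [Fintype ι] [DecidableEq ι] [Fintype κ]

/-- hypotheses of the interpolation -/
def Interp (a a' : κ → ℝ → ℝ) (c : κ → S → ℝ) (K : S → S → ℝ) : Prop :=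
  (∃ C, AmpPath a a' C) ∧ (∃ kd, ∀ s, K s s = kd) ∧
  ∀ θ s s', ∑ k, a k θ * a' k θ * (c k s * c k s') = sin θ * cos θ * K s s'

lemma Interp.deriv {e : S → ℝ} {a a' : κ → ℝ → ℝ} {c : κ → S → ℝ} {K : S → S → ℝ} (h : Interp a a' c K) (F : (ι → S) → ℝ) (θ : ℝ) :
    HasDerivAt (fun t => ER e (AM a c t) F) (sin θ * cos θ * ER e (AM a c θ) (TT K F)) θ := by
  obtain ⟨⟨C, hC⟩, ⟨kd, hkd⟩, hK⟩ := h
  exact ER_deriv e hC c F θ K _ kd (hK θ) hkd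

lemma sc_abs_le (θ : ℝ) : |sin θ * cos θ| ≤ 1 := by
  rw [abs_mul]; exact mul_le_one₀ (abs_sin_le_one _) (abs_nonneg _) (abs_cos_le_one _)

lemma inj0 : Function.Injective (fun u : ι => ((0 : Fin 3), u)) := fun a b h => (Prod.mk.inj h).2

lemma gron {e : S → ℝ} {a a' : κ → ℝ → ℝ} {c : κ → S → ℝ} {K : S → S → ℝ} (h : Interp a a' c K) {k0 : ℝ} (hk0 : 0 ≤ k0)
    (hK : ∀ s s', |K s s'| ≤ k0) {F : (ι → S) → ℝ} (hF : ∀ τ, 0 ≤ F τ) {θ : ℝ} (h0 : 0 ≤ θ) (h1 : θ ≤ π / 2) :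
    ER e (AM a c θ) F ≤ exp (2 * ((3 * Fintype.card ι : ℝ) ^ 2 * k0) * (π / 2)) * ER e (AM a c (π / 2)) F := by
  set C := 2 * ((3 * Fintype.card ι : ℝ) ^ 2 * k0) with hC
  have hC0 : 0 ≤ C := by positivity
  have hb : ∀ t, |ER e (AM a c t) (TT K F)| ≤ C * ER e (AM a c t) F := by
    intro t
    refine (ER_abs _ _ _).trans ?_
    rw [← ER_marg e (AM a c t) _ (inj0 (ι := ι)) F, ← ER_mul]
    refine ER_mono _ _ fun τ => (TT_abs _ _ _).trans ?_
    rw [abs_of_nonneg (hF _), mul_comm C]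
    refine mul_le_mul_of_nonneg_left ?_ (hF _)
    have := PK_le hk0 hK τ
    simp only [Fintype.card_prod, Fintype.card_fin, Nat.cast_mul, Nat.cast_ofNat] at this
    rw [hC]; linarith
  have hd : ∀ t, HasDerivAt (fun t => exp (C * t) * ER e (AM a c t) F) (exp (C * t) * (C * 1) * ER e (AM a c t) F + exp (C * t) * (sin t * cos t * ER e (AM a c t) (TT K F))) t :=
    fun t => (((hasDerivAt_id t).const_mul C).exp).mul (h.deriv F t)
  have hm : Monotone fun t => exp (C * t) * ER e (AM a c t) F := by
    refine monotone_of_deriv_nonneg (fun t => (hd t).differentiableAt) fun t => ?_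
    rw [(hd t).deriv]
    have h2 : |sin t * cos t * ER e (AM a c t) (TT K F)| ≤ C * ER e (AM a c t) F := by
      rw [abs_mul]
      calc _ ≤ 1 * |ER e (AM a c t) (TT K F)| := mul_le_mul_of_nonneg_right (sc_abs_le t) (abs_nonneg _)
        _ ≤ _ := by rw [one_mul]; exact hb t
    have h3 := (abs_le.1 h2).1
    have h4 := exp_pos (C * t)
    have : 0 ≤ exp (C * t) * (C * ER e (AM a c t) F + sin t * cos t * ER e (AM a c t) (TT K F)) :=
      mul_nonneg h4.le (by linarith)
    linarith
  have h2 := hm h1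
  have h3 : 1 ≤ exp (C * θ) := one_le_exp (by positivity)
  have h4 := ER_nonneg e (AM a c θ) hF
  simp only at h2
  nlinarith

lemma mvt {f f' : ℝ → ℝ} (hd : ∀ t, HasDerivAt f (f' t) t) {B : ℝ} (hB : ∀ t, 0 ≤ t → t ≤ π / 2 → |f' t| ≤ B) {t : ℝ} (h0 : 0 ≤ t) (h1 : t ≤ π / 2) :
    |f t - f 0| ≤ 2 * B := by
  have hB0 : 0 ≤ B := (abs_nonneg _).trans (hB 0 le_rfl (by positivity))
  have := (convex_Icc (0:ℝ) (π / 2)).norm_image_sub_le_of_norm_hasDerivWithin_le (f := f) (f' := f') (C := B)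
    (fun x _ => (hd x).hasDerivWithinAt) (fun x hx => hB x hx.1 hx.2) (x := 0) (y := t) ⟨le_rfl, by positivity⟩ ⟨h0, h1⟩
  simp only [norm_eq_abs, sub_zero] at this
  rw [abs_of_nonneg h0] at this
  have hpi := pi_le_four
  nlinarith

lemma taylor1 {e : S → ℝ} {a a' : κ → ℝ → ℝ} {c : κ → S → ℝ} {K : S → S → ℝ} (h : Interp a a' c K) (F : (ι → S) → ℝ) {B : ℝ}
    (hB : ∀ t, 0 ≤ t → t ≤ π / 2 → ER e (AM a c t) (fun τ => |TT K F τ|) ≤ B) {t : ℝ} (h0 : 0 ≤ t) (h1 : t ≤ π / 2) :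
    |ER e (AM a c t) F - ER e (AM a c 0) F| ≤ 2 * B := by
  refine mvt (f := fun t => ER e (AM a c t) F) (fun t => h.deriv F t) (fun t h0 h1 => ?_) h0 h1
  rw [abs_mul]
  calc _ ≤ 1 * |ER e (AM a c t) (TT K F)| := mul_le_mul_of_nonneg_right (sc_abs_le t) (abs_nonneg _)
    _ ≤ _ := by rw [one_mul]; exact (ER_abs _ _ _).trans (hB t h0 h1)

lemma taylor2 {e : S → ℝ} {a a' : κ → ℝ → ℝ} {c : κ → S → ℝ} {K : S → S → ℝ} (h : Interp a a' c K) (F : (ι → S) → ℝ) {B : ℝ}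
    (hB : ∀ t, 0 ≤ t → t ≤ π / 2 → ER e (AM a c t) (fun τ => |TT K (TT K F) τ|) ≤ B) :
    |ER e (AM a c (π / 2)) F - ER e (AM a c 0) F - 1 / 2 * ER e (AM a c 0) (TT K F)| ≤ 4 * B := by
  set P := ER e (AM a c 0) (TT K F) with hP
  have hpi : 0 ≤ π / 2 := by positivity
  have hd : ∀ t, HasDerivAt (fun t => ER e (AM a c t) F - sin t ^ 2 / 2 * P) (sin t * cos t * (ER e (AM a c t) (TT K F) - P)) t := by
    intro t
    have h2 : HasDerivAt (fun t => sin t ^ 2 / 2 * P) (sin t * cos t * P) t := by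
      have := ((((hasDerivAt_sin t).pow 2).div_const 2).mul_const P)
      refine this.congr_deriv ?_
      push_cast; ring
    exact ((h.deriv F t).sub h2).congr_deriv (by ring)
  have := mvt hd (B := 2 * B) (fun t h0 h1 => ?_) hpi le_rfl
  · simp only [sin_pi_div_two, sin_zero] at this
    calc _ = _ := by congr 1; ring
      _ ≤ _ := this.trans (by linarith)
  · rw [abs_mul]
    calc _ ≤ 1 * |ER e (AM a c t) (TT K F) - P| := mul_le_mul_of_nonneg_right (sc_abs_le t) (abs_nonneg _)
      _ ≤ _ := by rw [one_mul]; exact taylor1 h (TT K F) hB h0 h1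

end taylor

section cavity
variable {V : Type} [Fintype V] [LinearOrder V]

/-- cavity overlap -/
def rm (N : ℝ) (i : V) (s s' : V → Bool) : ℝ := (ov s s' - spin (s i) * spin (s' i)) / N

/-- cavity amplitudes -/
def acv (β q N : ℝ) (i : V) : Ks V → ℝ → ℝ
  | Sum.inl p, t => if p.1.1 = i ∨ p.1.2 = i then sin t * (β / √N) else β / √N
  | Sum.inr k, t => if k.1 = i then cos t * (β * √q) else 0
/-- their derivatives -/
def acv' (β q N : ℝ) (i : V) : Ks V → ℝ → ℝ
  | Sum.inl p, t => if p.1.1 = i ∨ p.1.2 = i then cos t * (β / √N) else 0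
  | Sum.inr k, t => if k.1 = i then -sin t * (β * √q) else 0
/-- cavity kernel -/
def KC (β q N : ℝ) (i : V) (s s' : V → Bool) : ℝ := β ^ 2 * (spin (s i) * spin (s' i)) * (rm N i s s' - q)

lemma ampCv (β q N : ℝ) (i : V) : AmpPath (acv β q N i) (acv' β q N i) (|β / √N| + |β * √q|) := by
  refine ⟨by positivity, fun k t => ?_⟩
  have h1 := abs_nonneg (β / √N)
  have h2 := abs_nonneg (β * √q)
  have h3 : |(0:ℝ)| ≤ |β / √N| + |β * √q| := by rw [abs_zero]; linarith
  rcases k with p | k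
  · by_cases hp : p.1.1 = i ∨ p.1.2 = i
    · have e1 : acv β q N i (Sum.inl p) = fun t => sin t * (β / √N) := by ext t; exact if_pos hp
      have e2 : acv' β q N i (Sum.inl p) = fun t => cos t * (β / √N) := by ext t; exact if_pos hp
      rw [e1, e2]
      refine ⟨(hasDerivAt_sin t).mul_const _, ?_, ?_⟩
      · exact (abs_sin_mul_le _ _).trans (by linarith)
      · exact (abs_cos_mul_le _ _).trans (by linarith)
    · have e1 : acv β q N i (Sum.inl p) = fun t => (β / √N) := by ext t; exact if_neg hp
      have e2 : acv' β q N i (Sum.inl p) = fun t => 0 := by ext t; exact if_neg hp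
      rw [e1, e2]
      exact ⟨hasDerivAt_const _ _, by linarith, h3⟩
  · by_cases hp : k.1 = i
    · have e1 : acv β q N i (Sum.inr k) = fun t => cos t * (β * √q) := by ext t; exact if_pos hp
      have e2 : acv' β q N i (Sum.inr k) = fun t => -sin t * (β * √q) := by ext t; exact if_pos hp
      rw [e1, e2]
      refine ⟨(hasDerivAt_cos t).mul_const _, ?_, ?_⟩
      · exact (abs_cos_mul_le _ _).trans (by linarith)
      · exact (abs_neg_sin_mul_le _ _).trans (by linarith)
    · have e1 : acv β q N i (Sum.inr k) = fun t => 0 := by ext t; exact if_neg hp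
      have e2 : acv' β q N i (Sum.inr k) = fun t => 0 := by ext t; exact if_neg hp
      rw [e1, e2]
      exact ⟨hasDerivAt_const _ _, h3, h3⟩

lemma pairs_at (i : V) (f : V → ℝ) :
    ∑ p : Pr V, (if p.1.1 = i ∨ p.1.2 = i then f p.1.1 * f p.1.2 else 0) = f i * (∑ j, f j - f i) := by
  have h1 := sum_pairs f
  have h2 := sum_pairs (Function.update f i 0)
  have h3 : ∑ j, Function.update f i 0 j = ∑ j, f j - f i := by
    rw [Finset.sum_update_of_mem (Finset.mem_univ i), zero_add, ← Finset.sum_sdiff (Finset.subset_univ {i})]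
    simp
  have h4 : ∑ j, Function.update f i 0 j ^ 2 = ∑ j, f j ^ 2 - f i ^ 2 := by
    have : ∀ j, Function.update f i 0 j ^ 2 = Function.update (fun j => f j ^ 2) i 0 j := by
      intro j; by_cases hj : j = i
      · subst hj; simp
      · simp [hj]
    simp_rw [this]
    rw [Finset.sum_update_of_mem (Finset.mem_univ i), zero_add, ← Finset.sum_sdiff (Finset.subset_univ {i}) (f := fun j => f j ^ 2)]
    simp
  have h5 : ∑ p : Pr V, Function.update f i 0 p.1.1 * Function.update f i 0 p.1.2 = ∑ p : Pr V, f p.1.1 * f p.1.2 - ∑ p : Pr V, (if p.1.1 = i ∨ p.1.2 = i then f p.1.1 * f p.1.2 else 0) := by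
    rw [← Finset.sum_sub_distrib]
    refine Finset.sum_congr rfl fun p _ => ?_
    by_cases ha : p.1.1 = i
    · simp [ha]
    · by_cases hb : p.1.2 = i
      · simp [hb]
      · simp [ha, hb]
  rw [h3, h4, h5] at h2
  nlinarith

lemma interpC (β q N : ℝ) (hq : 0 ≤ q) (hN : 0 < N) (i : V) : Interp (acv β q N i) (acv' β q N i) cS (KC β q N i) := by
  refine ⟨⟨_, ampCv β q N i⟩, ⟨β ^ 2 * ((Fintype.card V - 1) / N - q), fun s => ?_⟩, fun t s s' => ?_⟩
  · simp only [KC, rm, ov_self, spin_mul_self]; ring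
  · have hNs : √N ^ 2 = N := sq_sqrt hN.le
    have hqs : √q ^ 2 = q := sq_sqrt hq
    rw [Fintype.sum_sum_type, Fintype.sum_prod_type]
    simp only [acv, acv', cS, Fin.sum_univ_three]
    simp only [Fin.isValue, if_true, one_ne_zero, if_false, Fin.reduceEq, mul_zero, add_zero]
    have h1 : ∀ p : Pr V, (if p.1.1 = i ∨ p.1.2 = i then sin t * (β / √N) else β / √N) * (if p.1.1 = i ∨ p.1.2 = i then cos t * (β / √N) else 0) *
        (spin (s p.1.1) * spin (s p.1.2) * (spin (s' p.1.1) * spin (s' p.1.2)))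
        = sin t * cos t * β ^ 2 / N * (if p.1.1 = i ∨ p.1.2 = i then (fun j => spin (s j) * spin (s' j)) p.1.1 * (fun j => spin (s j) * spin (s' j)) p.1.2 else 0) := by
      intro p
      split_ifs
      · have : sin t * (β / √N) * (cos t * (β / √N)) = sin t * cos t * β ^ 2 / N := by
          rw [← hNs]; field_simp; rw [sqrt_sq (sqrt_nonneg _)]
        rw [this]; ring
      · simp
    simp_rw [h1]
    rw [← Finset.mul_sum, pairs_at i fun j => spin (s j) * spin (s' j)]
    have h2 : ∀ l : V, (if l = i then cos t * (β * √q) else 0) * (if l = i then -sin t * (β * √q) else 0) * (spin (s l) * spin (s' l))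
       = if l = i then - (sin t * cos t * β ^ 2 * q) * (spin (s i) * spin (s' i)) else 0 := by
      intro l
      split_ifs with hl
      · subst hl
        calc _ = - (sin t * cos t * β ^ 2 * √q ^ 2) * (spin (s l) * spin (s' l)) := by ring
          _ = _ := by rw [hqs]
      · simp
    simp_rw [h2]
    rw [Finset.sum_ite_eq' Finset.univ i, if_pos (Finset.mem_univ i)]
    simp only [KC, rm, ov]
    ring

lemma acv_end (β q N : ℝ) (i : V) : AM (acv β q N i) cS (π / 2) = AM (aS β q N) (cS (V := V)) (π / 2) := by
  ext k s
  rcases k with p | k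
  · simp [AM, acv, aS]
  · simp [AM, acv, aS]

lemma rm_abs {N : ℝ} (hN : N = Fintype.card V + 1) (i : V) (s s' : V → Bool) : |rm N i s s'| ≤ 1 := by
  have hN0 : 0 < N := by rw [hN]; positivity
  unfold rm
  rw [abs_div, abs_of_pos hN0, div_le_one hN0]
  have h1 := ov_abs_le s s'
  have h2 : |spin (s i) * spin (s' i)| = 1 := by rw [abs_mul, spin_abs, spin_abs, one_mul]
  have := abs_sub (ov s s') (spin (s i) * spin (s' i))
  rw [hN]; linarith

lemma KC_abs (β q N : ℝ) (i : V) (s s' : V → Bool) : |KC β q N i s s'| = β ^ 2 * |rm N i s s' - q| := by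
  unfold KC
  rw [abs_mul, abs_mul, abs_mul, spin_abs, spin_abs, abs_of_nonneg (sq_nonneg β)]; ring

lemma KC_le {β q N : ℝ} (hq : 0 ≤ q) (hq1 : q ≤ 1) (hN : N = Fintype.card V + 1) (i : V) (s s' : V → Bool) : |KC β q N i s s'| ≤ 2 * β ^ 2 := by
  rw [KC_abs]
  have := abs_le.1 (rm_abs hN i s s')
  have : |rm N i s s' - q| ≤ 2 := abs_le.2 ⟨by linarith, by linarith⟩
  nlinarith [sq_nonneg β]

end cavity

section zero
variable {V ι : Type} [Fintype V] [LinearOrder V] [Fintype ι] [DecidableEq ι]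

/-- replica `u` with the spin at `i` replaced -/
def ru (i : V) (u : ι) (b : Bool) (τ : ι → V → Bool) : ι → V → Bool := Function.update τ u (Function.update (τ u) i b)

/-- invariance under changes of the spin `i` of replica `u` -/
def FI (i : V) (u : ι) (G : (ι → V → Bool) → ℝ) : Prop := ∀ τ b, G (ru i u b τ) = G τ

lemma FI.mul {i : V} {u : ι} {G G' : (ι → V → Bool) → ℝ} (h : FI i u G) (h' : FI i u G') : FI i u (fun τ => G τ * G' τ) :=
  fun τ b => by simp only [h τ b, h' τ b]
lemma FI.add {i : V} {u : ι} {G G' : (ι → V → Bool) → ℝ} (h : FI i u G) (h' : FI i u G') : FI i u (fun τ => G τ + G' τ) :=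
  fun τ b => by simp only [h τ b, h' τ b]
lemma FI.sub {i : V} {u : ι} {G G' : (ι → V → Bool) → ℝ} (h : FI i u G) (h' : FI i u G') : FI i u (fun τ => G τ - G' τ) :=
  fun τ b => by simp only [h τ b, h' τ b]
lemma FI.pow {i : V} {u : ι} {G : (ι → V → Bool) → ℝ} (h : FI i u G) (n : ℕ) : FI i u (fun τ => G τ ^ n) :=
  fun τ b => by simp only [h τ b]
lemma FI.const {i : V} {u : ι} (a : ℝ) : FI i u (fun _ => a) := fun τ b => rfl
lemma FI.spin {i : V} {u v : ι} (h : v ≠ u) : FI i u (fun τ => spin (τ v i)) := fun τ b => by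
  simp only [ru, Function.update_of_ne h]

lemma rm_ru (N : ℝ) (i : V) (s s' : V → Bool) (b : Bool) : rm N i (Function.update s i b) s' = rm N i s s' := by
  unfold rm ov
  congr 1
  rw [← Finset.add_sum_erase _ _ (Finset.mem_univ i), ← Finset.add_sum_erase _ (fun j => SK.spin (s j) * SK.spin (s' j)) (Finset.mem_univ i)]
  rw [add_sub_cancel_left, add_sub_cancel_left]
  exact Finset.sum_congr rfl fun j hj => by rw [Function.update_of_ne (Finset.ne_of_mem_erase hj)]

lemma rm_comm (N : ℝ) (i : V) (s s' : V → Bool) : rm N i s s' = rm N i s' s := by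
  unfold rm; rw [ov_comm, mul_comm (SK.spin (s i))]

lemma FI.rm (N : ℝ) {i : V} {u : ι} (x y : ι) : FI i u (fun τ => rm N i (τ x) (τ y)) := by
  have h1 : ∀ (τ : ι → V → Bool) b z, ru i u b τ z = τ z ∨ ru i u b τ z = Function.update (τ z) i b := by
    intro τ b z
    by_cases hz : z = u
    · right; subst hz; simp [ru]
    · left; simp [ru, hz]
  intro τ b
  simp only
  rcases h1 τ b x with hx | hx <;> rcases h1 τ b y with hy | hy <;> rw [hx, hy]
  · rw [rm_comm, rm_ru, rm_comm]
  · rw [rm_ru]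
  · rw [rm_ru, rm_comm, rm_ru, rm_comm]

lemma sum_ru (H : (V → Bool) → ℝ) (i : V) (u : ι) (b : Bool) (τ : ι → V → Bool) :
    ∑ v, H (ru i u b τ v) = ∑ v, H (τ v) + (H (Function.update (τ u) i b) - H (τ u)) := by
  rw [← Finset.add_sum_erase _ _ (Finset.mem_univ u), ← Finset.add_sum_erase _ (fun v => H (τ v)) (Finset.mem_univ u)]
  rw [Finset.sum_congr rfl fun j hj => by rw [ru, Function.update_of_ne (Finset.ne_of_mem_erase hj)]]
  simp only [ru, Function.update_self]; ring

/-- flip of the spin `i` of replica `u` -/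
def flipE (i : V) (u : ι) : (ι → V → Bool) ≃ (ι → V → Bool) :=
  Function.Involutive.toPerm (fun τ => ru i u (!(τ u i)) τ) (fun τ => by
    simp only [ru, Function.update_self, Bool.not_not, Function.update_idem, Function.update_eq_self])

lemma flip_tanh (y : ℝ) (b : Bool) : (spin (!b) - tanh y) * exp (y * (spin (!b) - spin b)) = -(spin b - tanh y) := by
  have h1 := exp_pos y
  have h2 := exp_pos (-y)
  have h3 : exp y * exp (-y) = 1 := by rw [← exp_add]; simp
  rw [tanh_eq_sinh_div_cosh, sinh_eq, cosh_eq]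
  cases b
  · simp only [spin, Bool.not_false, if_true, Bool.false_eq_true, if_false]
    rw [show y * (1 - -1) = y + y by ring, exp_add]
    field_simp
    have h4 : exp y * exp (-y) * exp y = exp y := by rw [h3, one_mul]
    nlinarith
  · simp only [spin, Bool.not_true, if_true, Bool.false_eq_true, if_false]
    rw [show y * (-1 - 1) = -y + -y by ring, exp_add]
    field_simp
    have h4 : exp y * exp (-y) * exp (-y) = exp (-y) := by rw [h3, one_mul]
    nlinarith

variable {H : (V → Bool) → ℝ} {y : ℝ} {i : V}

lemma gR_spin (hH : ∀ s b, H (Function.update s i b) = H s + y * (spin b - spin (s i))) (u : ι) {G : (ι → V → Bool) → ℝ} (hG : FI i u G) :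
    gR H (fun τ => G τ * spin (τ u i)) = tanh y * gR H G := by
  have key : ∑ τ : ι → V → Bool, (G τ * (spin (τ u i) - tanh y)) * exp (∑ v, H (τ v)) = 0 := by
    have h1 : ∑ τ : ι → V → Bool, (G τ * (spin (τ u i) - tanh y)) * exp (∑ v, H (τ v)) = - ∑ τ : ι → V → Bool, (G τ * (spin (τ u i) - tanh y)) * exp (∑ v, H (τ v)) := by
      conv_lhs => rw [← (flipE i u).sum_comp]
      rw [← Finset.sum_neg_distrib]
      refine Finset.sum_congr rfl fun τ _ => ?_
      change (G (ru i u (!(τ u i)) τ) * (spin (ru i u (!(τ u i)) τ u i) - tanh y)) * exp (∑ v, H (ru i u (!(τ u i)) τ v)) = _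
      rw [hG, sum_ru, hH, exp_add, add_sub_cancel_left]
      have := flip_tanh y (τ u i)
      have e : ru i u (!(τ u i)) τ u i = !(τ u i) := by simp [ru]
      rw [e]
      calc _ = G τ * exp (∑ v, H (τ v)) * ((spin (!(τ u i)) - tanh y) * exp (y * (spin (!τ u i) - spin (τ u i)))) := by ring
        _ = _ := by rw [this]; ring
    linarith
  have h2 : gR H (fun τ => G τ * (spin (τ u i) - tanh y)) = 0 := by
    unfold gR ga; rw [key, zero_div]
  have h3 : (fun τ : ι → V → Bool => G τ * spin (τ u i)) = fun τ => G τ * (spin (τ u i) - tanh y) + tanh y * G τ := by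
    ext τ; ring
  rw [h3]
  unfold gR at h2 ⊢
  rw [ga_add, h2, ga_mul_const, zero_add]

lemma gR_diff (hH : ∀ s b, H (Function.update s i b) = H s + y * (spin b - spin (s i))) (u v : ι) {G : (ι → V → Bool) → ℝ} (hG : FI i u G) (hG' : FI i v G) :
    gR H (fun τ => G τ * (spin (τ u i) - spin (τ v i))) = 0 := by
  have h3 : (fun τ : ι → V → Bool => G τ * (spin (τ u i) - spin (τ v i))) = fun τ => G τ * spin (τ u i) + (-1) * (G τ * spin (τ v i)) := by
    ext τ; ring
  have h1 := gR_spin hH u hG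
  have h2 := gR_spin hH v hG'
  rw [h3]
  unfold gR at h1 h2 ⊢
  rw [ga_add, ga_mul_const, h1, h2]; ring

lemma gR_sech (hH : ∀ s b, H (Function.update s i b) = H s + y * (spin b - spin (s i))) (a b c d : ι) (hab : a ≠ b) (hac : a ≠ c) (had : a ≠ d) (hbc : b ≠ c)
    (hbd : b ≠ d) (hcd : c ≠ d) {G : (ι → V → Bool) → ℝ} (hG : ∀ u, FI i u G) :
    gR H (fun τ => G τ * ((1 - spin (τ a i) * spin (τ b i)) * (1 - spin (τ c i) * spin (τ d i)))) = (1 - tanh y ^ 2) ^ 2 * gR H G := by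
  have hab2 : gR H (fun τ => G τ * spin (τ b i) * spin (τ a i)) = tanh y * (tanh y * gR H G) := by
    rw [gR_spin hH a (G := fun τ => G τ * spin (τ b i)) ((hG a).mul (FI.spin hab.symm)), gR_spin hH b (hG b)]
  have hcd2 : gR H (fun τ => G τ * spin (τ d i) * spin (τ c i)) = tanh y * (tanh y * gR H G) := by
    rw [gR_spin hH c (G := fun τ => G τ * spin (τ d i)) ((hG c).mul (FI.spin hcd.symm)), gR_spin hH d (hG d)]
  have hall : gR H (fun τ => G τ * spin (τ d i) * spin (τ c i) * spin (τ b i) * spin (τ a i)) = tanh y * (tanh y * (tanh y * (tanh y * gR H G))) := by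
    rw [gR_spin hH a (G := fun τ => G τ * spin (τ d i) * spin (τ c i) * spin (τ b i)) ((((hG a).mul (FI.spin had.symm)).mul (FI.spin hac.symm)).mul (FI.spin hab.symm)),
      gR_spin hH b (G := fun τ => G τ * spin (τ d i) * spin (τ c i)) (((hG b).mul (FI.spin hbd.symm)).mul (FI.spin hbc.symm)), hcd2]
  have h3 : (fun τ : ι → V → Bool => G τ * ((1 - spin (τ a i) * spin (τ b i)) * (1 - spin (τ c i) * spin (τ d i)))) = fun τ =>
     (G τ + (-1) * (G τ * spin (τ b i) * spin (τ a i))) + ((-1) * (G τ * spin (τ d i) * spin (τ c i)) + G τ * spin (τ d i) * spin (τ c i) * spin (τ b i) * spin (τ a i)) := by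
    ext τ; ring
  rw [h3]
  unfold gR at hab2 hcd2 hall ⊢
  rw [ga_add, ga_add, ga_add, ga_mul_const, ga_mul_const, hab2, hcd2, hall]; ring

lemma H0_upd (β h q N : ℝ) (i : V) (x : Ks V → ℝ) (s : V → Bool) (b : Bool) :
    Hy (e1 h) (AM (acv β q N i) cS 0) x (Function.update s i b) = Hy (e1 h) (AM (acv β q N i) cS 0) x s
      + (h + β * √q * x (Sum.inr (i, 0))) * (spin b - spin (s i)) := by
  have h1 : ∀ s : V → Bool, Hy (e1 h) (AM (acv β q N i) cS 0) x s = ∑ j, h * spin (s j)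
     + ((∑ p : Pr V, (if p.1.1 = i ∨ p.1.2 = i then 0 else β / √N) * (spin (s p.1.1) * spin (s p.1.2)) * x (Sum.inl p)) + β * √q * spin (s i) * x (Sum.inr (i, 0))) := by
    intro s
    unfold Hy e1
    congr 1
    rw [Fintype.sum_sum_type, Fintype.sum_prod_type]
    simp only [AM, acv, cS, Fin.sum_univ_three]
    simp only [Fin.isValue, if_true, one_ne_zero, if_false, Fin.reduceEq, mul_zero, add_zero, zero_mul, sin_zero, cos_zero, one_mul]
    congr 1
    rw [Finset.sum_eq_single i]
    · simp
    · intro j _ hj; simp [hj]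
    · simp
  rw [h1, h1]
  have h2 : ∑ j, h * spin (Function.update s i b j) = ∑ j, h * spin (s j) + h * (spin b - spin (s i)) := by
    rw [← Finset.add_sum_erase _ _ (Finset.mem_univ i), ← Finset.add_sum_erase _ (fun j => h * spin (s j)) (Finset.mem_univ i)]
    rw [Finset.sum_congr rfl fun j hj => by rw [Function.update_of_ne (Finset.ne_of_mem_erase hj)]]
    simp only [Function.update_self]; ring
  rw [h2, Function.update_self]
  have h3 : ∀ p : Pr V, (if p.1.1 = i ∨ p.1.2 = i then 0 else β / √N) * (spin (Function.update s i b p.1.1) * spin (Function.update s i b p.1.2)) * x (Sum.inl p)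
     = (if p.1.1 = i ∨ p.1.2 = i then 0 else β / √N) * (spin (s p.1.1) * spin (s p.1.2)) * x (Sum.inl p) := by
    intro p
    split_ifs with hp
    · simp
    · push Not at hp
      rw [Function.update_of_ne hp.1, Function.update_of_ne hp.2]
  simp_rw [h3]; ring

/-- independence of the cavity field -/
lemma gR_indep (β h q N : ℝ) (i : V) (x : Ks V → ℝ) (s : ℝ) {G : (ι → V → Bool) → ℝ} (hG : ∀ u, FI i u G) :
    gR (Hy (e1 h) (AM (acv β q N i) cS 0) (Function.update x (Sum.inr (i, 0)) s)) G = gR (Hy (e1 h) (AM (acv β q N i) cS 0) x) G := by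
  set k : Ks V := Sum.inr (i, 0) with hk
  set A := AM (acv β q N i) cS 0 with hA
  have hD : ∀ s : V → Bool, A k s = β * √q * spin (s i) := by intro s; simp [hA, hk, AM, acv, cS]
  have hd : ∀ r, HasDerivAt (fun r => gR (Hy (e1 h) A (Function.update x k r)) G) 0 r := by
    intro r
    have := hasDerivAt_ga (H := fun r => fun τ : ι → V → Bool => ∑ u, Hy (e1 h) A (Function.update x k r) (τ u)) (H' := fun τ => ∑ u, β * √q * spin (τ u i)) (t := r) ?_ G
    · refine this.congr_deriv ?_
      set H := Hy (e1 h) A (Function.update x k r) with hHdef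
      have hH : ∀ s b, H (Function.update s i b) = H s + (h + β * √q * (Function.update x k r) k) * (spin b - spin (s i)) := fun s b => H0_upd β h q N i _ s b
      have p1 : ∀ G' : (ι → V → Bool) → ℝ, (∀ u, FI i u G') → ga (fun τ : ι → V → Bool => ∑ u, H (τ u)) (fun τ => G' τ * ∑ u, β * √q * spin (τ u i)) = ∑ u : ι, β * √q * (tanh (h + β * √q * (Function.update x k r) k) * gR H G') := by
        intro G' hG'
        simp_rw [Finset.mul_sum]
        rw [ga_sum]
        refine Finset.sum_congr rfl fun u _ => ?_
        rw [← gR_spin hH u (hG' u)]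
        unfold gR
        rw [← ga_mul_const]
        congr 1; ext τ; ring
      have p2 := p1 (fun _ => 1) fun u => FI.const 1
      simp only [one_mul] at p2
      rw [p1 G hG, p2, Finset.mul_sum, ← Finset.sum_sub_distrib]
      refine Finset.sum_eq_zero fun u _ => ?_
      unfold gR
      rw [ga_const]; ring
    · intro τ
      refine HasDerivAt.fun_sum fun u _ => ?_
      simp_rw [Hy_update]
      have := ((((hasDerivAt_id r).sub_const (x k)).const_mul (A k (τ u))).const_add (Hy (e1 h) A x (τ u)))
      refine this.congr_deriv ?_
      rw [hD, mul_one]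
  have hc := is_const_of_deriv_eq_zero (fun r => (hd r).differentiableAt) (fun r => (hd r).deriv) s (x k)
  rw [hc, Function.update_eq_self]

lemma ER_sech (β h q N : ℝ) (i : V) (a b c d : ι) (hab : a ≠ b) (hac : a ≠ c) (had : a ≠ d) (hbc : b ≠ c)
    (hbd : b ≠ d) (hcd : c ≠ d) {G : (ι → V → Bool) → ℝ} (hG : ∀ u, FI i u G) :
    ER (e1 h) (AM (acv β q N i) cS 0) (fun τ => G τ * ((1 - spin (τ a i) * spin (τ b i)) * (1 - spin (τ c i) * spin (τ d i))))
     = (∫ z, (cosh (h + β * √q * z))⁻¹ ^ 4 ∂(gaussianReal 0 1)) * ER (e1 h) (AM (acv β q N i) cS 0) G := by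
  unfold ER
  have h1 := integral_resample (Sum.inr (i, 0) : Ks V) (gR_integrable (e1 h) (AM (acv β q N i) cS 0) (fun τ => G τ * ((1 - spin (τ a i) * spin (τ b i)) * (1 - spin (τ c i) * spin (τ d i)))))
  rw [h1, ← integral_const_mul]
  congr 1; ext x
  have h2 : ∀ s, gR (Hy (e1 h) (AM (acv β q N i) cS 0) (Function.update x (Sum.inr (i, 0)) s)) (fun τ => G τ * ((1 - spin (τ a i) * spin (τ b i)) * (1 - spin (τ c i) * spin (τ d i))))
      = (cosh (h + β * √q * s))⁻¹ ^ 4 * gR (Hy (e1 h) (AM (acv β q N i) cS 0) x) G := by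
    intro s
    rw [gR_sech (fun s' b => H0_upd β h q N i _ s' b) a b c d hab hac had hbc hbd hcd hG, gR_indep _ _ _ _ _ _ _ hG, Function.update_self, one_sub_tanh_sq, ← pow_mul]
  simp_rw [h2]
  rw [integral_mul_const]

end zero

section crossing
variable {V : Type} [Fintype V] [LinearOrder V]

/-- cavity replica difference -/
def dm (N : ℝ) (i : V) (τ : Fin 4 → V → Bool) : ℝ :=
  rm N i (τ 0) (τ 2) - rm N i (τ 0) (τ 3) - rm N i (τ 1) (τ 2) + rm N i (τ 1) (τ 3)

/-- local replica difference -/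
def Di (i : V) (τ : Fin 4 → V → Bool) : ℝ := (spin (τ 0 i) - spin (τ 1 i)) * (spin (τ 2 i) - spin (τ 3 i))

/-- the crossing pairs -/
def crS : Finset ((Fin 3 × Fin 4) × (Fin 3 × Fin 4)) :=
  {((0,0),(0,2)), ((0,0),(0,3)), ((0,1),(0,2)), ((0,1),(0,3)), ((0,2),(0,0)), ((0,3),(0,0)), ((0,2),(0,1)), ((0,3),(0,1))}

set_option maxRecDepth 20000 in
lemma crS_cases : ∀ p : (Fin 3 × Fin 4) × (Fin 3 × Fin 4), p ∈ crS ∨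
   (p.1 ≠ (0,0) ∧ p.1 ≠ (0,1) ∧ p.2 ≠ (0,0) ∧ p.2 ≠ (0,1)) ∨ (p.1 ≠ (0,2) ∧ p.1 ≠ (0,3) ∧ p.2 ≠ (0,2) ∧ p.2 ≠ (0,3)) := by
  unfold crS; decide

lemma FI.dm (N : ℝ) {ι : Type} [Fintype ι] [DecidableEq ι] (i : V) (j : Fin 4 → ι) (u : ι) : FI i u (fun τ => dm N i (fun a => τ (j a))) :=
  (((FI.rm N (j 0) (j 2)).sub (FI.rm N (j 0) (j 3))).sub (FI.rm N (j 1) (j 2))).add (FI.rm N (j 1) (j 3))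

lemma ER_F0 (β h q N : ℝ) (i : V) : ER (e1 h) (AM (acv β q N i) cS 0) (fun τ : Fin 4 → V → Bool => dm N i τ ^ 3 * Di i τ) = 0 := by
  unfold ER
  have : ∀ x, gR (Hy (e1 h) (AM (acv β q N i) cS 0) x) (fun τ : Fin 4 → V → Bool => dm N i τ ^ 3 * Di i τ) = 0 := by
    intro x
    have h1 : ∀ u : Fin 4, u ≠ 2 → u ≠ 3 → FI i u (fun τ : Fin 4 → V → Bool => dm N i τ ^ 3 * (spin (τ 2 i) - spin (τ 3 i))) := fun u h2 h3 =>
      ((FI.dm N i id u).pow 3).mul ((FI.spin h2.symm).sub (FI.spin h3.symm))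
    refine Eq.trans ?_ (gR_diff (fun s' b => H0_upd β h q N i x s' b) 0 1 (h1 0 (by decide) (by decide)) (h1 1 (by decide) (by decide)))
    congr 1; ext τ; unfold Di; ring
  simp_rw [this]; simp

lemma ER_TF (β h q N : ℝ) (i : V) : ER (e1 h) (AM (acv β q N i) cS 0) (TT (KC β q N i) (fun τ : Fin 4 → V → Bool => dm N i τ ^ 3 * Di i τ))
    = 2 * (β ^ 2 * ∫ z, (cosh (h + β * √q * z))⁻¹ ^ 4 ∂(gaussianReal 0 1)) * ER (e1 h) (AM (acv β q N i) cS 0) (fun τ : Fin 4 → V → Bool => dm N i τ ^ 4) := by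
  set d := fun τ : Fin 3 × Fin 4 → V → Bool => dm N i (fun u => τ (0, u)) with hd
  set e := fun (τ : Fin 3 × Fin 4 → V → Bool) (x : Fin 3 × Fin 4) => spin (τ x i) with he
  have hdF : ∀ u, FI i u d := fun u => FI.dm N i (fun a => ((0 : Fin 3), a)) u
  set f := fun (p : (Fin 3 × Fin 4) × (Fin 3 × Fin 4)) (τ : Fin 3 × Fin 4 → V → Bool) =>
    (d τ ^ 3 * ((e τ (0,0) - e τ (0,1)) * (e τ (0,2) - e τ (0,3)))) * (MM p.1.1 p.2.1 * (if p.1 = p.2 then 0 else KC β q N i (τ p.1) (τ p.2))) with hf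
  have h1 : TT (KC β q N i) (fun τ : Fin 4 → V → Bool => dm N i τ ^ 3 * Di i τ) = fun τ => ∑ p, f p τ := by
    ext τ
    rw [Fintype.sum_prod_type]
    simp only [TT, hf, ← Finset.mul_sum]
    rfl
  have hz : ∀ p, p ∉ crS → ER (e1 h) (AM (acv β q N i) cS 0) (f p) = 0 := by
    intro p hp
    unfold ER
    have : ∀ x, gR (Hy (e1 h) (AM (acv β q N i) cS 0) x) (f p) = 0 := by
      intro x
      by_cases hpp : p.1 = p.2
      · simp only [hf, hpp, if_true, mul_zero]; unfold gR; rw [ga_const]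
      have hr : ∀ u, FI i u (fun τ : Fin 3 × Fin 4 → V → Bool => MM p.1.1 p.2.1 * (β ^ 2 * (d τ ^ 3 * (rm N i (τ p.1) (τ p.2) - q)))) := fun u =>
        (FI.const _).mul ((FI.const _).mul (((hdF u).pow 3).mul ((FI.rm N _ _).sub (FI.const q))))
      rcases (crS_cases p).resolve_left hp with hc | hc
      · have h1 : ∀ u : Fin 3 × Fin 4, u ≠ (0,2) → u ≠ (0,3) → u ≠ p.1 → u ≠ p.2 → FI i u (fun τ : Fin 3 × Fin 4 → V → Bool => MM p.1.1 p.2.1 * (β ^ 2 * (d τ ^ 3 * (rm N i (τ p.1) (τ p.2) - q))) * (spin (τ (0,2) i) - spin (τ (0,3) i)) * (spin (τ p.1 i) * spin (τ p.2 i))) := fun u h2 h3 h4 h5 =>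
          ((hr u).mul ((FI.spin h2.symm).sub (FI.spin h3.symm))).mul ((FI.spin h4.symm).mul (FI.spin h5.symm))
        refine Eq.trans ?_ (gR_diff (fun s' b => H0_upd β h q N i x s' b) (0,0) (0,1) (h1 (0,0) (by decide) (by decide) hc.1.symm hc.2.2.1.symm) (h1 (0,1) (by decide) (by decide) hc.2.1.symm hc.2.2.2.symm))
        congr 1; ext τ; simp only [hf, hpp, if_false, KC, he]; ring
      · have h1 : ∀ u : Fin 3 × Fin 4, u ≠ (0,0) → u ≠ (0,1) → u ≠ p.1 → u ≠ p.2 → FI i u (fun τ : Fin 3 × Fin 4 → V → Bool => MM p.1.1 p.2.1 * (β ^ 2 * (d τ ^ 3 * (rm N i (τ p.1) (τ p.2) - q))) * (spin (τ (0,0) i) - spin (τ (0,1) i)) * (spin (τ p.1 i) * spin (τ p.2 i))) := fun u h2 h3 h4 h5 =>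
          ((hr u).mul ((FI.spin h2.symm).sub (FI.spin h3.symm))).mul ((FI.spin h4.symm).mul (FI.spin h5.symm))
        refine Eq.trans ?_ (gR_diff (fun s' b => H0_upd β h q N i x s' b) (0,2) (0,3) (h1 (0,2) (by decide) (by decide) hc.1.symm hc.2.2.1.symm) (h1 (0,3) (by decide) (by decide) hc.2.1.symm hc.2.2.2.symm))
        congr 1; ext τ; simp only [hf, hpp, if_false, KC, he]; ring
    simp_rw [this]; simp
  rw [h1, ER_sum, ← Finset.sum_subset (Finset.subset_univ crS) fun p _ hp => hz p hp, ← ER_sum]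
  have h2 : (fun τ => ∑ p ∈ crS, f p τ) = fun τ => (2 * β ^ 2) * (d τ ^ 4 * ((1 - spin (τ (0,0) i) * spin (τ (0,1) i)) * (1 - spin (τ (0,2) i) * spin (τ (0,3) i)))) := by
    ext τ
    have hs : ∑ p ∈ crS, f p τ = f ((0,0),(0,2)) τ + (f ((0,0),(0,3)) τ + (f ((0,1),(0,2)) τ + (f ((0,1),(0,3)) τ + (f ((0,2),(0,0)) τ + (f ((0,3),(0,0)) τ + (f ((0,2),(0,1)) τ + f ((0,3),(0,1)) τ)))))) := by
      unfold crS
      repeat rw [Finset.sum_insert (by decide)]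
      rw [Finset.sum_singleton]
    rw [hs]
    have hM : MM 0 0 = 1 := by simp [MM]
    have q0 := spin_mul_self (τ (0,0) i)
    have q1 := spin_mul_self (τ (0,1) i)
    have q2 := spin_mul_self (τ (0,2) i)
    have q3 := spin_mul_self (τ (0,3) i)
    simp only [hf, hM, KC, he, Prod.mk.injEq, Fin.reduceEq, and_false, if_false, one_mul]
    rw [rm_comm N i (τ (0,2)) (τ (0,0)), rm_comm N i (τ (0,2)) (τ (0,1)), rm_comm N i (τ (0,3)) (τ (0,0)), rm_comm N i (τ (0,3)) (τ (0,1))]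
    rw [show d τ ^ 4 = d τ ^ 3 * (rm N i (τ (0,0)) (τ (0,2)) - rm N i (τ (0,0)) (τ (0,3)) - rm N i (τ (0,1)) (τ (0,2)) + rm N i (τ (0,1)) (τ (0,3))) by rw [pow_succ]; rfl]
    generalize spin (τ (0,0) i) = a0 at *
    generalize spin (τ (0,1) i) = a1 at *
    generalize spin (τ (0,2) i) = a2 at *
    generalize spin (τ (0,3) i) = a3 at *
    generalize rm N i (τ (0,0)) (τ (0,2)) = r02
    generalize rm N i (τ (0,0)) (τ (0,3)) = r03
    generalize rm N i (τ (0,1)) (τ (0,2)) = r12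
    generalize rm N i (τ (0,1)) (τ (0,3)) = r13
    have k00 : (a0 - a1) * a0 = 1 - a0 * a1 := by linear_combination q0
    have k01 : (a0 - a1) * a1 = -(1 - a0 * a1) := by linear_combination -q1
    have k22 : (a2 - a3) * a2 = 1 - a2 * a3 := by linear_combination q2
    have k23 : (a2 - a3) * a3 = -(1 - a2 * a3) := by linear_combination -q3
    calc _ = 2 * β ^ 2 * d τ ^ 3 * (((a0 - a1) * a0) * ((a2 - a3) * a2) * (r02 - q) + ((a0 - a1) * a0) * ((a2 - a3) * a3) * (r03 - q) + ((a0 - a1) * a1) * ((a2 - a3) * a2) * (r12 - q) + ((a0 - a1) * a1) * ((a2 - a3) * a3) * (r13 - q)) := by ring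
      _ = _ := by rw [k00, k01, k22, k23]; ring
  rw [h2, ER_mul, ER_sech β h q N i (0,0) (0,1) (0,2) (0,3) (by decide) (by decide) (by decide) (by decide) (by decide) (by decide) (G := fun τ => d τ ^ 4) fun u => (hdF u).pow 4]
  rw [show ER (e1 h) (AM (acv β q N i) cS 0) (fun τ => d τ ^ 4) = ER (e1 h) (AM (acv β q N i) cS 0) (fun τ : Fin 4 → V → Bool => dm N i τ ^ 4) from
    ER_marg (e1 h) (AM (acv β q N i) cS 0) (fun u : Fin 4 => ((0 : Fin 3), u)) inj0 (fun τ : Fin 4 → V → Bool => dm N i τ ^ 4)]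
  ring

end crossing

section bounds
variable {V : Type} [Fintype V] [LinearOrder V]

/-- total cavity fluctuation -/
def WK {ι : Type} [Fintype ι] [DecidableEq ι] (q N : ℝ) (i : V) (τ : ι → V → Bool) : ℝ := PK (fun s s' => rm N i s s' - q) τ

lemma PK_KC {ι : Type} [Fintype ι] [DecidableEq ι] (β q N : ℝ) (i : V) (τ : ι → V → Bool) : PK (KC β q N i) τ = β ^ 2 * WK q N i τ := by
  unfold WK PK
  simp_rw [Finset.mul_sum, KC_abs, mul_ite, mul_zero]

lemma pair_inj {ι : Type} {x y : ι} (h : x ≠ y) : Function.Injective ![x, y] := by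
  intro a b hab
  fin_cases a <;> fin_cases b <;> simp_all

lemma W8 {ι : Type} [Fintype ι] [DecidableEq ι] [Nonempty ι] {β h q N : ℝ} (hq : 0 ≤ q) (hq1 : q ≤ 1) (hN : N = Fintype.card V + 1) (i : V) {t : ℝ} (h0 : 0 ≤ t) (h1 : t ≤ π / 2) :
    ER (e1 h) (AM (acv β q N i) cS t) (fun τ : ι → V → Bool => WK q N i τ ^ 8)
     ≤ (Fintype.card ι : ℝ) ^ 16 * exp (2 * ((3 * (2 : ℝ)) ^ 2 * (2 * β ^ 2)) * (π / 2)) * E2 (V := V) β h q N (π / 2) (fun s s' => (rm N i s s' - q) ^ 8) := by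
  have hN0 : 0 < N := by rw [hN]; positivity
  set Λ := E2 (V := V) β h q N (π / 2) (fun s s' => (rm N i s s' - q) ^ 8) with hΛ
  set X := exp (2 * ((3 * (2 : ℝ)) ^ 2 * (2 * β ^ 2)) * (π / 2)) with hX
  set c : ℝ := (Fintype.card ι : ℝ) with hc
  have hc0 : 0 < c := by rw [hc]; exact_mod_cast Fintype.card_pos
  have hΛ0 : 0 ≤ Λ := E2_nonneg _ _ _ _ _ fun s s' => by positivity
  have hX0 : 0 < X := exp_pos _
  have hp : ∀ p : ι × ι, ER (e1 h) (AM (acv β q N i) cS t) (fun τ : ι → V → Bool => (if p.1 = p.2 then 0 else |rm N i (τ p.1) (τ p.2) - q|) ^ 8) ≤ X * Λ := by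
    intro p
    by_cases hpp : p.1 = p.2
    · simp only [hpp, if_true]
      rw [ER_const]; simp; positivity
    · simp only [hpp, if_false]
      have e1' : ER (e1 h) (AM (acv β q N i) cS t) (fun τ : ι → V → Bool => |rm N i (τ p.1) (τ p.2) - q| ^ 8) = ER (e1 h) (AM (acv β q N i) cS t) (fun τ : Fin 2 → V → Bool => (rm N i (τ 0) (τ 1) - q) ^ 8) := by
        rw [← ER_marg (e1 h) (AM (acv β q N i) cS t) ![p.1, p.2] (pair_inj hpp)]
        congr 1; ext τ
        rw [Even.pow_abs (by decide)]; rfl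
      rw [e1']
      refine (gron (interpC β q N hq hN0 i) (k0 := 2 * β ^ 2) (by positivity) (KC_le hq hq1 hN i) (fun τ => by positivity) h0 h1).trans (le_of_eq ?_)
      rw [hX, hΛ, acv_end]
      simp only [Fintype.card_fin, Nat.cast_ofNat]
      congr 1
      unfold ER E2 HS
      congr 1; ext x
      exact gR_two _ fun s s' => (rm N i s s' - q) ^ 8
  have hb : ∀ τ : ι → V → Bool, WK q N i τ ^ 8 ≤ c ^ 14 * ∑ p : ι × ι, (if p.1 = p.2 then 0 else |rm N i (τ p.1) (τ p.2) - q|) ^ 8 := by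
    intro τ
    have := pow_sum_div_card_le_sum_pow (s := (Finset.univ : Finset (ι × ι))) (f := fun p => if p.1 = p.2 then 0 else |rm N i (τ p.1) (τ p.2) - q|) (n := 7) (fun p _ => by split_ifs <;> positivity)
    rw [div_le_iff₀ (by simp), Finset.card_univ, Fintype.card_prod] at this
    push_cast at this
    rw [Fintype.sum_prod_type] at this
    unfold WK PK
    refine this.trans (le_of_eq ?_)
    rw [← hc]; ring
  refine (ER_mono _ _ hb).trans ?_
  rw [ER_mul, ER_sum]
  refine (mul_le_mul_of_nonneg_left (Finset.sum_le_sum fun p _ => hp p) (by positivity)).trans (le_of_eq ?_)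
  rw [Finset.sum_const, Finset.card_univ, Fintype.card_prod, nsmul_eq_mul]
  push_cast
  rw [← hc]; ring

lemma young {a b η : ℝ} (ha : 0 ≤ a) (hb : 0 ≤ b) (hη : 0 < η) : a ^ 3 * b ≤ η * a ^ 4 + η⁻¹ ^ 3 * b ^ 4 := by
  by_cases h : b ≤ η * a
  · have h1 : a ^ 3 * b ≤ a ^ 3 * (η * a) := mul_le_mul_of_nonneg_left h (by positivity)
    have h2 : 0 ≤ η⁻¹ ^ 3 * b ^ 4 := by positivity
    nlinarith
  · push Not at h
    have h1 : a ≤ η⁻¹ * b := by rw [inv_mul_eq_div, le_div_iff₀ hη]; linarith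
    have h2 : a ^ 3 ≤ (η⁻¹ * b) ^ 3 := pow_le_pow_left₀ ha h1 3
    have h3 := mul_le_mul_of_nonneg_right h2 hb
    have h4 : 0 ≤ η * a ^ 4 := by positivity
    nlinarith

lemma Di_abs (i : V) (τ : Fin 4 → V → Bool) : |Di i τ| ≤ 4 := by
  unfold Di
  rw [abs_mul]
  have h : ∀ a b : Bool, |spin a - spin b| ≤ 2 := by
    intro a b; refine (abs_sub _ _).trans ?_; rw [spin_abs, spin_abs]; norm_num
  nlinarith [h (τ 0 i) (τ 1 i), h (τ 2 i) (τ 3 i), abs_nonneg (spin (τ 0 i) - spin (τ 1 i)), abs_nonneg (spin (τ 2 i) - spin (τ 3 i))]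

lemma dm_abs (q N : ℝ) (i : V) (τ : Fin 4 → V → Bool) : |dm N i τ| ≤ WK q N i τ := by
  unfold WK PK dm
  simp only [Fin.sum_univ_four, Fin.reduceEq, if_true, if_false, Fin.isValue]
  set f := fun a b => rm N i (τ a) (τ b) - q with hf
  have e : rm N i (τ 0) (τ 2) - rm N i (τ 0) (τ 3) - rm N i (τ 1) (τ 2) + rm N i (τ 1) (τ 3) = f 0 2 - f 0 3 - f 1 2 + f 1 3 := by simp only [hf]; ring
  rw [e]
  change _ ≤ 0 + |f 0 1| + |f 0 2| + |f 0 3| + (|f 1 0| + 0 + |f 1 2| + |f 1 3|) + (|f 2 0| + |f 2 1| + 0 + |f 2 3|) + (|f 3 0| + |f 3 1| + |f 3 2| + 0)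
  have h1 : |f 0 2 - f 0 3 - f 1 2 + f 1 3| ≤ |f 0 2| + |f 0 3| + |f 1 2| + |f 1 3| := by
    refine (abs_add_le _ _).trans (add_le_add_left ?_ _)
    refine (abs_sub _ _).trans (add_le_add_left ?_ _)
    exact abs_sub _ _
  have := abs_nonneg (f 0 1); have := abs_nonneg (f 1 0); have := abs_nonneg (f 2 0); have := abs_nonneg (f 2 1)
  have := abs_nonneg (f 2 3); have := abs_nonneg (f 3 0); have := abs_nonneg (f 3 1); have := abs_nonneg (f 3 2)
  linarith

/-- generic third-power error term -/
lemma err {ι : Type} [Fintype ι] [DecidableEq ι] [Nonempty ι] {β h q N : ℝ} (hq : 0 ≤ q) (hq1 : q ≤ 1) (hN : N = Fintype.card V + 1) (i : V) (j : Fin 4 → ι) (hj : Function.Injective j)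
    {η : ℝ} (hη : 0 < η) {t : ℝ} (h0 : 0 ≤ t) (h1 : t ≤ π / 2) :
    ER (e1 h) (AM (acv β q N i) cS t) (fun τ : ι → V → Bool => |dm N i (fun a => τ (j a))| ^ 3 * WK q N i τ ^ 2)
     ≤ η * (exp (2 * ((3 * (4 : ℝ)) ^ 2 * (2 * β ^ 2)) * (π / 2)) * ER (e1 h) (AM (aS β q N) cS (π / 2)) (fun τ : Fin 4 → V → Bool => dm N i τ ^ 4))
     + η⁻¹ ^ 3 * ((Fintype.card ι : ℝ) ^ 16 * exp (2 * ((3 * (2 : ℝ)) ^ 2 * (2 * β ^ 2)) * (π / 2)) * E2 (V := V) β h q N (π / 2) (fun s s' => (rm N i s s' - q) ^ 8)) := by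
  have hN0 : 0 < N := by rw [hN]; positivity
  have h2 : ∀ τ : ι → V → Bool, |dm N i (fun a => τ (j a))| ^ 3 * WK q N i τ ^ 2 ≤ η * (fun τ : Fin 4 → V → Bool => dm N i τ ^ 4) (fun a => τ (j a)) + η⁻¹ ^ 3 * WK q N i τ ^ 8 := by
    intro τ
    have := young (abs_nonneg (dm N i (fun a => τ (j a)))) (sq_nonneg (WK q N i τ)) hη
    rw [Even.pow_abs (n := 4) (by decide), ← pow_mul] at this
    exact this
  refine (ER_mono _ _ h2).trans ?_
  rw [ER_add, ER_mul, ER_mul, ER_marg _ _ j hj (fun τ : Fin 4 → V → Bool => dm N i τ ^ 4)]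
  refine add_le_add (mul_le_mul_of_nonneg_left ?_ hη.le) (mul_le_mul_of_nonneg_left (W8 hq hq1 hN i h0 h1) (by positivity))
  refine (gron (interpC β q N hq hN0 i) (k0 := 2 * β ^ 2) (by positivity) (KC_le hq hq1 hN i) (fun τ => by positivity) h0 h1).trans (le_of_eq ?_)
  rw [acv_end]
  simp only [Fintype.card_fin, Nat.cast_ofNat]

lemma cav {β h q : ℝ} (hq : 0 ≤ q) (hq1 : q ≤ 1) : ∃ L : ℝ, 0 < L ∧ ∀ η : ℝ, 0 < η → ∀ (V : Type) [Fintype V] [LinearOrder V] (N : ℝ), N = Fintype.card V + 1 → ∀ i : V,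
    ER (e1 h) (AM (aS β q N) cS (π / 2)) (fun τ : Fin 4 → V → Bool => dm N i τ ^ 3 * Di i τ)
     ≤ (β ^ 2 * ∫ z, (cosh (h + β * √q * z))⁻¹ ^ 4 ∂(gaussianReal 0 1)) * ER (e1 h) (AM (aS β q N) cS (π / 2)) (fun τ : Fin 4 → V → Bool => dm N i τ ^ 4)
      + L * (η * ER (e1 h) (AM (aS β q N) cS (π / 2)) (fun τ : Fin 4 → V → Bool => dm N i τ ^ 4) + η⁻¹ ^ 3 * E2 (V := V) β h q N (π / 2) (fun s s' => (rm N i s s' - q) ^ 8)) := by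
  set κ := β ^ 2 * ∫ z, (cosh (h + β * √q * z))⁻¹ ^ 4 ∂(gaussianReal 0 1) with hκ
  have hκ0 : 0 ≤ κ := mul_nonneg (sq_nonneg _) (integral_nonneg fun z => by positivity)
  set X4 := exp (2 * ((3 * (4 : ℝ)) ^ 2 * (2 * β ^ 2)) * (π / 2))
  set X2 := exp (2 * ((3 * (2 : ℝ)) ^ 2 * (2 * β ^ 2)) * (π / 2))
  have hX4 : 0 < X4 := exp_pos _
  have hX2 : 0 < X2 := exp_pos _
  refine ⟨(64 * β ^ 4 + 4 * β ^ 2 * κ + 1) * (X4 + 36 ^ 16 * X2) * 4, by positivity, ?_⟩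
  intro η hη V _ _ N hN i
  have hN0 : 0 < N := by rw [hN]; positivity
  set ν4 := ER (e1 h) (AM (aS β q N) cS (π / 2)) (fun τ : Fin 4 → V → Bool => dm N i τ ^ 4) with hν4
  set Λ := E2 (V := V) β h q N (π / 2) (fun s s' => (rm N i s s' - q) ^ 8) with hΛ
  have hΛ0 : 0 ≤ Λ := E2_nonneg _ _ _ _ _ fun s s' => by positivity
  have hν0 : 0 ≤ ν4 := ER_nonneg _ _ fun τ => by positivity
  set B := (X4 + 36 ^ 16 * X2) * (η * ν4 + η⁻¹ ^ 3 * Λ) with hB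
  have hi3 : (0:ℝ) < η⁻¹ ^ 3 := by positivity
  have hAB : ∀ c : ℝ, 0 ≤ c → c ≤ 36 → η * (X4 * ν4) + η⁻¹ ^ 3 * (c ^ 16 * X2 * Λ) ≤ B := by
    intro c hc hc1
    have h1 : c ^ 16 ≤ 36 ^ 16 := pow_le_pow_left₀ hc hc1 16
    have h2 : c ^ 16 * (X2 * η⁻¹ ^ 3 * Λ) ≤ 36 ^ 16 * (X2 * η⁻¹ ^ 3 * Λ) := mul_le_mul_of_nonneg_right h1 (by positivity)
    have h3 : 0 ≤ X4 * (η⁻¹ ^ 3 * Λ) := by positivity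
    have h4 : 0 ≤ X2 * (η * ν4) := by positivity
    rw [hB]
    have : (X4 + 36 ^ 16 * X2) * (η * ν4 + η⁻¹ ^ 3 * Λ) = η * (X4 * ν4) + 36 ^ 16 * (X2 * η⁻¹ ^ 3 * Λ) + X4 * (η⁻¹ ^ 3 * Λ) + 36 ^ 16 * (X2 * (η * ν4)) := by ring
    rw [this]
    have : η⁻¹ ^ 3 * (c ^ 16 * X2 * Λ) = c ^ 16 * (X2 * η⁻¹ ^ 3 * Λ) := by ring
    linarith
  have t2 := taylor2 (e := e1 h) (interpC β q N hq hN0 i) (fun τ : Fin 4 → V → Bool => dm N i τ ^ 3 * Di i τ) (B := 16 * β ^ 4 * B) ?_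
  · have t1 := taylor1 (e := e1 h) (interpC β q N hq hN0 i) (fun τ : Fin 4 → V → Bool => dm N i τ ^ 4) (B := 2 * β ^ 2 * B) ?_ (t := π / 2) (by positivity) le_rfl
    · rw [ER_F0, ER_TF, acv_end, ← hκ] at t2
      rw [acv_end, ← hν4] at t1
      have u1 := (abs_le.1 t1).1
      have u2 := (abs_le.1 t2).2
      set a0 := ER (e1 h) (AM (acv β q N i) cS 0) (fun τ : Fin 4 → V → Bool => dm N i τ ^ 4)
      have u3 : κ * a0 ≤ κ * (ν4 + 2 * (2 * β ^ 2 * B)) := mul_le_mul_of_nonneg_left (by linarith) hκ0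
      have hB0 : 0 ≤ B := by positivity
      have : (64 * β ^ 4 + 4 * β ^ 2 * κ + 1) * (X4 + 36 ^ 16 * X2) * 4 * (η * ν4 + η⁻¹ ^ 3 * Λ) = (64 * β ^ 4 + 4 * β ^ 2 * κ + 1) * B * 4 := by rw [hB]; ring
      rw [this]
      have : 0 ≤ β ^ 4 * B := by positivity
      have : 0 ≤ β ^ 2 * κ * B := by positivity
      linarith
    · intro t h0 h1
      have := err (h := h) (β := β) hq hq1 hN i (fun u : Fin 4 => ((0 : Fin 3), u)) inj0 hη h0 h1
      refine le_trans ?_ (mul_le_mul_of_nonneg_left (this.trans (hAB _ (by positivity) (by simp; norm_num))) (by positivity))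
      rw [← ER_mul]
      refine ER_mono _ _ fun τ => (TT_abs _ _ _).trans ?_
      rw [PK_KC, abs_of_nonneg (by positivity)]
      set d := dm N i (fun u => τ (0, u))
      have w1 : |d| ≤ WK q N i τ := (dm_abs q N i _).trans (PK_marg _ _ inj0 τ)
      have w2 : d ^ 4 = |d| ^ 3 * |d| := by rw [← pow_succ, Even.pow_abs (by decide)]
      rw [w2]
      have w0 : 0 ≤ WK q N i τ := PK_nonneg _ _
      calc _ = 2 * β ^ 2 * (|d| ^ 3 * (|d| * WK q N i τ)) := by ring
        _ ≤ 2 * β ^ 2 * (|d| ^ 3 * (WK q N i τ * WK q N i τ)) := by gcongr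
        _ = _ := by ring
  · intro t h0 h1
    have := err (h := h) (β := β) hq hq1 hN i (fun u : Fin 4 => ((0 : Fin 3), ((0 : Fin 3), u))) (fun a b hab => by simpa using hab) hη h0 h1
    refine le_trans ?_ (mul_le_mul_of_nonneg_left (this.trans (hAB _ (by positivity) (by simp))) (by positivity))
    rw [← ER_mul]
    refine ER_mono _ _ fun τ => (TT_abs _ _ _).trans ?_
    refine (mul_le_mul_of_nonneg_right (TT_abs _ _ _) (mul_nonneg two_pos.le (PK_nonneg _ _))).trans ?_
    rw [PK_KC, PK_KC, abs_mul, abs_pow]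
    set d := dm N i (fun u => τ (0, 0, u))
    have w0 : 0 ≤ WK q N i τ := PK_nonneg _ _
    have w1 : WK q N i (fun u => τ (0, u)) ≤ WK q N i τ := PK_marg _ _ inj0 τ
    have w3 : 0 ≤ WK q N i (fun u => τ (0, u)) := PK_nonneg _ _
    have w2 := Di_abs i (fun u => τ (0, 0, u))
    calc _ ≤ |d| ^ 3 * 4 * (2 * (β ^ 2 * WK q N i τ)) * (2 * (β ^ 2 * WK q N i τ)) := by gcongr
      _ = _ := by ring

end bounds

section concl
variable {V : Type} [Fintype V] [LinearOrder V]

/-- replica difference of overlaps -/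
def dR (N : ℝ) (τ : Fin 4 → V → Bool) : ℝ := (ov (τ 0) (τ 2) - ov (τ 0) (τ 3) - ov (τ 1) (τ 2) + ov (τ 1) (τ 3)) / N

lemma dR_sum (N : ℝ) (τ : Fin 4 → V → Bool) : dR N τ = N⁻¹ * ∑ i, Di i τ := by
  unfold dR ov Di
  rw [← Finset.sum_sub_distrib, ← Finset.sum_sub_distrib, ← Finset.sum_add_distrib, div_eq_inv_mul]
  congr 1
  exact Finset.sum_congr rfl fun i _ => by ring

lemma dR_dm (N : ℝ) (i : V) (τ : Fin 4 → V → Bool) : dR N τ = dm N i τ + Di i τ / N := by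
  unfold dR dm Di rm; ring

lemma rm8 {N q : ℝ} (hN : 0 < N) (i : V) (s s' : V → Bool) : (rm N i s s' - q) ^ 8 ≤ 128 * ((ov s s' / N - q) ^ 8 + (N⁻¹) ^ 8) := by
  set a := |ov s s' / N - q| with ha
  have h1 : |rm N i s s' - q| ≤ a + N⁻¹ := by
    have : rm N i s s' - q = (ov s s' / N - q) - spin (s i) * spin (s' i) * N⁻¹ := by unfold rm; ring
    rw [this]
    refine (abs_sub _ _).trans (le_of_eq ?_)
    rw [abs_mul, abs_mul, spin_abs, spin_abs, abs_of_pos (inv_pos.2 hN)]; ring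
  have h2 := pow_le_pow_left₀ (abs_nonneg _) h1 8
  have h3 := add_pow_le (abs_nonneg (ov s s' / N - q)) (inv_pos.2 hN).le 8
  rw [Even.pow_abs (by decide)] at h2
  rw [Even.pow_abs (by decide)] at h3
  norm_num at h3 ⊢
  linarith

lemma d_arith {d m D N δ : ℝ} (hN : 1 ≤ N) (hδ : 0 < δ) (hδ1 : δ ≤ 1) (hD : |D| ≤ 4) (hd : d = m + D / N) :
    d ^ 3 * D ≤ m ^ 3 * D + δ * d ^ 4 + (1296 / δ + 768) / N ^ 2 ∧ m ^ 4 ≤ (1 + 15 * δ) * d ^ 4 + ((1 + 1 / δ) * 4) ^ 4 / N ^ 2 := by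
  have hN0 : 0 < N := by linarith
  set r := N⁻¹ with hr
  have hr0 : 0 < r := inv_pos.2 hN0
  have hr1 : r ≤ 1 := inv_le_one_of_one_le₀ hN
  have hdm : |d - m| ≤ 4 * r := by
    rw [hd, add_sub_cancel_left, div_eq_mul_inv, abs_mul, abs_of_pos hr0]
    exact mul_le_mul_of_nonneg_right hD hr0.le
  have hr2 : ∀ c : ℝ, c / N ^ 2 = c * r ^ 2 := fun c => by rw [hr, inv_pow]; rfl
  rw [hr2, hr2]
  obtain ⟨x1, x2⟩ := abs_le.1 hdm
  have hm2 : m ^ 2 ≤ 2 * d ^ 2 + 32 * r ^ 2 := by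
    have : (d - m) ^ 2 ≤ (4 * r) ^ 2 := sq_le_sq' (by linarith) (by linarith)
    nlinarith [sq_nonneg (2 * d - m)]
  constructor
  · have h1 : |(d ^ 3 - m ^ 3) * D| ≤ (4 * r * (3 / 2 * (d ^ 2 + m ^ 2))) * 4 := by
      rw [abs_mul, show d ^ 3 - m ^ 3 = (d - m) * (d ^ 2 + d * m + m ^ 2) by ring, abs_mul]
      have h2 : |d ^ 2 + d * m + m ^ 2| ≤ 3 / 2 * (d ^ 2 + m ^ 2) := by
        rw [abs_le]; constructor <;> nlinarith [sq_nonneg (d - m), sq_nonneg (d + m)]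
      gcongr
    have h3 := (abs_le.1 h1).2
    have h4 : r * (d ^ 2 + m ^ 2) ≤ r * (3 * d ^ 2 + 32 * r ^ 2) := mul_le_mul_of_nonneg_left (by linarith) hr0.le
    have h5 : 72 * r * d ^ 2 ≤ δ * d ^ 4 + 1296 / δ * r ^ 2 := by
      have e : δ * d ^ 4 + 1296 / δ * r ^ 2 - 72 * r * d ^ 2 = δ * (d ^ 2 - 36 / δ * r) ^ 2 := by field_simp; ring
      have : 0 ≤ δ * (d ^ 2 - 36 / δ * r) ^ 2 := by positivity
      linarith
    have h6 : r ^ 3 ≤ r ^ 2 := by nlinarith [sq_nonneg r]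
    nlinarith
  · have hmd : |m| ≤ |d| + 4 * r := by
      have := abs_sub_abs_le_abs_sub m d
      rw [abs_sub_comm] at this; linarith
    have e4 : m ^ 4 = |m| ^ 4 := by rw [Even.pow_abs (by decide)]
    have e4' : d ^ 4 = |d| ^ 4 := by rw [Even.pow_abs (by decide)]
    rw [e4, e4']
    by_cases hc : 4 * r ≤ δ * |d|
    · have h1 : |m| ≤ (1 + δ) * |d| := by linarith
      have h2 := pow_le_pow_left₀ (abs_nonneg _) h1 4
      rw [mul_pow] at h2
      have h3 : (1 + δ) ^ 4 ≤ 1 + 15 * δ := by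
        have a2 : δ ^ 2 ≤ δ := by nlinarith
        have a3 : δ ^ 3 ≤ δ := by nlinarith
        have a4 : δ ^ 4 ≤ δ := by nlinarith
        nlinarith
      have h4 := mul_le_mul_of_nonneg_right h3 (by positivity : 0 ≤ |d| ^ 4)
      have : 0 ≤ ((1 + 1 / δ) * 4) ^ 4 * r ^ 2 := by positivity
      linarith
    · push Not at hc
      have h0 : |d| ≤ 1 / δ * (4 * r) := by rw [one_div, inv_mul_eq_div, le_div_iff₀ hδ]; linarith
      have h1 : |m| ≤ ((1 + 1 / δ) * 4) * r := by linarith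
      have h2 := pow_le_pow_left₀ (abs_nonneg _) h1 4
      rw [mul_pow] at h2
      have h3 : r ^ 4 ≤ r ^ 2 := pow_le_pow_of_le_one hr0.le hr1 (by norm_num)
      have h4 := mul_le_mul_of_nonneg_left h3 (by positivity : 0 ≤ ((1 + 1 / δ) * 4) ^ 4)
      have : 0 ≤ (1 + 15 * δ) * |d| ^ 4 := by positivity
      linarith

theorem d4 {β h q : ℝ} (hβ : 0 < β) (hq : isFixedq β h q) (hAT : ATcond β h q) (hATp : ATplus β h q) :
    ∃ K > 0, ∀ (V : Type) [Fintype V] [LinearOrder V] (N : ℝ), N = Fintype.card V + 1 →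
      ER (e1 h) (AM (aS β q N) cS (π / 2)) (fun τ : Fin 4 → V → Bool => dR N τ ^ 4) ≤ K / N ^ 2 := by
  obtain ⟨K8, hK8, H8⟩ := ov8 hβ hq hAT hATp
  obtain ⟨L, hL, HL⟩ := cav (β := β) (h := h) hq.1.le hq.2.1.le
  unfold ATcond at hAT
  set κ := β ^ 2 * ∫ z, (cosh (h + β * √q * z))⁻¹ ^ 4 ∂(gaussianReal 0 1) with hκ
  have hκ0 : 0 ≤ κ := mul_nonneg (sq_nonneg _) (integral_nonneg fun z => by positivity)
  set η := (1 - κ) / (2 * L) with hη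
  have hη0 : 0 < η := div_pos (by linarith) (by positivity)
  set κ1 := (1 + κ) / 2 with hκ1
  have hκ1' : κ + L * η = κ1 := by rw [hη, hκ1]; field_simp; ring
  set δ := (1 - κ1) / 32 with hδ
  have hδ0 : 0 < δ := by rw [hδ, hκ1]; linarith
  have hδ1 : δ ≤ 1 := by rw [hδ, hκ1]; linarith
  set K3 := κ1 * ((1 + 1 / δ) * 4) ^ 4 + L * (η⁻¹ ^ 3 * (128 * (K8 + 1))) + (1296 / δ + 768) with hK3
  have hK3' : 0 < K3 := by positivity
  refine ⟨K3 / (16 * δ), by positivity, ?_⟩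
  intro V _ _ N hN
  have hN1 : 1 ≤ N := by rw [hN]; linarith [(Nat.cast_nonneg (Fintype.card V) : (0:ℝ) ≤ _)]
  have hN0 : 0 < N := by linarith
  set ν := fun F : (Fin 4 → V → Bool) → ℝ => ER (e1 h) (AM (aS β q N) cS (π / 2)) F with hν
  set D4 := ν (fun τ => dR N τ ^ 4) with hD4
  change D4 ≤ _
  have hD40 : 0 ≤ D4 := ER_nonneg _ _ fun τ => by positivity
  have hi : ∀ i : V, ν (fun τ => dR N τ ^ 3 * Di i τ) ≤ (1 - 16 * δ) * D4 + K3 / N ^ 2 := by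
    intro i
    have hΛ : E2 (V := V) β h q N (π / 2) (fun s s' => (rm N i s s' - q) ^ 8) ≤ 128 * (K8 + 1) / N ^ 2 := by
      refine (E2_mono _ _ _ _ _ fun s s' => rm8 hN0 i s s').trans ?_
      rw [E2_mul, E2_add, E2_const]
      have h1 := H8 V N hN
      have h2 : (N⁻¹) ^ 8 ≤ 1 / N ^ 2 := by
        rw [one_div, ← inv_pow]
        exact pow_le_pow_of_le_one (by positivity) (inv_le_one_of_one_le₀ hN1) (by norm_num)
      have : 128 * (K8 + 1) / N ^ 2 = 128 * (K8 / N ^ 2 + 1 / N ^ 2) := by ring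
      rw [this]; linarith
    have hc := HL η hη0 V N hN i
    set m4 := ER (e1 h) (AM (aS β q N) cS (π / 2)) (fun τ : Fin 4 → V → Bool => dm N i τ ^ 4) with hm4
    have hm0 : 0 ≤ m4 := ER_nonneg _ _ fun τ => by positivity
    have a1 : ν (fun τ => dR N τ ^ 3 * Di i τ) ≤ ν (fun τ => dm N i τ ^ 3 * Di i τ) + δ * D4 + (1296 / δ + 768) / N ^ 2 := by
      have := ER_mono (e1 h) (AM (aS β q N) cS (π / 2)) (F := fun τ : Fin 4 → V → Bool => dR N τ ^ 3 * Di i τ)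
        (G := fun τ => (dm N i τ ^ 3 * Di i τ + δ * dR N τ ^ 4) + (1296 / δ + 768) / N ^ 2) fun τ => (d_arith hN1 hδ0 hδ1 (Di_abs i τ) (dR_dm N i τ)).1
      rw [ER_add, ER_add, ER_mul, ER_const] at this
      exact this
    have a2 : m4 ≤ (1 + 15 * δ) * D4 + ((1 + 1 / δ) * 4) ^ 4 / N ^ 2 := by
      have := ER_mono (e1 h) (AM (aS β q N) cS (π / 2)) (F := fun τ : Fin 4 → V → Bool => dm N i τ ^ 4)
        (G := fun τ => (1 + 15 * δ) * dR N τ ^ 4 + ((1 + 1 / δ) * 4) ^ 4 / N ^ 2) fun τ => (d_arith hN1 hδ0 hδ1 (Di_abs i τ) (dR_dm N i τ)).2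
      rw [ER_add, ER_mul, ER_const] at this
      exact this
    have a3 : κ * m4 + L * (η * m4 + η⁻¹ ^ 3 * E2 (V := V) β h q N (π / 2) (fun s s' => (rm N i s s' - q) ^ 8)) ≤ κ1 * m4 + L * (η⁻¹ ^ 3 * (128 * (K8 + 1) / N ^ 2)) := by
      rw [← hκ1']
      have : L * (η⁻¹ ^ 3 * E2 (V := V) β h q N (π / 2) (fun s s' => (rm N i s s' - q) ^ 8)) ≤ L * (η⁻¹ ^ 3 * (128 * (K8 + 1) / N ^ 2)) := by gcongr
      linarith
    have a4 : κ1 * m4 ≤ κ1 * ((1 + 15 * δ) * D4 + ((1 + 1 / δ) * 4) ^ 4 / N ^ 2) := mul_le_mul_of_nonneg_left a2 (by positivity)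
    have a5 : κ1 * (1 + 15 * δ) + δ ≤ 1 - 16 * δ := by
      have : κ1 = 1 - 32 * δ := by rw [hδ]; ring
      rw [this]; nlinarith
    have a6 := mul_le_mul_of_nonneg_right a5 hD40
    have a7 : K3 / N ^ 2 = κ1 * (((1 + 1 / δ) * 4) ^ 4 / N ^ 2) + L * (η⁻¹ ^ 3 * (128 * (K8 + 1) / N ^ 2)) + (1296 / δ + 768) / N ^ 2 := by
      rw [hK3]; ring
    rw [a7]
    have a8 : ν (fun τ => dm N i τ ^ 3 * Di i τ) ≤ κ1 * m4 + L * (η⁻¹ ^ 3 * (128 * (K8 + 1) / N ^ 2)) := hc.trans a3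
    linarith
  have hs : D4 = N⁻¹ * ∑ i, ν (fun τ => dR N τ ^ 3 * Di i τ) := by
    rw [hD4, hν]
    simp only
    rw [← ER_sum, ← ER_mul]
    congr 1; ext τ
    rw [← Finset.mul_sum, pow_succ]
    conv_lhs => rw [dR_sum N τ]
    rw [← dR_sum N τ]
    rw [dR_sum N τ]; ring
  have h1 : ∑ i : V, ν (fun τ => dR N τ ^ 3 * Di i τ) ≤ N * ((1 - 16 * δ) * D4 + K3 / N ^ 2) := by
    refine (Finset.sum_le_sum fun i _ => hi i).trans ?_
    rw [Finset.sum_const, nsmul_eq_mul, Finset.card_univ]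
    refine mul_le_mul_of_nonneg_right (by rw [hN]; linarith) ?_
    have : 16 * δ ≤ 1 := by rw [hδ, hκ1]; linarith
    have : 0 ≤ (1 - 16 * δ) * D4 := mul_nonneg (by linarith) hD40
    positivity
  have h2 : D4 ≤ (1 - 16 * δ) * D4 + K3 / N ^ 2 := by
    have := mul_le_mul_of_nonneg_left h1 (inv_pos.2 hN0).le
    rw [← hs, ← mul_assoc, inv_mul_cancel₀ hN0.ne', one_mul] at this
    exact this
  rw [div_div, mul_comm (16 * δ), ← div_div, le_div_iff₀ (by positivity)]
  linarith

end concl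

section chaos
lemma pow_exp_bound (n : ℕ) (x : ℝ) : |x ^ n| ≤ n.factorial * exp (1 * |x|) := by
  have := Real.pow_div_factorial_le_exp |x| (abs_nonneg x) n
  rw [div_le_iff₀ (by positivity)] at this
  rw [abs_pow, one_mul, mul_comm]; exact this

lemma pow_integrable (n : ℕ) : Integrable (fun x : ℝ => x ^ n) g1 :=
  integrable_of_exp_bound (by fun_prop) _ 1 (pow_exp_bound n)

lemma mom_rec (n : ℕ) : ∫ x, x ^ (n + 2) ∂g1 = (n + 1) * ∫ x, x ^ n ∂g1 := by
  rw [← integral_const_mul]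
  have := stein_one (f := fun x => x ^ (n + 1)) (f' := fun x => (n + 1) * x ^ n) (fun x => by simpa using hasDerivAt_pow (n + 1) x) (by fun_prop)
    ((n + 1) * (n + 1).factorial) 1 (fun x => ?_) (fun x => ?_)
  · rw [← this]; congr 1; ext x; ring
  · refine (pow_exp_bound _ x).trans ?_
    refine mul_le_mul_of_nonneg_right ?_ (exp_pos _).le
    have : (0:ℝ) ≤ n := n.cast_nonneg
    nlinarith [(Nat.cast_nonneg (n + 1).factorial : (0:ℝ) ≤ _)]
  · rw [abs_mul, abs_of_nonneg (by positivity : (0:ℝ) ≤ n + 1), mul_assoc]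
    refine mul_le_mul_of_nonneg_left ((pow_exp_bound n x).trans ?_) (by positivity)
    refine mul_le_mul_of_nonneg_right ?_ (exp_pos _).le
    exact_mod_cast Nat.factorial_le (Nat.le_succ n)

lemma quart (a b : ℝ) : ∫ s, (a + s * b) ^ 4 ∂g1 = a ^ 4 + 6 * (a ^ 2 * b ^ 2) + 3 * b ^ 4 := by
  have m0 : ∫ x, x ^ 0 ∂g1 = 1 := by simp
  have m1 : ∫ x, x ^ 1 ∂g1 = 0 := by simp
  have m2 : ∫ x, x ^ 2 ∂g1 = 1 := by rw [mom_rec 0, m0]; norm_num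
  have m3 : ∫ x, x ^ 3 ∂g1 = 0 := by rw [mom_rec 1, m1]; norm_num
  have m4 : ∫ x, x ^ 4 ∂g1 = 3 := by rw [mom_rec 2, m2]; norm_num
  have e : ∀ s : ℝ, (a + s * b) ^ 4 = ∑ n ∈ Finset.range 5, (![a ^ 4, 4 * a ^ 3 * b, 6 * (a ^ 2 * b ^ 2), 4 * a * b ^ 3, b ^ 4] : Fin 5 → ℝ) (Fin.ofNat 5 n) * s ^ n := by
    intro s
    simp [Finset.sum_range_succ, Fin.ofNat]
    ring
  simp_rw [e]
  rw [integral_finsetSum _ fun n _ => (pow_integrable n).const_mul _]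
  simp_rw [integral_const_mul]
  simp only [Finset.sum_range_succ, Finset.sum_range_zero, m0, m1, m2, m3, m4]
  simp [Fin.ofNat]
  ring

variable {V : Type} [Fintype V] [DecidableEq V]

lemma hyper_step {A B : (V → ℝ) → ℝ} (n : V) (hA : EB (fun _ : Unit => A)) (hB : EB (fun _ : Unit => B)) (mA : Measurable A) (mB : Measurable B)
    (iA : ∀ x s, A (Function.update x n s) = A x) (iB : ∀ x s, B (Function.update x n s) = B x) {K S c S' : ℝ} (hK : 0 ≤ K) (hS : 0 ≤ S) (hc : 0 ≤ c) (hS' : S + c ≤ S')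
    (h1 : ∫ x, A x ^ 4 ∂(gm V) ≤ 9 * K * S ^ 2) (h2 : ∫ x, B x ^ 4 ∂(gm V) ≤ K * c ^ 2) :
    ∫ x, (A x + x n * B x) ^ 4 ∂(gm V) ≤ 9 * K * S' ^ 2 := by
  have jA : Integrable (fun x => A x ^ 4) (gm V) := (hA.pow 4).integrable () (mA.pow_const 4)
  have jB : Integrable (fun x => B x ^ 4) (gm V) := (hB.pow 4).integrable () (mB.pow_const 4)
  have jAB : Integrable (fun x => A x ^ 2 * B x ^ 2) (gm V) := ((hA.pow 2).mul (hB.pow 2)).integrable () ((mA.pow_const 2).mul (mB.pow_const 2))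
  have jT : Integrable (fun x => (A x + x n * B x) ^ 4) (gm V) := ((hA.add ((EB.coord n).mul hB)).pow 4).integrable () ((mA.add ((measurable_pi_apply n).mul mB)).pow_const 4)
  have e : ∫ x, (A x + x n * B x) ^ 4 ∂(gm V) = ∫ x, A x ^ 4 ∂(gm V) + 6 * ∫ x, A x ^ 2 * B x ^ 2 ∂(gm V) + 3 * ∫ x, B x ^ 4 ∂(gm V) := by
    rw [integral_resample n jT]
    simp only [iA, iB, Function.update_self, quart]
    have jj : Integrable (fun x => A x ^ 4 + 6 * (A x ^ 2 * B x ^ 2)) (gm V) := jA.add (jAB.const_mul 6)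
    rw [integral_add jj (jB.const_mul 3), integral_add jA (jAB.const_mul 6), integral_const_mul, integral_const_mul]
  set a := ∫ x, A x ^ 4 ∂(gm V)
  set b := ∫ x, B x ^ 4 ∂(gm V)
  set m := ∫ x, A x ^ 2 * B x ^ 2 ∂(gm V)
  have hb0 : 0 ≤ b := integral_nonneg fun x => by positivity
  have ha0 : 0 ≤ a := integral_nonneg fun x => by positivity
  have hdis : ∀ t : ℝ, 0 ≤ a * (t * t) + (2 * m) * t + b := by
    intro t
    have : 0 ≤ ∫ x, (t * A x ^ 2 + B x ^ 2) ^ 2 ∂(gm V) := integral_nonneg fun x => by positivity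
    have e2 : ∀ x, (t * A x ^ 2 + B x ^ 2) ^ 2 = (t * t) * A x ^ 4 + (2 * t) * (A x ^ 2 * B x ^ 2) + B x ^ 4 := fun x => by ring
    simp_rw [e2] at this
    have jj : Integrable (fun x => (t * t) * A x ^ 4 + (2 * t) * (A x ^ 2 * B x ^ 2)) (gm V) := (jA.const_mul _).add (jAB.const_mul _)
    rw [integral_add jj jB, integral_add (jA.const_mul _) (jAB.const_mul _), integral_const_mul, integral_const_mul] at this
    linarith
  have hd := discrim_le_zero hdis
  unfold discrim at hd
  have hm : m ≤ 3 * K * S * c := by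
    have h3 : a * b ≤ (9 * K * S ^ 2) * (K * c ^ 2) := mul_le_mul h1 h2 hb0 (by positivity)
    refine le_of_sq_le_sq ?_ (by positivity)
    nlinarith
  have h4 : 9 * K * (S + c) ^ 2 ≤ 9 * K * S' ^ 2 := mul_le_mul_of_nonneg_left (pow_le_pow_left₀ (by positivity) hS' 2) (by positivity)
  have h5 : 0 ≤ K * c ^ 2 := by positivity
  rw [e]; nlinarith

lemma lin4 (c : V → ℝ) (s : Finset V) : ∫ x, (∑ j ∈ s, x j * c j) ^ 4 ∂(gm V) ≤ 9 * (∑ j ∈ s, c j ^ 2) ^ 2 := by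
  induction s using Finset.induction_on with
  | empty => simp
  | insert n s hn ih =>
    have h := hyper_step (A := fun x => ∑ j ∈ s, x j * c j) (B := fun _ => c n) n (EB.sum fun j _ => (EB.coord j).mul (EB.const _)) (EB.const _) (by fun_prop) (by fun_prop)
      (fun x t => Finset.sum_congr rfl fun j hj => by rw [Function.update_of_ne (ne_of_mem_of_not_mem hj hn)]) (fun x t => rfl) (K := 1) (S := ∑ j ∈ s, c j ^ 2) (c := c n ^ 2) (S' := ∑ j ∈ insert n s, c j ^ 2)
      zero_le_one (by positivity) (by positivity) (by rw [Finset.sum_insert hn, add_comm]) (by simpa using ih) (by simp; apply le_of_eq; ring)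
    simp_rw [Finset.sum_insert hn] at h ⊢
    simp_rw [add_comm (_ * c n)]
    simpa using h

lemma quad4 (a : V → V → ℝ) (s : Finset V) : ∫ x, (∑ j ∈ s, ∑ k ∈ s, if j ≠ k then x j * x k * a j k else 0) ^ 4 ∂(gm V) ≤ 81 * (2 * ∑ j ∈ s, ∑ k ∈ s, a j k ^ 2) ^ 2 := by
  induction s using Finset.induction_on with
  | empty => simp
  | insert n s hn ih =>
    have hu : ∀ (x : V → ℝ) t, ∀ j ∈ s, Function.update x n t j = x j := fun x t j hj => Function.update_of_ne (ne_of_mem_of_not_mem hj hn) _ _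
    have h := hyper_step (A := fun x => ∑ j ∈ s, ∑ k ∈ s, if j ≠ k then x j * x k * a j k else 0) (B := fun x => ∑ j ∈ s, x j * (a n j + a j n)) n
      (EB.sum fun j _ => EB.sum fun k _ => by
        by_cases hjk : j ≠ k
        · simp only [if_pos hjk]; exact ((EB.coord j).mul (EB.coord k)).mul (EB.const _)
        · simp only [if_neg hjk]; exact EB.const 0)
      (EB.sum fun j _ => (EB.coord j).mul (EB.const _)) (Finset.measurable_fun_sum _ fun j _ => Finset.measurable_fun_sum _ fun k _ => by split_ifs <;> fun_prop) (by fun_prop)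
      (fun x t => Finset.sum_congr rfl fun j hj => Finset.sum_congr rfl fun k hk => by rw [hu x t j hj, hu x t k hk])
      (fun x t => Finset.sum_congr rfl fun j hj => by rw [hu x t j hj]) (K := 9) (S := 2 * ∑ j ∈ s, ∑ k ∈ s, a j k ^ 2) (c := ∑ j ∈ s, (a n j + a j n) ^ 2) (S' := 2 * ∑ j ∈ insert n s, ∑ k ∈ insert n s, a j k ^ 2)
      (by norm_num) (by positivity) (by positivity) ?_ (ih.trans (by norm_num)) (lin4 _ s)
    · refine le_trans (le_of_eq ?_) (h.trans (by norm_num))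
      congr 1; ext x; congr 1
      rw [Finset.sum_insert hn, Finset.sum_insert hn]
      simp_rw [Finset.sum_insert hn]
      rw [Finset.sum_add_distrib]
      have e1 : ∑ k ∈ s, (if n ≠ k then x n * x k * a n k else 0) = ∑ k ∈ s, x n * x k * a n k :=
        Finset.sum_congr rfl fun k hk => if_pos (ne_of_mem_of_not_mem hk hn).symm
      have e2 : ∑ k ∈ s, (if k ≠ n then x k * x n * a k n else 0) = ∑ k ∈ s, x k * x n * a k n :=
        Finset.sum_congr rfl fun k hk => if_pos (ne_of_mem_of_not_mem hk hn)
      rw [e1, e2]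
      have e3 : x n * ∑ j ∈ s, x j * (a n j + a j n) = ∑ k ∈ s, x n * x k * a n k + ∑ k ∈ s, x k * x n * a k n := by
        rw [Finset.mul_sum, ← Finset.sum_add_distrib]
        exact Finset.sum_congr rfl fun k _ => by ring
      simp only [ne_eq, not_true_eq_false, if_false] at *
      rw [e3]
      simp only [ite_not]
      ring
    · rw [Finset.sum_insert hn, Finset.sum_insert hn]
      simp_rw [Finset.sum_insert hn]
      rw [Finset.sum_add_distrib]
      have : ∑ j ∈ s, (a n j + a j n) ^ 2 ≤ 2 * (∑ j ∈ s, a n j ^ 2 + ∑ j ∈ s, a j n ^ 2) := by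
        rw [← Finset.sum_add_distrib, Finset.mul_sum]
        exact Finset.sum_le_sum fun j _ => by nlinarith [sq_nonneg (a n j - a j n)]
      nlinarith [sq_nonneg (a n n)]

end chaos

section summ
variable {V : Type} [Fintype V] [LinearOrder V]

/-- two point correlations -/
def mV (H : (V → Bool) → ℝ) (j k : V) : ℝ :=
  ga H (fun s => spin (s j) * spin (s k)) - ga H (fun s => spin (s j)) * ga H (fun s => spin (s k))

lemma gR_DD (H : (V → Bool) → ℝ) (j k : V) : gR H (fun τ : Fin 4 → V → Bool => Di j τ * Di k τ) = 4 * mV H j k ^ 2 := by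
  have h := gR_expand (ι := Fin 4) H (fun r : Fin 4 × Fin 4 => (![1, -1, -1, 1] : Fin 4 → ℝ) r.1 * (![1, -1, -1, 1] : Fin 4 → ℝ) r.2)
    (fun r => let f : Fin 4 → Fin 2 → (V → Bool) → ℝ := ![![fun s => spin (s j) * spin (s k), fun _ => 1], ![fun s => spin (s j), fun s => spin (s k)],
      ![fun s => spin (s k), fun s => spin (s j)], ![fun _ => 1, fun s => spin (s j) * spin (s k)]]
      ![f r.1 0, f r.1 1, f r.2 0, f r.2 1])
  simp only [Fintype.sum_prod_type, Fin.sum_univ_four, Fin.prod_univ_four, Matrix.cons_val_zero, Matrix.cons_val_one, Matrix.cons_val, ga_const] at h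
  refine Eq.trans (congrArg (gR H) (funext fun τ => ?_)) (h.trans ?_)
  · unfold Di; ring
  · unfold mV; ring

lemma sum_mV (H : (V → Bool) → ℝ) {N : ℝ} (hN : 0 < N) :
    (∑ j, ∑ k, mV H j k ^ 2) ^ 2 ≤ N ^ 4 / 16 * gR H (fun τ : Fin 4 → V → Bool => dR N τ ^ 4) := by
  have h1 : ∑ j, ∑ k, mV H j k ^ 2 = N ^ 2 / 4 * gR H (fun τ : Fin 4 → V → Bool => dR N τ ^ 2) := by
    have e : (fun τ : Fin 4 → V → Bool => dR N τ ^ 2) = fun τ => (N ^ 2)⁻¹ * ∑ j, ∑ k, Di j τ * Di k τ := by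
      ext τ; rw [dR_sum, mul_pow, sq (∑ i, Di i τ), Finset.sum_mul_sum, inv_pow]
    have h2 : ∀ j k, ga (fun τ : Fin 4 → V → Bool => ∑ u, H (τ u)) (fun τ => Di j τ * Di k τ) = 4 * mV H j k ^ 2 := gR_DD H
    rw [e, gR, ga_mul_const, ga_sum]
    simp_rw [ga_sum, h2, ← Finset.mul_sum]
    field_simp
  have h3 : gR H (fun τ : Fin 4 → V → Bool => dR N τ ^ 2) ^ 2 ≤ gR H (fun τ : Fin 4 → V → Bool => dR N τ ^ 4) := by
    unfold gR
    set c := ga (fun τ : Fin 4 → V → Bool => ∑ u, H (τ u)) (fun τ => dR N τ ^ 2) with hc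
    have h4 : 0 ≤ ga (fun τ : Fin 4 → V → Bool => ∑ u, H (τ u)) (fun τ => dR N τ ^ 4 + ((-2 * c) * dR N τ ^ 2 + c ^ 2)) :=
      ga_nonneg _ fun τ => by nlinarith [sq_nonneg (dR N τ ^ 2 - c)]
    rw [ga_add, ga_add _ (fun τ => (-2 * c) * dR N τ ^ 2) (fun τ => c ^ 2), ga_mul_const, ga_const, ← hc] at h4
    linarith
  rw [h1, mul_pow]
  have := mul_le_mul_of_nonneg_left h3 (by positivity : (0:ℝ) ≤ (N ^ 2 / 4) ^ 2)
  refine this.trans (le_of_eq (by ring))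

/-- the Hamiltonian in terms of standard Gaussian pair disorder -/
def HP (β h N : ℝ) (y : Pr V → ℝ) : (V → Bool) → ℝ :=
  fun s => ∑ i, h * spin (s i) + ∑ p : Pr V, β / √N * (spin (s p.1.1) * spin (s p.1.2)) * y p

lemma mV_meas (β h N : ℝ) (j k : V) : Measurable fun y : Pr V → ℝ => mV (HP β h N y) j k := by
  unfold mV
  have : ∀ s, Measurable fun y : Pr V → ℝ => HP β h N y s := fun s => by unfold HP; fun_prop
  have h2 : ∀ c : (V → Bool) → ℝ, Measurable fun y : Pr V → ℝ => ga (HP β h N y) c := fun c => measurable_ga this fun _ => measurable_const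
  exact (h2 _).sub ((h2 _).mul (h2 _))

lemma mV_abs (H : (V → Bool) → ℝ) (j k : V) : |mV H j k| ≤ 2 := by
  unfold mV
  have a := ga_abs_le H (c := fun s => spin (s j) * spin (s k)) (C := 1) fun s => by rw [abs_mul, spin_abs, spin_abs, one_mul]
  have b : ∀ j : V, |ga H (fun s => spin (s j))| ≤ 1 := fun j => ga_abs_le H fun s => (spin_abs _).le
  refine (abs_sub _ _).trans ?_
  rw [abs_mul]
  nlinarith [mul_le_mul (b j) (b k) (abs_nonneg _) zero_le_one]

lemma E_sum_mV {β h q K N : ℝ} (hN : 0 < N)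
    (hK : ER (e1 h) (AM (aS β q N) cS (π / 2)) (fun τ : Fin 4 → V → Bool => dR N τ ^ 4) ≤ K / N ^ 2) :
    ∫ y, (∑ j, ∑ k, mV (HP β h N y) j k ^ 2) ^ 2 ∂(gm (Pr V)) ≤ K * N ^ 2 / 16 := by
  have hm : Measurable fun y : Pr V → ℝ => (∑ j, ∑ k, mV (HP β h N y) j k ^ 2) ^ 2 :=
    (Finset.measurable_fun_sum _ fun j _ => Finset.measurable_fun_sum _ fun k _ => (mV_meas β h N j k).pow_const 2).pow_const 2
  rw [← integral_comp_coords (Sum.inl : Pr V → Ks V) Sum.inl_injective hm]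
  have e : ∀ x : Ks V → ℝ, HP β h N (fun p => x (Sum.inl p)) = Hy (e1 h) (AM (aS β q N) cS (π / 2)) x := by
    intro x; ext s
    unfold HP Hy e1
    rw [Fintype.sum_sum_type]
    simp [AM, aS, cS]
  simp_rw [e]
  refine (integral_mono_of_nonneg (Eventually.of_forall fun x => by positivity) ((gR_integrable (e1 h) (AM (aS β q N) cS (π / 2)) fun τ : Fin 4 → V → Bool => dR N τ ^ 4).const_mul (N ^ 4 / 16))
    (Eventually.of_forall fun x => sum_mV _ hN)).trans ?_
  rw [integral_const_mul]
  refine (mul_le_mul_of_nonneg_left hK (by positivity)).trans (le_of_eq ?_)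
  field_simp

/-- the fourth power of the quadratic chaos -/
def chF (β h N : ℝ) (z : V ⊕ Pr V → ℝ) : ℝ :=
  (∑ j, ∑ k, if j ≠ k then z (Sum.inl j) * z (Sum.inl k) * mV (HP β h N (fun p => z (Sum.inr p))) k j else 0) ^ 4

lemma chF_meas (β h N : ℝ) : Measurable (chF (V := V) β h N) := by
  have mP : Measurable fun z : V ⊕ Pr V → ℝ => fun p : Pr V => z (Sum.inr p) := measurable_pi_lambda _ fun p => measurable_pi_apply _
  exact (Finset.measurable_fun_sum _ fun j _ => Finset.measurable_fun_sum _ fun k _ => by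
    split_ifs
    · exact ((measurable_pi_apply (Sum.inl j)).mul (measurable_pi_apply (Sum.inl k))).mul ((mV_meas β h N k j).comp mP)
    · exact measurable_const).pow_const 4

lemma chaos4 {β h q K N : ℝ} (hN : 0 < N)
    (hK : ER (e1 h) (AM (aS β q N) cS (π / 2)) (fun τ : Fin 4 → V → Bool => dR N τ ^ 4) ≤ K / N ^ 2) :
    ∫ z, chF (V := V) β h N z ∂(gm (V ⊕ Pr V)) ≤ 81 / 4 * K * N ^ 2 := by
  set F := chF (V := V) β h N with hF
  have mF : Measurable F := chF_meas β h N
  have iF : Integrable F (gm (V ⊕ Pr V)) := by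
    have : EB (fun _ : Unit => F) := (EB.sum fun j _ => EB.sum fun k _ => by
      by_cases hjk : j ≠ k
      · simp only [if_pos hjk]
        exact ((EB.coord _).mul (EB.coord _)).mul (EB.bdd 2 fun _ _ => mV_abs _ _ _)
      · simp only [if_neg hjk]; exact EB.const 0).pow 4
    exact this.integrable () mF
  have mp := measurePreserving_sumPiEquivProdPi_symm (fun _ : V ⊕ Pr V => gaussianReal 0 1)
  have iF' : Integrable (fun w : (V → ℝ) × (Pr V → ℝ) => F ((MeasurableEquiv.sumPiEquivProdPi fun _ => ℝ).symm w)) ((gm V).prod (gm (Pr V))) := mp.integrable_comp_of_integrable iF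
  have e1 : ∫ z, F z ∂(gm (V ⊕ Pr V)) = ∫ w, F ((MeasurableEquiv.sumPiEquivProdPi fun _ => ℝ).symm w) ∂((gm V).prod (gm (Pr V))) :=
    (mp.integral_comp (MeasurableEquiv.measurableEmbedding _) F).symm
  rw [e1, integral_prod_symm _ iF']
  have hE := E_sum_mV hN hK
  have iM : Integrable (fun y : Pr V → ℝ => (∑ j, ∑ k, mV (HP β h N y) j k ^ 2) ^ 2) (gm (Pr V)) := by
    have : EB (fun (_ : Unit) (y : Pr V → ℝ) => (∑ j, ∑ k, mV (HP β h N y) j k ^ 2) ^ 2) :=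
      (EB.sum fun j _ => EB.sum fun k _ => (EB.bdd 2 fun _ _ => mV_abs _ _ _ : EB fun (_ : Unit) (y : Pr V → ℝ) => mV (HP β h N y) j k).pow 2).pow 2
    exact this.integrable () ((Finset.measurable_fun_sum _ fun j _ => Finset.measurable_fun_sum _ fun k _ => (mV_meas β h N j k).pow_const 2).pow_const 2)
  refine (integral_mono_of_nonneg (Eventually.of_forall fun y => integral_nonneg fun x => ?_) (iM.const_mul 324) (Eventually.of_forall fun y => ?_)).trans ?_
  · simp only [hF, chF]; positivity
  · refine (quad4 (fun j k => mV (HP β h N y) k j) Finset.univ).trans (le_of_eq ?_)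
    simp only
    rw [Finset.sum_comm]; ring
  · rw [integral_const_mul]; linarith
end summ

section final

lemma gibbs_ga (N : ℕ) (β : ℝ) (g : Fin N → Fin N → ℝ) (hv : Fin N → ℝ) (f : (Fin N → ℝ) → ℝ) :
    gibbs N β g hv f = ga (fun s : Fin N → Bool => hamiltonian N β g hv (fun u => spin (s u))) (fun s => f (fun u => spin (s u))) := rfl

lemma ga_snd {S T : Type*} [Fintype S] [Fintype T] [Nonempty T] (H c : S → ℝ) : ga (fun p : T × S => H p.2) (fun p => c p.2) = ga H c := by
  unfold ga Zf
  rw [Fintype.sum_prod_type, Fintype.sum_prod_type]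
  simp only [Finset.sum_const, nsmul_eq_mul]
  exact mul_div_mul_left _ _ (by simp)

lemma sum_Pr {V : Type*} [Fintype V] [LinearOrder V] (f : V → V → ℝ) : ∑ p : Pr V, f p.1.1 p.1.2 = ∑ u, ∑ v, if u < v then f u v else 0 := by
  rw [← Fintype.sum_prod_type' (f := fun u v => if u < v then f u v else 0), ← Finset.sum_filter]
  exact (Finset.sum_subtype _ (by simp) fun p : V × V => f p.1 p.2).symm

lemma hamil_red (N : ℕ) (β h : ℝ) (g : Fin N → Fin N → ℝ) (i : Fin N) (σ : Fin N → ℝ) :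
    hamiltonian N β (redCoup N g i) (fun u => if u = i then 0 else h) σ
      = ∑ l : {l : Fin N // l ≠ i}, h * σ l + ∑ p : Pr {l : Fin N // l ≠ i}, β * (σ p.1.1 * σ p.1.2) * g p.1.1 p.1.2 := by
  unfold hamiltonian redCoup
  rw [sum_Pr fun u v : {l : Fin N // l ≠ i} => β * (σ u * σ v) * g u v]
  simp_rw [Fintype.sum_eq_add_sum_subtype_ne _ i]
  simp only [true_or, or_true, if_true, zero_mul, ite_self, Finset.sum_const_zero, add_zero, zero_add]
  rw [add_comm, Finset.mul_sum]
  congr 1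
  · exact Finset.sum_congr rfl fun l _ => by rw [if_neg l.2]
  · refine Finset.sum_congr rfl fun u _ => ?_
    rw [Finset.mul_sum]
    refine Finset.sum_congr rfl fun v _ => ?_
    rw [if_neg (not_or.2 ⟨u.2, v.2⟩)]
    by_cases huv : u < v
    · rw [if_pos huv, if_pos (show u.1 < v.1 from huv)]; ring
    · rw [if_neg huv, if_neg (show ¬ u.1 < v.1 from huv)]; ring

/-- the Hamiltonian of the system without `i` -/
def HI {N : ℕ} (β h : ℝ) (g : Fin N → Fin N → ℝ) (i : Fin N) (s : {l : Fin N // l ≠ i} → Bool) : ℝ :=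
  ∑ l, h * spin (s l) + ∑ p : Pr {l : Fin N // l ≠ i}, β * (spin (s p.1.1) * spin (s p.1.2)) * g p.1.1 p.1.2

lemma gibbs_red (N : ℕ) (β h : ℝ) (g : Fin N → Fin N → ℝ) (i : Fin N) (f : (Fin N → ℝ) → ℝ) (c : ({l : Fin N // l ≠ i} → Bool) → ℝ)
    (hc : ∀ s : Fin N → Bool, f (fun u => spin (s u)) = c (fun l => s l)) :
    gibbs N β (redCoup N g i) (fun u => if u = i then 0 else h) f
      = ga (HI β h g i) c := by
  rw [gibbs_ga, ga_equiv (Equiv.funSplitAt i Bool).symm]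
  refine Eq.trans ?_ (ga_snd (T := Bool) _ c)
  have hr : ∀ (x : Bool × ({l : Fin N // l ≠ i} → Bool)) (l : {l : Fin N // l ≠ i}), (Equiv.funSplitAt i Bool).symm x l = x.2 l := fun x l => by
    simp [l.2]
  congr 1
  · ext x
    rw [hamil_red]
    simp only [hr, HI]
  · ext x
    rw [hc]
    simp only [hr]

lemma corrRemoved_eq (N : ℕ) (β h : ℝ) (g : Fin N → Fin N → ℝ) (i : Fin N) (k j : {l : Fin N // l ≠ i}) :
    corrRemoved N β h g i k j = mV (HI β h g i) k j := by
  unfold corrRemoved corr mag mV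
  rw [gibbs_red N β h g i _ (fun s => spin (s k) * spin (s j)) fun s => rfl, gibbs_red N β h g i _ (fun s => spin (s k)) fun s => rfl,
    gibbs_red N β h g i _ (fun s => spin (s j)) fun s => rfl]
  congr!

lemma goe_law {N : ℕ} (hN : 0 < N) {Ω : Type*} [MeasurableSpace Ω] {P : Measure Ω} [IsProbabilityMeasure P] {G : Ω → Fin N → Fin N → ℝ} (hG : IsGOE N P G)
    {f : (Pr (Fin N) → ℝ) → ℝ} (hf : Measurable f) : ∫ ω, f (fun p => √N * G ω p.1.1 p.1.2) ∂P = ∫ x, f x ∂(gm (Pr (Fin N))) := by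
  obtain ⟨-, -, hind, hlaw⟩ := hG
  have hm : ∀ p : Pr (Fin N), AEMeasurable (fun ω => G ω p.1.1 p.1.2) P := fun p => by
    have : NeZero (Measure.map (fun ω => G ω p.1.1 p.1.2) P) := by rw [hlaw p]; infer_instance
    exact aemeasurable_of_map_neZero this
  have hm' : ∀ p : Pr (Fin N), AEMeasurable (fun ω => √N * G ω p.1.1 p.1.2) P := fun p => (hm p).const_mul _
  have hind' : iIndepFun (fun (p : Pr (Fin N)) ω => √N * G ω p.1.1 p.1.2) P := hind.comp (fun _ x => √N * x) fun _ => measurable_const_mul _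
  have h1 := hind'.map_fun_eq_pi_map hm'
  have h2 : ∀ p : Pr (Fin N), Measure.map (fun ω => √N * G ω p.1.1 p.1.2) P = gaussianReal 0 1 := fun p => by
    have : Measure.map (fun ω => √N * G ω p.1.1 p.1.2) P = Measure.map (fun x => √N * x) (Measure.map (fun ω => G ω p.1.1 p.1.2) P) :=
      (AEMeasurable.map_map_of_aemeasurable (measurable_const_mul _).aemeasurable (hm p)).symm
    rw [this, hlaw p, gaussianReal_map_const_mul]
    congr 1
    · simp
    · ext; simp; field_simp
  simp_rw [h2] at h1
  have h3 : Measure.map (fun ω (p : Pr (Fin N)) => √N * G ω p.1.1 p.1.2) P = gm (Pr (Fin N)) := by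
    rw [h1]
  rw [← h3, integral_map (aemeasurable_pi_lambda _ hm') hf.aestronglyMeasurable]

/-- coordinates of the row `i` and of the system without `i` -/
def crd {N : ℕ} (i : Fin N) : {l : Fin N // l ≠ i} ⊕ Pr {l : Fin N // l ≠ i} → Pr (Fin N)
  | Sum.inl l => if hl : i < l then ⟨(i, l), hl⟩ else ⟨(l, i), lt_of_le_of_ne (not_lt.1 hl) l.2⟩
  | Sum.inr p => ⟨(p.1.1, p.1.2), p.2⟩

lemma crd_inj {N : ℕ} (i : Fin N) : Function.Injective (crd i) := by
  have hval : ∀ l : {l : Fin N // l ≠ i}, (crd i (Sum.inl l)).1 = (i, l.1) ∨ (crd i (Sum.inl l)).1 = (l.1, i) := fun l => by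
    by_cases hl : i < l.1
    · left; simp [crd, hl]
    · right; simp [crd, hl]
  rintro (l | p) (l' | p') hh
  · have h2 := congrArg Subtype.val hh
    congr 1; apply Subtype.ext
    have := l.2; have := l'.2
    rcases hval l with h | h <;> rcases hval l' with h' | h' <;> rw [h, h', Prod.mk.injEq] at h2 <;> simp_all
  · have h2 := congrArg Subtype.val hh
    have := p'.1.1.2; have := p'.1.2.2
    rcases hval l with h | h <;> rw [h] at h2 <;> simp [crd] at h2 <;> simp_all
  · have h2 := congrArg Subtype.val hh
    have := p.1.1.2; have := p.1.2.2
    rcases hval l' with h | h <;> rw [h] at h2 <;> simp [crd] at h2 <;> simp_all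
  · have h2 := congrArg Subtype.val hh
    simp only [crd, Prod.mk.injEq] at h2
    congr 1
    exact Subtype.ext (Prod.ext (Subtype.ext h2.1) (Subtype.ext h2.2))

lemma chF_key {β h : ℝ} {N : ℕ} {g : Fin N → Fin N → ℝ} (hg : ∀ u v, g u v = g v u) (i : Fin N) :
    (∑ j : {l : Fin N // l ≠ i}, ∑ k : {l : Fin N // l ≠ i},
          if j.1 ≠ k.1 then g i j.1 * g i k.1 * corrRemoved N β h g i k.1 j.1 else 0) ^ 4
      = ((N:ℝ) ^ 4)⁻¹ * chF β h N fun a => √N * g (crd i a).1.1 (crd i a).1.2 := by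
  have hN' : (0:ℝ) < N := by exact_mod_cast i.pos
  have hs : 0 < √(N:ℝ) := sqrt_pos.2 hN'
  have hrow : ∀ (l : {l : Fin N // l ≠ i}), g (crd i (Sum.inl l)).1.1 (crd i (Sum.inl l)).1.2 = g i l := fun l => by
    by_cases hl : i < l.1
    · simp [crd, hl]
    · simp [crd, hl]; exact hg _ _
  simp only [chF, hrow]
  rw [← inv_pow, ← mul_pow]
  congr 1
  rw [Finset.mul_sum]
  refine Finset.sum_congr rfl fun j _ => ?_
  rw [Finset.mul_sum]
  refine Finset.sum_congr rfl fun k _ => ?_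
  by_cases hjk : j = k
  · simp [hjk]
  · rw [if_pos hjk, if_pos (fun hh => hjk (Subtype.ext hh)), corrRemoved_eq]
    have eH : (HI β h g i)
        = HP β h N (fun p => √N * g (crd i (Sum.inr p)).1.1 (crd i (Sum.inr p)).1.2) := by
      ext s
      unfold HI HP
      congr 1
      refine Finset.sum_congr rfl fun p _ => ?_
      simp only [crd]
      field_simp
    rw [eH]
    have hsq : √(N:ℝ) * √(N:ℝ) = N := mul_self_sqrt hN'.le
    field_simp
    rw [sq, hsq]
    ring

lemma chF_transfer (β h : ℝ) {N : ℕ} {Ω : Type*} [MeasurableSpace Ω] {P : Measure Ω} [IsProbabilityMeasure P] {G : Ω → Fin N → Fin N → ℝ} (hG : IsGOE N P G) (i : Fin N) :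
    ∫ ω, (∑ j : {l : Fin N // l ≠ i}, ∑ k : {l : Fin N // l ≠ i},
          if j.1 ≠ k.1 then G ω i j.1 * G ω i k.1 * corrRemoved N β h (G ω) i k.1 j.1 else 0) ^ 4 ∂P
      = ((N:ℝ) ^ 4)⁻¹ * ∫ z, chF β h N z ∂(gm ({l : Fin N // l ≠ i} ⊕ Pr {l : Fin N // l ≠ i})) := by
  have mF : Measurable (chF (V := {l : Fin N // l ≠ i}) β h N) := chF_meas β h N
  have mC : Measurable fun (x : Pr (Fin N) → ℝ) a => x (crd i a) := measurable_pi_lambda _ fun a => measurable_pi_apply _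
  rw [← integral_comp_coords (crd i) (crd_inj i) mF]
  refine Eq.trans ?_ (congrArg (((N:ℝ) ^ 4)⁻¹ * ·) (goe_law i.pos hG (mF.comp mC)))
  simp only
  rw [← integral_const_mul]
  congr 1; ext ω
  exact chF_key (hG.1 ω) i

lemma chaos_bound {β h q K : ℝ} {N : ℕ} (i : Fin N)
    (H : ∀ (V : Type) [Fintype V] [LinearOrder V] (N : ℝ), N = Fintype.card V + 1 →
      ER (e1 h) (AM (aS β q N) cS (π / 2)) (fun τ : Fin 4 → V → Bool => dR N τ ^ 4) ≤ K / N ^ 2) :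
    ∫ z, chF β h N z ∂(gm ({l : Fin N // l ≠ i} ⊕ Pr {l : Fin N // l ≠ i})) ≤ 81 / 4 * K * N ^ 2 := by
  have hN : 0 < N := i.pos
  have hN' : (0:ℝ) < N := by exact_mod_cast hN
  have hcard : (N:ℝ) = Fintype.card {l : Fin N // l ≠ i} + 1 := by
    have : Fintype.card {l : Fin N // l ≠ i} = N - 1 := by simp [Fintype.card_subtype_compl]
    rw [this, Nat.cast_sub hN]; simp
  exact chaos4 hN' (H {l : Fin N // l ≠ i} N hcard)
end final

/-- Assume `(β,h)` satisfy the AT condition and (AT+). Then there is a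
constant `C > 0` such that for every `i ∈ [N]`,
`𝔼 (∑_{j,k ≠ i, j ≠ k} g_{ij} g_{ik} m^{(i)}_{kj})⁴ ≤ C N⁻²`. -/
theorem quadratic_chaos_fourth_moment_bound
    (β h q : ℝ) (hβ : 0 < β) (hh : 0 < h)
    (hq : isFixedq β h q) (hAT : ATcond β h q) (hATp : ATplus β h q)
    (Ω : ℕ → Type) [∀ N, MeasurableSpace (Ω N)] (P : ∀ N, Measure (Ω N))
    (hP : ∀ N, IsProbabilityMeasure (P N))
    (G : ∀ N, Ω N → Fin N → Fin N → ℝ) (hG : ∀ N, IsGOE N (P N) (G N)) :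
    ∃ C : ℝ, 0 < C ∧ ∀ N : ℕ, ∀ i : Fin N,
      (∫ ω, (∑ j : {l : Fin N // l ≠ i}, ∑ k : {l : Fin N // l ≠ i},
          if j.1 ≠ k.1 then
            G N ω i j.1 * G N ω i k.1 * corrRemoved N β h (G N ω) i k.1 j.1
          else 0) ^ 4 ∂(P N))
        ≤ C * (N : ℝ) ^ (-(2 : ℝ)) := by
  obtain ⟨K, hK, H⟩ := d4 hβ hq hAT hATp
  refine ⟨81 / 4 * K, by positivity, fun N i => ?_⟩
  have := hP N
  have hN' : (0:ℝ) < N := by exact_mod_cast i.pos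
  rw [chF_transfer β h (hG N) i]
  refine (mul_le_mul_of_nonneg_left (chaos_bound i H) (by positivity)).trans (le_of_eq ?_)
  rw [rpow_neg hN'.le, rpow_two]
  field_simp

end SK
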